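/- (Sphere case of the main classification theorem.) Let f : S² → S² be a nonwandering orientation-preserving homeomorphism of the 2-sphere and U ⊆ S² an open f-invariant simply connected set whose boundary ∂U has more than one point. Suppose some extension F of f|_U to c_E(U,S²) has no periodic point in b_E(U,S²) (i.e. the prime ends rotation number ρ(f,U) is irrational). Then one of the following holds: (i) ∂U is an annular continuum, contractible in S², containing no periodic point of f; or (ii) U is dense in S² and S²∖U is a continuum whose complement is connected (a non-separating continuum) containing exactly one fixed point of f and no other periodic point of f. -/

import Mathlib

open Set Topology Filter

noncomputable section

universe u

variable {X : Type u} [TopologicalSpace X]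

/-- A homeomorphism is *orientation preserving* if it is isotopic to the identity. -/
def IsOrientationPreserving (f : X ≃ₜ X) : Prop :=
  ∃ H : unitInterval × X → X,
    Continuous H ∧ (∀ x, H (0, x) = x) ∧ (∀ x, H (1, x) = f x) ∧
      ∀ t : unitInterval, IsHomeomorph fun x => H (t, x)

/-- `D` is a connected component of `A`. -/
def IsCompOf (A D : Set X) : Prop := ∃ x ∈ A, D = connectedComponentIn A x

/-- `A` has exactly two connected components, the distinct sets `D₁` and `D₂`. -/
def HasTwoComps (A D₁ D₂ : Set X) : Prop :=
  IsCompOf A D₁ ∧ IsCompOf A D₂ ∧ D₁ ≠ D₂ ∧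
    ∀ x ∈ A, connectedComponentIn A x = D₁ ∨ connectedComponentIn A x = D₂

/-- A *cross-cut* of the open set `U`: the image of an arc `g` on `(0,1)`, where `g` is
continuous and injective on `[0,1]`'s interior, runs inside `U`, has endpoints on `∂U`, and
separates `U` into exactly two components, each with a boundary point on `∂U` away from the
closed arc. -/
def IsCrossCut (U γ : Set X) : Prop :=
  ∃ g : ℝ → X,
    ContinuousOn g (Icc 0 1) ∧ InjOn g (Ioo 0 1) ∧ (∀ t ∈ Ioo (0:ℝ) 1, g t ∈ U) ∧
      g 0 ∈ frontier U ∧ g 1 ∈ frontier U ∧ γ = g '' Ioo 0 1 ∧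
      ∃ D₁ D₂ : Set X, HasTwoComps (U \ γ) D₁ D₂ ∧
        (frontier D₁ ∩ (frontier U \ g '' Icc 0 1)).Nonempty ∧
        (frontier D₂ ∩ (frontier U \ g '' Icc 0 1)).Nonempty

/-- A *cross-section* of `U`: a connected component of `U ∖ γ` for a cross-cut `γ`. -/
def IsCrossSection (U D : Set X) : Prop := ∃ γ : Set X, IsCrossCut U γ ∧ IsCompOf (U \ γ) D

/-- The image of a set under the `k`-th integer iterate of a homeomorphism. -/
def iterZ (f : X ≃ₜ X) (k : ℤ) (A : Set X) : Set X := ⇑(f.toEquiv ^ k) '' A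

/-- A cross-section of `U` which is wandering for `f^n`. -/
def IsWanderingSection (f : X ≃ₜ X) (U : Set X) (n : ℕ) (D : Set X) : Prop :=
  IsCrossSection U D ∧ ∀ k : ℤ, k ≠ 0 → iterZ f ((n : ℤ) * k) D ∩ D = ∅

/-- `f` is ∂-nonwandering in `U`. -/
def BdNonwandering (f : X ≃ₜ X) (U : Set X) : Prop :=
  ∀ n : ℕ, 1 ≤ n → ∃ K : Set X, IsCompact K ∧ K ⊆ U ∧
    ∀ D : Set X, IsWanderingSection f U n D →
      (∃ k : ℤ, 0 < k ∧ (iterZ f ((n : ℤ) * k) D ∩ K).Nonempty) ∧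
      (∃ k : ℤ, k < 0 ∧ (iterZ f ((n : ℤ) * k) D ∩ K).Nonempty)

/-- The boundary of `D` inside `U` (for `D` open in `U`). -/
def bdIn (U D : Set X) : Set X := (closure D \ D) ∩ U

/-- A chain of cross-sections of `U`. -/
def IsPEChain (U : Set X) (D : ℕ → Set X) : Prop :=
  (∀ i, IsCrossSection U (D i)) ∧ (∀ i j : ℕ, j ≤ i → D i ⊆ D j) ∧
    ∀ i j : ℕ, i ≠ j → closure (bdIn U (D i)) ∩ closure (bdIn U (D j)) = ∅

/-- The chain `D` divides the cross-section `E`. -/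
def ChainDividesSection (D : ℕ → Set X) (E : Set X) : Prop := ∃ N : ℕ, ∀ i, N ≤ i → D i ⊆ E

/-- The chain `D` divides the chain `D'`. -/
def ChainDivides (D D' : ℕ → Set X) : Prop := ∀ n : ℕ, ∃ m : ℕ, D m ⊆ D' n

/-- A prime chain: a chain dividing every chain that divides it. -/
def IsPrimeChain (U : Set X) (D : ℕ → Set X) : Prop :=
  IsPEChain U D ∧ ∀ D' : ℕ → Set X, IsPEChain U D' → ChainDivides D' D → ChainDivides D D'

/-- The type of prime chains of `U`. -/
def PrimeChain (U : Set X) : Type u := {D : ℕ → Set X // IsPrimeChain U D}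

/-- A prime end of `U`: an equivalence class of prime chains. -/
def PrimeEnd (U : Set X) : Type u :=
  Quot fun C C' : PrimeChain U => ChainDivides C.1 C'.1 ∧ ChainDivides C'.1 C.1

/-- The prime end `p` divides the cross-section `E`. -/
def PrimeEndDivides {U : Set X} (p : PrimeEnd U) (E : Set X) : Prop :=
  ∃ C : PrimeChain U, Quot.mk _ C = p ∧ ChainDividesSection C.1 E

/-- The prime ends compactification of `U` (as a set: `U ⊔ (prime ends)`). -/
def PrimeEndComp (U : Set X) : Type u := ↥U ⊕ PrimeEnd U

/-- A point of `U`, as an element of the prime ends compactification. -/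
def pePt (U : Set X) (x : ↥U) : PrimeEndComp U := Sum.inl x

/-- A prime end, as an element of the prime ends compactification. -/
def peEnd (U : Set X) (p : PrimeEnd U) : PrimeEndComp U := Sum.inr p

/-- The copy of a subset `V ⊆ U` inside the prime ends compactification. -/
def peOpen (U V : Set X) : Set (PrimeEndComp U) := {z | ∃ x : ↥U, z = pePt U x ∧ (x : X) ∈ V}

/-- The basic set `E ∪ i_E(E)` of the prime ends compactification, for a cross-section `E`. -/
def peSection (U E : Set X) : Set (PrimeEndComp U) :=
  peOpen U E ∪ {z | ∃ p : PrimeEnd U, z = peEnd U p ∧ PrimeEndDivides p E}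

/-- The topology of the prime ends compactification. -/
instance primeEndCompTopology (U : Set X) : TopologicalSpace (PrimeEndComp U) :=
  TopologicalSpace.generateFrom
    ({s | ∃ V : Set X, IsOpen V ∧ V ⊆ U ∧ s = peOpen U V} ∪
      {s | ∃ E : Set X, IsCrossSection U E ∧ s = peSection U E})

/-- The circle of prime ends, as a subset of the prime ends compactification. -/
def PrimeEndCircle (U : Set X) : Set (PrimeEndComp U) := Set.range (peEnd U)

/-- `F` is an extension of `f|_U` to the prime ends compactification of `U`. -/
def IsPEExtension (f : X ≃ₜ X) (U : Set X) (F : PrimeEndComp U ≃ₜ PrimeEndComp U) : Prop :=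
  ∀ (x : X) (hx : x ∈ U) (hfx : f x ∈ U), F (pePt U ⟨x, hx⟩) = pePt U ⟨f x, hfx⟩

/-- An end-cut of `U`: an injective arc in `U` defined on `[0,1)` converging in the ambient
space as `t → 1⁻`. -/
def IsEndCut (U : Set X) (γ : ℝ → X) : Prop :=
  ContinuousOn γ (Ico 0 1) ∧ InjOn γ (Ico 0 1) ∧ (∀ t ∈ Ico (0:ℝ) 1, γ t ∈ U) ∧
    ∃ z : X, Tendsto γ (𝓝[<] (1:ℝ)) (𝓝 z)

/-- `z` is an accessible point of `∂U`. -/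
def IsAccessiblePoint (U : Set X) (z : X) : Prop :=
  ∃ γ : ℝ → X, IsEndCut U γ ∧ Tendsto γ (𝓝[<] (1:ℝ)) (𝓝 z)

/-- `p` is an accessible prime end of `U`. -/
def IsAccessiblePrimeEnd (U : Set X) (p : PrimeEnd U) : Prop :=
  ∃ (γ : ℝ → X) (hγ : ∀ t ∈ Ico (0:ℝ) 1, γ t ∈ U), IsEndCut U γ ∧
    Tendsto (fun t : ↥(Ico (0:ℝ) 1) => pePt U ⟨γ ↑t, hγ ↑t t.2⟩)
      (comap Subtype.val (𝓝[<] (1:ℝ))) (𝓝 (peEnd U p))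

/-- A translation arc for `f` based at `x`: a simple arc from `x` to `f x` meeting its image
only as allowed. -/
def IsTranslationArc (f : X ≃ₜ X) (γ : Set X) (x : X) : Prop :=
  f x ≠ x ∧
    ∃ g : ℝ → X, ContinuousOn g (Icc 0 1) ∧ InjOn g (Icc 0 1) ∧
      g 0 = x ∧ g 1 = f x ∧ γ = g '' Icc 0 1 ∧
      ((⇑f '' γ) ∩ γ = {f x} ∨ ((⇑f '' γ) ∩ γ = {x, f x} ∧ f (f x) = x))

/-- An `N`-translation arc for `f` based at `x` (for `N = 1` this is just a translation arc). -/
def IsNTranslationArc (f : X ≃ₜ X) (N : ℕ) (γ : Set X) (x : X) : Prop :=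
  IsTranslationArc f γ x ∧
    (2 ≤ N →
      (∀ k : ℕ, 2 ≤ k → k ≤ N - 1 → (⇑f)^[k] '' γ ∩ γ = ∅) ∧
        ((⇑f)^[N] '' γ ∩ γ = ∅ ∨ ((⇑f)^[N] '' γ ∩ γ = {x} ∧ (⇑f)^[N + 1] x = x)))

/-- An ∞-translation arc: an `N`-translation arc for every `N ≥ 1`. -/
def IsInfTranslationArc (f : X ≃ₜ X) (γ : Set X) (x : X) : Prop :=
  ∀ N : ℕ, 1 ≤ N → IsNTranslationArc f N γ x

/-- A nonwandering homeomorphism. -/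
def IsNonwanderingMap (f : X → X) : Prop :=
  ∀ V : Set X, IsOpen V → V.Nonempty → ∃ n : ℕ, 1 ≤ n ∧ (f^[n] '' V ∩ V).Nonempty

/-- A loop contained in `A` which is not null-homotopic in `V`. -/
def IsEssentialLoopIn (V A : Set X) : Prop :=
  ∃ (z : ↥V) (δ : Path z z), (∀ t : unitInterval, (↑(δ t) : X) ∈ A) ∧
    ¬ δ.Homotopic (Path.refl z)

/-- An annular continuum: a continuum with an open annular neighborhood `V` such that `V ∖ K`
has exactly two components, each essential in `V`. -/
def IsAnnularContinuum (K : Set X) : Prop :=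
  IsCompact K ∧ IsConnected K ∧ K.Nontrivial ∧
    ∃ V : Set X, IsOpen V ∧ K ⊆ V ∧
      Nonempty (↥V ≃ₜ AddCircle (1 : ℝ) × ↥(Ioo (0 : ℝ) 1)) ∧
      ∃ D₁ D₂ : Set X, HasTwoComps (V \ K) D₁ D₂ ∧
        IsEssentialLoopIn V D₁ ∧ IsEssentialLoopIn V D₂

/-- A set contractible in the ambient surface: it has an open neighborhood homeomorphic to the
plane. -/
def ContractibleInSurface (K : Set X) : Prop :=
  ∃ W : Set X, IsOpen W ∧ K ⊆ W ∧ Nonempty (↥W ≃ₜ (ℝ × ℝ))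

/-- `α ∈ ℝ/ℤ` is rational. -/
def IsRationalAC (α : AddCircle (1 : ℝ)) : Prop := ∃ r : ℚ, α = ((r : ℝ) : AddCircle (1 : ℝ))

/-- The constant `q(α,g)`: the smallest positive integer `q` with `‖qα‖ = 0` if `α` is
rational, and `(2g+1)‖qα‖ < ‖α‖` if `α` is irrational. -/
def qConst (α : AddCircle (1 : ℝ)) (g : ℕ) : ℕ :=
  sInf {q : ℕ | 0 < q ∧
    ((IsRationalAC α ∧ ‖q • α‖ = 0) ∨
      (¬IsRationalAC α ∧ ((2 * g + 1 : ℕ) : ℝ) * ‖q • α‖ < ‖α‖))}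


/-- The two-dimensional sphere. -/
abbrev SphereTwo : Type := ↥(Metric.sphere (0 : EuclideanSpace ℝ (Fin 3)) 1)

section

open scoped Real
open Complex (exp I log exp_add exp_ne_zero exp_sub exp_log norm_exp norm_exp_ofReal_mul_I
  two_pi_I_ne_zero slitPlane exp_pi_mul_I exp_periodic norm_mul_exp_arg_mul_I re_add_im
  normSq_eq_norm_sq norm_real ofReal_re ofReal_zero add_re sub_im sub_re continuous_re)
open Metric (ball closedBall isOpen_ball ball_subset_closedBall mem_ball_self ball_mem_nhds
  closedBall_subset_ball mem_closedBall_self ball_subset_ball isClosed_closedBall mem_ball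
  mem_closedBall)
open Function (iterate_succ_apply iterate_succ_apply' comp_apply invFun invFunOn iterate_succ
  iterate_succ' iterate_fixed iterate_mul invFunOn_mem iterate_add_apply invFunOn_eq Semiconj)
open ENNReal (ofReal add_ne_top mul_ne_top ofReal_ne_top)
open MeasureTheory
open scoped ENNReal

/-- The open unit disc. -/
local notation "𝔻" => Metric.ball (0:ℂ) 1

/-- A continuous nonvanishing function on a convex set has a continuous logarithm. -/
theorem exists_log_of_convex {E : Type*} [NormedAddCommGroup E] [NormedSpace ℝ E] {A : Set E}
    (hA : Convex ℝ A) {u : E → ℂ} (hu : ContinuousOn u A) (h0 : ∀ x ∈ A, u x ≠ 0) :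
    ∃ l : E → ℂ, ContinuousOn l A ∧ ∀ x ∈ A, exp (l x) = u x := by
  classical
  rcases A.eq_empty_or_nonempty with rfl | ⟨a, ha⟩
  · simp
  have := hA.contractibleSpace ⟨a, ha⟩
  have := Convex.locallyPathConnectedSpace E hA
  obtain ⟨F, ⟨-, hF⟩, -⟩ := Complex.isCoveringMapOn_exp.existsUnique_continuousMap_lifts
    (⟨A.domRestrict u, continuousOn_iff_continuous_domRestrict.mp hu⟩ : C(A, ℂ)) (a₀ := ⟨a, ha⟩)
    (e₀ := log (u a)) (by simpa using exp_log (h0 a ha)) (fun x ↦ h0 x x.2)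
  refine ⟨fun z ↦ if hz : z ∈ A then F ⟨z, hz⟩ else 0, ?_, ?_⟩
  · rw [continuousOn_iff_continuous_domRestrict]
    convert F.continuous using 1
    ext z
    simp
  · intro x hx
    simpa [hx] using congrFun hF ⟨x, hx⟩

/-- A continuous function on a preconnected set whose exponential is `1` is constant. -/
theorem eq_of_exp_eq_one {α : Type*} [TopologicalSpace α] {s : Set α} (hs : IsPreconnected s)
    {f : α → ℂ} (hf : ContinuousOn f s) (h1 : ∀ x ∈ s, exp (f x) = 1) {x y : α}
    (hx : x ∈ s) (hy : y ∈ s) : f x = f y := by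
  have hpi : (0 : ℝ) < 2 * π := by positivity
  refine hs.constant_of_mapsTo (T := range fun n : ℤ ↦ (n : ℂ) * (2 * π * I))
    ?_ hf ?_ hx hy
  · have : Topology.IsClosedEmbedding (fun n : ℤ ↦ (n : ℂ) * (2 * π * I)) := by
      apply Metric.isClosedEmbedding_of_pairwise_le_dist (ε := 2 * π) hpi
      intro m n hmn
      rw [dist_eq_norm, ← sub_mul, norm_mul]
      have : ‖(2 * π * I : ℂ)‖ = 2 * π := by
        simp [abs_of_pos Real.pi_pos]
      rw [this]
      have h1 : (1 : ℝ) ≤ ‖((m : ℂ) - n)‖ := by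
        rw [← Int.cast_sub, Complex.norm_intCast]
        exact_mod_cast Int.one_le_abs (sub_ne_zero.mpr hmn)
      nlinarith
    exact this.isEmbedding.isDiscrete_range
  · intro z hz
    obtain ⟨n, hn⟩ := Complex.exp_eq_one_iff.mp (h1 z hz)
    exact ⟨n, hn.symm⟩

theorem sub_eq_sub_of_exp_eq {α : Type*} [TopologicalSpace α] {s : Set α} (hs : IsPreconnected s)
    {f g : α → ℂ} (hf : ContinuousOn f s) (hg : ContinuousOn g s)
    (h : ∀ x ∈ s, exp (f x) = exp (g x)) {x y : α}
    (hx : x ∈ s) (hy : y ∈ s) : f x - g x = f y - g y :=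
  eq_of_exp_eq_one hs (f := fun x ↦ f x - g x) (hf.sub hg)
    (fun z hz ↦ by rw [exp_sub, h z hz, div_self (exp_ne_zero _)]) hx hy

/-- `l` is a continuous logarithm of `u` on `[0,1]`. -/
def IsLogOn (l u : ℝ → ℂ) : Prop :=
  ContinuousOn l (Icc 0 1) ∧ ∀ t ∈ Icc (0 : ℝ) 1, exp (l t) = u t

open Classical in
/-- The variation of a continuous logarithm of `u` along `[0,1]`. -/
def logVar (u : ℝ → ℂ) : ℂ := if h : ∃ l, IsLogOn l u then h.choose 1 - h.choose 0 else 0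

theorem IsLogOn.logVar_eq {l u : ℝ → ℂ} (h : IsLogOn l u) : logVar u = l 1 - l 0 := by
  have hex : ∃ l, IsLogOn l u := ⟨l, h⟩
  rw [logVar, dif_pos hex]
  have h2 := hex.choose_spec
  have := sub_eq_sub_of_exp_eq isPreconnected_Icc h2.1 h.1
    (fun x hx ↦ by rw [h2.2 x hx, h.2 x hx]) (x := (1 : ℝ)) (y := 0) (by simp) (by simp)
  linear_combination this

theorem exists_isLogOn {u : ℝ → ℂ} (hu : ContinuousOn u (Icc 0 1))
    (h0 : ∀ t ∈ Icc (0 : ℝ) 1, u t ≠ 0) : ∃ l, IsLogOn l u :=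
  exists_log_of_convex (convex_Icc 0 1) hu h0

theorem logVar_mul {u v : ℝ → ℂ} (hu : ContinuousOn u (Icc 0 1))
    (hu0 : ∀ t ∈ Icc (0 : ℝ) 1, u t ≠ 0) (hv : ContinuousOn v (Icc 0 1))
    (hv0 : ∀ t ∈ Icc (0 : ℝ) 1, v t ≠ 0) : logVar (fun t ↦ u t * v t) = logVar u + logVar v := by
  obtain ⟨l, hl⟩ := exists_isLogOn hu hu0
  obtain ⟨m, hm⟩ := exists_isLogOn hv hv0
  have : IsLogOn (fun t ↦ l t + m t) (fun t ↦ u t * v t) :=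
    ⟨hl.1.add hm.1, fun t ht ↦ by rw [exp_add, hl.2 t ht, hm.2 t ht]⟩
  rw [this.logVar_eq, hl.logVar_eq, hm.logVar_eq]
  ring

theorem logVar_congr {u v : ℝ → ℂ} (h : EqOn u v (Icc 0 1)) : logVar u = logVar v := by
  by_cases hex : ∃ l, IsLogOn l u
  · obtain ⟨l, hl⟩ := hex
    have : IsLogOn l v := ⟨hl.1, fun t ht ↦ by rw [hl.2 t ht, h ht]⟩
    rw [this.logVar_eq, hl.logVar_eq]
  · have h2 : ¬ ∃ l, IsLogOn l v := fun ⟨l, hl⟩ ↦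
      hex ⟨l, hl.1, fun t ht ↦ by rw [hl.2 t ht, h ht]⟩
    rw [logVar, logVar, dif_neg hex, dif_neg h2]

/-- A homotopy through nonvanishing functions that all have equal end values keeps `logVar`. -/
theorem logVar_eq_of_homotopy {H : ℝ × ℝ → ℂ} (hH : ContinuousOn H (Icc 0 1 ×ˢ Icc 0 1))
    (h0 : ∀ p ∈ Icc (0 : ℝ) 1 ×ˢ Icc (0 : ℝ) 1, H p ≠ 0)
    (hloop : ∀ s ∈ Icc (0 : ℝ) 1, H (s, 0) = H (s, 1)) :
    logVar (fun t ↦ H (0, t)) = logVar (fun t ↦ H (1, t)) := by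
  obtain ⟨l, hl, hle⟩ := exists_log_of_convex ((convex_Icc (0 : ℝ) 1).prod (convex_Icc (0 : ℝ) 1))
    hH h0
  have hs : ∀ s ∈ Icc (0 : ℝ) 1, logVar (fun t ↦ H (s, t)) = l (s, 1) - l (s, 0) := by
    intro s hs
    have : IsLogOn (fun t ↦ l (s, t)) (fun t ↦ H (s, t)) :=
      ⟨hl.comp (by fun_prop) fun t ht ↦ ⟨hs, ht⟩, fun t ht ↦ hle _ ⟨hs, ht⟩⟩
    exact this.logVar_eq
  rw [hs 0 (by simp), hs 1 (by simp)]
  refine eq_of_exp_eq_one isPreconnected_Icc (f := fun s ↦ l (s, 1) - l (s, 0)) (s := Icc 0 1)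
    ?_ ?_ (by simp) (by simp)
  · exact (hl.comp (by fun_prop) fun s hs ↦ ⟨hs, by simp⟩).sub
      (hl.comp (by fun_prop) fun s hs ↦ ⟨hs, by simp⟩)
  · intro s hs
    rw [exp_sub, hle (s, 1) ⟨hs, by simp⟩, hle (s, 0) ⟨hs, by simp⟩, hloop s hs,
      div_self (h0 _ ⟨hs, by simp⟩)]

/-- The parametrization `t ↦ r e^{2πit}` of a circle. -/
def circ (r t : ℝ) : ℂ := r * exp (2 * π * t * I)

@[fun_prop] theorem continuous_circ : Continuous fun p : ℝ × ℝ ↦ circ p.1 p.2 := by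
  unfold circ; fun_prop

theorem norm_circ (r t : ℝ) : ‖circ r t‖ = |r| := by
  have : (2 * π * t * I : ℂ) = ((2 * π * t : ℝ) : ℂ) * I := by
    push_cast; ring
  rw [circ, norm_mul, this, norm_exp_ofReal_mul_I]
  simp

theorem circ_zero_eq_one (r : ℝ) : circ r 0 = circ r 1 := by
  simp [circ, Complex.exp_two_pi_mul_I]

theorem logVar_circ {r : ℝ} (hr : 0 < r) : logVar (circ r) = 2 * π * I := by
  have : IsLogOn (fun t : ℝ ↦ Real.log r + 2 * π * t * I) (circ r) := by
    refine ⟨by fun_prop, fun t _ ↦ ?_⟩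
    rw [exp_add, circ, ← Complex.ofReal_exp, Real.exp_log hr]
  rw [this.logVar_eq]
  push_cast
  ring

/-- A nonvanishing continuous function on a disc has zero logarithmic variation on its circles. -/
theorem logVar_comp_eq_zero {E : Type*} [NormedAddCommGroup E] [NormedSpace ℝ E] {A : Set E}
    (hA : Convex ℝ A) {u : E → ℂ} (hu : ContinuousOn u A) (h0 : ∀ x ∈ A, u x ≠ 0)
    {c : ℝ → E} (hc : ContinuousOn c (Icc 0 1)) (hcA : MapsTo c (Icc 0 1) A) (hl : c 0 = c 1) :
    logVar (fun t ↦ u (c t)) = 0 := by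
  obtain ⟨l, hl1, hl2⟩ := exists_log_of_convex hA hu h0
  have : IsLogOn (fun t ↦ l (c t)) (fun t ↦ u (c t)) :=
    ⟨hl1.comp hc hcA, fun t ht ↦ hl2 _ (hcA ht)⟩
  rw [this.logVar_eq, hl, sub_self]

theorem logVar_const (c : ℂ) : logVar (fun _ ↦ c) = 0 := by
  by_cases hc : c = 0
  · have : ¬ ∃ l, IsLogOn l (fun _ ↦ c) := fun ⟨l, hl⟩ ↦
      exp_ne_zero _ ((hl.2 0 (by simp)).trans hc)
    rw [logVar, dif_neg this]
  · have : IsLogOn (fun _ ↦ log c) (fun _ ↦ c) :=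
      ⟨continuousOn_const, fun t _ ↦ exp_log hc⟩
    rw [this.logVar_eq, sub_self]

open Complex Metric in
/-- Hurwitz: a locally uniform limit of nonvanishing holomorphic functions that has a zero
vanishes identically near that zero. -/
lemma eventually_eq_zero_of_hurwitz {ι : Type*} {l : Filter ι} [l.NeBot] {V : Set ℂ}
    (hV : IsOpen V) {g : ι → ℂ → ℂ} {G : ℂ → ℂ} (hg : ∀ i, DifferentiableOn ℂ (g i) V)
    (hlim : TendstoLocallyUniformlyOn g G l V) {z₀ : ℂ} (hz : z₀ ∈ V)
    (hne : ∀ᶠ z in 𝓝 z₀, ∀ i, g i z ≠ 0) (h0 : G z₀ = 0) : ∀ᶠ z in 𝓝 z₀, G z = 0 := by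
  have hG := hlim.differentiableOn (.of_forall hg) hV
  have hGa := hG.analyticAt (hV.mem_nhds hz)
  refine hGa.eventually_eq_zero_or_eventually_ne_zero.resolve_right fun hGne => ?_
  rw [eventually_nhdsWithin_iff] at hGne
  obtain ⟨r, hr, hball⟩ := Metric.eventually_nhds_iff_ball.1
    (hGne.and (hne.and (hV.mem_nhds hz)))
  set ρ := r / 2 with hρ
  have hρ0 : 0 < ρ := by positivity
  have hsub : closedBall z₀ ρ ⊆ ball z₀ r := closedBall_subset_ball (by linarith)
  have hsV : closedBall z₀ ρ ⊆ V := fun z h => (hball z (hsub h)).2.2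
  have hunif :=
    (tendstoLocallyUniformlyOn_iff_forall_isCompact hV).1 hlim _ hsV (isCompact_closedBall _ _)
  have hsne : (sphere z₀ ρ).Nonempty := NormedSpace.sphere_nonempty.2 hρ0.le
  obtain ⟨w, hw, hmin⟩ := (isCompact_sphere z₀ ρ).exists_isMinOn hsne
    ((hG.continuousOn.mono (sphere_subset_closedBall.trans hsV)).norm)
  set m := ‖G w‖ with hm
  have hm0 := norm_pos_iff.2
    ((hball w (hsub (sphere_subset_closedBall hw))).1 (ne_of_mem_sphere hw hρ0.ne'))
  have hev := Metric.tendstoUniformlyOn_iff.1 hunif (m / 2) (by positivity)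
  obtain ⟨i, hi⟩ := hev.exists
  have hgi := fun z h => (hball z (hsub h)).2.1 i
  have hbd : ∀ z ∈ frontier (ball z₀ ρ), ‖(g i z)⁻¹‖ ≤ (m / 2)⁻¹ := by
    intro z h
    rw [frontier_ball _ hρ0.ne'] at h
    have h1 := hi z (sphere_subset_closedBall h)
    have h2 : m ≤ ‖G z‖ := hmin h
    rw [norm_inv]
    apply inv_anti₀ (by positivity)
    rw [dist_eq_norm] at h1
    have := norm_sub_norm_le (G z) (g i z)
    linarith
  have hd : DiffContOnCl ℂ (fun z => (g i z)⁻¹) (ball z₀ ρ) := by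
    apply DifferentiableOn.diffContOnCl
    rw [closure_ball _ hρ0.ne']
    exact ((hg i).mono hsV).inv hgi
  have h3 := Complex.norm_le_of_forall_mem_frontier_norm_le isBounded_ball hd hbd
    (subset_closure (mem_ball_self hρ0))
  rw [norm_inv] at h3
  have h4 : m / 2 ≤ ‖g i z₀‖ := by
    have := inv_anti₀ (inv_pos.2 (norm_pos_iff.2 (hgi z₀ (mem_closedBall_self hρ0.le)))) h3
    simpa using this
  have h5 := hi z₀ (mem_closedBall_self hρ0.le)
  rw [h0, dist_zero_left] at h5
  linarith

open Complex Metric in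
/-- Pointwise limits along an ultrafilter of uniformly bounded holomorphic functions are
locally uniform. -/
lemma exists_tendstoLocallyUniformlyOn_of_mapsTo_ball {ι : Type*} (l : Ultrafilter ι)
    {V : Set ℂ} (hV : IsOpen V) {g : ι → ℂ → ℂ} (hg : ∀ i, DifferentiableOn ℂ (g i) V)
    (hb : ∀ i, MapsTo (g i) V (ball 0 1)) :
    ∃ G : ℂ → ℂ, TendstoLocallyUniformlyOn g G (l : Filter ι) V := by
  have hex : ∀ z, ∃ w, z ∈ V → Tendsto (fun i => g i z) l (𝓝 w) := by
    intro z
    by_cases hz : z ∈ V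
    · obtain ⟨w, -, hw⟩ := (isCompact_closedBall (0:ℂ) 1).ultrafilter_le_nhds
        (l.map fun i => g i z) (by
          rw [Ultrafilter.coe_map, le_principal_iff, mem_map]
          exact univ_mem' fun i => ball_subset_closedBall (hb i hz))
      exact ⟨w, fun _ => hw⟩
    · simp_all
  choose G hG using hex
  refine ⟨G, Metric.tendstoLocallyUniformlyOn_iff.2 fun ε hε z hz => ?_⟩
  obtain ⟨r, hr, hrV⟩ := Metric.isOpen_iff.1 hV z hz
  have hlip : ∀ i, ∀ w ∈ ball z (r / 2), dist (g i w) (g i z) ≤ (2 / r) * dist w z := by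
    intro i w hw
    rw [dist_eq_norm, dist_eq_norm]
    refine (convex_ball z (r/2)).norm_image_sub_le_of_norm_deriv_le (𝕜 := ℂ) (f := g i) ?_ ?_
      (mem_ball_self (by positivity)) hw
    · intro x hx
      exact (hg i).differentiableAt (hV.mem_nhds (hrV (ball_subset_ball (by linarith) hx)))
    · intro x hx
      have : ∀ r' < r / 2, 0 < r' → ‖deriv (g i) x‖ ≤ 1 / r' := by
        intro r' hr' h0
        have hsub : closedBall x r' ⊆ V := by
          intro y hy
          apply hrV
          rw [mem_closedBall] at hy
          rw [mem_ball] at hx ⊢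
          linarith [dist_triangle y x z]
        refine norm_deriv_le_of_forall_mem_sphere_norm_le h0 ?_ ?_
        · apply DifferentiableOn.diffContOnCl
          exact (hg i).mono (closure_ball_subset_closedBall.trans hsub)
        · intro y hy
          have := hb i (hsub (sphere_subset_closedBall hy))
          simpa using (mem_ball_zero_iff.1 this).le
      have h2 : Tendsto (fun r' : ℝ => 1 / r') (𝓝[<] (r / 2)) (𝓝 (1 / (r / 2))) :=
        (tendsto_const_nhds.div tendsto_id (by positivity)).mono_left nhdsWithin_le_nhds
      have h3 := ge_of_tendsto h2 (b := ‖deriv (g i) x‖) (by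
        filter_upwards [self_mem_nhdsWithin,
          nhdsWithin_le_nhds (lt_mem_nhds (show (0:ℝ) < r / 2 by positivity))] with r' h1 h0
        exact this r' h1 h0)
      simpa using h3
  set ρ := min (r / 2) (ε / 3 * (r / 2)) with hρ
  have hρ0 : 0 < ρ := by positivity
  refine ⟨ball z ρ, mem_nhdsWithin_of_mem_nhds (ball_mem_nhds z hρ0), ?_⟩
  have hclose : ∀ i, ∀ w ∈ ball z ρ, dist (g i w) (g i z) ≤ ε / 3 := by
    intro i w hw
    have h1 : dist w z < ρ := hw
    have h2 := hlip i w (ball_subset_ball (min_le_left _ _) hw)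
    have h3 := h1.le.trans (min_le_right _ _)
    calc dist (g i w) (g i z) ≤ (2 / r) * dist w z := h2
      _ ≤ (2 / r) * (ε / 3 * (r / 2)) := by gcongr
      _ = ε / 3 := by field_simp
  filter_upwards [Metric.tendsto_nhds.1 (hG z hz) (ε / 3) (by positivity)] with i hi w hw
  have hwV := hrV (ball_subset_ball ((min_le_left _ _).trans (by linarith)) hw)
  have hlim :=
    le_of_tendsto ((hG w hwV).dist (hG z hz)) (.of_forall fun i => hclose i w hw)
  have := hclose i w hw
  have h4 : dist (G w) (g i w) ≤ dist (G w) (G z) + dist (G z) (g i z) + dist (g i z) (g i w) :=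
    dist_triangle4 _ _ _ _
  rw [dist_comm (G z), dist_comm (g i z) (g i w)] at h4
  linarith

lemma hasDerivAt_of_sq_eq {h s : ℂ → ℂ} {z h' : ℂ} (hsz : ContinuousAt s z)
    (hs : ∀ y, s y ^ 2 = h y) (hs0 : s z ≠ 0) (hh : HasDerivAt h h' z) :
    HasDerivAt s (h' / (2 * s z)) z := by
  have hps : HasStrictDerivAt (fun y : ℂ => y ^ 2) (2 * s z) (s z) := by
    simpa using hasStrictDerivAt_pow 2 (s z)
  have h2s := mul_ne_zero two_ne_zero hs0
  set L := hps.localInverse _ _ _ h2s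
  have hL := hps.to_localInverse h2s
  have hev : ∀ᶠ y in 𝓝 z, s y = L (h y) := by
    have h1 := hsz.eventually (HasStrictFDerivAt.eventually_left_inverse
      (hps.hasStrictFDerivAt_equiv h2s))
    filter_upwards [h1] with y hy
    rw [← hs y]; exact hy.symm
  have hc : HasDerivAt (fun y => L (h y)) ((2 * s z)⁻¹ * h') z := by
    refine HasDerivAt.comp z ?_ hh
    rw [← hs z]
    exact hL.hasDerivAt
  refine (hc.congr_of_eventuallyEq hev).congr_deriv ?_
  field_simp

/-- A univalent branch of `√(z - b)` on a simply connected set avoiding `b`; its image stays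
away from the antipode of each of its points. -/
lemma exists_sqrt_branch {V : Set ℂ} (hV : IsOpen V) (hVs : IsSimplyConnected V) {b : ℂ}
    (hb : b ∉ V) {x₀ : ℂ} (hx₀ : x₀ ∈ V) :
    ∃ s : ℂ → ℂ, (∀ z, s z ^ 2 = z - b) ∧ (∀ z ∈ V, HasDerivAt s (1 / (2 * s z)) z) ∧
      (∀ z ∈ V, s z ≠ 0) ∧ ∃ ε > 0, ∀ z ∈ V, ε ≤ ‖s z + s x₀‖ := by
  obtain ⟨s, hsc, hs⟩ := Complex.exists_continuousOn_pow_eq hVs hV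
    (g := fun z => z - b) (by fun_prop) (by grind) two_ne_zero
  have hs0 : ∀ z ∈ V, s z ≠ 0 := fun z hz h => by grind
  have hsd := fun z hz =>
    hasDerivAt_of_sq_eq (hsc.continuousAt (hV.mem_nhds hz)) hs (hs0 z hz)
      ((hasDerivAt_id z).sub_const b)
  refine ⟨s, hs, hsd, hs0, ?_⟩
  have hnhds : s '' V ∈ 𝓝 (s x₀) := by
    have hA := DifferentiableOn.analyticAt (s := V)
      (fun z hz => (hsd z hz).differentiableAt.differentiableWithinAt) (hV.mem_nhds hx₀)
    have hd := hA.hasStrictDerivAt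
    rw [(hsd x₀ hx₀).deriv] at hd
    rw [← hd.map_nhds_eq (one_div_ne_zero (mul_ne_zero two_ne_zero (hs0 x₀ hx₀)))]
    exact image_mem_map (hV.mem_nhds hx₀)
  obtain ⟨ε, hε, hball⟩ := Metric.mem_nhds_iff.1 hnhds
  refine ⟨ε, hε, fun z hz => ?_⟩
  by_contra! hlt
  obtain ⟨y, hy, hyz⟩ := hball (show -s z ∈ ball (s x₀) ε by
    rw [mem_ball, dist_eq_norm, ← norm_neg]
    grind)
  grind

/-- The disc automorphism moving `w` to `0`. -/
def discAut (w z : ℂ) : ℂ := (z - w) / (1 - (starRingEnd ℂ) w * z)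

lemma discAut_denom_ne {w z : ℂ} (hw : ‖w‖ < 1) (hz : ‖z‖ < 1) :
    1 - (starRingEnd ℂ) w * z ≠ 0 := by
  intro h
  have h1 : (starRingEnd ℂ) w * z = 1 := by linear_combination -h
  have h2 : ‖w‖ * ‖z‖ = 1 := by
    simpa using congrArg norm h1
  nlinarith [norm_nonneg w, norm_nonneg z]

lemma norm_discAut_lt {w z : ℂ} (hw : ‖w‖ < 1) (hz : ‖z‖ < 1) : ‖discAut w z‖ < 1 := by
  rw [discAut, norm_div, div_lt_one (norm_pos_iff.2 (discAut_denom_ne hw hz))]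
  have h : ‖1 - (starRingEnd ℂ) w * z‖ ^ 2 - ‖z - w‖ ^ 2 = (1 - ‖w‖ ^ 2) * (1 - ‖z‖ ^ 2) := by
    simp only [← normSq_eq_norm_sq, Complex.normSq_apply]
    simp
    ring
  have h1 : 0 < (1 - ‖w‖ ^ 2) * (1 - ‖z‖ ^ 2) := by
    apply mul_pos <;> nlinarith [norm_nonneg w, norm_nonneg z]
  exact lt_of_pow_lt_pow_left₀ 2 (norm_nonneg _) (by linarith)

lemma discAut_self (w : ℂ) : discAut w w = 0 := by simp [discAut]

lemma discAut_injOn {w : ℂ} (hw : ‖w‖ < 1) : InjOn (discAut w) 𝔻 := by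
  intro x hx y hy h
  have hx' := discAut_denom_ne hw (mem_ball_zero_iff.1 hx)
  have hy' := discAut_denom_ne hw (mem_ball_zero_iff.1 hy)
  rw [discAut, discAut, div_eq_div_iff hx' hy'] at h
  have h1 : (x - y) * (1 - (starRingEnd ℂ) w * w) = 0 := by linear_combination h
  rcases mul_eq_zero.1 h1 with h2 | h2
  · exact sub_eq_zero.1 h2
  · exact absurd h2 (discAut_denom_ne hw hw)

lemma hasDerivAt_discAut {w z : ℂ} (hw : ‖w‖ < 1) (hz : ‖z‖ < 1) :
    HasDerivAt (discAut w) ((1 - (starRingEnd ℂ) w * w) / (1 - (starRingEnd ℂ) w * z) ^ 2) z := by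
  have h := ((hasDerivAt_id z).sub_const w).div
    (((hasDerivAt_id z).const_mul ((starRingEnd ℂ) w)).const_sub 1) (discAut_denom_ne hw hz)
  refine h.congr_deriv ?_
  congr 1
  simp
  ring

open Complex Metric in
/-- Univalent maps of `V` into the unit disc with nonvanishing derivative. -/
def DiscFamily (V : Set ℂ) (f : ℂ → ℂ) : Prop :=
  MapsTo f V (ball 0 1) ∧ InjOn f V ∧ ∀ z ∈ V, DifferentiableAt ℂ f z ∧ deriv f z ≠ 0

lemma DiscFamily.discAut_comp {V : Set ℂ} {f : ℂ → ℂ} (hf : DiscFamily V f) {w : ℂ}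
    (hw : ‖w‖ < 1) : DiscFamily V (discAut w ∘ f) := by
  obtain ⟨h1, h2, h3⟩ := hf
  refine ⟨fun z hz => mem_ball_zero_iff.2 (norm_discAut_lt hw (mem_ball_zero_iff.1 (h1 hz))),
    (discAut_injOn hw).comp h2 h1, fun z hz => ?_⟩
  have hz1 := mem_ball_zero_iff.1 (h1 hz)
  have hd := (hasDerivAt_discAut hw hz1).comp z (h3 z hz).1.hasDerivAt
  refine ⟨hd.differentiableAt, ?_⟩
  rw [hd.deriv]
  exact mul_ne_zero (div_ne_zero (discAut_denom_ne hw hw)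
    (pow_ne_zero _ (discAut_denom_ne hw hz1))) (h3 z hz).2

open Complex Metric in
lemma DiscFamily.exists_larger_deriv {V : Set ℂ} (hV : IsOpen V) (hVs : IsSimplyConnected V)
    {f : ℂ → ℂ} (hf : DiscFamily V f) {x₀ : ℂ} (hx₀ : x₀ ∈ V) (h0 : f x₀ = 0) {w : ℂ}
    (hw : ‖w‖ < 1) (hwV : w ∉ f '' V) :
    ∃ g, DiscFamily V g ∧ g x₀ = 0 ∧ ‖deriv f x₀‖ < ‖deriv g x₀‖ := by
  have hF := hf.discAut_comp hw
  have hne : 0 ∉ (discAut w ∘ f) '' V := by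
    rintro ⟨z, hz, h⟩
    apply hwV
    refine ⟨z, hz, discAut_injOn hw (hf.1 hz) (mem_ball_zero_iff.2 hw) ?_⟩
    rw [discAut_self]; exact h
  obtain ⟨s, hsc, hs⟩ := Complex.exists_continuousOn_pow_eq hVs hV
    (fun z hz => (hF.2.2 z hz).1.continuousAt.continuousWithinAt) hne two_ne_zero
  have hs0 : ∀ z ∈ V, s z ≠ 0 := fun z hz h => hne ⟨z, hz, by rw [← hs, h]; simp⟩
  have hsd : ∀ z ∈ V, HasDerivAt s (deriv (discAut w ∘ f) z / (2 * s z)) z := by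
    intro z hz
    exact hasDerivAt_of_sq_eq (hsc.continuousAt (hV.mem_nhds hz)) hs (hs0 z hz)
      (hF.2.2 z hz).1.hasDerivAt
  have hsF : DiscFamily V s := by
    refine ⟨fun z hz => ?_, fun a ha b hb hab => hF.2.1 ha hb ?_, fun z hz => ?_⟩
    · have := mem_ball_zero_iff.1 (hF.1 hz)
      rw [← hs z, norm_pow] at this
      rw [mem_ball_zero_iff]
      nlinarith [norm_nonneg (s z)]
    · rw [← hs a, ← hs b, hab]
    · refine ⟨(hsd z hz).differentiableAt, ?_⟩
      rw [(hsd z hz).deriv]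
      exact div_ne_zero (hF.2.2 z hz).2 (mul_ne_zero two_ne_zero (hs0 z hz))
  have hsx : ‖s x₀‖ < 1 := mem_ball_zero_iff.1 (hsF.1 hx₀)
  refine ⟨discAut (s x₀) ∘ s, hsF.discAut_comp hsx, discAut_self _, ?_⟩
  have hd1 : deriv (discAut w ∘ f) x₀ = (1 - (starRingEnd ℂ) w * w) * deriv f x₀ := by
    have := ((hasDerivAt_discAut hw (mem_ball_zero_iff.1 (hf.1 hx₀))).comp x₀
      (hf.2.2 x₀ hx₀).1.hasDerivAt).deriv
    rw [this, h0]; simp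
  have hd2 : deriv (discAut (s x₀) ∘ s) x₀ = (1 - (starRingEnd ℂ) (s x₀) * s x₀)⁻¹ *
      ((1 - (starRingEnd ℂ) w * w) * deriv f x₀ / (2 * s x₀)) := by
    have := ((hasDerivAt_discAut hsx hsx).comp x₀ (hsd x₀ hx₀)).deriv
    rw [this, hd1]
    have := discAut_denom_ne hsx hsx
    field_simp
  have hconj : ∀ a : ℂ, ‖1 - (starRingEnd ℂ) a * a‖ = |1 - ‖a‖ ^ 2| := by
    intro a
    rw [Complex.conj_mul']
    have : (1 - (‖a‖ : ℂ) ^ 2) = ((1 - ‖a‖ ^ 2 : ℝ) : ℂ) := by push_cast; rfl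
    rw [this, norm_real, Real.norm_eq_abs]
  set t := ‖s x₀‖ with ht
  have ht0 := norm_pos_iff.2 (hs0 x₀ hx₀)
  have hwt : ‖w‖ = t ^ 2 := by
    have := hs x₀
    simp only [Function.comp, h0, discAut] at this
    have h2 := congrArg norm this
    simp at h2
    rw [ht, ← h2]
  rw [hd2, norm_mul, norm_inv, norm_div, norm_mul, norm_mul, hconj, hconj, ← ht, hwt]
  have hp := norm_pos_iff.2 (hf.2.2 x₀ hx₀).2
  have h1 : 0 < 1 - t ^ 2 := by nlinarith
  have h2 : 0 < 1 - (t ^ 2) ^ 2 := by nlinarith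
  rw [abs_of_pos h1, abs_of_pos h2]
  simp only [Complex.norm_ofNat]
  rw [inv_mul_eq_div, div_div, lt_div_iff₀ (by positivity)]
  have : 2 * t * (1 - t ^ 2) < 1 - (t ^ 2) ^ 2 := by
    have : (1 - (t ^ 2) ^ 2) - 2 * t * (1 - t ^ 2) = (1 - t ^ 2) * (1 - t) ^ 2 := by ring
    have : 0 < (1 - t ^ 2) * (1 - t) ^ 2 := mul_pos h1 (pow_pos (by linarith) 2)
    linarith
  nlinarith

open Complex Metric in
lemma exists_isMax_deriv {V : Set ℂ} (hV : IsOpen V) (hVc : IsPreconnected V) {x₀ : ℂ}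
    (hx₀ : x₀ ∈ V) {f₀ : ℂ → ℂ} (hf₀ : DiscFamily V f₀) (h0 : f₀ x₀ = 0) :
    ∃ f, DiscFamily V f ∧ f x₀ = 0 ∧
      ∀ g, DiscFamily V g → g x₀ = 0 → ‖deriv g x₀‖ ≤ ‖deriv f x₀‖ := by
  set D : Set ℝ := {d | ∃ g, DiscFamily V g ∧ g x₀ = 0 ∧ d = ‖deriv g x₀‖}
  have hDne : D.Nonempty := ⟨_, f₀, hf₀, h0, rfl⟩
  obtain ⟨r, hr, hrV⟩ := Metric.isOpen_iff.1 hV x₀ hx₀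
  have hDb : BddAbove D := by
    refine ⟨1 / (r / 2), ?_⟩
    rintro _ ⟨g, hg, -, rfl⟩
    have hsub : closedBall x₀ (r / 2) ⊆ V := (closedBall_subset_ball (by linarith)).trans hrV
    refine norm_deriv_le_of_forall_mem_sphere_norm_le (by positivity) ?_ fun y hy => ?_
    · apply DifferentiableOn.diffContOnCl
      exact fun z hz => (hg.2.2 z (hsub (closure_ball_subset_closedBall
        hz))).1.differentiableWithinAt
    · exact (mem_ball_zero_iff.1 (hg.1 (hsub (sphere_subset_closedBall hy)))).le
  obtain ⟨d, -, hdlim, hdD⟩ := exists_seq_tendsto_sSup hDne hDb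
  choose g hgF hg0 hgd using hdD
  set l : Ultrafilter ℕ := hyperfilter ℕ
  have hgdiff : ∀ i, DifferentiableOn ℂ (g i) V := fun i z hz =>
    ((hgF i).2.2 z hz).1.differentiableWithinAt
  obtain ⟨G, hG⟩ := exists_tendstoLocallyUniformlyOn_of_mapsTo_ball l hV hgdiff
    (fun i => (hgF i).1)
  have hGd : DifferentiableOn ℂ G V := hG.differentiableOn (.of_forall hgdiff) hV
  have hG' := hG.deriv (.of_forall hgdiff) hV
  have hGx : G x₀ = 0 := tendsto_nhds_unique (hG.tendsto_at hx₀) (by simp [hg0])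
  have hnorm : ‖deriv G x₀‖ = sSup D := by
    refine tendsto_nhds_unique (hG'.tendsto_at hx₀).norm ?_
    refine (hdlim.mono_left ?_).congr fun i => by rw [hgd i]; rfl
    exact (Nat.hyperfilter_le_atTop)
  have hpos : 0 < ‖deriv G x₀‖ := by
    rw [hnorm]
    exact (norm_pos_iff.2 (hf₀.2.2 x₀ hx₀).2).trans_le (le_csSup hDb ⟨f₀, hf₀, h0, rfl⟩)
  have hGne : ∀ c, ∀ z ∈ V, ¬ ∀ᶠ y in 𝓝 z, G y = c := by
    intro c z hz h
    have hA : AnalyticOnNhd ℂ (fun y => G y - c) V :=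
      (hGd.sub_const c).analyticOnNhd hV
    have h2 := hA.eqOn_zero_of_preconnected_of_eventuallyEq_zero hVc hz
      (h.mono fun y hy => by simp [hy])
    have h3 : G =ᶠ[𝓝 x₀] fun _ => c := by
      filter_upwards [hV.mem_nhds hx₀] with y hy
      exact sub_eq_zero.1 (h2 hy)
    rw [h3.deriv_eq] at hpos
    simp at hpos
  have hderiv : ∀ z ∈ V, deriv G z ≠ 0 := by
    intro z hz hz0
    have hGd' : DifferentiableOn ℂ (deriv G) V := hGd.deriv hV
    have h := eventually_eq_zero_of_hurwitz hV (fun i => (hgdiff i).deriv hV) hG' hz (by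
      filter_upwards [hV.mem_nhds hz] with y hy i using ((hgF i).2.2 y hy).2) hz0
    have h2 := (hGd'.analyticOnNhd hV).eqOn_zero_of_preconnected_of_eventuallyEq_zero hVc hz h
    rw [h2 hx₀] at hpos
    simp at hpos
  refine ⟨G, ⟨fun z hz => ?_, ?_, fun z hz => ⟨hGd.differentiableAt (hV.mem_nhds hz),
    hderiv z hz⟩⟩, hGx, fun g hg h => ?_⟩
  · have hle : ∀ y ∈ V, ‖G y‖ ≤ 1 := fun y hy =>
      le_of_tendsto (hG.tendsto_at hy).norm
        (.of_forall fun i => (mem_ball_zero_iff.1 ((hgF i).1 hy)).le)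
    rw [mem_ball_zero_iff]
    refine lt_of_le_of_ne (hle z hz) fun h1 => ?_
    have hmax : IsLocalMax (norm ∘ G) z := by
      filter_upwards [hV.mem_nhds hz] with y hy
      simpa [h1] using hle y hy
    exact hGne _ z hz (Complex.eventually_eq_of_isLocalMax_norm (by
      filter_upwards [hV.mem_nhds hz] with y hy using hGd.differentiableAt (hV.mem_nhds hy)) hmax)
  · intro a ha b hb hab
    by_contra hne
    have hlim : TendstoLocallyUniformlyOn (fun i y => g i y - g i a) (fun y => G y - G a)
        (l : Filter ℕ) V := by
      refine Metric.tendstoLocallyUniformlyOn_iff.2 fun ε hε z hz => ?_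
      obtain ⟨t, ht, h1⟩ := Metric.tendstoLocallyUniformlyOn_iff.1 hG (ε / 2) (by positivity) z hz
      refine ⟨t, ht, ?_⟩
      filter_upwards [h1, Metric.tendsto_nhds.1 (hG.tendsto_at ha) (ε / 2) (by positivity)]
        with i h2 h3 y hy
      have h4 := h2 y hy
      rw [dist_comm] at h3
      calc dist (G y - G a) (g i y - g i a) ≤ dist (G y) (g i y) + dist (G a) (g i a) :=
            dist_sub_sub_le _ _ _ _
        _ < ε := by linarith
    have := eventually_eq_zero_of_hurwitz hV (fun i => (hgdiff i).sub_const _) hlim hb (by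
      filter_upwards [hV.mem_nhds hb, isOpen_ne.mem_nhds (Ne.symm hne)] with y hy hya i h
      exact hya ((hgF i).2.1 hy ha (sub_eq_zero.1 h))) (by simp [hab])
    exact hGne (G a) b hb (this.mono fun y hy => sub_eq_zero.1 hy)
  · rw [hnorm]; exact le_csSup hDb ⟨g, hg, h, rfl⟩

open Complex Metric in
/-- Riemann mapping theorem. -/
theorem exists_riemann_map {V : Set ℂ} (hV : IsOpen V) (hVs : IsSimplyConnected V)
    (hne : V ≠ univ) {x₀ : ℂ} (hx₀ : x₀ ∈ V) :
    ∃ φ : ℂ → ℂ, DifferentiableOn ℂ φ (ball 0 1) ∧ InjOn φ (ball 0 1) ∧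
      φ '' ball 0 1 = V ∧ φ 0 = x₀ ∧ deriv φ 0 ≠ 0 := by
  obtain ⟨b, hb⟩ := (ne_univ_iff_exists_notMem V).1 hne
  obtain ⟨s, hs, hsd, hs0, ε, hε, hsε⟩ := exists_sqrt_branch hV hVs hb hx₀
  have hsn := fun z hz => norm_pos_iff.1 (hε.trans_le (hsε z hz))
  have hd : ∀ z ∈ V, HasDerivAt (fun z => (ε / 2 : ℂ) / (s z + s x₀))
      (-((ε / 2 : ℂ) * (1 / (2 * s z))) / (s z + s x₀) ^ 2) z := fun z hz =>
    ((hasDerivAt_const z (ε / 2 : ℂ)).fun_div ((hsd z hz).add_const _) (hsn z hz)).congr_deriv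
      (by simp)
  have hε2 : (ε / 2 : ℂ) ≠ 0 := by simpa using hε.ne'
  have h1 : MapsTo (fun z => (ε / 2 : ℂ) / (s z + s x₀)) V (ball 0 1) := fun z hz => by
    rw [mem_ball_zero_iff, norm_div, div_lt_one (hε.trans_le (hsε z hz))]
    refine lt_of_lt_of_le ?_ (hsε z hz)
    simp [abs_of_pos hε, hε]
  have hf₁ : DiscFamily V (fun z => (ε / 2 : ℂ) / (s z + s x₀)) := by
    refine ⟨h1, fun x hx y hy hxy => ?_, fun z hz => ⟨(hd z hz).differentiableAt, ?_⟩⟩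
    · grind
    · rw [(hd z hz).deriv]
      grind
  obtain ⟨f, hf, hf0, hmax⟩ := exists_isMax_deriv hV hVs.isPathConnected.isConnected.isPreconnected
    hx₀ (hf₁.discAut_comp (mem_ball_zero_iff.1 (h1 hx₀))) (discAut_self _)
  have hsurj : f '' V = ball 0 1 := by
    refine (image_subset_iff.2 hf.1).antisymm fun w hw => ?_
    by_contra hwV
    obtain ⟨g, hg, hg0, hlt⟩ := hf.exists_larger_deriv hV hVs hx₀ hf0 (mem_ball_zero_iff.1 hw) hwV
    exact absurd (hmax g hg hg0) (not_le.2 hlt)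
  have hinv : InvOn (invFunOn f V) f V (f '' V) :=
    ⟨hf.2.1.leftInvOn_invFunOn, fun y hy => invFunOn_eq hy⟩
  have hmaps : ∀ y ∈ ball (0:ℂ) 1, invFunOn f V y ∈ V := fun y hy =>
    invFunOn_mem (by rw [← hsurj] at hy; exact hy)
  have hder : ∀ y ∈ ball (0:ℂ) 1, ∃ d, d ≠ 0 ∧ HasDerivAt (invFunOn f V) d y := by
    intro y hy
    obtain ⟨z, hz, rfl⟩ : y ∈ f '' V := by rwa [hsurj]
    have hstrict : HasStrictDerivAt f (deriv f z) z := by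
      have : AnalyticAt ℂ f z := DifferentiableOn.analyticAt (s := V)
        (fun y hy => (hf.2.2 y hy).1.differentiableWithinAt) (hV.mem_nhds hz)
      exact this.hasStrictDerivAt
    have hd := (hf.2.2 z hz).2
    have hL := hstrict.to_localInverse hd
    refine ⟨_, inv_ne_zero hd, hL.hasDerivAt.congr_of_eventuallyEq ?_⟩
    have hE := hstrict.hasStrictFDerivAt_equiv hd
    have hcont := hE.localInverse_continuousAt
    have hLz := hE.localInverse_apply_image
    filter_upwards [hE.eventually_right_inverse,
      hcont.eventually (by rw [hLz]; exact hV.mem_nhds hz)] with y h1 h2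
    have : f (invFunOn f V y) = y := hinv.2 ⟨_, h2, h1⟩
    exact hf.2.1 (invFunOn_mem ⟨_, h2, h1⟩) h2 (this.trans h1.symm)
  refine ⟨invFunOn f V, fun y hy => ?_, ?_, ?_, ?_, ?_⟩
  · obtain ⟨d, -, hd⟩ := hder y hy
    exact hd.differentiableAt.differentiableWithinAt
  · intro a ha b hb hab
    rw [← hsurj] at ha hb
    rw [← hinv.2 ha, ← hinv.2 hb, hab]
  · refine (image_subset_iff.2 hmaps).antisymm fun z hz => ?_
    exact ⟨f z, hf.1 hz, hinv.1 hz⟩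
  · rw [← hf0]; exact hinv.1 hx₀
  · obtain ⟨d, hd0, hd⟩ := hder 0 (mem_ball_self one_pos)
    rwa [hd.deriv]

lemma lintegral_polar {F : ℂ → ℝ≥0∞} (hF : Measurable F) :
    ∫⁻ r in Ioi (0:ℝ), ∫⁻ t in Ioo (-π) π,
      ofReal r * F (r * exp (t * I)) = ∫⁻ z, F z := by
  rw [← Complex.lintegral_comp_polarCoord_symm, polarCoord_target,
    Measure.volume_eq_prod, ← Measure.prod_restrict, lintegral_prod]
  · simp only [Complex.polarCoord_symm_apply, Complex.exp_mul_I, smul_eq_mul]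
    push_cast
    rfl
  · apply Measurable.aemeasurable
    have h : Measurable fun p : ℝ × ℝ => F (Complex.polarCoord.symm p) := by
      have h0 : Measurable fun p : ℝ × ℝ => (p.1 * (Real.cos p.2 + Real.sin p.2 * I) : ℂ) := by
        fun_prop
      have h1 := hF.comp h0
      simpa only [Function.comp_def, ← Complex.polarCoord_symm_apply] using h1
    exact (show Measurable fun p : ℝ × ℝ => ofReal p.1 by fun_prop).mul h

/-- The image of a univalent bounded map has finite area. -/
lemma lintegral_deriv_sq_lt_top {H : ℂ → ℂ} (hd : DifferentiableOn ℂ H 𝔻)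
    (hi : InjOn H 𝔻) {M : ℝ} (hM : ∀ z ∈ 𝔻, ‖H z‖ ≤ M) :
    ∫⁻ z, (𝔻).indicator (fun z => ‖deriv H z‖ₑ ^ 2) z < ∞ := by
  rw [lintegral_indicator isOpen_ball.measurableSet]
  have h := lintegral_image_eq_lintegral_abs_det_fderiv_mul volume
    (s := 𝔻) (f := H)
    (f' := fun z => (ContinuousLinearMap.toSpanSingleton ℂ (deriv H z)).restrictScalars ℝ)
    isOpen_ball.measurableSet (fun z hz => by
      have h1 :=
        (hd.differentiableAt (isOpen_ball.mem_nhds hz)).hasDerivAt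
      exact (h1.hasFDerivAt.restrictScalars ℝ).hasFDerivWithinAt) hi (fun _ => 1)
  have hdet : ∀ a : ℂ, |((ContinuousLinearMap.toSpanSingleton ℂ a).restrictScalars ℝ).det|
      = ‖a‖ ^ 2 := by
    intro a
    simp only [ContinuousLinearMap.det, ContinuousLinearMap.coe_restrictScalars]
    rw [LinearMap.det_restrictScalars]
    simp [Algebra.norm_complex_eq, normSq_eq_norm_sq]
  simp only [hdet, mul_one] at h
  have h2 : ∀ z, ‖deriv H z‖ₑ ^ 2 = ofReal (‖deriv H z‖ ^ 2) := fun z => by simp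
  simp only [h2]
  rw [← h]
  calc ∫⁻ _ in H '' 𝔻, (1 : ℝ≥0∞) = volume (H '' 𝔻) := by simp
    _ ≤ volume (closedBall (0:ℂ) M) := measure_mono (by
        rintro _ ⟨z, hz, rfl⟩
        simpa using hM z hz)
    _ < ∞ := measure_closedBall_lt_top

lemma enorm_sub_le_of_contDiffOn {γ : ℝ → ℂ} {a b c d : ℝ} (hγ : ContDiffOn ℝ 1 γ (Ioo a b))
    (hc : c ∈ Ioo a b) (hd : d ∈ Ioo a b) :
    ‖γ d - γ c‖ₑ ≤ ∫⁻ t in Ioo a b, ‖deriv γ t‖ₑ := by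
  wlog h : c ≤ d generalizing c d
  · rw [enorm_sub_rev]; grind
  have hsub := Icc_subset_Ioo hc.1 hd.2
  refine (enorm_sub_le_lintegral_deriv_of_contDiffOn_Icc (hγ.mono hsub) h).trans ?_
  exact lintegral_mono_set (by assumption)

/-- A curve of finite length has a limit at the right end. -/
lemma exists_tendsto_right_of_lintegral {γ : ℝ → ℂ} {a b : ℝ} (hab : a < b)
    (hγ : ContDiffOn ℝ 1 γ (Ioo a b)) (hfin : ∫⁻ t in Ioo a b, ‖deriv γ t‖ₑ ≠ ∞) :
    ∃ w, Tendsto γ (𝓝[<] b) (𝓝 w) := by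
  rw [← cauchy_map_iff_exists_tendsto, Metric.cauchy_iff]
  refine ⟨inferInstance, fun ε hε => ?_⟩
  have hμ : Tendsto (fun c => (volume.restrict (Ioo a b)) (Ioo c b)) (𝓝[<] b) (𝓝 0) := by
    have : Tendsto (fun c => ofReal (b - c)) (𝓝[<] b) (𝓝 0) := by
      have : Tendsto (fun c => b - c) (𝓝[<] b) (𝓝 (b - b)) :=
        (tendsto_const_nhds.sub tendsto_id).mono_left nhdsWithin_le_nhds
      simpa using ENNReal.tendsto_ofReal this
    refine tendsto_of_tendsto_of_tendsto_of_le_of_le tendsto_const_nhds this (fun _ => zero_le)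
      fun c => ?_
    calc _ ≤ volume (Ioo c b) := Measure.restrict_apply_le _ _
      _ = _ := Real.volume_Ioo
  have h0 := tendsto_setLIntegral_zero (μ := volume.restrict (Ioo a b)) hfin hμ
  have h1 := h0.eventually (gt_mem_nhds (show (0:ℝ≥0∞) < ofReal ε by simpa))
  obtain ⟨c, hc, hac⟩ := (h1.and (Ioo_mem_nhdsLT hab)).exists
  refine ⟨γ '' Ioo c b, image_mem_map (Ioo_mem_nhdsLT hac.2), ?_⟩
  rintro _ ⟨x, hx, rfl⟩ _ ⟨y, hy, rfl⟩
  have h2 := enorm_sub_le_of_contDiffOn (hγ.mono (Ioo_subset_Ioo_left hac.1.le)) hy hx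
  rw [Measure.restrict_restrict measurableSet_Ioo,
    inter_eq_left.2 (Ioo_subset_Ioo_left hac.1.le)] at hc
  have h3 := h2.trans_lt hc
  rw [← ofReal_norm, ENNReal.ofReal_lt_ofReal_iff hε] at h3
  rwa [dist_eq_norm]

/-- A curve of finite length has a limit at the left end. -/
lemma exists_tendsto_left_of_lintegral {γ : ℝ → ℂ} {a b : ℝ} (hab : a < b)
    (hγ : ContDiffOn ℝ 1 γ (Ioo a b)) (hfin : ∫⁻ t in Ioo a b, ‖deriv γ t‖ₑ ≠ ∞) :
    ∃ w, Tendsto γ (𝓝[>] a) (𝓝 w) := by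
  have hmaps : MapsTo (fun t : ℝ => -t) (Ioo (-b) (-a)) (Ioo a b) := fun t ht =>
    ⟨by linarith [ht.2], by linarith [ht.1]⟩
  have := exists_tendsto_right_of_lintegral (γ := fun t => γ (-t)) (neg_lt_neg hab)
    (hγ.comp contDiff_neg.contDiffOn hmaps) (by
      have h1 : ∀ t, ‖deriv (fun t => γ (-t)) t‖ₑ = ‖deriv γ (-t)‖ₑ := fun t => by
        rw [deriv_comp_neg, enorm_neg]
      simp only [h1]
      have h2 := (Measure.measurePreserving_neg (volume : Measure ℝ)).setLIntegral_comp_preimage_emb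
        (MeasurableEquiv.neg ℝ).measurableEmbedding (fun t => ‖deriv γ t‖ₑ) (Ioo a b)
      simp_all)
  obtain ⟨w, hw⟩ := this
  refine ⟨w, ?_⟩
  have h : Tendsto (fun t : ℝ => -t) (𝓝[>] a) (𝓝[<] (-a)) := tendsto_neg_nhdsGT
  simpa [Function.comp_def] using hw.comp h

/-- The circle of radius `r` about the boundary point `ζ`, parametrized from the side of `0`. -/
def crossCirc (ζ : ℂ) (r t : ℝ) : ℂ := ζ * (1 - r * exp (t * I))

lemma norm_crossCirc_sq {ζ : ℂ} (hζ : ‖ζ‖ = 1) (r t : ℝ) :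
    ‖crossCirc ζ r t‖ ^ 2 = 1 - 2 * r * Real.cos t + r ^ 2 := by
  rw [crossCirc, norm_mul, hζ, one_mul, ← normSq_eq_norm_sq, Complex.normSq_apply,
    Complex.exp_mul_I, ← Complex.ofReal_cos, ← Complex.ofReal_sin]
  simp only [sub_re, Complex.one_re, Complex.re_ofReal_mul, add_re,
    ofReal_re, Complex.I_re, sub_im, Complex.one_im,
    Complex.im_ofReal_mul, Complex.add_im, Complex.ofReal_im, Complex.I_im]
  nlinarith [Real.sin_sq_add_cos_sq t]

lemma dist_crossCirc {ζ : ℂ} (hζ : ‖ζ‖ = 1) {r : ℝ} (hr : 0 ≤ r) (t : ℝ) :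
    dist (crossCirc ζ r t) ζ = r := by
  rw [crossCirc, dist_eq_norm]
  have : ζ * (1 - r * exp (t * I)) - ζ = -(ζ * (r * exp (t * I))) := by
    ring
  simp_all

lemma continuous_crossCirc (ζ : ℂ) (r : ℝ) : Continuous (crossCirc ζ r) := by
  unfold crossCirc; fun_prop

lemma crossCirc_mem_ball_iff {ζ : ℂ} (hζ : ‖ζ‖ = 1) {r t : ℝ} (hr : 0 < r) :
    crossCirc ζ r t ∈ 𝔻 ↔ r / 2 < Real.cos t := by
  rw [mem_ball_zero_iff, ← sq_lt_one_iff₀ (norm_nonneg _), norm_crossCirc_sq hζ]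
  constructor <;> intro h <;> nlinarith

/-- Half the opening angle of the arc `|z - ζ| = r` inside the unit disc. -/
def openAngle (r : ℝ) : ℝ := Real.arccos (r / 2)

lemma openAngle_pos {r : ℝ} (hr1 : r < 2) : 0 < openAngle r :=
  Real.arccos_pos.2 (by linarith)

lemma openAngle_lt {r : ℝ} (hr : 0 < r) : openAngle r < π / 2 :=
  Real.arccos_lt_pi_div_two.2 (by linarith)

lemma cos_openAngle {r : ℝ} (hr : 0 < r) (hr1 : r < 2) : Real.cos (openAngle r) = r / 2 :=
  Real.cos_arccos (by linarith) (by linarith)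

lemma lt_cos_iff_of_openAngle {r t : ℝ} (hr : 0 < r) (hr1 : r < 2)
    (ht : t ∈ Icc (-π) π) :
    r / 2 < Real.cos t ↔ t ∈ Ioo (-openAngle r) (openAngle r) := by
  have h1 : |t| ∈ Icc 0 π := ⟨abs_nonneg t, abs_le.2 ht⟩
  have h2 : openAngle r ∈ Icc 0 π := ⟨Real.arccos_nonneg _, Real.arccos_le_pi _⟩
  rw [← cos_openAngle hr hr1, ← Real.cos_abs t, Real.strictAntiOn_cos.lt_iff_gt h2 h1, mem_Ioo,
    ← abs_lt]

lemma crossCirc_mem_ball {ζ : ℂ} (hζ : ‖ζ‖ = 1) {r t : ℝ} (hr : 0 < r) (hr1 : r < 2)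
    (ht : t ∈ Ioo (-openAngle r) (openAngle r)) : crossCirc ζ r t ∈ 𝔻 := by
  rw [crossCirc_mem_ball_iff hζ hr]
  have := openAngle_lt hr
  have := Real.pi_pos
  exact (lt_cos_iff_of_openAngle hr hr1 ⟨by linarith [ht.1], by linarith [ht.2]⟩).2 ht

lemma exists_crossCirc_eq {ζ : ℂ} (hζ : ‖ζ‖ = 1) {r : ℝ} (hr : 0 < r) (hr1 : r < 2) {z : ℂ}
    (hz : z ∈ 𝔻) (hzr : dist z ζ = r) :
    ∃ t ∈ Ioo (-openAngle r) (openAngle r), crossCirc ζ r t = z := by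
  have hζ0 : ζ ≠ 0 := norm_pos_iff.1 (by rw [hζ]; exact one_pos)
  set w : ℂ := 1 - z / ζ
  have hw : ‖w‖ = r := by
    have : w = -(z - ζ) / ζ := by simp only [w]; field_simp; ring
    rw [this, norm_div, hζ, norm_neg, div_one, ← dist_eq_norm, hzr]
  have hz2 : crossCirc ζ r w.arg = z := by
    rw [crossCirc, ← hw, norm_mul_exp_arg_mul_I]
    simp only [w]; field_simp; ring
  refine ⟨w.arg, ?_, hz2⟩
  rw [← lt_cos_iff_of_openAngle hr hr1 ⟨(Complex.neg_pi_lt_arg w).le, Complex.arg_le_pi w⟩,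
    ← crossCirc_mem_ball_iff hζ hr, hz2]
  exact hz

lemma hasDerivAt_crossCirc (ζ : ℂ) (r t : ℝ) :
    HasDerivAt (crossCirc ζ r) (-(ζ * (r * (exp (t * I) * I)))) t := by
  have h1 : HasDerivAt (fun t : ℝ => (t : ℂ) * I) I t := by
    simpa using (Complex.ofRealCLM.hasDerivAt (x := t)).mul_const I
  have h2 := ((h1.cexp.const_mul (r : ℂ)).const_sub 1).const_mul ζ
  exact h2.congr_deriv (by ring)

lemma enorm_deriv_comp_crossCirc {H : ℂ → ℂ} (hd : DifferentiableOn ℂ H 𝔻) {ζ : ℂ} (hζ : ‖ζ‖ = 1)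
    {r t : ℝ} (hr : 0 < r)
    (hz : crossCirc ζ r t ∈ 𝔻) :
    ‖deriv (fun t => H (crossCirc ζ r t)) t‖ₑ =
      ofReal r * ‖deriv H (crossCirc ζ r t)‖ₑ := by
  have h1 :=
    (hd.differentiableAt (isOpen_ball.mem_nhds hz)).hasDerivAt
  have h2 := (h1.comp t (hasDerivAt_crossCirc ζ r t)).deriv
  rw [show (fun t => H (crossCirc ζ r t)) = H ∘ crossCirc ζ r from rfl, h2]
  rw [← ofReal_norm, ← ofReal_norm, ← ENNReal.ofReal_mul hr.le]
  congr 1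
  simp [hζ, norm_exp_ofReal_mul_I, abs_of_pos hr]
  ring

lemma contDiffOn_comp_crossCirc {H : ℂ → ℂ} (hd : DifferentiableOn ℂ H 𝔻) {ζ : ℂ} (hζ : ‖ζ‖ = 1)
    {r : ℝ} (hr : 0 < r) (hr1 : r < 2) :
    ContDiffOn ℝ 1 (fun t => H (crossCirc ζ r t)) (Ioo (-openAngle r) (openAngle r)) := by
  have h1 : ContDiffOn ℝ 1 H 𝔻 :=
    (hd.contDiffOn isOpen_ball).restrict_scalars ℝ
  refine h1.comp (g := H) (f := crossCirc ζ r) ?_ fun t ht => crossCirc_mem_ball hζ hr hr1 ht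
  apply ContDiff.contDiffOn
  unfold crossCirc
  have : ContDiff ℝ 1 (fun t : ℝ => (t : ℂ)) := Complex.ofRealCLM.contDiff
  fun_prop

/-- The length of the image of the arc `|z - ζ| = r` under `H`. -/
def arcLength (H : ℂ → ℂ) (ζ : ℂ) (r : ℝ) : ENNReal :=
  ∫⁻ t in Ioo (-openAngle r) (openAngle r), ‖deriv (fun t => H (crossCirc ζ r t)) t‖ₑ

/-- The squared derivative integrated over the arc `|z - ζ| = r` inside the unit disc. -/
def arcEnergy (H : ℂ → ℂ) (ζ : ℂ) (r : ℝ) : ENNReal :=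
  ∫⁻ t in Ioo (-π) π, ofReal r *
    (𝔻).indicator (fun z => ‖deriv H z‖ₑ ^ 2) (crossCirc ζ r t)

lemma lintegral_arcEnergy (H : ℂ → ℂ) {ζ : ℂ} (hζ : ‖ζ‖ = 1) :
    ∫⁻ r in Ioi (0:ℝ), arcEnergy H ζ r =
      ∫⁻ z, (𝔻).indicator (fun z => ‖deriv H z‖ₑ ^ 2) z := by
  set F := (𝔻).indicator (fun z => ‖deriv H z‖ₑ ^ 2)
  have hF : Measurable F := by
    refine Measurable.indicator ?_ isOpen_ball.measurableSet
    exact ((measurable_deriv H).enorm).pow_const 2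
  have h1 := lintegral_polar (F := fun w => F (ζ * (1 - w))) (hF.comp (by fun_prop))
  refine h1.trans ?_
  have hmp : MeasurePreserving (fun w : ℂ => ζ * (1 - w)) volume volume := by
    have hr := (rotation (⟨ζ, mem_sphere_zero_iff_norm.2 hζ⟩ : Circle)).measurePreserving
    have hs := Measure.measurePreserving_sub_left (volume : Measure ℂ) 1
    exact hr.comp hs
  exact hmp.lintegral_comp hF

lemma arcLength_le {H : ℂ → ℂ} (hd : DifferentiableOn ℂ H 𝔻) {ζ : ℂ}
    (hζ : ‖ζ‖ = 1) {r : ℝ} (hr : 0 < r) (hr1 : r < 2) {c : ℝ} (hc : 0 < c) :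
    arcLength H ζ r ≤ ofReal (c / 2) +
      ofReal (π * r / c) * arcEnergy H ζ r := by
  have hpi := Real.pi_pos
  have hsub : Ioo (-openAngle r) (openAngle r) ⊆ Ioo (-π) π := by
    have := openAngle_lt hr
    exact Ioo_subset_Ioo (by linarith) (by linarith)
  have h1 : ∀ t ∈ Ioo (-openAngle r) (openAngle r),
      ‖deriv (fun t => H (crossCirc ζ r t)) t‖ₑ ≤ ofReal (c / (4 * π)) +
        ofReal (π * r / c) * (ofReal r *
        (𝔻).indicator (fun z => ‖deriv H z‖ₑ ^ 2) (crossCirc ζ r t)) := by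
    intro t ht
    have hz := crossCirc_mem_ball hζ hr hr1 ht
    rw [enorm_deriv_comp_crossCirc hd hζ hr hz, indicator_of_mem hz]
    set x := ‖deriv H (crossCirc ζ r t)‖ with hx
    have hx0 : 0 ≤ x := norm_nonneg _
    rw [← ofReal_norm, ← hx, ← ENNReal.ofReal_pow hx0, ← ENNReal.ofReal_mul hr.le,
      ← ENNReal.ofReal_mul hr.le, ← ENNReal.ofReal_mul (by positivity),
      ← ENNReal.ofReal_add (by positivity) (by positivity)]
    apply ENNReal.ofReal_le_ofReal
    have : c / (4 * π) + π * r / c * (r * x ^ 2) - r * x =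
        (c - 2 * π * (r * x)) ^ 2 / (4 * π * c) := by
      field_simp
      ring
    have h2 : 0 ≤ (c - 2 * π * (r * x)) ^ 2 / (4 * π * c) := by positivity
    linarith
  calc arcLength H ζ r ≤ ∫⁻ t in Ioo (-openAngle r) (openAngle r), (ofReal (c / (4 * π)) +
        ofReal (π * r / c) * (ofReal r *
        (𝔻).indicator (fun z => ‖deriv H z‖ₑ ^ 2) (crossCirc ζ r t))) :=
        MeasureTheory.setLIntegral_mono' measurableSet_Ioo h1
    _ ≤ ∫⁻ t in Ioo (-π) π, (ofReal (c / (4 * π)) +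
        ofReal (π * r / c) * (ofReal r *
        (𝔻).indicator (fun z => ‖deriv H z‖ₑ ^ 2) (crossCirc ζ r t))) :=
        MeasureTheory.lintegral_mono_set hsub
    _ = _ := by
      rw [MeasureTheory.lintegral_add_left measurable_const,
        MeasureTheory.lintegral_const_mul' _ _ ENNReal.ofReal_ne_top,
        MeasureTheory.lintegral_const, MeasureTheory.Measure.restrict_apply_univ,
        Real.volume_Ioo, ← ENNReal.ofReal_mul (by positivity)]
      congr 2
      field_simp
      ring

/-- The length–area principle. -/
theorem exists_short_arcs {H : ℂ → ℂ} (hd : DifferentiableOn ℂ H 𝔻)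
    (hA : ∫⁻ z, (𝔻).indicator (fun z => ‖deriv H z‖ₑ ^ 2) z < ∞)
    {c ε : ℝ} (hc : 0 < c) (hε : 0 < ε) (hε1 : ε ≤ 1) :
    ∃ δ > 0, δ < ε ∧ ∀ ζ : ℂ, ‖ζ‖ = 1 →
      ¬ ∀ᵐ r ∂volume.restrict (Ioo δ ε), ofReal c ≤ arcLength H ζ r := by
  have hpi := Real.pi_pos
  obtain ⟨A, hA0, hAe⟩ : ∃ A : ℝ, 0 ≤ A ∧
      ∫⁻ z, (𝔻).indicator (fun z => ‖deriv H z‖ₑ ^ 2) z = ofReal A :=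
    ⟨_, ENNReal.toReal_nonneg, (ENNReal.ofReal_toReal hA.ne).symm⟩
  set N := 2 * π * (A + 1) / c ^ 2 with hN
  have hN0 : 0 < N := by positivity
  refine ⟨ε * Real.exp (-N), by positivity, ?_, fun ζ hζ hall => ?_⟩
  · simp_all
  set δ := ε * Real.exp (-N) with hδ
  have hδ0 : 0 < δ := by positivity
  have hδε : δ ≤ ε := by
    have : Real.exp (-N) ≤ 1 := Real.exp_le_one_iff.2 (by linarith)
    nlinarith
  have h1 : ∀ᵐ r ∂volume.restrict (Ioo δ ε),
      ofReal (c ^ 2 / (2 * π) * r⁻¹) ≤ arcEnergy H ζ r := by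
    filter_upwards [hall, ae_restrict_mem measurableSet_Ioo] with r h2 hr
    have hr0 := hδ0.trans hr.1
    have h3 := h2.trans (arcLength_le hd hζ hr0 (by linarith [hr.2]) hc)
    have h4 : ofReal (c / 2) ≤ ofReal (π * r / c) * arcEnergy H ζ r := by
      rw [show c = c / 2 + c / 2 by ring, ENNReal.ofReal_add (by positivity) (by positivity)] at h3
      rw [show (c / 2 + c / 2) = c by ring] at h3
      exact (ENNReal.add_le_add_iff_left ENNReal.ofReal_ne_top).1 h3
    calc ofReal (c ^ 2 / (2 * π) * r⁻¹) =
        ofReal (c / (π * r)) * ofReal (c / 2) := by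
          rw [← ENNReal.ofReal_mul (by positivity)]
          congr 1
          field_simp
      _ ≤ ofReal (c / (π * r)) *
          (ofReal (π * r / c) * arcEnergy H ζ r) := by gcongr
      _ = arcEnergy H ζ r := by
          rw [← mul_assoc, ← ENNReal.ofReal_mul (by positivity)]
          have : c / (π * r) * (π * r / c) = 1 := by field_simp
          rw [this]; simp
  have h2 : ∫⁻ r in Ioo δ ε, ofReal (c ^ 2 / (2 * π) * r⁻¹) ≤ ofReal A := by
    rw [← hAe, ← lintegral_arcEnergy H hζ]
    refine (lintegral_mono_ae h1).trans (lintegral_mono_set ?_)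
    intro r hr; exact hδ0.trans hr.1
  have h3 : ∫⁻ r in Ioo δ ε, ofReal (c ^ 2 / (2 * π) * r⁻¹) =
      ofReal (A + 1) := by
    have hii : IntervalIntegrable (fun r : ℝ => c ^ 2 / (2 * π) * r⁻¹) volume δ ε := by
      apply IntervalIntegrable.const_mul
      apply intervalIntegral.intervalIntegrable_inv (fun x hx => ?_) continuousOn_id
      rw [uIcc_of_le hδε] at hx
      exact (hδ0.trans_le hx.1).ne'
    rw [intervalIntegrable_iff_integrableOn_Ioo_of_le hδε] at hii
    rw [← ofReal_integral_eq_lintegral_ofReal hii]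
    · congr 1
      rw [← integral_Ioc_eq_integral_Ioo, ← intervalIntegral.integral_of_le hδε,
        intervalIntegral.integral_const_mul, integral_inv_of_pos hδ0 hε, hδ]
      have : ε / (ε * Real.exp (-N)) = Real.exp N := by
        rw [Real.exp_neg]; field_simp
      rw [this, Real.log_exp, hN]
      field_simp
    · filter_upwards [ae_restrict_mem measurableSet_Ioo] with r hr
      have hr0 := hδ0.trans hr.1
      positivity
  rw [h3, ENNReal.ofReal_le_ofReal_iff hA0] at h2
  linarith

lemma ae_arcLength_lt_top {H : ℂ → ℂ} (hd : DifferentiableOn ℂ H 𝔻)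
    (hA : ∫⁻ z, (𝔻).indicator (fun z => ‖deriv H z‖ₑ ^ 2) z < ∞)
    {ζ : ℂ} (hζ : ‖ζ‖ = 1) :
    ∀ᵐ r ∂volume.restrict (Ioo (0:ℝ) 1), arcLength H ζ r ≠ ∞ := by
  have h1 : ∀ᵐ r ∂volume.restrict (Ioi (0:ℝ)), arcEnergy H ζ r < ∞ := by
    refine ae_lt_top' ?_ (by rw [lintegral_arcEnergy H hζ]; exact hA.ne)
    apply Measurable.aemeasurable
    have : Measurable fun p : ℝ × ℝ => ofReal p.1 *
        (𝔻).indicator (fun z => ‖deriv H z‖ₑ ^ 2) (crossCirc ζ p.1 p.2) := by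
      have hF : Measurable ((𝔻).indicator (fun z => ‖deriv H z‖ₑ ^ 2)) :=
        ((measurable_deriv H).enorm.pow_const 2).indicator isOpen_ball.measurableSet
      have hg : Measurable fun p : ℝ × ℝ => crossCirc ζ p.1 p.2 := by unfold crossCirc; fun_prop
      exact (show Measurable fun p : ℝ × ℝ => ofReal p.1 by fun_prop).mul (hF.comp hg)
    exact this.lintegral_prod_right'
  have h2 := ae_restrict_of_ae_restrict_of_subset (fun r hr => hr.1 : Ioo (0:ℝ) 1 ⊆ Ioi 0) h1
  filter_upwards [h2, ae_restrict_mem measurableSet_Ioo] with r h3 hr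
  refine ne_top_of_le_ne_top ?_ (arcLength_le hd hζ hr.1 (by linarith [hr.2]) one_pos)
  exact add_ne_top.2 ⟨ofReal_ne_top, mul_ne_top ofReal_ne_top h3.ne⟩

/-- Radial limits exist almost everywhere for a univalent map of finite area. -/
lemma ae_exists_radial_limit {H : ℂ → ℂ} (hd : DifferentiableOn ℂ H 𝔻)
    (hA : ∫⁻ z, (𝔻).indicator (fun z => ‖deriv H z‖ₑ ^ 2) z < ∞) :
    ∀ᵐ t : ℝ ∂volume.restrict (Ioo (-π) π),
      ∃ w, Tendsto (fun r : ℝ => H (r * exp (t * I))) (𝓝[<] 1) (𝓝 w) := by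
  set F := (𝔻).indicator (fun z => ‖deriv H z‖ₑ ^ 2) with hFdef
  have hF : Measurable F :=
    ((measurable_deriv H).enorm.pow_const 2).indicator isOpen_ball.measurableSet
  have hFp : Measurable fun p : ℝ × ℝ =>
      ofReal p.1 * F (p.1 * exp (p.2 * I)) :=
    Measurable.mul (by fun_prop) (hF.comp (by fun_prop))
  have h1 := lintegral_polar hF
  rw [lintegral_lintegral_swap hFp.aemeasurable] at h1
  have h2 : ∀ᵐ t : ℝ ∂volume.restrict (Ioo (-π) π), ∫⁻ r in Ioi (0:ℝ),
      ofReal r * F (r * exp (t * I)) < ∞ := by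
    refine ae_lt_top' ?_ (by rw [h1]; exact hA.ne)
    exact (Measurable.lintegral_prod_left' (f := fun p : ℝ × ℝ =>
      ofReal p.1 * F (p.1 * exp (p.2 * I))) hFp).aemeasurable
  filter_upwards [h2] with t ht
  have hmem : ∀ r ∈ Ioo (1/2:ℝ) 1, (r * exp (t * I) : ℂ) ∈ 𝔻 := by
    intro r hr
    rw [mem_ball_zero_iff, norm_mul, norm_exp_ofReal_mul_I, mul_one, norm_real,
      Real.norm_eq_abs, abs_of_pos (by linarith [hr.1])]
    exact hr.2
  refine exists_tendsto_right_of_lintegral (a := 1/2) (by norm_num) ?_ ?_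
  · have h3 : ContDiffOn ℝ 1 H 𝔻 :=
      (hd.contDiffOn isOpen_ball).restrict_scalars ℝ
    refine h3.comp (f := fun r : ℝ => (r * exp (t * I) : ℂ)) ?_ hmem
    have : ContDiff ℝ 1 (fun t : ℝ => (t : ℂ)) := Complex.ofRealCLM.contDiff
    fun_prop
  · have h4 : ∀ r ∈ Ioo (1/2:ℝ) 1, ‖deriv (fun r : ℝ => H (r * exp (t * I))) r‖ₑ ≤
        1 + 2 * (ofReal r * F (r * exp (t * I))) := by
      intro r hr
      have hz := hmem r hr
      have h5 :=
        (hd.differentiableAt (isOpen_ball.mem_nhds hz)).hasDerivAt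
      have h6 : HasDerivAt (fun r : ℝ => (r * exp (t * I) : ℂ))
          (exp (t * I)) r := by
        simpa using (Complex.ofRealCLM.hasDerivAt (x := r)).mul_const (exp (t * I))
      have h7 := (h5.comp r h6).deriv
      rw [show (fun r : ℝ => H (r * exp (t * I))) =
        H ∘ fun r : ℝ => (r * exp (t * I) : ℂ) from rfl, h7, hFdef,
        indicator_of_mem hz]
      set x := ‖deriv H (r * exp (t * I))‖ with hx
      have hr0 : 0 < r := by linarith [hr.1]
      rw [← ofReal_norm, norm_mul, norm_exp_ofReal_mul_I, mul_one, ← hx, ← ofReal_norm,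
        ← hx, ← ENNReal.ofReal_pow (norm_nonneg _), ← ENNReal.ofReal_mul hr0.le,
        ← ENNReal.ofReal_ofNat 2, ← ENNReal.ofReal_mul (by norm_num), ← ENNReal.ofReal_one,
        ← ENNReal.ofReal_add (by norm_num) (by positivity)]
      apply ENNReal.ofReal_le_ofReal
      nlinarith [hr.1, sq_nonneg (x - 1), sq_nonneg x]
    refine ne_top_of_le_ne_top ?_ (setLIntegral_mono' measurableSet_Ioo h4)
    rw [lintegral_add_left measurable_const, lintegral_const_mul' _ _ (by norm_num)]
    refine add_ne_top.2 ⟨by simp, mul_ne_top (by norm_num) ?_⟩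
    refine ne_top_of_le_ne_top ht.ne (lintegral_mono_set ?_)
    grind

/-- A parametrization of the simply connected set `U` by the unit disc with the boundary behaviour
of a conformal map. -/
structure IsDiscModel {S : Type*} [MetricSpace S] (U : Set S) (φ : ℂ → S) : Prop where
  cont : ContinuousOn φ 𝔻
  inj : InjOn φ 𝔻
  img : φ '' 𝔻 = U
  open_map : ∀ V : Set ℂ, IsOpen V → V ⊆ 𝔻 → IsOpen (φ '' V)
  la : ∀ ε : ℝ, 0 < ε → ε ≤ 1 → ∃ δ > 0, δ < ε ∧ ∀ ζ : ℂ, ‖ζ‖ = 1 →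
    ¬ ∀ᵐ r ∂MeasureTheory.volume.restrict (Ioo δ ε),
      ¬ ∀ t ∈ Ioo (-openAngle r) (openAngle r), ∀ t' ∈ Ioo (-openAngle r) (openAngle r),
        dist (φ (crossCirc ζ r t)) (φ (crossCirc ζ r t')) < ε
  land : ∀ ζ : ℂ, ‖ζ‖ = 1 → ∀ᵐ r ∂MeasureTheory.volume.restrict (Ioo (0:ℝ) 1),
    (∃ a, Tendsto (fun t => φ (crossCirc ζ r t)) (𝓝[>] (-openAngle r)) (𝓝 a)) ∧
    ∃ a, Tendsto (fun t => φ (crossCirc ζ r t)) (𝓝[<] (openAngle r)) (𝓝 a)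
  rad : ∀ a ∉ U, ∀ᵐ t : ℝ, ∃ w ≠ a,
    Tendsto (fun r : ℝ => φ (r * exp (t * I))) (𝓝[<] 1) (𝓝 w)

/-- The inverse of a disc model. -/
def discInv {S : Type*} (φ : ℂ → S) : S → ℂ := invFunOn φ 𝔻

/-- A point of the open disc `|z - ζ| < r` cannot be joined to its exterior inside the unit disc
without crossing the circle. -/
lemma IsPreconnected.subset_ball_compl {C : Set ℂ} (hC : IsPreconnected C) {ζ : ℂ} {r : ℝ}
    (hd : ∀ z ∈ C, dist z ζ ≠ r) {z₀ : ℂ} (hz₀ : z₀ ∈ C) (h0 : r ≤ dist z₀ ζ) :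
    ∀ z ∈ C, r < dist z ζ := by
  intro z hz
  by_contra h
  have hc : ContinuousOn (fun z => dist z ζ) C := by fun_prop
  obtain ⟨w, hw, hwr⟩ := (hC.image _ hc).Icc_subset (mem_image_of_mem _ hz)
    (mem_image_of_mem _ hz₀) ⟨not_lt.1 h, h0⟩
  exact hd w hw hwr

lemma arg_neg_mul {ρ s t : ℝ} (hρ : 0 < ρ) (h1 : t < s) (h2 : s < t + 2 * π) :
    (-(ρ * exp (s * I)) * exp (-t * I)).arg = s - t - π := by
  have : -(ρ * exp (s * I)) * exp (-t * I) =
      ρ * exp ((s - t - π : ℝ) * I) := by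
    push_cast
    rw [show ((s : ℂ) - t - π) * I = s * I + -t * I -
      π * I by ring, exp_sub, exp_add, exp_pi_mul_I]
    ring
  rw [this, Complex.arg_real_mul _ hρ, Complex.exp_mul_I]
  exact Complex.arg_cos_add_sin_mul_I ⟨by linarith, by linarith⟩

/-- A connected subset of the disc avoiding two radii lies on one side. -/
lemma not_preconnected_of_radii {C : Set ℂ} (hC : IsPreconnected C) (h0 : (0:ℂ) ∉ C) {t₁ t₂ : ℝ}
    (hC1 : ∀ z ∈ C, z ≠ ‖z‖ * exp (t₁ * I))
    (hC2 : ∀ z ∈ C, z ≠ ‖z‖ * exp (t₂ * I)) {x y : ℂ} (hx : x ∈ C) (hy : y ∈ C)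
    (hx2 : (-x * exp (-t₁ * I)).arg < t₂ - t₁ - π)
    (hy2 : t₂ - t₁ - π < (-y * exp (-t₁ * I)).arg) : False := by
  have hpi := Real.pi_pos
  have hexp : ∀ t : ℝ, exp (t * I) * exp (-t * I) = 1 := by
    intro t; rw [← exp_add]; simp
  have hnorm : ∀ z : ℂ, ‖-z * exp (-t₁ * I)‖ = ‖z‖ := by
    intro z
    have := norm_exp_ofReal_mul_I (-t₁)
    push_cast at this
    rw [norm_mul, norm_neg, this, mul_one]
  have hback : ∀ z : ℂ, z = -(-z * exp (-t₁ * I)) * exp (t₁ * I) := by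
    intro z; linear_combination (-z) * hexp t₁
  have hslit : ∀ z ∈ C, -z * exp (-t₁ * I) ∈ slitPlane := by
    intro z hz
    rw [Complex.mem_slitPlane_iff_arg]
    constructor
    · intro harg
      apply hC1 z hz
      have h3 := norm_mul_exp_arg_mul_I (-z * exp (-t₁ * I))
      rw [harg, exp_pi_mul_I, hnorm] at h3
      grind
    · grind
  have hcont : ContinuousOn (fun z => (-z * exp (-t₁ * I)).arg) C := fun z hz =>
    ((Complex.continuousAt_arg (hslit z hz)).comp (f := fun z => -z * exp (-t₁ * I))
      (by fun_prop)).continuousWithinAt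
  obtain ⟨z, hz, hzt⟩ := (hC.image _ hcont).Icc_subset (mem_image_of_mem _ hx)
    (mem_image_of_mem _ hy) ⟨hx2.le, hy2.le⟩
  apply hC2 z hz
  have h3 := norm_mul_exp_arg_mul_I (-z * exp (-t₁ * I))
  simp only at hzt
  rw [hzt, hnorm] at h3
  conv_lhs => rw [hback z]
  rw [← h3]
  push_cast
  rw [show ((t₂ : ℂ) - t₁ - π) * I = t₂ * I + -t₁ * I -
      π * I by ring, exp_sub, exp_add, exp_pi_mul_I]
  grind

lemma exists_mem_Ioo_of_ae {p : ℝ → Prop} (hp : ∀ᵐ t, p t) {a b : ℝ} (hab : a < b) :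
    ∃ t ∈ Ioo a b, p t := by
  by_contra h
  push Not at h
  have h1 :=
    MeasureTheory.measure_mono_null (fun t ht => h t ht) hp
  rw [Real.volume_Ioo] at h1
  have := ENNReal.ofReal_eq_zero.1 h1
  linarith

namespace IsDiscModel

variable {S : Type*} [MetricSpace S] {U : Set S} {φ : ℂ → S}

lemma mem (h : IsDiscModel U φ) {z : ℂ} (hz : z ∈ 𝔻) : φ z ∈ U :=
  h.img ▸ mem_image_of_mem φ hz

lemma isOpen (h : IsDiscModel U φ) : IsOpen U :=
  h.img ▸ h.open_map _ isOpen_ball subset_rfl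

lemma inv_mem (h : IsDiscModel U φ) {x : S} (hx : x ∈ U) : discInv φ x ∈ 𝔻 :=
  invFunOn_mem (h.img.symm ▸ hx : x ∈ φ '' 𝔻)

lemma apply_inv (h : IsDiscModel U φ) {x : S} (hx : x ∈ U) : φ (discInv φ x) = x :=
  invFunOn_eq (h.img.symm ▸ hx : x ∈ φ '' 𝔻)

lemma inv_apply (h : IsDiscModel U φ) {z : ℂ} (hz : z ∈ 𝔻) :
    discInv φ (φ z) = z := h.inj.leftInvOn_invFunOn hz

lemma inv_cont (h : IsDiscModel U φ) : ContinuousOn (discInv φ) U := by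
  rw [continuousOn_iff']
  intro t ht
  refine ⟨φ '' (t ∩ 𝔻), h.open_map _ (ht.inter isOpen_ball)
    inter_subset_right, ?_⟩
  ext x
  constructor
  · rintro ⟨hx, hxU⟩
    exact ⟨⟨_, ⟨hx, h.inv_mem hxU⟩, h.apply_inv hxU⟩, hxU⟩
  · rintro ⟨⟨z, hz, rfl⟩, hxU⟩
    exact ⟨by rw [mem_preimage, h.inv_apply hz.2]; exact hz.1, hxU⟩

lemma tendsto_inv (h : IsDiscModel U φ) {ι : Type*} {l : Filter ι} {p : ι → ℂ} {w : ℂ}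
    (hp : ∀ᶠ i in l, p i ∈ 𝔻) (hw : w ∈ 𝔻)
    (ht : Tendsto (fun i => φ (p i)) l (𝓝 (φ w))) : Tendsto p l (𝓝 w) := by
  have h1 := (h.inv_cont.continuousAt (h.isOpen.mem_nhds (h.mem hw))).tendsto.comp ht
  rw [h.inv_apply hw] at h1
  exact h1.congr' (hp.mono fun i hi => h.inv_apply hi)

/-- A sequence of points of the disc accumulating at the boundary has no limit in `U`. -/
lemma limit_notMem (h : IsDiscModel U φ) {ι : Type*} {l : Filter ι} [l.NeBot] {p : ι → ℂ} {ξ : ℂ}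
    {a : S} (hp : ∀ᶠ i in l, p i ∈ 𝔻) (hξ : ‖ξ‖ = 1) (hpξ : Tendsto p l (𝓝 ξ))
    (ht : Tendsto (fun i => φ (p i)) l (𝓝 a)) : a ∉ U := by
  intro ha
  rw [← h.apply_inv ha] at ht
  have := tendsto_nhds_unique (h.tendsto_inv hp (h.inv_mem ha) ht) hpξ
  have h1 := mem_ball_zero_iff.1 (h.inv_mem ha)
  grind

lemma limit_mem_frontier (h : IsDiscModel U φ) {ι : Type*} {l : Filter ι} [l.NeBot] {p : ι → ℂ}
    {ξ : ℂ} {a : S} (hp : ∀ᶠ i in l, p i ∈ 𝔻) (hξ : ‖ξ‖ = 1)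
    (hpξ : Tendsto p l (𝓝 ξ)) (ht : Tendsto (fun i => φ (p i)) l (𝓝 a)) : a ∈ frontier U := by
  rw [h.isOpen.frontier_eq]
  exact ⟨mem_closure_of_tendsto ht (hp.mono fun i hi => h.mem hi), h.limit_notMem hp hξ hpξ ht⟩

/-- Short crosscuts about every boundary point, with generic radius. -/
lemma exists_crosscut (h : IsDiscModel U φ) {ε : ℝ} (hε : 0 < ε) :
    ∃ δ > 0, δ < ε ∧ ∀ ζ : ℂ, ‖ζ‖ = 1 → ∀ p : ℝ → Prop,
      (∀ᵐ r ∂MeasureTheory.volume.restrict (Ioo (0:ℝ) 1), p r) →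
      ∃ r, δ < r ∧ r < ε ∧ r < 1 ∧ p r ∧ ∀ z ∈ 𝔻, ∀ z' ∈ 𝔻,
        dist z ζ = r → dist z' ζ = r → dist (φ z) (φ z') < ε := by
  obtain ⟨δ, hδ0, hδ, H⟩ := h.la (min ε 1) (by positivity) (min_le_right _ _)
  refine ⟨δ, hδ0, hδ.trans_le (min_le_left _ _), fun ζ hζ p hp => ?_⟩
  have h1 := H ζ hζ
  by_contra hcon
  push Not at hcon
  apply h1
  have hsub : Ioo δ (min ε 1) ⊆ Ioo (0:ℝ) 1 :=
    fun r hr => ⟨hδ0.trans hr.1, hr.2.trans_le (min_le_right _ _)⟩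
  filter_upwards [MeasureTheory.ae_restrict_of_ae_restrict_of_subset hsub hp,
    MeasureTheory.ae_restrict_mem measurableSet_Ioo] with r hr hr' hall
  have hr1 := hr'.2.trans_le (min_le_right _ _)
  have hr0 := hδ0.trans hr'.1
  obtain ⟨z, hz, z', hz', hzr, hzr', hd⟩ :=
    hcon r hr'.1 (hr'.2.trans_le (min_le_left _ _)) hr1 hr
  obtain ⟨t, ht, rfl⟩ := exists_crossCirc_eq hζ hr0 (by linarith) hz hzr
  obtain ⟨t', ht', rfl⟩ := exists_crossCirc_eq hζ hr0 (by linarith) hz' hzr'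
  grind

/-- Two paths landing at the same boundary point of the disc have the same limit in `S`. -/
lemma limit_unique (h : IsDiscModel U φ) {p p' : ℝ → ℂ} {b b' : ℝ} {ξ : ℂ} {a a' : S}
    (hξ : ‖ξ‖ = 1)
    (hp : ∀ᶠ t in 𝓝[<] b, ContinuousAt p t ∧ p t ∈ 𝔻)
    (hp' : ∀ᶠ t in 𝓝[<] b', ContinuousAt p' t ∧ p' t ∈ 𝔻)
    (hpξ : Tendsto p (𝓝[<] b) (𝓝 ξ)) (hpξ' : Tendsto p' (𝓝[<] b') (𝓝 ξ))
    (ha : Tendsto (fun t => φ (p t)) (𝓝[<] b) (𝓝 a))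
    (ha' : Tendsto (fun t => φ (p' t)) (𝓝[<] b') (𝓝 a')) : a = a' := by
  have key : ∀ {p : ℝ → ℂ} {b : ℝ} {a : S} {η : ℝ}, 0 < η →
      (∀ᶠ t in 𝓝[<] b, ContinuousAt p t ∧ p t ∈ 𝔻) →
      Tendsto p (𝓝[<] b) (𝓝 ξ) → Tendsto (fun t => φ (p t)) (𝓝[<] b) (𝓝 a) →
      ∃ ρ > 0, ∀ r, 0 < r → r < ρ → ∃ z ∈ 𝔻, dist z ξ = r ∧ dist (φ z) a < η := by
    intro p b a η hη hp hpξ ha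
    have h1 := ha.eventually (ball_mem_nhds a hη)
    obtain ⟨c, hcb, hc⟩ := (mem_nhdsLT_iff_exists_Ioo_subset).1 (hp.and h1)
    have hcb : c < b := hcb
    set m := (c + b) / 2
    have hm : m ∈ Ioo c b := ⟨by simp only [m]; linarith, by simp only [m]; linarith⟩
    have hmb := (hc hm).1.2
    have hpos : 0 < dist (p m) ξ := dist_pos.2 (fun he => by simp_all)
    refine ⟨dist (p m) ξ, hpos, fun r hr0 hr => ?_⟩
    have h2 := hpξ.eventually (ball_mem_nhds ξ hr0)
    obtain ⟨m', hm'1, hm'2⟩ := (h2.and (Ioo_mem_nhdsLT hm.2)).exists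
    have hsub := Icc_subset_Ioo hm.1 hm'2.2
    have hcont : ContinuousOn (fun t => dist (p t) ξ) (Icc m m') := fun t ht =>
      ContinuousAt.continuousWithinAt (Filter.Tendsto.dist (hc (hsub ht)).1.1 tendsto_const_nhds)
    obtain ⟨t, ht, htr⟩ := intermediate_value_Icc' hm'2.1.le hcont ⟨hm'1.le, hr.le⟩
    exact ⟨p t, (hc (hsub ht)).1.2, htr, (hc (hsub ht)).2⟩
  by_contra hne
  have hd : 0 < dist a a' / 3 := by have := dist_pos.2 hne; positivity
  obtain ⟨ρ, hρ, H⟩ := key hd hp hpξ ha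
  obtain ⟨ρ', hρ', H'⟩ := key hd hp' hpξ' ha'
  obtain ⟨δ, hδ0, -, hc⟩ := h.exists_crosscut (ε := min (min ρ ρ') (dist a a' / 3)) (by positivity)
  obtain ⟨r, hr0, hr1, -, -, hr⟩ := hc ξ hξ (fun _ => True) (univ_mem' fun _ => trivial)
  have hr0 := hδ0.trans hr0
  obtain ⟨z, hz, hzr, hza⟩ := H r hr0 (hr1.trans_le ((min_le_left _ _).trans (min_le_left _ _)))
  obtain ⟨z', hz', hzr', hza'⟩ :=
    H' r hr0 (hr1.trans_le ((min_le_left _ _).trans (min_le_right _ _)))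
  have h3 := (hr z hz z' hz' hzr hzr').trans_le (min_le_right _ _)
  have h4 := dist_triangle4 a (φ z) (φ z') a'
  rw [dist_comm a (φ z)] at h4
  linarith

/-- Points of the disc whose images are close to a point outside `U` are close to the circle. -/
lemma exists_norm_gt (h : IsDiscModel U φ) {a : S} (ha : a ∉ U) {ρ : ℝ} (hρ : ρ < 1) :
    ∃ η > 0, ∀ z ∈ 𝔻, dist (φ z) a < η → ρ < ‖z‖ := by
  have hsub : closedBall (0:ℂ) ρ ⊆ 𝔻 := closedBall_subset_ball hρ
  have hK :=
    (isCompact_closedBall 0 ρ).image_of_continuousOn (h.cont.mono hsub)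
  have haK : a ∈ (φ '' closedBall (0:ℂ) ρ)ᶜ := fun ⟨z, hz, hza⟩ =>
    ha (hza ▸ h.mem (hsub hz))
  obtain ⟨η, hη, hb⟩ := Metric.isOpen_iff.1 hK.isClosed.isOpen_compl a haK
  refine ⟨η, hη, fun z hz hd => ?_⟩
  by_contra hcon
  exact hb (mem_ball.2 hd) (mem_image_of_mem _ (mem_closedBall_zero_iff.2 (not_lt.1 hcon)))

/-- Sets of small diameter in `U` that are connected have small preimages in the disc. -/
theorem small_preimage [CompactSpace S] (h : IsDiscModel U φ) {ε : ℝ} (hε : 0 < ε) :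
    ∃ δ > 0, ∀ C ⊆ 𝔻, IsPreconnected C →
      (∀ x ∈ C, ∀ y ∈ C, dist (φ x) (φ y) < δ) → ∀ x ∈ C, ∀ y ∈ C, dist x y < ε := by
  by_contra hcon
  push Not at hcon
  have hpi := Real.pi_pos
  have hpos : ∀ n : ℕ, (0:ℝ) < 1 / (n + 1) := fun n => Nat.one_div_pos_of_nat
  choose C hC hCc hCd x hx y hy hxy using fun n : ℕ => hcon _ (hpos n)
  have hK : IsCompact (closedBall (0:ℂ) 1 ×ˢ closedBall (0:ℂ) 1 ×ˢ (univ : Set S)) :=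
    (isCompact_closedBall 0 1).prod ((isCompact_closedBall 0 1).prod isCompact_univ)
  obtain ⟨⟨x0, y0, a⟩, -, n, hn, hlim⟩ := hK.tendsto_subseq
    (x := fun n => (x n, y n, φ (x n))) fun n => ⟨ball_subset_closedBall (hC n (hx n)),
      ball_subset_closedBall (hC n (hy n)), mem_univ _⟩
  have hxl : Tendsto (fun i => x (n i)) atTop (𝓝 x0) := (continuous_fst.tendsto _).comp hlim
  have hyl : Tendsto (fun i => y (n i)) atTop (𝓝 y0) :=
    ((continuous_fst.comp continuous_snd).tendsto _).comp hlim
  have hal : Tendsto (fun i => φ (x (n i))) atTop (𝓝 a) :=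
    ((continuous_snd.comp continuous_snd).tendsto _).comp hlim
  have hdl : Tendsto (fun i => (1:ℝ) / (n i + 1)) atTop (𝓝 0) :=
    tendsto_one_div_add_atTop_nhds_zero_nat.comp hn.tendsto_atTop
  -- points of `C (n i)` map close to `a`
  have hz : ∀ z : ℕ → ℂ, (∀ i, z i ∈ C (n i)) → Tendsto (fun i => φ (z i)) atTop (𝓝 a) := by
    intro z hz
    refine hal.congr_dist ?_
    exact squeeze_zero (fun _ => dist_nonneg) (fun i => (hCd _ _ (hx _) _ (hz i)).le) hdl
  have hyal := hz _ fun i => hy (n i)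
  have hne : x0 ≠ y0 := by
    rintro rfl
    have h1 : Tendsto (fun i => dist (x (n i)) (y (n i))) atTop (𝓝 (dist x0 x0)) := hxl.dist hyl
    rw [dist_self] at h1
    exact not_le.2 hε (ge_of_tendsto' h1 fun i => hxy _)
  have haU : a ∉ U := by
    intro ha
    rw [← h.apply_inv ha] at hal hyal
    have h1 := h.tendsto_inv (p := fun i => x (n i)) (univ_mem' fun i => hC _ (hx (n i)))
        (h.inv_mem ha) hal
    have h2 := h.tendsto_inv (p := fun i => y (n i)) (univ_mem' fun i => hC _ (hy (n i)))
        (h.inv_mem ha) hyal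
    exact hne ((tendsto_nhds_unique hxl h1).trans (tendsto_nhds_unique hyl h2).symm)

  have hC0 : ∀ ρ < (1:ℝ), ∀ᶠ i in atTop, ∀ z ∈ C (n i), ρ < ‖z‖ := by
    intro ρ hρ
    obtain ⟨η, hη, H⟩ := h.exists_norm_gt haU hρ
    filter_upwards [hdl.eventually (gt_mem_nhds (half_pos hη)),
      hal.eventually (ball_mem_nhds a (half_pos hη))] with i h1 h2 z hzC
    refine H z (hC _ hzC) ?_
    have h3 := hCd _ z hzC _ (hx (n i))
    have h4 := dist_triangle (φ z) (φ (x (n i))) a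
    have h5 : dist (φ (x (n i))) a < η / 2 := h2
    linarith
  have hbdry : ∀ (z : ℕ → ℂ) (z0 : ℂ), (∀ i, z i ∈ C (n i)) → Tendsto z atTop (𝓝 z0) → ‖z0‖ = 1 :=
      by
    intro z z0 hzC hzl
    refine le_antisymm (le_of_tendsto hzl.norm
      (univ_mem' fun i => (mem_ball_zero_iff.1 (hC _ (hzC i))).le)) ?_
    refine le_of_forall_lt fun ρ hρ => ?_
    obtain ⟨ρ', h1, h2⟩ := exists_between hρ
    exact h1.trans_le (ge_of_tendsto hzl.norm ((hC0 ρ' h2).mono fun i hi => (hi _ (hzC i)).le))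
  have hx0 := hbdry _ _ (fun i => hx (n i)) hxl
  have hy0 := hbdry _ _ (fun i => hy (n i)) hyl
  have hmiss : ∀ t : ℝ, (∃ w ≠ a, Tendsto (fun r : ℝ => φ (r * exp (t * I)))
      (𝓝[<] 1) (𝓝 w)) → ∀ᶠ i in atTop, ∀ z ∈ C (n i), z ≠ ‖z‖ * exp (t * I) := by
    rintro t ⟨w, hwa, hw⟩
    by_contra hcon
    obtain ⟨m, hm, hmz⟩ := extraction_of_frequently_atTop (not_eventually.1 hcon)
    push Not at hmz
    choose z hzC hze using hmz
    have h1 : Tendsto (fun k => ‖z k‖) atTop (𝓝[<] 1) := by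
      refine tendsto_nhdsWithin_iff.2 ⟨?_, univ_mem' fun k => mem_ball_zero_iff.1 (hC _ (hzC k))⟩
      refine tendsto_order.2 ⟨fun ρ hρ => ?_, fun ρ hρ => univ_mem' fun k =>
        (mem_ball_zero_iff.1 (hC _ (hzC k))).trans hρ⟩
      exact (hm.tendsto_atTop.eventually (hC0 ρ hρ)).mono fun k hk => hk _ (hzC k)
    have h2 : Tendsto (fun k => φ (z k)) atTop (𝓝 w) :=
      (hw.comp h1).congr fun k => by grind
    have h3 : Tendsto (fun k => φ (z k)) atTop (𝓝 a) := by
      refine (hal.comp hm.tendsto_atTop).congr_dist ?_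
      exact squeeze_zero (fun _ => dist_nonneg) (fun i => (hCd _ _ (hx _) _ (hzC i)).le)
        (hdl.comp hm.tendsto_atTop)
    exact hwa (tendsto_nhds_unique h2 h3)
  have hfin : ∀ (x y : ℕ → ℂ) (x0 y0 : ℂ), (∀ i, x i ∈ C (n i)) → (∀ i, y i ∈ C (n i)) →
      Tendsto x atTop (𝓝 x0) → Tendsto y atTop (𝓝 y0) → x0.arg < y0.arg → False := by
    intro x y x0 y0 hxC hyC hxl hyl harg
    have hx0 := hbdry x x0 hxC hxl
    have hy0 := hbdry y y0 hyC hyl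
    have hya := Complex.arg_le_pi y0
    have hxa := Complex.neg_pi_lt_arg x0
    have hae := h.rad a haU
    obtain ⟨t₁, ht₁, hg₁⟩ := exists_mem_Ioo_of_ae hae (show y0.arg - 2 * π < x0.arg by linarith)
    obtain ⟨t₂, ht₂, hg₂⟩ := exists_mem_Ioo_of_ae hae harg
    have hlim : ∀ (z : ℕ → ℂ) (z0 : ℂ), ‖z0‖ = 1 → Tendsto z atTop (𝓝 z0) → t₁ < z0.arg →
        z0.arg < t₁ + 2 * π →
        Tendsto (fun i => (-z i * exp (-t₁ * I)).arg) atTop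
          (𝓝 (z0.arg - t₁ - π)) := by
      intro z z0 hz0 hzl h1 h2
      have h3 := arg_neg_mul one_pos h1 h2
      have h4 := norm_mul_exp_arg_mul_I z0
      rw [hz0] at h4
      rw [h4] at h3
      have h5 : -z0 * exp (-t₁ * I) ∈ slitPlane := by
        rw [Complex.mem_slitPlane_iff_arg, h3]
        refine ⟨by linarith, mul_ne_zero (neg_ne_zero.2 ?_) (exp_ne_zero _)⟩
        rintro rfl
        simp at hz0
      rw [← h3]
      exact (Complex.continuousAt_arg h5).tendsto.comp (hzl.neg.mul_const _)
    have hxL := hlim x x0 hx0 hxl ht₁.2 (by linarith [ht₁.1])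
    have hyL := hlim y y0 hy0 hyl (by linarith [ht₁.2]) (by linarith [ht₁.1])
    obtain ⟨i, h1, h2, h3, h4, h5⟩ := ((hmiss t₁ hg₁).and ((hmiss t₂ hg₂).and ((hC0 0 one_pos).and
      ((hxL.eventually (gt_mem_nhds (show _ < t₂ - t₁ - π by linarith [ht₂.1]))).and
      (hyL.eventually (lt_mem_nhds (show t₂ - t₁ - π < _ by linarith [ht₂.2]))))))).exists
    exact not_preconnected_of_radii (hCc _) (fun h0 => by simpa using h3 0 h0) h1 h2 (hxC i) (hyC i)
      h4 h5
  rcases lt_trichotomy x0.arg y0.arg with hlt | heq | hgt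
  · grind
  · exact hne (Complex.ext_norm_arg (hx0.trans hy0.symm) heq)
  grind

/-- A path in the disc whose image lands at a point outside `U` lands at a boundary point. -/
theorem exists_landing [CompactSpace S] (h : IsDiscModel U φ) {p : ℝ → ℂ} {b : ℝ} {a : S}
    (ha : a ∉ U) (hp : ∀ᶠ t in 𝓝[<] b, ContinuousAt p t ∧ p t ∈ 𝔻)
    (hpa : Tendsto (fun t => φ (p t)) (𝓝[<] b) (𝓝 a)) :
    ∃ ξ : ℂ, ‖ξ‖ = 1 ∧ Tendsto p (𝓝[<] b) (𝓝 ξ) := by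
  have hcau : Cauchy (map p (𝓝[<] b)) := by
    rw [Metric.cauchy_iff]
    refine ⟨inferInstance, fun ε hε => ?_⟩
    obtain ⟨δ, hδ, H⟩ := h.small_preimage hε
    have h1 : ∀ᶠ t in 𝓝[<] b, dist (φ (p t)) a < δ / 2 :=
      hpa.eventually (ball_mem_nhds a (half_pos hδ))
    obtain ⟨c, hcb, hc⟩ := (mem_nhdsLT_iff_exists_Ioo_subset).1 (hp.and h1)
    refine ⟨p '' Ioo c b, image_mem_map (Ioo_mem_nhdsLT hcb), H _ ?_ ?_ ?_⟩
    · rintro _ ⟨t, ht, rfl⟩; exact (hc ht).1.2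
    · exact isPreconnected_Ioo.image _ fun t ht => (hc ht).1.1.continuousWithinAt
    · rintro _ ⟨t, ht, rfl⟩ _ ⟨t', ht', rfl⟩
      have h2 := (hc ht).2
      have h3 := (hc ht').2
      have := dist_triangle_right (φ (p t)) (φ (p t')) a
      linarith
  obtain ⟨ξ, hξ⟩ := cauchy_map_iff_exists_tendsto.1 hcau
  refine ⟨ξ, le_antisymm (le_of_tendsto hξ.norm
      (hp.mono fun t ht => (mem_ball_zero_iff.1 ht.2).le)) ?_, hξ⟩
  refine le_of_forall_lt fun ρ hρ => ?_
  obtain ⟨ρ', h1, h2⟩ := exists_between hρ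
  obtain ⟨η, hη, H⟩ := h.exists_norm_gt ha h2
  refine h1.trans_le (ge_of_tendsto hξ.norm ?_)
  filter_upwards [hp, hpa.eventually (ball_mem_nhds a hη)] with t h3 h4
  exact (H _ h3.2 h4).le

/-- The map of the disc conjugate to `g`. -/
lemma conj_mem (h : IsDiscModel U φ) {g : S → S} (hg : MapsTo g U U) {z : ℂ}
    (hz : z ∈ 𝔻) : discInv φ (g (φ z)) ∈ 𝔻 :=
  h.inv_mem (hg (h.mem hz))

lemma conj_cont (h : IsDiscModel U φ) {g : S → S} (hgc : Continuous g) (hg : MapsTo g U U) :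
    ContinuousOn (fun z => discInv φ (g (φ z))) 𝔻 :=
  h.inv_cont.comp (hgc.comp_continuousOn h.cont) fun _ hz => hg (h.mem hz)

/-- Short arcs about a boundary point bound regions with small image under a conjugate map. -/
lemma conj_small_ball [CompactSpace S] (h : IsDiscModel U φ) (g : S ≃ₜ S) (hg : g '' U = U)
    {ε : ℝ} (hε : 0 < ε) {ζ : ℂ} (hζ : ‖ζ‖ = 1) :
    ∃ r > 0, ∀ z ∈ 𝔻, ∀ z' ∈ 𝔻, dist z ζ < r → dist z' ζ < r →
      dist (discInv φ (g (φ z))) (discInv φ (g (φ z'))) < ε := by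
  have hgm : MapsTo g U U := fun x hx => hg ▸ mem_image_of_mem g hx
  have hgs : MapsTo g.symm U U := by
    intro x hx
    rw [← hg] at hx
    obtain ⟨y, hy, rfl⟩ := hx
    simpa using hy
  set k : ℂ → ℂ := fun z => discInv φ (g (φ z)) with hk
  set k' : ℂ → ℂ := fun z => discInv φ (g.symm (φ z)) with hk'
  have hkm : ∀ {z}, z ∈ 𝔻 → k z ∈ 𝔻 := h.conj_mem hgm
  have hkm' : ∀ {z}, z ∈ 𝔻 → k' z ∈ 𝔻 := h.conj_mem hgs
  have hkc := h.conj_cont g.continuous hgm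
  have hkc' := h.conj_cont g.symm.continuous hgs
  have hkk' : ∀ {z}, z ∈ 𝔻 → k (k' z) = z := fun {z} hz => by
    simp only [hk, hk', h.apply_inv (hgs (h.mem hz)), g.apply_symm_apply, h.inv_apply hz]
  have hk'k : ∀ {z}, z ∈ 𝔻 → k' (k z) = z := fun {z} hz => by
    simp only [hk, hk', h.apply_inv (hgm (h.mem hz)), g.symm_apply_apply, h.inv_apply hz]
  -- a small parameter
  set e : ℝ := min (1 / 4) ((ε / 8) ^ 2) with he
  have he0 : 0 < e := by positivity
  have he1 : e ≤ 1 / 4 := min_le_left _ _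
  have he2 : e ≤ (ε / 8) ^ 2 := min_le_right _ _
  obtain ⟨δ₁, hδ₁, H₁⟩ := h.small_preimage he0
  obtain ⟨δ₂, hδ₂, H₂⟩ := Metric.uniformContinuous_iff.1
    (CompactSpace.uniformContinuous_of_continuous g.continuous) δ₁ hδ₁
  -- near `ζ` the conjugate map has values close to the circle
  obtain ⟨ρ, hρ0, hρ⟩ : ∃ ρ > 0, ∀ z ∈ 𝔻, dist z ζ < ρ → 1 - e < ‖k z‖ := by
    have hK : IsCompact (k' '' closedBall (0:ℂ) (1 - e)) :=
      (isCompact_closedBall _ _).image_of_continuousOn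
        (hkc'.mono (closedBall_subset_ball (by linarith)))
    have hζK : ζ ∈ (k' '' closedBall (0:ℂ) (1 - e))ᶜ := by
      rintro ⟨z, hz, rfl⟩
      have := mem_ball_zero_iff.1 (hkm' (closedBall_subset_ball (by linarith) hz))
      linarith
    obtain ⟨ρ, hρ, hb⟩ := Metric.isOpen_iff.1 hK.isClosed.isOpen_compl _ hζK
    refine ⟨ρ, hρ, fun z hz hd => ?_⟩
    by_contra hcon
    exact hb (mem_ball.2 hd) ⟨k z, mem_closedBall_zero_iff.2 (not_lt.1 hcon), hk'k hz⟩
  obtain ⟨δ, hδ0, -, hcut⟩ := h.exists_crosscut (ε := min ρ δ₂) (by positivity)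
  obtain ⟨r, hδr, hrρ, hr1, -, hr⟩ := hcut ζ hζ (fun _ => True) (univ_mem' fun _ => trivial)
  have hr0 : 0 < r := hδ0.trans hδr
  have hrρ' : r < ρ := hrρ.trans_le (min_le_left _ _)
  set κ : Set ℂ := 𝔻 ∩ Metric.sphere ζ r with hκ
  have hκeq : κ = crossCirc ζ r '' Ioo (-openAngle r) (openAngle r) := by
    ext z
    constructor
    · rintro ⟨hz, hzr⟩
      obtain ⟨t, ht, rfl⟩ := exists_crossCirc_eq hζ hr0 (by linarith) hz hzr
      exact mem_image_of_mem _ ht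
    · rintro ⟨t, ht, rfl⟩
      exact ⟨crossCirc_mem_ball hζ hr0 (by linarith) ht, dist_crossCirc hζ hr0.le t⟩
  have hκc : IsPreconnected κ := by
    rw [hκeq]
    exact isPreconnected_Ioo.image _ (continuous_crossCirc ζ r).continuousOn
  have hsmall : ∀ x ∈ k '' κ, ∀ y ∈ k '' κ, dist x y < e := by
    refine H₁ (k '' κ) ?_ (hκc.image _ (hkc.mono inter_subset_left)) ?_
    · rintro _ ⟨z, hz, rfl⟩; exact hkm hz.1
    · rintro _ ⟨z, hz, rfl⟩ _ ⟨z', hz', rfl⟩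
      simp only [hk, h.apply_inv (hgm (h.mem hz.1)), h.apply_inv (hgm (h.mem hz'.1))]
      exact H₂ ((hr z hz.1 z' hz'.1 hz.2 hz'.2).trans_le (min_le_right _ _))
  have hα := openAngle_pos (show r < 2 by linarith)
  have hz₀ : crossCirc ζ r 0 ∈ κ := by
    rw [hκeq]; exact mem_image_of_mem _ ⟨by linarith, hα⟩
  set w₀ := k (crossCirc ζ r 0) with hw₀
  have hw₀1 := hρ _ hz₀.1 (by rw [hz₀.2]; exact hrρ')
  have hw₀2 := mem_ball_zero_iff.1 (hkm hz₀.1)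
  -- the half plane cap at `w₀`
  set P : Set ℂ := 𝔻 ∩ {z | inner ℝ w₀ z ≤ 1 - 3 * e} with hP
  have hPconv : Convex ℝ P := (convex_ball 0 1).inter
    (convex_halfSpace_le (IsLinearMap.mk (fun x y => inner_add_right _ _ _)
      (fun c x => by simp; ring)) _)
  have hP0 : (0:ℂ) ∈ P := ⟨by simp, by
    change inner ℝ w₀ (0:ℂ) ≤ _
    rw [inner_zero_right]; linarith⟩
  have hPc := hPconv.isPreconnected.image _ (hkc'.mono inter_subset_left)
  have hPr : ∀ z ∈ k' '' P, dist z ζ ≠ r := by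
    rintro _ ⟨z, hz, rfl⟩ hzr
    have h1 := hsmall _ (mem_image_of_mem k ⟨hkm' hz.1, hzr⟩) _ (mem_image_of_mem k hz₀)
    rw [hkk' hz.1, dist_eq_norm] at h1
    have h2 : inner ℝ w₀ z = ‖w₀‖ ^ 2 + inner ℝ w₀ (z - w₀) := by
      rw [inner_sub_right, real_inner_self_eq_norm_sq]; ring
    have h3 := abs_le.1 ((abs_real_inner_le_norm w₀ (z - w₀)))
    have h4 : inner ℝ w₀ z ≤ 1 - 3 * e := hz.2
    nlinarith [norm_nonneg (z - w₀), norm_nonneg w₀]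
  have hk0 : r ≤ dist (k' 0) ζ := by
    by_contra hcon
    have := hρ (k' 0) (hkm' (by simp)) ((not_le.1 hcon).trans hrρ')
    rw [hkk' (by simp), norm_zero] at this
    linarith
  have hfar := hPc.subset_ball_compl hPr (mem_image_of_mem k' hP0) hk0
  have hcap : ∀ z ∈ 𝔻, dist z ζ < r → 1 - 3 * e < inner ℝ w₀ (k z) := by
    intro z hz hzr
    by_contra hcon
    have := hfar _ (mem_image_of_mem k' ⟨hkm hz, not_lt.1 hcon⟩)
    rw [hk'k hz] at this
    linarith
  have hclose : ∀ z ∈ 𝔻, dist z ζ < r → dist (k z) w₀ < ε / 2 := by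
    intro z hz hzr
    have h1 := hcap z hz hzr
    have h2 := mem_ball_zero_iff.1 (hkm hz)
    have h3 := norm_sub_sq_real (k z) w₀
    rw [real_inner_comm] at h3
    rw [dist_eq_norm]
    refine lt_of_pow_lt_pow_left₀ 2 (by positivity) ?_
    nlinarith [norm_nonneg (k z), norm_nonneg w₀]
  refine ⟨r, hr0, fun z hz z' hz' hzr hzr' => ?_⟩
  have := dist_triangle_right (k z) (k z') w₀
  grind

end IsDiscModel

/-- The extension to the closed disc of the map of the disc conjugate to `g`. -/
def discExt {S : Type*} (φ : ℂ → S) (g : S → S) : ℂ → ℂ :=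
  extendFrom 𝔻 fun z => discInv φ (g (φ z))

namespace IsDiscModel

variable {S : Type*} [MetricSpace S] {U : Set S} {φ : ℂ → S}

lemma continuousOn_discExt [CompactSpace S] (h : IsDiscModel U φ) (g : S ≃ₜ S) (hg : g '' U = U) :
    ContinuousOn (discExt φ g) (closedBall 0 1) := by
  have hgm : MapsTo g U U := fun x hx => hg ▸ mem_image_of_mem g hx
  refine continuousOn_extendFrom (closure_ball (0:ℂ) one_ne_zero).ge fun ζ hζ => ?_
  rcases (mem_closedBall_zero_iff.1 hζ).lt_or_eq with h1 | h1
  · exact ⟨_, h.conj_cont g.continuous hgm ζ (mem_ball_zero_iff.2 h1)⟩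
  · have hne : (𝓝[𝔻] ζ).NeBot := by
      rw [← mem_closure_iff_nhdsWithin_neBot, closure_ball (0:ℂ) one_ne_zero]; exact hζ
    refine cauchy_map_iff_exists_tendsto.1 ((Metric.cauchy_iff).2 ⟨hne.map _, fun ε hε => ?_⟩)
    obtain ⟨r, hr, H⟩ := h.conj_small_ball g hg hε h1
    refine ⟨_, image_mem_map (inter_mem_nhdsWithin _ (ball_mem_nhds ζ hr)), ?_⟩
    aesop

lemma discExt_eq (h : IsDiscModel U φ) {g : S → S} (hgc : Continuous g) (hg : MapsTo g U U) {z : ℂ}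
    (hz : z ∈ 𝔻) : discExt φ g z = discInv φ (g (φ z)) :=
  extendFrom_eq (subset_closure hz) (h.conj_cont hgc hg z hz)

lemma discExt_mapsTo [CompactSpace S] (h : IsDiscModel U φ) (g : S ≃ₜ S) (hg : g '' U = U) :
    MapsTo (discExt φ g) (closedBall 0 1) (closedBall 0 1) := by
  have hgm : MapsTo g U U := fun x hx => hg ▸ mem_image_of_mem g hx
  have h1 : MapsTo (discExt φ g) 𝔻 𝔻 := fun z hz => by
    rw [h.discExt_eq g.continuous hgm hz]; exact h.conj_mem hgm hz
  have h2 := h1.closure_of_continuousOn (by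
    rw [closure_ball (0:ℂ) one_ne_zero]; exact h.continuousOn_discExt g hg)
  rwa [closure_ball (0:ℂ) one_ne_zero] at h2

/-- Two continuous maps on the closed disc agreeing on the open disc agree. -/
lemma _root_.eqOn_closedBall_of_eqOn_ball {F G : ℂ → ℂ}
    (hF : ContinuousOn F (closedBall 0 1)) (hG : ContinuousOn G (closedBall 0 1))
    (h : EqOn F G 𝔻) : EqOn F G (closedBall 0 1) :=
  h.of_subset_closure hF hG ball_subset_closedBall (closure_ball (0:ℂ) one_ne_zero).ge

lemma discExt_comp [CompactSpace S] (h : IsDiscModel U φ) (g g' : S ≃ₜ S) (hg : g '' U = U)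
    (hg' : g' '' U = U) (hgg' : (g.trans g') '' U = U) :
    EqOn (discExt φ (g.trans g')) (discExt φ g' ∘ discExt φ g) (closedBall 0 1) := by
  have hgm : MapsTo g U U := fun x hx => hg ▸ mem_image_of_mem g hx
  have hgm' : MapsTo g' U U := fun x hx => hg' ▸ mem_image_of_mem g' hx
  have hgm'' : MapsTo (g.trans g') U U := fun x hx => hgm' (hgm hx)
  refine eqOn_closedBall_of_eqOn_ball (h.continuousOn_discExt _ hgg')
    ((h.continuousOn_discExt g' hg').comp (h.continuousOn_discExt g hg) (h.discExt_mapsTo g hg)) ?_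
  intro z hz
  simp only [comp_apply]
  rw [h.discExt_eq (g.trans g').continuous hgm'' hz, h.discExt_eq g.continuous hgm hz,
    h.discExt_eq g'.continuous hgm' (h.conj_mem hgm hz), h.apply_inv (hgm (h.mem hz))]
  rfl

lemma discExt_refl [CompactSpace S] (h : IsDiscModel U φ) :
    EqOn (discExt φ (Homeomorph.refl S)) id (closedBall 0 1) := by
  refine eqOn_closedBall_of_eqOn_ball (h.continuousOn_discExt _ (by simp)) continuousOn_id ?_
  intro z hz
  rw [h.discExt_eq (Homeomorph.refl S).continuous (fun x hx => hx) hz]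
  exact h.inv_apply hz

end IsDiscModel

lemma ae_of_periodic {p : ℝ → Prop} {a : ℝ} (hp : ∀ t, p (t + 2 * π) ↔ p t)
    (h : ∀ᵐ t ∂volume.restrict (Ioc a (a + 2 * π)), p t) : ∀ᵐ t, p t := by
  have hz : ∀ (n : ℤ) t, p (t + n • (2 * π)) ↔ p t := by
    intro n
    induction n using Int.induction_on with
    | zero => simp
    | succ n ih => grind
    | pred n ih => grind
  rw [ae_restrict_iff' measurableSet_Ioc, ae_iff] at h
  rw [ae_iff]
  refine measure_mono_null (t := ⋃ n : ℤ, (· + n • (2 * π)) ⁻¹'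
    {t | ¬ (t ∈ Ioc a (a + 2 * π) → p t)}) ?_ (measure_iUnion_null fun n => ?_)
  · intro t ht
    have h1 : t ∈ ⋃ n : ℤ, Ioc (a + n • (2 * π)) (a + (n + 1) • (2 * π)) := by
      rw [iUnion_Ioc_add_zsmul Real.two_pi_pos]; trivial
    obtain ⟨n, hn⟩ := mem_iUnion.1 h1
    refine mem_iUnion.2 ⟨-n, ?_⟩
    change ¬ (t + (-n) • (2 * π) ∈ Ioc a (a + 2 * π) → p (t + (-n) • (2 * π)))
    rw [hz]
    grind
  · rw [measure_preimage_add_right]; exact h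

/-- A bounded nonvanishing holomorphic function on the disc has radial limit `0` almost nowhere. -/
lemma ae_not_tendsto_zero {B : ℂ → ℂ} {M : ℝ} (hd : DifferentiableOn ℂ B 𝔻)
    (h0 : ∀ z ∈ 𝔻, B z ≠ 0) (hM : ∀ z ∈ 𝔻, ‖B z‖ ≤ M) :
    ∀ᵐ t : ℝ, ¬ Tendsto (fun r : ℝ => B (r * exp (t * I))) (𝓝[<] 1) (𝓝 0) := by
  set r : ℕ → ℝ := fun n => 1 - 1 / ((n:ℝ) + 1) with hr
  have hr0 : ∀ n, 0 ≤ r n := by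
    intro n
    have : 1 / ((n:ℝ) + 1) ≤ 1 := by
      rw [div_le_one (by positivity)]; linarith [n.cast_nonneg (α := ℝ)]
    simp only [hr]; linarith
  have hr1 : ∀ n, r n < 1 := by
    intro n
    have : 0 < 1 / ((n:ℝ) + 1) := by positivity
    simp only [hr]; linarith
  have hrt : Tendsto r atTop (𝓝[<] 1) := by
    refine tendsto_nhdsWithin_iff.2 ⟨?_, univ_mem' hr1⟩
    simpa [hr] using (tendsto_const_nhds (x := (1:ℝ))).sub
      (tendsto_one_div_add_atTop_nhds_zero_nat (𝕜 := ℝ))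
  have hcm : ∀ n t, circleMap 0 (r n) t = r n * exp (t * I) := by
    intro n t; simp [circleMap]
  have hmem : ∀ n t, circleMap 0 (r n) t ∈ 𝔻 := by
    intro n t
    have := circleMap_mem_sphere (0:ℂ) (hr0 n) t
    rw [mem_sphere_zero_iff_norm] at this
    rw [mem_ball_zero_iff, this]; exact hr1 n
  have hcont : ∀ n, Continuous fun t => Real.log M - Real.log ‖B (circleMap 0 (r n) t)‖ := by
    intro n
    refine continuous_const.sub (Continuous.log ?_ fun t => norm_ne_zero_iff.2 (h0 _ (hmem n t)))
    exact continuous_norm.comp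
      (hd.continuousOn.comp_continuous (continuous_circleMap 0 (r n)) (hmem n))
  have hnn : ∀ n t, 0 ≤ Real.log M - Real.log ‖B (circleMap 0 (r n) t)‖ := by
    intro n t
    exact sub_nonneg.2 (Real.log_le_log (norm_pos_iff.2 (h0 _ (hmem n t))) (hM _ (hmem n t)))
  have hii : ∀ n, ∫⁻ t in Ioc 0 (0 + 2 * π), ofReal (Real.log M - Real.log ‖B (circleMap 0 (r n)
      t)‖)
      = ofReal (2 * π * (Real.log M - Real.log ‖B 0‖)) := by
    intro n
    rw [← ofReal_integral_eq_lintegral_ofReal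
      ((hcont n).integrableOn_Icc.mono_set Ioc_subset_Icc_self) (univ_mem' (hnn n)), zero_add,
      ← intervalIntegral.integral_of_le Real.two_pi_pos.le]
    congr 1
    have han :=
      hd.analyticOnNhd isOpen_ball
    have hsub : closedBall (0:ℂ) |r n| ⊆ 𝔻 :=
      closedBall_subset_ball (by grind)
    have := (han.mono hsub).circleAverage_log_norm_of_ne_zero fun u hu => h0 u (hsub hu)
    rw [Real.circleAverage_def, smul_eq_mul] at this
    rw [intervalIntegral.integral_sub (by simp)]
    · rw [intervalIntegral.integral_const, ← this, smul_eq_mul]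
      have := Real.pi_pos
      field_simp
      ring
    · have : Continuous fun t => Real.log ‖B (circleMap 0 (r n) t)‖ := by
        have := (continuous_const (y := Real.log M)).sub (hcont n)
        refine this.congr fun t => ?_
        simp
      exact this.intervalIntegrable _ _
  refine ae_of_periodic (a := 0) (fun t => ?_) ?_
  · have : exp (((t + 2 * π : ℝ) : ℂ) * I) = exp (t * I) := by
      push_cast
      rw [add_mul, exp_add, Complex.exp_two_pi_mul_I, mul_one]
    rw [this]
  have hfat := lintegral_liminf_le' (μ := volume.restrict (Ioc 0 (0 + 2 * π))) (u := atTop)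
    (f := fun n t => ofReal (Real.log M - Real.log ‖B (circleMap 0 (r n) t)‖))
    fun n => (hcont n).measurable.ennreal_ofReal.aemeasurable
  simp only [hii, liminf_const] at hfat
  have hmeas :=
    Measurable.liminf fun n => (hcont n).measurable.ennreal_ofReal
  filter_upwards [ae_lt_top hmeas (hfat.trans_lt ENNReal.ofReal_lt_top).ne] with t ht hlim
  have h1 : Tendsto (fun n => B (circleMap 0 (r n) t)) atTop (𝓝 0) := by
    simp only [hcm]; exact hlim.comp hrt
  have h2 : Tendsto (fun n => Real.log ‖B (circleMap 0 (r n) t)‖) atTop atBot := by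
    refine Real.tendsto_log_nhdsNE_zero.comp (tendsto_nhdsWithin_iff.2 ⟨by simpa using h1.norm, ?_⟩)
    exact univ_mem' fun n => norm_ne_zero_iff.2 (h0 _ (hmem n t))
  have h3 : Tendsto (fun n => ofReal (Real.log M - Real.log ‖B (circleMap 0 (r n) t)‖)) atTop
      (𝓝 ⊤) := by
    refine ENNReal.tendsto_ofReal_nhds_top.2 ?_
    simp only [sub_eq_add_neg]
    exact tendsto_atTop_add_const_left _ _ (tendsto_neg_atBot_atTop.comp h2)
  rw [h3.liminf_eq] at ht
  exact lt_irrefl _ ht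

/-- `j` identifies the plane with the complement of the point `q`. -/
structure IsPlaneChart {S : Type*} [TopologicalSpace S] (j : ℂ → S) (q : S) : Prop where
  emb : IsOpenEmbedding j
  range_eq : range j = {q}ᶜ

namespace IsPlaneChart

variable {S : Type*} [TopologicalSpace S] {j : ℂ → S} {q : S}

lemma apply_ne (h : IsPlaneChart j q) (z : ℂ) : j z ≠ q := by
  have : j z ∈ range j := mem_range_self z
  rw [h.range_eq] at this
  exact this

lemma exists_eq (h : IsPlaneChart j q) {x : S} (hx : x ≠ q) : ∃ z, j z = x := by
  have : x ∈ range j := by rw [h.range_eq]; exact hx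
  exact this

lemma tendsto_cocompact [CompactSpace S] [T2Space S] (h : IsPlaneChart j q) :
    Tendsto j (cocompact ℂ) (𝓝 q) := by
  intro O hO
  obtain ⟨O', hO', hO'o, hq⟩ := mem_nhds_iff.1 hO
  have hK : IsCompact (j ⁻¹' O'ᶜ) := by
    refine h.emb.isInducing.isCompact_preimage_iff ?_ |>.2 hO'o.isClosed_compl.isCompact
    rw [h.range_eq]
    exact compl_subset_compl.2 (singleton_subset_iff.2 hq)
  refine mem_map.2 ?_
  filter_upwards [hK.compl_mem_cocompact] with z hz
  exact hO' (not_not.1 hz)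

end IsPlaneChart

/-- The parametrization of the sphere by the reciprocal of a square root coordinate. -/
def sqrtChart {S : Type*} (j : ℂ → S) (q : S) (b s₀ w : ℂ) : S :=
  if w = 0 then q else j (b + (1 / w - s₀) ^ 2)

lemma continuous_sqrtChart {S : Type*} [TopologicalSpace S] [CompactSpace S] [T2Space S]
    {j : ℂ → S} {q : S} (h : IsPlaneChart j q) (b s₀ : ℂ) : Continuous (sqrtChart j q b s₀) := by
  rw [continuous_iff_continuousAt]
  intro w
  by_cases hw : w = 0
  · subst hw
    rw [ContinuousAt, show sqrtChart j q b s₀ 0 = q by simp [sqrtChart],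
      ← nhdsNE_sup_pure, tendsto_sup]
    refine ⟨?_, ?_⟩
    · have h1 : Tendsto (fun w : ℂ => b + (1 / w - s₀) ^ 2) (𝓝[≠] 0) (Bornology.cobounded ℂ) := by
        have h2 : Tendsto (fun w : ℂ => 1 / w) (𝓝[≠] 0) (Bornology.cobounded ℂ) := by
          simpa using Filter.tendsto_inv₀_nhdsNE_zero (α := ℂ)
        rw [← tendsto_norm_atTop_iff_cobounded] at h2 ⊢
        have h3 : Tendsto (fun w : ℂ => (‖1 / w‖ - ‖s₀‖)) (𝓝[≠] 0) atTop := by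
          simpa [sub_eq_add_neg] using tendsto_atTop_add_const_right _ (-‖s₀‖) h2
        have h4 : Tendsto (fun w : ℂ => (‖1 / w‖ - ‖s₀‖) ^ 2 - ‖b‖) (𝓝[≠] 0) atTop := by
          simpa [sub_eq_add_neg] using tendsto_atTop_add_const_right _ (-‖b‖)
            ((tendsto_pow_atTop two_ne_zero).comp h3)
        refine tendsto_atTop_mono' _ ?_ h4
        filter_upwards [h3.eventually_ge_atTop 0] with w hw
        have h5 : ‖1 / w‖ - ‖s₀‖ ≤ ‖1 / w - s₀‖ := norm_sub_norm_le _ _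
        have h6 : ‖(1 / w - s₀) ^ 2‖ - ‖b‖ ≤ ‖b + (1 / w - s₀) ^ 2‖ := by
          have := norm_sub_norm_le ((1 / w - s₀) ^ 2) (-b)
          rw [norm_neg, sub_neg_eq_add, add_comm _ b] at this
          exact this
        rw [norm_pow] at h6
        nlinarith
      rw [Metric.cobounded_eq_cocompact] at h1
      refine (h.tendsto_cocompact.comp h1).congr' ?_
      filter_upwards [self_mem_nhdsWithin] with w hw
      exact (if_neg hw).symm
    · rw [tendsto_pure_left]
      intro s hs
      simpa [sqrtChart] using mem_of_mem_nhds hs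
  · have h1 : ContinuousAt (fun w => j (b + (1 / w - s₀) ^ 2)) w := by
      refine h.emb.continuous.continuousAt.comp ?_
      exact (((continuousAt_const.div continuousAt_id hw).sub continuousAt_const).pow 2).const_add b
    refine h1.congr ?_
    filter_upwards [isOpen_ne.mem_nhds hw] with v hv
    rw [sqrtChart, if_neg hv]

/-- A Riemann map onto a simply connected domain of the sphere is a disc model. -/
theorem isDiscModel_comp {S : Type*} [MetricSpace S] [CompactSpace S] {j : ℂ → S} {q : S}
    (hj : IsPlaneChart j q) {U : Set S} (hU : IsOpen U) (hq : q ∉ U) {b₁ : S} (hb₁ : b₁ ≠ q)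
    (hb₁U : b₁ ∉ U) (hsc : IsSimplyConnected (j ⁻¹' U)) {φ : ℂ → ℂ}
    (hd : DifferentiableOn ℂ φ 𝔻) (hi : InjOn φ 𝔻)
    (himg : φ '' 𝔻 = j ⁻¹' U) : IsDiscModel U (j ∘ φ) := by
  have hV := hU.preimage hj.emb.continuous
  have hmem : ∀ z ∈ 𝔻, φ z ∈ j ⁻¹' U := fun z hz =>
    himg ▸ mem_image_of_mem φ hz
  have hx₀ := hmem 0 (mem_ball_self one_pos)
  obtain ⟨b, rfl⟩ := hj.exists_eq hb₁
  obtain ⟨s, hs2, hsd, hs0, ε, hε, hsε⟩ := exists_sqrt_branch hV hsc (b := b) hb₁U hx₀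
  set s₀ := s (φ 0) with hs₀
  set H : ℂ → ℂ := fun z => 1 / (s (φ z) + s₀) with hH
  have hne : ∀ z ∈ 𝔻, s (φ z) + s₀ ≠ 0 := fun z hz h0 => by grind
  have hsdiff : ∀ {b : ℂ} {s : ℂ → ℂ}, (∀ z ∈ j ⁻¹' U, HasDerivAt s (1 / (2 * s z)) z) →
      DifferentiableOn ℂ (fun z => s (φ z)) 𝔻 := by
    intro b s hsd
    have h1 : DifferentiableOn ℂ s (j ⁻¹' U) := fun z hz =>
      (hsd z hz).differentiableAt.differentiableWithinAt
    exact h1.comp hd hmem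
  have hHd : DifferentiableOn ℂ H 𝔻 :=
    (differentiableOn_const 1).div ((hsdiff (b := b) hsd).add_const s₀) hne
  have hH0 := fun z hz => one_div_ne_zero (hne z hz)
  have hHM : ∀ z ∈ 𝔻, ‖H z‖ ≤ 1 / ε := fun z hz => by
    rw [hH, norm_div, norm_one]
    bound
  have hφH : ∀ z ∈ 𝔻, φ z = b + (1 / H z - s₀) ^ 2 := fun z hz => by
    simp only [hH, one_div_one_div, add_sub_cancel_right, hs2]
    ring
  have hHi : InjOn H 𝔻 := fun x hx y hy hxy => hi hx hy (by
    rw [hφH x hx, hφH y hy, hxy])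
  set R := sqrtChart j q b s₀ with hR
  have hRc : Continuous R := continuous_sqrtChart hj b s₀
  have hRH : ∀ z ∈ 𝔻, (j ∘ φ) z = R (H z) := fun z hz => by
    rw [hR, sqrtChart, if_neg (hH0 z hz), ← hφH z hz, comp_apply]
  have hA := lintegral_deriv_sq_lt_top hHd hHi hHM
  have hlim : ∀ {l : Filter ℝ} {p : ℝ → ℂ} {w : ℂ}, Tendsto (fun t => H (p t)) l (𝓝 w) →
      (∀ᶠ t in l, p t ∈ 𝔻) → Tendsto (fun t => (j ∘ φ) (p t)) l (𝓝 (R w)) := by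
    intro l p w hw hp
    refine ((hRc.tendsto w).comp hw).congr' ?_
    filter_upwards [hp] with t ht
    rw [hRH _ ht, comp_apply]
  refine ⟨hj.emb.continuous.comp_continuousOn hd.continuousOn, ?_, ?_, ?_, ?_, ?_, ?_⟩
  · exact hj.emb.injective.comp_injOn hi
  · rw [image_comp, himg, image_preimage_eq_inter_range, hj.range_eq, inter_eq_left]
    exact fun x hx hxq => hq (hxq ▸ hx)
  · intro V hVo hVb
    rw [image_comp]
    refine hj.emb.isOpenMap _ ?_
    have han : AnalyticOnNhd ℂ φ 𝔻 := hd.analyticOnNhd isOpen_ball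
    rcases han.is_constant_or_isOpen (convex_ball 0 1).isPreconnected with ⟨w, hw⟩ | h
    · exfalso
      have h1 : (0:ℂ) ∈ 𝔻 := mem_ball_self one_pos
      have h2 : (1/2:ℂ) ∈ 𝔻 := by rw [mem_ball_zero_iff]; norm_num
      have := hi h1 h2 ((hw _ h1).trans (hw _ h2).symm)
      norm_num at this
    · exact h V hVb hVo
  · intro ε' hε' hε'1
    have huc := (isCompact_closedBall (0:ℂ) (1/ε)).uniformContinuousOn_of_continuous
      hRc.continuousOn
    rw [Metric.uniformContinuousOn_iff] at huc
    obtain ⟨η, hη, hη2⟩ := huc ε' hε'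
    obtain ⟨δ, hδ, hδε, hδ2⟩ := exists_short_arcs hHd hA hη hε' hε'1
    refine ⟨δ, hδ, hδε, fun ζ hζ hae => hδ2 ζ hζ ?_⟩
    filter_upwards [hae, ae_restrict_mem measurableSet_Ioo] with r hr hrm
    by_contra hlt
    rw [not_le] at hlt
    refine hr fun t ht t' ht' => ?_
    have hr0 := hδ.trans hrm.1
    have hr2 : r < 2 := by linarith [hrm.2]
    have hm := fun {t} (ht : t ∈ Ioo (-openAngle r) (openAngle r)) =>
      crossCirc_mem_ball hζ hr0 hr2 ht
    rw [hRH _ (hm ht), hRH _ (hm ht')]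
    refine hη2 _ (mem_closedBall_zero_iff.2 (hHM _ (hm ht))) _
      (mem_closedBall_zero_iff.2 (hHM _ (hm ht'))) ?_
    have := (enorm_sub_le_of_contDiffOn (contDiffOn_comp_crossCirc hHd hζ hr0 hr2) ht' ht).trans_lt
      hlt
    rw [dist_eq_norm]
    rw [← ofReal_norm, ENNReal.ofReal_lt_ofReal_iff hη] at this
    exact this
  · intro ζ hζ
    filter_upwards [ae_arcLength_lt_top hHd hA hζ, ae_restrict_mem measurableSet_Ioo] with r hr hrm
    have hr2 : r < 2 := by linarith [hrm.2]
    have hop : -openAngle r < openAngle r := by linarith [openAngle_pos hr2]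
    have hc := contDiffOn_comp_crossCirc hHd hζ hrm.1 hr2
    have hm := fun {t} (ht : t ∈ Ioo (-openAngle r) (openAngle r)) =>
      crossCirc_mem_ball hζ hrm.1 hr2 ht
    obtain ⟨w, hw⟩ := exists_tendsto_left_of_lintegral hop hc hr
    obtain ⟨w', hw'⟩ := exists_tendsto_right_of_lintegral hop hc hr
    refine ⟨⟨_, hlim hw ?_⟩, _, hlim hw' ?_⟩
    · filter_upwards [Ioo_mem_nhdsGT hop] with t ht using hm ht
    · filter_upwards [Ioo_mem_nhdsLT hop] with t ht using hm ht
  · intro a haU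
    have hper : ∀ t : ℝ, exp (((t + 2 * π : ℝ) : ℂ) * I) =
        exp (t * I) := fun t => by
      push_cast
      rw [add_mul, exp_add, Complex.exp_two_pi_mul_I, mul_one]
    have hrl : ∀ᵐ t : ℝ,
        ∃ w, Tendsto (fun r : ℝ => H (r * exp (t * I))) (𝓝[<] 1) (𝓝 w) := by
      refine ae_of_periodic (a := -π) (fun t => by rw [hper]) ?_
      rw [show -π + 2 * π = π by ring, ← Measure.restrict_congr_set Ioo_ae_eq_Ioc]
      exact ae_exists_radial_limit hHd hA
    have hball : ∀ t : ℝ, ∀ᶠ r : ℝ in 𝓝[<] 1, r * exp (t * I) ∈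
        𝔻 := fun t => by
      filter_upwards [Ioo_mem_nhdsLT (show (0:ℝ) < 1 by norm_num)] with r hr
      rw [mem_ball_zero_iff, norm_mul, norm_exp_ofReal_mul_I, mul_one, norm_real,
        Real.norm_of_nonneg hr.1.le]
      exact hr.2
    by_cases haq : a = q
    · filter_upwards [hrl, ae_not_tendsto_zero hHd hH0 hHM] with t ⟨w, hw⟩ hnot
      refine ⟨R w, ?_, hlim hw (hball t)⟩
      rw [haq, hR, sqrtChart, if_neg]
      · exact hj.apply_ne _
      · rintro rfl; exact hnot hw
    · obtain ⟨b', rfl⟩ := hj.exists_eq haq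
      obtain ⟨s', hs2', hsd', hs0', ε', hε', hsε'⟩ := exists_sqrt_branch hV hsc (b := b') haU hx₀
      have hne' : ∀ z ∈ 𝔻, s' (φ z) + s' (φ 0) ≠ 0 := fun z hz h0 => by grind
      have hN := ae_not_tendsto_zero (B := fun z => s' (φ z) / (s' (φ z) + s' (φ 0)))
        (M := 1 + ‖s' (φ 0)‖ / ε')
        ((hsdiff (b := b') hsd').div ((hsdiff (b := b') hsd').add_const _) hne')
        (fun z hz => div_ne_zero (hs0' _ (hmem z hz)) (hne' z hz)) (fun z hz => by
          rw [show s' (φ z) / (s' (φ z) + s' (φ 0)) = 1 - s' (φ 0) / (s' (φ z) + s' (φ 0)) by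
            grind]
          refine (norm_sub_le _ _).trans ?_
          rw [norm_one, norm_div]
          bound)
      filter_upwards [hrl, hN] with t ⟨w, hw⟩ hnot
      refine ⟨R w, fun hRw => hnot ?_, hlim hw (hball t)⟩
      have hw0 : w ≠ 0 := by
        rintro rfl
        rw [hR, sqrtChart, if_pos rfl] at hRw
        exact hj.apply_ne _ hRw.symm
      rw [hR, sqrtChart, if_neg hw0] at hRw
      have hwb := hj.emb.injective hRw
      set p : ℝ → ℂ := fun r => r * exp (t * I)
      have h1 : Tendsto (fun r => φ (p r)) (𝓝[<] 1) (𝓝 b') := by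
        rw [← hwb]
        refine ((((tendsto_const_nhds (x := (1:ℂ))).div hw hw0).sub_const s₀).pow 2
          |>.const_add b).congr' ?_
        filter_upwards [hball t] with r hr
        rw [hφH _ hr]
        rfl
      have h2 : Tendsto (fun r => s' (φ (p r))) (𝓝[<] 1) (𝓝 0) := by
        rw [tendsto_zero_iff_norm_tendsto_zero]
        have h3 : Tendsto (fun r => Real.sqrt ‖φ (p r) - b'‖) (𝓝[<] 1) (𝓝 0) := by
          have := (h1.sub_const b').norm.sqrt
          simpa using this
        refine h3.congr fun r => ?_
        rw [← hs2', norm_pow, Real.sqrt_sq (norm_nonneg _)]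
      have h4 : Tendsto (fun r => ‖s' (φ (p r))‖ / ε') (𝓝[<] 1) (𝓝 0) := by
        simpa using h2.norm.div_const ε'
      refine squeeze_zero_norm' ?_ h4
      filter_upwards [hball t] with r hr
      rw [norm_div]
      bound

/-- Stereographic charts of the sphere. -/
lemma exists_planeChart {q x₀ : SphereTwo} (h : x₀ ≠ q) :
    ∃ j : ℂ → SphereTwo, IsPlaneChart j q ∧ j 0 = x₀ := by
  have : Fact (Module.finrank ℝ (EuclideanSpace ℝ (Fin 3)) = 2 + 1) :=
    ⟨finrank_euclideanSpace_fin⟩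
  let e := stereographic' 2 q
  let L : ℂ ≃L[ℝ] EuclideanSpace ℝ (Fin 2) :=
    Complex.orthonormalBasisOneI.repr.toContinuousLinearEquiv
  let T : ℂ ≃ₜ EuclideanSpace ℝ (Fin 2) := L.toHomeomorph.trans (Homeomorph.addRight (e x₀))
  have hs : e.source = {q}ᶜ := stereographic'_source q
  have ht : e.target = univ := stereographic'_target q
  have hemb : IsOpenEmbedding e.symm := by
    refine e.symm.isOpenEmbedding ?_
    exact ht
  refine ⟨e.symm ∘ T, ⟨hemb.comp T.isOpenEmbedding, ?_⟩, ?_⟩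
  · rw [range_comp, T.range_coe, ← hs, ← e.symm_image_target_eq_source, ht]
  aesop

namespace IsPlaneChart

variable {S : Type*} [TopologicalSpace S] {j : ℂ → S} {q : S}

lemma invFun_apply (h : IsPlaneChart j q) (z : ℂ) : invFun j (j z) = z :=
  Function.leftInverse_invFun h.emb.injective z

lemma apply_invFun (h : IsPlaneChart j q) {x : S} (hx : x ≠ q) : j (invFun j x) = x :=
  Function.invFun_eq (h.exists_eq hx)

lemma continuousOn_invFun [T1Space S] (h : IsPlaneChart j q) :
    ContinuousOn (invFun j) {q}ᶜ := by
  intro x hx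
  obtain ⟨z, rfl⟩ := h.exists_eq hx
  refine ContinuousAt.continuousWithinAt ?_
  rw [ContinuousAt, h.invFun_apply, ← h.emb.map_nhds_eq, tendsto_map'_iff]
  refine tendsto_id.congr fun w => ?_
  rw [comp_apply, h.invFun_apply, id]

/-- Chart centred at the point omitted by the chart `j`. -/
lemma exists_inversion [CompactSpace S] [T2Space S] (h : IsPlaneChart j q) :
    ∃ j' : ℂ → S, IsPlaneChart j' (j 0) ∧ j' 0 = q ∧ ∀ z ≠ 0, j' z = j z⁻¹ := by
  classical
  set j' : ℂ → S := fun z => if z = 0 then q else j z⁻¹ with hj'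
  have h0 : j' 0 = q := if_pos rfl
  have h1 : ∀ z ≠ 0, j' z = j z⁻¹ := fun z hz => if_neg hz
  have hnhds : ∀ z, map j' (𝓝 z) = 𝓝 (j' z) := by
    intro z
    by_cases hz : z = 0
    · subst hz
      rw [h0]
      apply le_antisymm
      · change Tendsto j' (𝓝 0) (𝓝 q)
        rw [← nhdsNE_sup_pure, tendsto_sup]
        refine ⟨?_, ?_⟩
        · have h2 := Filter.tendsto_inv₀_nhdsNE_zero (α := ℂ)
          rw [Metric.cobounded_eq_cocompact] at h2
          refine (h.tendsto_cocompact.comp h2).congr' ?_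
          filter_upwards [self_mem_nhdsWithin] with w hw
          exact (h1 w hw).symm
        · rw [tendsto_pure_left]
          intro s hs
          rw [h0]; exact mem_of_mem_nhds hs
      · intro A hA
        obtain ⟨ε, hε, hεA⟩ := Metric.mem_nhds_iff.1 (mem_map.1 hA)
        have hK : IsClosed (j '' closedBall 0 (1 / ε)) :=
          ((isCompact_closedBall (0:ℂ) (1/ε)).image h.emb.continuous).isClosed
        refine mem_of_superset (hK.isOpen_compl.mem_nhds ?_) ?_
        · rintro ⟨z, -, hz⟩; exact h.apply_ne z hz
        · intro x hx
          by_cases hxq : x = q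
          · rw [hxq, ← h0]; exact hεA (mem_ball_self hε)
          · obtain ⟨z, rfl⟩ := h.exists_eq hxq
            have hz : 1 / ε < ‖z‖ := by
              by_contra hz
              exact hx ⟨z, mem_closedBall_zero_iff.2 (not_lt.1 hz), rfl⟩
            have hzpos : 0 < ‖z‖ := (by positivity : 0 < 1 / ε).trans hz
            have hz0 : z ≠ 0 := norm_pos_iff.1 hzpos
            have : j z = j' z⁻¹ := by rw [h1 _ (inv_ne_zero hz0), inv_inv]
            rw [this]
            refine hεA ?_
            rw [mem_ball_zero_iff, norm_inv, inv_lt_comm₀ hzpos hε, ← one_div]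
            exact hz
    · have h2 : j' =ᶠ[𝓝 z] fun w => j w⁻¹ := by
        filter_upwards [isOpen_ne.mem_nhds hz] with w hw using h1 w hw
      rw [map_congr h2, h1 z hz, ← h.emb.map_nhds_eq, nhds_inv₀ hz]
      rfl
  refine ⟨j', ⟨.of_continuous_injective_isOpenMap ?_ ?_ ?_, ?_⟩, h0, h1⟩
  · exact continuous_iff_continuousAt.2 fun z => (hnhds z).le
  · intro z w hzw
    by_cases hz : z = 0 <;> by_cases hw : w = 0
    · rw [hz, hw]
    · rw [hz, h0, h1 w hw] at hzw; exact (h.apply_ne _ hzw.symm).elim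
    · rw [hw, h0, h1 z hz] at hzw; exact (h.apply_ne _ hzw).elim
    · rw [h1 z hz, h1 w hw] at hzw; exact inv_injective (h.emb.injective hzw)
  · exact IsOpenMap.of_nhds_le fun z => (hnhds z).ge
  · ext x
    constructor
    · rintro ⟨z, rfl⟩
      by_cases hz : z = 0
      · rw [hz, h0]; exact fun h2 => h.apply_ne 0 h2.symm
      · rw [h1 z hz]
        exact fun h2 => inv_ne_zero hz (h.emb.injective h2)
    · intro hx
      by_cases hxq : x = q
      · exact ⟨0, by rw [h0, hxq]⟩
      · obtain ⟨z, rfl⟩ := h.exists_eq hxq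
        have hz : z ≠ 0 := fun h2 => hx (by rw [h2]; rfl)
        exact ⟨z⁻¹, by grind⟩

lemma exists_log [T1Space S] (h : IsPlaneChart j q) {u : S → ℂ} (hu : ContinuousOn u {q}ᶜ)
    (h0 : ∀ x ≠ q, u x ≠ 0) :
    ∃ l : S → ℂ, ContinuousOn l {q}ᶜ ∧ ∀ x ≠ q, exp (l x) = u x := by
  obtain ⟨l, hl, hle⟩ := exists_log_of_convex convex_univ (u := u ∘ j)
    (hu.comp h.emb.continuous.continuousOn fun z _ => h.apply_ne z) fun z _ => h0 _ (h.apply_ne z)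
  refine ⟨l ∘ invFun j, hl.comp h.continuousOn_invFun (mapsTo_univ _ _), fun x hx => ?_⟩
  rw [comp_apply, hle _ trivial, comp_apply, h.apply_invFun hx]

lemma isConnected_compl_pair (h : IsPlaneChart j q) (z : ℂ) : IsConnected ({q, j z}ᶜ : Set S) := by
  have h1 : ({q, j z}ᶜ : Set S) = j '' {z}ᶜ := by
    rw [image_compl_eq_range_sdiff_image h.emb.injective, h.range_eq, image_singleton]
    ext x; simp
  rw [h1]
  refine IsConnected.image ?_ _ h.emb.continuous.continuousOn
  exact isConnected_compl_singleton_of_one_lt_rank (by simp) z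

end IsPlaneChart

/-- Nonvanishing continuous functions on the sphere have continuous logarithms. -/
lemma exists_log_sphere {u : SphereTwo → ℂ} (hu : Continuous u) (h0 : ∀ x, u x ≠ 0) :
    ∃ l : SphereTwo → ℂ, Continuous l ∧ ∀ x, exp (l x) = u x := by
  obtain ⟨q, q', hq⟩ : ∃ q q' : SphereTwo, q ≠ q' := by
    refine ⟨⟨EuclideanSpace.single 0 1, by simp⟩, ⟨EuclideanSpace.single 1 1, by simp⟩, fun h => ?_⟩
    have := congrArg (fun x : SphereTwo => x.1 0) h
    simp at this
  obtain ⟨j, hj, hj0⟩ := exists_planeChart hq.symm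
  obtain ⟨j', hj', -⟩ := exists_planeChart hq
  obtain ⟨l, hl, hle⟩ := hj.exists_log hu.continuousOn fun x _ => h0 x
  obtain ⟨l', hl', hle'⟩ := hj'.exists_log hu.continuousOn fun x _ => h0 x
  have hc := hj.isConnected_compl_pair 0
  rw [hj0] at hc
  have hm : ∀ x ∈ ({q, q'}ᶜ : Set SphereTwo), x ≠ q ∧ x ≠ q' := fun x hx => by simpa using hx
  obtain ⟨y, hy⟩ := hc.nonempty
  have hdiff : ∀ x ∈ ({q, q'}ᶜ : Set SphereTwo), l x = l' x + (l y - l' y) := fun x hx => by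
    have := sub_eq_sub_of_exp_eq hc.isPreconnected (hl.mono fun x hx => (hm x hx).1)
      (hl'.mono fun x hx => (hm x hx).2)
      (fun x hx => (hle x (hm x hx).1).trans (hle' x (hm x hx).2).symm) hx hy
    rw [← this]; ring
  have hexp : exp (l y - l' y) = 1 := by
    rw [exp_sub, hle y (hm y hy).1, hle' y (hm y hy).2, div_self (h0 y)]
  classical
  refine ⟨fun x => if x = q then l' x + (l y - l' y) else l x, ?_, fun x => ?_⟩
  · rw [continuous_iff_continuousAt]
    intro x
    by_cases hx : x = q
    · subst hx
      refine ContinuousAt.congr (f := fun x => l' x + (l y - l' y)) ?_ ?_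
      · exact (hl'.continuousAt (isOpen_compl_singleton.mem_nhds hq)).add_const _
      · filter_upwards [isOpen_compl_singleton.mem_nhds (show x ∈ ({q'}ᶜ : Set _) from hq)] with w
          hw
        split_ifs with hwx
        · rfl
        · exact (hdiff w (by simpa using ⟨hwx, hw⟩)).symm
    · refine (hl.continuousAt (isOpen_compl_singleton.mem_nhds hx)).congr ?_
      filter_upwards [isOpen_compl_singleton.mem_nhds (show x ∈ ({q}ᶜ : Set _) from hx)] with w hw
      exact (if_neg hw).symm
  · by_cases hx : x = q
    · subst hx
      simp only [if_true]
      rw [exp_add, hexp, mul_one, hle' _ hq]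
    grind

lemma crossCirc_two_sin (ζ : ℂ) (β : ℝ) {σ : ℝ} (hσ : σ = 1 ∨ σ = -1) :
    crossCirc ζ (2 * Real.sin (β / 2)) (σ * (π / 2 - β / 2)) =
      ζ * exp (-(σ * β) * I) := by
  have h1 : (2 * Complex.sin (β / 2) : ℂ) =
      I * (exp (-(β / 2) * I) - exp (β / 2 * I)) := by
    rw [Complex.sin]; ring
  have hpi : exp (π / 2 * I) = I := by
    rw [Complex.exp_mul_I, ← Complex.ofReal_ofNat, ← Complex.ofReal_div, ← Complex.ofReal_cos,
      ← Complex.ofReal_sin, Real.cos_pi_div_two, Real.sin_pi_div_two]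
    simp
  have hI := Complex.I_mul_I
  rw [crossCirc]
  congr 1
  push_cast
  rw [h1]
  have hm : exp (-(β / 2) * I) * exp (β / 2 * I) = 1 := by
    rw [← exp_add]; simp
  rcases hσ with rfl | rfl
  · rw [show ((1:ℝ):ℂ) * ((π:ℂ) / 2 - β / 2) * I =
      π / 2 * I + -(β / 2) * I by push_cast; ring, exp_add, hpi,
      show (-(((1:ℝ):ℂ) * β) * I) = -(β / 2) * I + -(β / 2) * I by
        push_cast; ring, exp_add]
    grind
  · rw [show ((-1:ℝ):ℂ) * ((π:ℂ) / 2 - β / 2) * I =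
      -(π / 2 * I) + (β / 2) * I by push_cast; ring, exp_add,
      Complex.exp_neg, hpi, Complex.inv_I,
      show (-(((-1:ℝ):ℂ) * β) * I) = (β / 2) * I + (β / 2) * I by
        push_cast; ring, exp_add]
    grind

lemma exp_arg_of_norm_one {ζ : ℂ} (hζ : ‖ζ‖ = 1) : exp (ζ.arg * I) = ζ := by
  have := norm_mul_exp_arg_mul_I ζ
  simp_all

lemma norm_mul_exp_ofReal (ζ : ℂ) (s : ℝ) : ‖ζ * exp (s * I)‖ = ‖ζ‖ := by simp

lemma connectedComponentIn_eq_of_disjoint_open {α : Type*} [TopologicalSpace α] {A B W : Set α}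
    (hA : IsOpen A) (hB : IsOpen B) (hAB : Disjoint A B) (hW : W = A ∪ B)
    (hc : IsPreconnected A) {x : α} (hx : x ∈ A) : connectedComponentIn W x = A := by
  have hxW : x ∈ W := hW ▸ Or.inl hx
  refine Subset.antisymm ?_ (hc.subset_connectedComponentIn hx (hW ▸ subset_union_left))
  refine isPreconnected_connectedComponentIn.subset_left_of_subset_union hA hB hAB ?_
    ⟨x, mem_connectedComponentIn hxW, hx⟩
  exact hW ▸ connectedComponentIn_subset W x

lemma isPreconnected_ball_inter_compl_closedBall {ζ : ℂ} (hζ : ‖ζ‖ = 1) {r : ℝ} (hr : 0 < r)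
    (hr1 : r < 1) : IsPreconnected (𝔻 ∩ (closedBall ζ r)ᶜ) := by
  refine isPreconnected_of_forall 0 fun z hz => ?_
  have hρ : r < dist z ζ := not_le.1 hz.2
  have hρ2 : dist z ζ < 2 := by
    rw [dist_eq_norm]
    linarith [norm_sub_le z ζ, mem_ball_zero_iff.1 hz.1]
  have hρ0 := hr.trans hρ
  obtain ⟨t, ht, htz⟩ := exists_crossCirc_eq hζ hρ0 hρ2 hz.1 rfl
  have hop := openAngle_pos hρ2
  refine ⟨((fun s : ℝ => crossCirc ζ s 0) '' (Ioo r 2)) ∪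
    (crossCirc ζ (dist z ζ) '' Ioo (-openAngle (dist z ζ)) (openAngle (dist z ζ))), ?_, ?_, ?_, ?_⟩
  · rintro _ (⟨s, hs, rfl⟩ | ⟨s, hs, rfl⟩)
    · refine ⟨crossCirc_mem_ball hζ (hr.trans hs.1) hs.2 ⟨?_, openAngle_pos hs.2⟩, ?_⟩
      · linarith [openAngle_pos hs.2]
      · rw [mem_compl_iff, mem_closedBall, dist_crossCirc hζ (hr.trans hs.1).le]
        exact not_le.2 hs.1
    · refine ⟨crossCirc_mem_ball hζ hρ0 hρ2 hs, ?_⟩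
      rw [mem_compl_iff, mem_closedBall, dist_crossCirc hζ hρ0.le]
      exact not_le.2 hρ
  · exact Or.inl ⟨1, ⟨hr1, by norm_num⟩, by simp [crossCirc]⟩
  · exact Or.inr ⟨t, ht, htz⟩
  · refine IsPreconnected.union (crossCirc ζ (dist z ζ) 0) ⟨_, ⟨hρ, hρ2⟩, rfl⟩
      ⟨0, ⟨by linarith, hop⟩, rfl⟩ ?_ ?_
    · refine isPreconnected_Ioo.image _ (Continuous.continuousOn ?_)
      unfold crossCirc; fun_prop
    · exact isPreconnected_Ioo.image _ (continuous_crossCirc ζ _).continuousOn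

namespace IsDiscModel

variable {S : Type*} [MetricSpace S] {U : Set S} {φ : ℂ → S}

/-- Crosscuts about a boundary point generically do not land at a given point. -/
lemma ae_not_land (h : IsDiscModel U φ) {ζ : ℂ} (hζ : ‖ζ‖ = 1) {p : S} (hp : p ∉ U) {σ : ℝ}
    (hσ : σ = 1 ∨ σ = -1) : ∀ᵐ r ∂volume.restrict (Ioo (0:ℝ) 1),
      ¬ Tendsto (fun t => φ (crossCirc ζ r (σ * t))) (𝓝[<] (openAngle r)) (𝓝 p) := by
  have h1 : ∀ᵐ β : ℝ, ∃ w ≠ p, Tendsto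
      (fun r : ℝ => φ (r * exp ((ζ.arg - σ * β : ℝ) * I))) (𝓝[<] 1) (𝓝 w) := by
    rcases hσ with rfl | rfl
    · simp only [one_mul]
      exact (Measure.measurePreserving_sub_left volume ζ.arg).quasiMeasurePreserving.ae (h.rad p hp)
    · simp only [neg_mul, one_mul, sub_neg_eq_add]
      exact (measurePreserving_add_left volume ζ.arg).quasiMeasurePreserving.ae (h.rad p hp)
  rw [ae_iff] at h1
  have h2 := addHaar_image_eq_zero_of_differentiableOn_of_addHaar_eq_zero volume
    (f := fun β : ℝ => 2 * Real.sin (β / 2)) (by fun_prop) h1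
  rw [ae_restrict_iff' measurableSet_Ioo, ae_iff]
  refine measure_mono_null ?_ h2
  intro r hr
  change ¬ (r ∈ Ioo (0:ℝ) 1 → _) at hr
  push Not at hr
  obtain ⟨⟨hr0, hr1⟩, hlim⟩ := hr
  have hr2 : r < 2 := by linarith
  have hsin : 2 * Real.sin (2 * Real.arcsin (r / 2) / 2) = r := by
    rw [mul_div_cancel_left₀ _ two_ne_zero, Real.sin_arcsin (by linarith) (by linarith)]
    ring
  refine ⟨2 * Real.arcsin (r / 2), fun ⟨w, hwp, hw⟩ => hwp ?_, hsin⟩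
  have hθ : openAngle r = π / 2 - 2 * Real.arcsin (r / 2) / 2 := by
    rw [mul_div_cancel_left₀ _ two_ne_zero, openAngle, Real.arccos]
  have hc := crossCirc_two_sin ζ (2 * Real.arcsin (r / 2)) hσ
  rw [hsin, ← hθ] at hc
  have hc2 : crossCirc ζ r (σ * openAngle r) =
      exp ((ζ.arg - σ * (2 * Real.arcsin (r / 2)) : ℝ) * I) := by
    rw [hc]
    conv_lhs => rw [← exp_arg_of_norm_one hζ]
    rw [← exp_add]
    congr 1
    push_cast; ring
  have hop := openAngle_pos hr2
  refine (h.limit_unique (ξ := crossCirc ζ r (σ * openAngle r)) (p := fun t => crossCirc ζ r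
    (σ * t))
    (b := openAngle r) (b' := 1)
    (p' := fun s : ℝ => s * exp ((ζ.arg - σ * (2 * Real.arcsin (r / 2)) : ℝ) * I))
    ?_ ?_ ?_ ?_ ?_ hlim hw).symm
  · rw [hc2, norm_exp_ofReal_mul_I]
  · filter_upwards [Ioo_mem_nhdsLT (show -openAngle r < openAngle r by linarith)] with t ht
    refine ⟨?_, crossCirc_mem_ball hζ hr0 hr2 ?_⟩
    · exact ((continuous_crossCirc ζ r).comp (continuous_const_mul σ)).continuousAt
    · rcases hσ with rfl | rfl
      · simpa using ht
      grind
  · filter_upwards [Ioo_mem_nhdsLT (show (0:ℝ) < 1 by norm_num)] with t ht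
    refine ⟨by fun_prop, ?_⟩
    rw [mem_ball_zero_iff, norm_mul_exp_ofReal, norm_real, Real.norm_of_nonneg ht.1.le]
    exact ht.2
  · exact (((continuous_crossCirc ζ r).comp (continuous_const_mul σ)).tendsto _).mono_left
      nhdsWithin_le_nhds
  · rw [hc2]
    have : Continuous fun s : ℝ =>
      (s:ℂ) * exp ((ζ.arg - σ * (2 * Real.arcsin (r / 2)) : ℝ) * I) := by fun_prop
    have := (this.tendsto 1).mono_left (nhdsWithin_le_nhds (s := Iio 1))
    simpa using this

end IsDiscModel

/-- The part of the domain cut off by a small circle about a boundary point of the disc. -/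
def discCap {S : Type*} (φ : ℂ → S) (ζ : ℂ) (r : ℝ) : Set S :=
  φ '' (𝔻 ∩ ball ζ r)

/-- The crosscut bounding `discCap`. -/
def discArc {S : Type*} (φ : ℂ → S) (ζ : ℂ) (r : ℝ) : Set S :=
  φ '' (𝔻 ∩ Metric.sphere ζ r)

namespace IsDiscModel

variable {S : Type*} [MetricSpace S] {U : Set S} {φ : ℂ → S}

lemma isOpen_discCap (h : IsDiscModel U φ) (ζ : ℂ) (r : ℝ) : IsOpen (discCap φ ζ r) :=
  h.open_map _ (isOpen_ball.inter isOpen_ball) inter_subset_left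

lemma discCap_subset (h : IsDiscModel U φ) (ζ : ℂ) (r : ℝ) : discCap φ ζ r ⊆ U := by
  rintro _ ⟨z, hz, rfl⟩; exact h.mem hz.1

lemma discArc_subset (h : IsDiscModel U φ) (ζ : ℂ) (r : ℝ) : discArc φ ζ r ⊆ U := by
  rintro _ ⟨z, hz, rfl⟩; exact h.mem hz.1

lemma isPreconnected_discCap (h : IsDiscModel U φ) (ζ : ℂ) (r : ℝ) :
    IsPreconnected (discCap φ ζ r) :=
  ((convex_ball 0 1).inter (convex_ball ζ r)).isPreconnected.image _
    (h.cont.mono inter_subset_left)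

lemma isOpen_discCap_compl (h : IsDiscModel U φ) (ζ : ℂ) (r : ℝ) :
    IsOpen (φ '' (𝔻 ∩ (closedBall ζ r)ᶜ)) :=
  h.open_map _ (isOpen_ball.inter isClosed_closedBall.isOpen_compl) inter_subset_left

lemma apply_mem_image_iff (h : IsDiscModel U φ) {A : Set ℂ} {z : ℂ}
    (hz : z ∈ 𝔻) : φ z ∈ φ '' (𝔻 ∩ A) ↔ z ∈ A := by
  refine ⟨fun ⟨w, hw, hwz⟩ => ?_, fun hA => ⟨z, ⟨hz, hA⟩, rfl⟩⟩
  rw [← h.inj hw.1 hz hwz]; exact hw.2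

lemma bdIn_discCap_subset (h : IsDiscModel U φ) (ζ : ℂ) (r : ℝ) :
    bdIn U (discCap φ ζ r) ⊆ discArc φ ζ r := by
  rintro x ⟨⟨hx, hxn⟩, hxU⟩
  rw [← h.img] at hxU
  obtain ⟨z, hz, rfl⟩ := hxU
  refine ⟨z, ⟨hz, ?_⟩, rfl⟩
  rw [discCap, h.apply_mem_image_iff hz] at hxn
  rw [Metric.mem_sphere]
  by_contra hne
  have hlt : z ∈ (closedBall ζ r)ᶜ := by
    rw [mem_compl_iff, mem_closedBall, not_le]
    exact lt_of_le_of_ne (not_lt.1 hxn) (Ne.symm hne)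
  obtain ⟨_, ⟨w, hw, rfl⟩, hwc⟩ := mem_closure_iff.1 hx _ (h.isOpen_discCap_compl ζ r)
    ⟨z, ⟨hz, hlt⟩, rfl⟩
  rw [discCap, h.apply_mem_image_iff hw.1] at hwc
  exact hw.2 (ball_subset_closedBall hwc)

lemma diff_discArc (h : IsDiscModel U φ) (ζ : ℂ) (r : ℝ) :
    U \ discArc φ ζ r = discCap φ ζ r ∪ φ '' (𝔻 ∩ (closedBall ζ r)ᶜ) := by
  ext x
  constructor
  · rintro ⟨hxU, hx⟩
    rw [← h.img] at hxU
    obtain ⟨z, hz, rfl⟩ := hxU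
    rw [discArc, h.apply_mem_image_iff hz, Metric.mem_sphere] at hx
    rw [mem_union, discCap, h.apply_mem_image_iff hz, h.apply_mem_image_iff hz, mem_ball,
      mem_compl_iff, mem_closedBall, not_le]
    exact lt_or_gt_of_ne hx
  · rintro (⟨z, hz, rfl⟩ | ⟨z, hz, rfl⟩)
    · refine ⟨h.mem hz.1, ?_⟩
      rw [discArc, h.apply_mem_image_iff hz.1]
      exact (mem_ball.1 hz.2).ne
    · refine ⟨h.mem hz.1, ?_⟩
      rw [discArc, h.apply_mem_image_iff hz.1]
      exact fun h2 => hz.2 (Metric.sphere_subset_closedBall h2)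

set_option maxHeartbeats 1000000 in
/-- A landing crosscut as a path. -/
lemma exists_discArc_path (h : IsDiscModel U φ) {ζ : ℂ} (hζ : ‖ζ‖ = 1) {r : ℝ} (hr : 0 < r)
    (hr2 : r < 2) {a b : S}
    (ha : Tendsto (fun t => φ (crossCirc ζ r (1 * t))) (𝓝[<] (openAngle r)) (𝓝 a))
    (hb : Tendsto (fun t => φ (crossCirc ζ r (-1 * t))) (𝓝[<] (openAngle r)) (𝓝 b)) :
    ∃ g : ℝ → S, ContinuousOn g (Icc 0 1) ∧ InjOn g (Ioo 0 1) ∧ g '' Ioo 0 1 = discArc φ ζ r ∧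
      g 0 = b ∧ g 1 = a ∧ a ∈ frontier U ∧ b ∈ frontier U := by
  have hop := openAngle_pos hr2
  have hop2 := openAngle_lt hr
  set θ := openAngle r
  set k : ℝ → ℂ := fun t => crossCirc ζ r (θ * (2 * t - 1)) with hk
  have hkc : Continuous k := (continuous_crossCirc ζ r).comp (by fun_prop)
  have hang : ∀ t ∈ Ioo (0:ℝ) 1, θ * (2 * t - 1) ∈ Ioo (-θ) θ := fun t ht =>
    ⟨by nlinarith [ht.1], by nlinarith [ht.2]⟩
  have hkm : ∀ t ∈ Ioo (0:ℝ) 1, k t ∈ 𝔻 := fun t ht =>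
    crossCirc_mem_ball hζ hr hr2 (hang t ht)
  have hcc : ContinuousOn (φ ∘ k) (Ioo 0 1) := h.cont.comp hkc.continuousOn hkm
  have h1 : Tendsto (φ ∘ k) (𝓝[<] 1) (𝓝 a) := by
    have : Tendsto (fun t : ℝ => θ * (2 * t - 1)) (𝓝[<] 1) (𝓝[<] θ) := by
      refine tendsto_nhdsWithin_iff.2 ⟨?_, ?_⟩
      · have hc : Continuous fun t : ℝ => θ * (2 * t - 1) := by fun_prop
        have := (hc.tendsto 1).mono_left (nhdsWithin_le_nhds (s := Iio 1))
        simpa [show (2:ℝ) - 1 = 1 by norm_num] using this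
      · filter_upwards [self_mem_nhdsWithin] with t ht
        have : t < 1 := ht
        change θ * (2 * t - 1) < θ
        nlinarith
    refine (ha.comp this).congr fun t => ?_
    simp [hk]
  have h0 : Tendsto (φ ∘ k) (𝓝[>] 0) (𝓝 b) := by
    have : Tendsto (fun t : ℝ => θ * (1 - 2 * t)) (𝓝[>] 0) (𝓝[<] θ) := by
      refine tendsto_nhdsWithin_iff.2 ⟨?_, ?_⟩
      · have hc : Continuous fun t : ℝ => θ * (1 - 2 * t) := by fun_prop
        have := (hc.tendsto 0).mono_left (nhdsWithin_le_nhds (s := Ioi 0))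
        simpa using this
      · filter_upwards [self_mem_nhdsWithin] with t ht
        have : 0 < t := ht
        change θ * (1 - 2 * t) < θ
        nlinarith
    refine (hb.comp this).congr fun t => ?_
    simp only [hk, comp_apply]
    congr 2; ring
  have hend : ∀ {l : Filter ℝ} [l.NeBot] {x : ℝ} {c : S}, l ≤ 𝓝 x → (∀ᶠ t in l, t ∈ Ioo (0:ℝ) 1) →
      (‖k x‖ = 1) → Tendsto (φ ∘ k) l (𝓝 c) → c ∈ frontier U := by
    intro l _ x c hl hm hx hc
    exact h.limit_mem_frontier (hm.mono fun t ht => hkm t ht) hx ((hkc.tendsto x).mono_left hl) hc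
  have hnk : ∀ σ : ℝ, σ = 1 ∨ σ = -1 → ‖crossCirc ζ r (σ * θ)‖ = 1 := by
    intro σ hσ
    have h2 := norm_crossCirc_sq hζ r (σ * θ)
    have h3 : Real.cos (σ * θ) = r / 2 := by
      rcases hσ with rfl | rfl
      · rw [one_mul, cos_openAngle hr hr2]
      · rw [neg_mul, one_mul, Real.cos_neg, cos_openAngle hr hr2]
    rw [h3] at h2
    have h4 : ‖crossCirc ζ r (σ * θ)‖ ^ 2 = 1 := by rw [h2]; ring
    nlinarith [norm_nonneg (crossCirc ζ r (σ * θ))]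
  have hext : ∀ t ∈ Ioo (0:ℝ) 1, extendFrom (Ioo 0 1) (φ ∘ k) t = φ (k t) := fun t ht =>
    extendFrom_eq (subset_closure ht) (hcc t ht)
  refine ⟨extendFrom (Ioo 0 1) (φ ∘ k), continuousOn_Icc_extendFrom_Ioo hcc h0 h1,
    ?_, ?_, eq_lim_at_left_extendFrom_Ioo zero_lt_one h0,
    eq_lim_at_right_extendFrom_Ioo zero_lt_one h1, ?_, ?_⟩
  · intro s hs t ht hst
    rw [hext s hs, hext t ht] at hst
    have h5 := h.inj (hkm s hs) (hkm t ht) hst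
    have hζ0 : ζ ≠ 0 := by rintro rfl; simp at hζ
    simp only [hk, crossCirc] at h5
    have h6 := mul_left_cancel₀ hζ0 h5
    have h7 : exp ((θ * (2 * s - 1) : ℝ) * I) =
        exp ((θ * (2 * t - 1) : ℝ) * I) := by
      have hr0 := Complex.ofReal_ne_zero.2 hr.ne'
      exact mul_left_cancel₀ hr0 (by linear_combination -h6)
    have h8 := congrArg Complex.arg h7
    have ha1 := hang s hs
    have ha2 := hang t ht
    rw [Complex.arg_exp_mul_I, Complex.arg_exp_mul_I, (toIocMod_eq_self _).2,
      (toIocMod_eq_self _).2] at h8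
    · grind
    · grind
    grind
  · ext x
    constructor
    · rintro ⟨t, ht, rfl⟩
      rw [hext t ht]
      exact ⟨_, ⟨hkm t ht, dist_crossCirc hζ hr.le _⟩, rfl⟩
    · rintro ⟨z, ⟨hz, hzr⟩, rfl⟩
      obtain ⟨s, hs, rfl⟩ := exists_crossCirc_eq hζ hr hr2 hz hzr
      have hs' : (s / θ + 1) / 2 ∈ Ioo (0:ℝ) 1 := by
        have h2 : -1 < s / θ := by rw [lt_div_iff₀ hop]; linarith [hs.1]
        have h3 : s / θ < 1 := by rw [div_lt_one hop]; exact hs.2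
        exact ⟨by linarith, by linarith⟩
      grind
  · refine hend nhdsWithin_le_nhds (Ioo_mem_nhdsLT zero_lt_one) ?_ h1
    have := hnk 1 (Or.inl rfl)
    grind
  · refine hend nhdsWithin_le_nhds (Ioo_mem_nhdsGT zero_lt_one) ?_ h0
    have := hnk (-1) (Or.inr rfl)
    grind

lemma exists_frontier_ne (h : IsDiscModel U φ) {a b : S} (ha : a ∉ U) (hb : b ∉ U) {O : Set ℂ}
    (hO : IsOpen O) {s : ℝ} (hs : exp (s * I) ∈ O) :
    ∃ w ∈ frontier U, w ≠ a ∧ w ≠ b ∧ w ∈ closure (φ '' (𝔻 ∩ O)) := by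
  have hd := MeasureTheory.Measure.dense_of_ae ((h.rad a ha).and (h.rad b hb))
  have hc : Continuous fun s : ℝ => exp (s * I) := by fun_prop
  obtain ⟨t, ht, ⟨w, hwa, hw⟩, ⟨w', hwb, hw'⟩⟩ := hd.inter_open_nonempty _ (hO.preimage hc) ⟨s, hs⟩
  obtain rfl := tendsto_nhds_unique hw hw'
  have hb : ∀ᶠ ρ : ℝ in 𝓝[<] 1, (ρ:ℂ) * exp (t * I) ∈ 𝔻 := by
    filter_upwards [Ioo_mem_nhdsLT (show (0:ℝ) < 1 by norm_num)] with ρ hρ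
    rw [mem_ball_zero_iff, norm_mul_exp_ofReal, norm_real, Real.norm_of_nonneg hρ.1.le]
    exact hρ.2
  have hlim : Tendsto (fun ρ : ℝ => (ρ:ℂ) * exp (t * I)) (𝓝[<] 1)
      (𝓝 (exp (t * I))) := by
    have : Continuous fun ρ : ℝ => (ρ:ℂ) * exp (t * I) := by fun_prop
    simpa using (this.tendsto 1).mono_left (nhdsWithin_le_nhds (s := Iio 1))
  refine ⟨w, h.limit_mem_frontier hb (norm_exp_ofReal_mul_I t) hlim hw, hwa, hwb, ?_⟩
  refine mem_closure_of_tendsto hw ?_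
  filter_upwards [hb, hlim.eventually (hO.mem_nhds ht)] with ρ h1 h2 using ⟨_, ⟨h1, h2⟩, rfl⟩

/-- Landing crosscuts about boundary points bound cross-sections. -/
lemma isCrossSection_discCap (h : IsDiscModel U φ) {ζ : ℂ} (hζ : ‖ζ‖ = 1) {r : ℝ} (hr : 0 < r)
    (hr1 : r < 1) {a b : S}
    (ha : Tendsto (fun t => φ (crossCirc ζ r (1 * t))) (𝓝[<] (openAngle r)) (𝓝 a))
    (hb : Tendsto (fun t => φ (crossCirc ζ r (-1 * t))) (𝓝[<] (openAngle r)) (𝓝 b)) :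
    IsCrossSection U (discCap φ ζ r) ∧
      closure (bdIn U (discCap φ ζ r)) ⊆ discArc φ ζ r ∪ {a, b} ∧ a ∉ U ∧ b ∉ U := by
  have hr2 : r < 2 := by linarith
  obtain ⟨g, hgc, hgi, hgim, hg0, hg1, haf, hbf⟩ := h.exists_discArc_path hζ hr hr2 ha hb
  have haU : a ∉ U := by have := haf.2; rwa [h.isOpen.interior_eq] at this
  have hbU : b ∉ U := by have := hbf.2; rwa [h.isOpen.interior_eq] at this
  have hIcc : g '' Icc 0 1 ⊆ discArc φ ζ r ∪ {a, b} := by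
    rintro _ ⟨t, ht, rfl⟩
    rcases eq_or_lt_of_le ht.1 with h0 | h0
    · rw [← h0, hg0]; simp
    rcases eq_or_lt_of_le ht.2 with h1 | h1
    · rw [h1, hg1]; simp
    · exact Or.inl (hgim ▸ mem_image_of_mem g ⟨h0, h1⟩)
  have hmA : φ ((1 - r / 2 : ℝ) * ζ) ∈ discCap φ ζ r := by
    refine ⟨_, ⟨?_, ?_⟩, rfl⟩
    · rw [mem_ball_zero_iff, norm_mul, hζ, mul_one, norm_real, Real.norm_of_nonneg] <;>
        linarith
    · rw [mem_ball, dist_eq_norm, show ((1 - r / 2 : ℝ) : ℂ) * ζ - ζ =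
        ((-(r / 2) : ℝ) : ℂ) * ζ by push_cast; ring, norm_mul, hζ, mul_one, norm_real,
        norm_neg, Real.norm_of_nonneg] <;> linarith
  have hmB : φ 0 ∈ φ '' (𝔻 ∩ (closedBall ζ r)ᶜ) := by
    refine ⟨0, ⟨mem_ball_self one_pos, ?_⟩, rfl⟩
    rw [mem_compl_iff, mem_closedBall, dist_zero_left, hζ, not_le]; exact hr1
  have hdisj : Disjoint (discCap φ ζ r) (φ '' (𝔻 ∩ (closedBall ζ r)ᶜ)) := by
    rw [Set.disjoint_left]
    rintro _ ⟨z, hz, rfl⟩ hz2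
    rw [h.apply_mem_image_iff hz.1] at hz2
    exact hz2 (ball_subset_closedBall hz.2)
  have hoA := h.isOpen_discCap ζ r
  have hoB := h.isOpen_discCap_compl ζ r
  have hcB :=
    (isPreconnected_ball_inter_compl_closedBall hζ hr hr1).image _ (h.cont.mono inter_subset_left)
  have hcompA : ∀ x ∈ discCap φ ζ r, connectedComponentIn (U \ discArc φ ζ r) x = discCap φ ζ r :=
    fun x hx => connectedComponentIn_eq_of_disjoint_open hoA hoB hdisj (h.diff_discArc ζ r)
      (h.isPreconnected_discCap ζ r) hx
  have hcompB : ∀ x ∈ φ '' (𝔻 ∩ (closedBall ζ r)ᶜ),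
      connectedComponentIn (U \ discArc φ ζ r) x =
        φ '' (𝔻 ∩ (closedBall ζ r)ᶜ) :=
    fun x hx => connectedComponentIn_eq_of_disjoint_open hoB hoA hdisj.symm
      ((h.diff_discArc ζ r).trans (union_comm _ _)) hcB hx
  have hisA : IsCompOf (U \ discArc φ ζ r) (discCap φ ζ r) :=
    ⟨_, h.diff_discArc ζ r ▸ Or.inl hmA, (hcompA _ hmA).symm⟩
  have hw : ∀ w ∈ frontier U, w ≠ a → w ≠ b → w ∈ frontier U \ g '' Icc 0 1 := by
    intro w hw hwa hwb
    refine ⟨hw, fun hwg => ?_⟩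
    rcases hIcc hwg with h1 | h1 | h1
    · have := hw.2
      rw [h.isOpen.interior_eq] at this
      exact this (h.discArc_subset ζ r h1)
    · exact hwa h1
    · exact hwb h1
  have hfr : ∀ {A : Set S} {w : S}, A ⊆ U → w ∈ frontier U → w ∈ closure A → w ∈ frontier A := by
    intro A w hA hw hc
    refine ⟨hc, fun hi => ?_⟩
    have := hw.2
    rw [h.isOpen.interior_eq] at this
    exact this (hA (interior_subset hi))
  refine ⟨⟨discArc φ ζ r, ⟨g, hgc, hgi, ?_, hg0 ▸ hbf, hg1 ▸ haf, hgim.symm, _, _,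
    ⟨hisA, ⟨_, h.diff_discArc ζ r ▸ Or.inr hmB, (hcompB _ hmB).symm⟩, ?_, ?_⟩, ?_, ?_⟩, hisA⟩, ?_,
    haU, hbU⟩
  · intro t ht
    exact h.discArc_subset ζ r (hgim ▸ mem_image_of_mem g ht)
  · grind
  · intro x hx
    rw [h.diff_discArc] at hx
    grind
  · obtain ⟨w, hwf, hwa, hwb, hwc⟩ := h.exists_frontier_ne haU hbU (O := ball ζ r)
      isOpen_ball (s := ζ.arg) (by rw [exp_arg_of_norm_one hζ]; exact mem_ball_self hr)
    exact ⟨w, hfr (h.discCap_subset ζ r) hwf hwc, hw w hwf hwa hwb⟩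
  · obtain ⟨w, hwf, hwa, hwb, hwc⟩ := h.exists_frontier_ne haU hbU (O := (closedBall ζ r)ᶜ)
      isClosed_closedBall.isOpen_compl (s := ζ.arg + π) (by
        rw [Complex.ofReal_add, add_mul, exp_add, exp_pi_mul_I,
          exp_arg_of_norm_one hζ, mem_compl_iff, mem_closedBall, dist_eq_norm,
          show ζ * -1 - ζ = -(2 * ζ) by ring, norm_neg, norm_mul, hζ]
        norm_num; exact hr2)
    refine ⟨w, hfr ?_ hwf hwc, hw w hwf hwa hwb⟩
    rintro _ ⟨z, hz, rfl⟩; exact h.mem hz.1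
  · refine (closure_minimal ?_ ((isCompact_Icc.image_of_continuousOn hgc).isClosed)).trans hIcc
    refine (h.bdIn_discCap_subset ζ r).trans ?_
    grind

end IsDiscModel

section Chains

variable {S : Type*} [TopologicalSpace S]

lemma IsPreconnected.exists_mem_closure_diff {A B : Set S} (hA : IsPreconnected A)
    (hB : IsOpen B) (h1 : (A ∩ B).Nonempty) (h2 : ¬A ⊆ B) : (A ∩ (closure B \ B)).Nonempty := by
  by_contra hne
  rw [not_nonempty_iff_eq_empty] at hne
  obtain ⟨x, hxA, hxB⟩ := not_subset.1 h2
  obtain ⟨y, hyA, hyB, hyc⟩ := hA B (closure B)ᶜ hB isClosed_closure.isOpen_compl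
    (fun y hy => by
      by_contra hyn
      simp only [mem_union, not_or, mem_compl_iff, not_not] at hyn
      exact (eq_empty_iff_forall_notMem.1 hne y) ⟨hy, hyn.2, hyn.1⟩) h1
    ⟨x, hxA, fun hxc => (eq_empty_iff_forall_notMem.1 hne x) ⟨hxA, hxc, hxB⟩⟩
  exact hyc (subset_closure hyB)

lemma bdIn_subset_of_isCompOf {U γ C : Set S} (hC : IsCompOf (U \ γ) C) : bdIn U C ⊆ γ := by
  rintro x ⟨⟨hx, hxC⟩, hxU⟩
  by_contra hxγ
  obtain ⟨y, hy, rfl⟩ := hC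
  have h1 :=
    isPreconnected_connectedComponentIn.subset_closure (subset_insert _ _)
      (insert_subset hx subset_closure)
  exact hxC (h1.subset_connectedComponentIn (mem_insert_of_mem _ (mem_connectedComponentIn hy))
    (insert_subset (show x ∈ U \ γ from ⟨hxU, hxγ⟩) (connectedComponentIn_subset _ _)) (mem_insert
      _ _))

lemma IsCrossSection.nonempty {U C : Set S} (hC : IsCrossSection U C) : C.Nonempty := by
  obtain ⟨γ, -, y, hy, rfl⟩ := hC
  exact ⟨y, mem_connectedComponentIn hy⟩

lemma IsCrossSection.isOpen [T2Space S] [LocallyConnectedSpace S] {U C : Set S} (hU : IsOpen U)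
    (hC : IsCrossSection U C) : IsOpen C := by
  obtain ⟨γ, ⟨g, hgc, -, -, h0, h1, rfl, -⟩, y, hy, rfl⟩ := hC
  have he : U \ g '' Ioo 0 1 = U \ g '' Icc 0 1 := by
    refine Subset.antisymm ?_ (sdiff_subset_sdiff_right (image_mono Ioo_subset_Icc_self))
    rintro x ⟨hxU, hx⟩
    refine ⟨hxU, ?_⟩
    rintro ⟨t, ht, rfl⟩
    rcases eq_or_lt_of_le ht.1 with h | h
    · rw [← h] at hxU; rw [hU.frontier_eq] at h0; exact h0.2 hxU
    rcases eq_or_lt_of_le ht.2 with h' | h'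
    · rw [h'] at hxU; rw [hU.frontier_eq] at h1; exact h1.2 hxU
    exact hx ⟨t, ⟨h, h'⟩, rfl⟩
  rw [he]
  exact (hU.sdiff (isCompact_Icc.image_of_continuousOn hgc).isClosed).connectedComponentIn

/-- A chain shrinking to a boundary point divides every chain all of whose members it meets. -/
lemma chainDivides_of_meets [T2Space S] [LocallyConnectedSpace S] {U : Set S} (hU : IsOpen U)
    {D C : ℕ → Set S} {a : S} (hDo : ∀ m, IsOpen (D m)) (hDc : ∀ m, IsPreconnected (D m))
    (hDU : ∀ m, D m ⊆ U) (haU : a ∉ U)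
    (h1 : ∀ x ∈ U, ∃ V ∈ 𝓝 x, ∀ᶠ m in atTop, Disjoint V (D m))
    (h2 : ∀ V ∈ 𝓝 a, ∀ᶠ m in atTop, bdIn U (D m) ⊆ V) (hC : IsPEChain U C)
    (hm : ∀ m n, (D m ∩ C n).Nonempty) : ChainDivides D C := by
  have key : ∀ n, (∃ m, D m ⊆ C n) ∨ a ∈ closure (bdIn U (C n)) := by
    intro n
    by_contra hcon
    push Not at hcon
    obtain ⟨hcon, hab⟩ := hcon
    obtain ⟨γ, ⟨g, hgc, -, hgU, hg0, hg1, rfl, -⟩, hcomp⟩ := hC.1 n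
    have hCo := (hC.1 n).isOpen hU
    have ht : ∀ m, ∃ t ∈ Ioo (0:ℝ) 1, g t ∈ D m ∧ g t ∈ bdIn U (C n) := by
      intro m
      obtain ⟨x, hxD, hx⟩ := (hDc m).exists_mem_closure_diff hCo (hm m n) (hcon m)
      have hxb : x ∈ bdIn U (C n) := ⟨hx, hDU m hxD⟩
      obtain ⟨t, ht, rfl⟩ := bdIn_subset_of_isCompOf hcomp hxb
      exact ⟨t, ht, hxD, hxb⟩
    choose t ht htD htb using ht
    have hhalf : (1/2:ℝ) ∈ Ioo (0:ℝ) 1 := by norm_num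
    have hs : ∀ᶠ m in atTop, ∃ s ∈ uIcc (t m) (1/2), g s ∈ bdIn U (D m) := by
      obtain ⟨V, hV, hVD⟩ := h1 _ (hgU _ hhalf)
      filter_upwards [hVD] with m hVm
      have hsub := ordConnected_Ioo.uIcc_subset (ht m) hhalf
      obtain ⟨_, ⟨s, hs, rfl⟩, hsc⟩ := ((isPreconnected_uIcc).image g
        (hgc.mono (hsub.trans Ioo_subset_Icc_self))).exists_mem_closure_diff (hDo m)
        ⟨_, mem_image_of_mem g left_mem_uIcc, htD m⟩ (fun hss =>
          Set.disjoint_left.1 hVm (mem_of_mem_nhds hV) (hss (mem_image_of_mem g right_mem_uIcc)))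
      exact ⟨s, hs, hsc, hgU s (hsub hs)⟩
    have hs' : ∀ m, ∃ s ∈ uIcc (t m) (1/2), (∃ s' ∈ uIcc (t m) (1/2), g s' ∈ bdIn U (D m)) →
        g s ∈ bdIn U (D m) := by
      intro m
      by_cases hx : ∃ s' ∈ uIcc (t m) (1/2), g s' ∈ bdIn U (D m)
      · obtain ⟨s, h3, h4⟩ := hx
        exact ⟨s, h3, fun _ => h4⟩
      · exact ⟨_, left_mem_uIcc, fun h => absurd h hx⟩
    choose s hsm hsb using hs'
    have hsI : ∀ m, s m ∈ Icc (0:ℝ) 1 := fun m =>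
      Ioo_subset_Icc_self (ordConnected_Ioo.uIcc_subset (ht m) hhalf (hsm m))
    obtain ⟨⟨t₀, s₀⟩, hts, θ, hθ, hlim⟩ := (isCompact_Icc.prod isCompact_Icc).tendsto_subseq
      (x := fun m => (t m, s m)) (s := Icc (0:ℝ) 1 ×ˢ Icc (0:ℝ) 1)
      fun m => ⟨Ioo_subset_Icc_self (ht m), hsI m⟩
    have hlt : Tendsto (fun m => t (θ m)) atTop (𝓝 t₀) := (continuous_fst.tendsto _).comp hlim
    have hls : Tendsto (fun m => s (θ m)) atTop (𝓝 s₀) := (continuous_snd.tendsto _).comp hlim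
    have hgt : Tendsto (fun m => g (t (θ m))) atTop (𝓝 (g t₀)) :=
      (hgc t₀ hts.1).tendsto.comp (tendsto_nhdsWithin_iff.2 ⟨hlt, Eventually.of_forall fun m =>
        Ioo_subset_Icc_self (ht _)⟩)
    have hgs : Tendsto (fun m => g (s (θ m))) atTop (𝓝 (g s₀)) :=
      (hgc s₀ hts.2).tendsto.comp (tendsto_nhdsWithin_iff.2 ⟨hls, Eventually.of_forall fun m =>
        hsI _⟩)
    have hgsa : Tendsto (fun m => g (s (θ m))) atTop (𝓝 a) := by
      intro V hV
      refine mem_map.2 ?_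
      filter_upwards [hθ.tendsto_atTop.eventually (h2 V hV), hθ.tendsto_atTop.eventually hs]
        with m h3 h4 using h3 (hsb _ h4)
    have hsa := tendsto_nhds_unique hgs hgsa
    have ht₀ : t₀ = 0 ∨ t₀ = 1 := by
      by_contra hne
      push Not at hne
      obtain ⟨V, hV, hVD⟩ := h1 (g t₀) (hgU _ ⟨lt_of_le_of_ne hts.1.1 (Ne.symm hne.1),
        lt_of_le_of_ne hts.1.2 hne.2⟩)
      obtain ⟨m, h3, h4⟩ := ((hgt.eventually hV).and (hθ.tendsto_atTop.eventually hVD)).exists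
      exact Set.disjoint_left.1 h4 h3 (htD _)
    have hs₀ : s₀ = 0 ∨ s₀ = 1 := by
      by_contra hne
      push Not at hne
      exact haU (hsa ▸ hgU _ ⟨lt_of_le_of_ne hts.2.1 (Ne.symm hne.1),
        lt_of_le_of_ne hts.2.2 hne.2⟩)
    have hbet : s₀ ∈ uIcc t₀ (1/2) := by
      have hl : Tendsto (fun m => t (θ m) ⊓ 1/2) atTop (𝓝 (t₀ ⊓ 1/2)) := hlt.min tendsto_const_nhds
      have hu : Tendsto (fun m => t (θ m) ⊔ 1/2) atTop (𝓝 (t₀ ⊔ 1/2)) := hlt.max tendsto_const_nhds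
      exact ⟨le_of_tendsto_of_tendsto' hl hls fun m => (hsm _).1,
        le_of_tendsto_of_tendsto' hls hu fun m => (hsm _).2⟩
    have hst : s₀ = t₀ := by
      rcases ht₀ with rfl | rfl <;> rcases hs₀ with rfl | rfl <;> first | rfl | skip
      · rw [uIcc_of_le (by norm_num)] at hbet; norm_num at hbet
      · rw [uIcc_of_ge (by norm_num)] at hbet; norm_num at hbet
    refine hab (mem_closure_of_tendsto (hsa ▸ hst ▸ hgt) (Eventually.of_forall fun m => htb _))
  intro n
  rcases key n with h | h
  · exact h
  rcases key (n + 1) with ⟨m, h'⟩ | h'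
  · exact ⟨m, h'.trans (hC.2.1 _ _ n.le_succ)⟩
  · exact ((eq_empty_iff_forall_notMem.1 (hC.2.2 n (n + 1) (by omega))) a ⟨h, h'⟩).elim

end Chains

namespace PrimeEnd

variable {S : Type*} [TopologicalSpace S] {U : Set S}

lemma chainDivides_of_mk_eq {C C' : PrimeChain U}
    (h : (Quot.mk _ C : PrimeEnd U) = Quot.mk _ C') : ChainDivides C.1 C'.1 := by
  have h' := Quot.eqvGen_exact h
  suffices hs : ChainDivides C.1 C'.1 ∧ ChainDivides C'.1 C.1 from hs.1
  clear h
  have htr : ∀ {A B E : PrimeChain U}, ChainDivides A.1 B.1 → ChainDivides B.1 E.1 →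
      ChainDivides A.1 E.1 := by
    intro A B E h1 h2 n
    obtain ⟨m, hm⟩ := h2 n
    obtain ⟨k, hk⟩ := h1 m
    exact ⟨k, hk.trans hm⟩
  induction h' with
  | rel x y h => exact h
  | refl x => exact ⟨fun n => ⟨n, Subset.rfl⟩, fun n => ⟨n, Subset.rfl⟩⟩
  | symm x y _ ih => exact ⟨ih.2, ih.1⟩
  | trans x y z _ _ ih1 ih2 => grind

/-- Convergence to a prime end represented by a given chain. -/
lemma tendsto_peEnd {ι : Type*} {l : Filter ι} {x : ι → U} (D : PrimeChain U)
    (hx : ∀ m, ∀ᶠ i in l, (x i : S) ∈ D.1 m) :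
    Tendsto (fun i => pePt U (x i)) l (𝓝 (peEnd U (Quot.mk _ D))) := by
  rw [TopologicalSpace.tendsto_nhds_generateFrom_iff]
  rintro s (⟨V, -, -, rfl⟩ | ⟨E, hE, rfl⟩) hs
  · obtain ⟨y, hy, -⟩ := hs
    exact absurd hy (by simp [peEnd, pePt])
  · rcases hs with ⟨y, hy, -⟩ | ⟨p, hp, C, hC, N, hN⟩
    · exact absurd hy (by simp [peEnd, pePt])
    · have hp' : (Quot.mk _ D : PrimeEnd U) = p := Sum.inr_injective hp
      obtain ⟨m, hm⟩ := chainDivides_of_mk_eq (hp'.trans hC.symm) N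
      filter_upwards [hx m] with i hi
      exact Or.inl ⟨x i, rfl, hN N le_rfl (hm hi)⟩

end PrimeEnd

namespace IsDiscModel

variable {S : Type*} [MetricSpace S] {U : Set S} {φ : ℂ → S}

lemma exists_next_crosscut (h : IsDiscModel U φ) {ζ : ℂ} (hζ : ‖ζ‖ = 1) {ε : ℝ} (hε : 0 < ε)
    {A : Set S} (hA : A.Finite) (hAU : Disjoint A U) : ∃ r a b, 0 < r ∧ r < ε ∧ r < 1 ∧
      Tendsto (fun t => φ (crossCirc ζ r (1 * t))) (𝓝[<] (openAngle r)) (𝓝 a) ∧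
      Tendsto (fun t => φ (crossCirc ζ r (-1 * t))) (𝓝[<] (openAngle r)) (𝓝 b) ∧
      a ∉ A ∧ b ∉ A ∧ ∀ x ∈ discArc φ ζ r, ∀ y ∈ discArc φ ζ r, dist x y < ε := by
  obtain ⟨δ, hδ, -, hd⟩ := h.exists_crosscut hε
  have hav : ∀ᵐ r ∂MeasureTheory.volume.restrict (Ioo (0:ℝ) 1), ∀ p ∈ A,
      ¬Tendsto (fun t => φ (crossCirc ζ r (1 * t))) (𝓝[<] openAngle r) (𝓝 p) ∧
      ¬Tendsto (fun t => φ (crossCirc ζ r (-1 * t))) (𝓝[<] openAngle r) (𝓝 p) := by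
    refine (MeasureTheory.ae_ball_iff hA.countable).2 fun p hp => ?_
    have hpU := Set.disjoint_left.1 hAU hp
    exact (h.ae_not_land hζ hpU (Or.inl rfl)).and (h.ae_not_land hζ hpU (Or.inr rfl))
  obtain ⟨r, hr, hrε, hr1, ⟨⟨⟨b, hb⟩, a, ha⟩, hav⟩, hdiam⟩ := hd ζ hζ _ ((h.land ζ hζ).and hav)
  have hb' : Tendsto (fun t => φ (crossCirc ζ r (-1 * t))) (𝓝[<] (openAngle r)) (𝓝 b) := by
    have : Tendsto (fun t : ℝ => -1 * t) (𝓝[<] (openAngle r)) (𝓝[>] (-openAngle r)) := by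
      simpa using tendsto_neg_nhdsLT (a := openAngle r)
    exact hb.comp this
  have ha' : Tendsto (fun t => φ (crossCirc ζ r (1 * t))) (𝓝[<] (openAngle r)) (𝓝 a) := by
    simpa using ha
  refine ⟨r, a, b, hδ.trans hr, hrε, hr1, ha', hb', fun hh => (hav a hh).1 ha',
    fun hh => (hav b hh).2 hb', ?_⟩
  rintro _ ⟨z, hz, rfl⟩ _ ⟨w, hw, rfl⟩
  exact hdiam z hz.1 w hw.1 hz.2 hw.2

/-- Nested crosscuts about a boundary point, with disjoint closures and diameters tending to zero.-/
lemma exists_crosscut_seq (h : IsDiscModel U φ) {ζ : ℂ} (hζ : ‖ζ‖ = 1) :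
    ∃ r : ℕ → ℝ, StrictAnti r ∧ Tendsto r atTop (𝓝 0) ∧
      (∀ k, 0 < r k ∧ r k < 1 ∧ IsCrossSection U (discCap φ ζ (r k))) ∧
      (∀ i j, i < j → closure (bdIn U (discCap φ ζ (r i))) ∩
        closure (bdIn U (discCap φ ζ (r j))) = ∅) ∧
      ∀ ε > 0, ∀ᶠ k in atTop, ∀ x ∈ discArc φ ζ (r k), ∀ y ∈ discArc φ ζ (r k), dist x y < ε := by
  classical
  let σ := {s : ℝ × Set S // 0 < s.1 ∧ s.2.Finite ∧ Disjoint s.2 U}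
  have step : ∀ s : σ, ∃ s' : σ, ∃ a b, s'.1.1 < s.1.1 / 2 ∧ s'.1.1 < 1 ∧
      Tendsto (fun t => φ (crossCirc ζ s'.1.1 (1 * t))) (𝓝[<] (openAngle s'.1.1)) (𝓝 a) ∧
      Tendsto (fun t => φ (crossCirc ζ s'.1.1 (-1 * t))) (𝓝[<] (openAngle s'.1.1)) (𝓝 b) ∧
      a ∉ s.1.2 ∧ b ∉ s.1.2 ∧ s.1.2 ⊆ s'.1.2 ∧ a ∈ s'.1.2 ∧ b ∈ s'.1.2 ∧
      ∀ x ∈ discArc φ ζ s'.1.1, ∀ y ∈ discArc φ ζ s'.1.1, dist x y < s.1.1 / 2 := by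
    rintro ⟨⟨r, A⟩, hr, hA, hAU⟩
    obtain ⟨r', a, b, hr', hrε, hr1, ha, hb, haA, hbA, hd⟩ :=
      h.exists_next_crosscut hζ (half_pos hr) hA hAU
    obtain ⟨-, -, haU, hbU⟩ := h.isCrossSection_discCap hζ hr' hr1 ha hb
    refine ⟨⟨(r', insert a (insert b A)), hr', (hA.insert b).insert a, ?_⟩, a, b, hrε, hr1, ha, hb,
      haA, hbA, (subset_insert _ _).trans (subset_insert _ _), mem_insert _ _,
      mem_insert_of_mem _ (mem_insert _ _), hd⟩
    rw [disjoint_insert_left, disjoint_insert_left]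
    exact ⟨haU, hbU, hAU⟩
  choose nx a b hlt hlt1 ha hb haA hbA hsub ha' hb' hd using step
  let s : ℕ → σ := fun k => nx^[k + 1] ⟨(1, ∅), one_pos, finite_empty, empty_disjoint _⟩
  let s' : ℕ → σ := fun k => nx^[k] ⟨(1, ∅), one_pos, finite_empty, empty_disjoint _⟩
  have hs : ∀ k, s k = nx (s' k) := fun k => iterate_succ_apply' nx k _
  have hs2 : ∀ k, s' (k + 1) = s k := fun k => rfl
  have hpos := fun k => (s' k).2.1
  have hanti : ∀ k, (s' (k+1)).1.1 < (s' k).1.1 / 2 := fun k => by rw [hs2, hs]; exact hlt _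
  have hpow : ∀ k, (s' k).1.1 ≤ (1/2) ^ k := by
    intro k
    induction k with
    | zero => simp [s']
    | succ k ih => rw [pow_succ]; linarith [hanti k]
  have h0 :=
    squeeze_zero (fun k => (hpos k).le) hpow
      (tendsto_pow_atTop_nhds_zero_of_lt_one (by norm_num) (by norm_num))
  have hmono : ∀ i j, i ≤ j → (s' i).1.2 ⊆ (s' j).1.2 := by
    intro i j hij
    induction j, hij using Nat.le_induction with
    | base => exact Subset.rfl
    | succ j hij ih => grind
  have hsa : StrictAnti fun k => (s k).1.1 := strictAnti_nat_of_succ_lt fun k => by grind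
  have hcs : ∀ k, IsCrossSection U (discCap φ ζ (s k).1.1) ∧
      closure (bdIn U (discCap φ ζ (s k).1.1)) ⊆ discArc φ ζ (s k).1.1 ∪ {a (s' k), b (s' k)} ∧
      a (s' k) ∉ U ∧ b (s' k) ∉ U := by
    intro k
    rw [hs]
    exact h.isCrossSection_discCap hζ (nx (s' k)).2.1 (hlt1 _) (ha _) (hb _)
  refine ⟨fun k => (s k).1.1, hsa, (tendsto_add_atTop_iff_nat 1).2 h0, fun k => ⟨(s k).2.1, ?_,
    (hcs k).1⟩, ?_, ?_⟩
  · grind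
  · intro i j hij
    obtain ⟨-, hi, hai, hbi⟩ := hcs i
    obtain ⟨-, hj, haj, hbj⟩ := hcs j
    have hAi : ({a (s' i), b (s' i)} : Set S) ⊆ (s' j).1.2 := by
      refine Subset.trans ?_ (hmono (i+1) j hij)
      rw [hs2, hs]
      exact insert_subset (ha' _) (singleton_subset_iff.2 (hb' _))
    rw [eq_empty_iff_forall_notMem]
    rintro x ⟨hxi, hxj⟩
    rcases hi hxi with hxi | hxi <;> rcases hj hxj with hxj | hxj
    · obtain ⟨z, hz, rfl⟩ := hxi
      rw [discArc, h.apply_mem_image_iff hz.1] at hxj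
      have h1 := Metric.mem_sphere.1 hz.2
      have h2 := Metric.mem_sphere.1 hxj
      exact (hsa hij).ne (h2.symm.trans h1)
    · have := h.discArc_subset _ _ hxi
      rcases hxj with rfl | rfl
      exacts [haj this, hbj this]
    · have := h.discArc_subset _ _ hxj
      rcases hxi with rfl | rfl
      exacts [hai this, hbi this]
    · have := hAi hxi
      rcases hxj with rfl | rfl
      exacts [haA _ this, hbA _ this]
  · intro ε hε
    filter_upwards [h0.eventually (gt_mem_nhds hε)] with k hk x hx y hy
    grind

/-- The prime chain attached to a boundary point of the disc. -/
lemma exists_primeChain [CompactSpace S] [LocallyConnectedSpace S] (h : IsDiscModel U φ) {ζ : ℂ}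
    (hζ : ‖ζ‖ = 1) : ∃ r : ℕ → ℝ, (∀ k, 0 < r k) ∧ Tendsto r atTop (𝓝 0) ∧
      IsPEChain U (fun k => discCap φ ζ (r k)) ∧
      ∀ C, IsPEChain U C → (∀ m n, (discCap φ ζ (r m) ∩ C n).Nonempty) →
        ChainDivides (fun k => discCap φ ζ (r k)) C := by
  obtain ⟨r, hanti, h0, hr, hdisj, hdiam⟩ := h.exists_crosscut_seq hζ
  have hne : ∀ k, ∃ z, z ∈ 𝔻 ∩ Metric.sphere ζ (r k) := by
    intro k
    have h1 := (hr k).1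
    have h2 := (hr k).2.1
    refine ⟨(1 - r k : ℝ) * ζ, ?_, ?_⟩
    · rw [mem_ball_zero_iff, norm_mul, hζ, mul_one, norm_real, Real.norm_of_nonneg] <;>
        linarith
    · rw [Metric.mem_sphere, dist_eq_norm, show ((1 - r k : ℝ) : ℂ) * ζ - ζ =
        ((-(r k) : ℝ) : ℂ) * ζ by push_cast; ring, norm_mul, hζ, mul_one, norm_real,
        norm_neg, Real.norm_of_nonneg h1.le]
  choose z hz using hne
  obtain ⟨a, -, θ, hθ, hlim⟩ := isCompact_univ.tendsto_subseq (x := fun k => φ (z k))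
    fun _ => mem_univ _
  have hzζ : Tendsto (fun k => z (θ k)) atTop (𝓝 ζ) := by
    rw [tendsto_iff_dist_tendsto_zero]
    exact (h0.comp hθ.tendsto_atTop).congr fun k => (Metric.mem_sphere.1 (hz _).2).symm
  have haU := h.limit_notMem (Eventually.of_forall fun k => (hz (θ k)).1) hζ hzζ hlim
  have hchain : IsPEChain U (fun k => discCap φ ζ (r (θ k))) := by
    refine ⟨fun i => (hr _).2.2, fun i j hij => image_mono (inter_subset_inter_right _
      (ball_subset_ball (hanti.antitone (hθ.monotone hij)))), fun i j hij => ?_⟩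
    rcases lt_or_gt_of_ne hij with hlt | hlt
    · exact hdisj _ _ (hθ hlt)
    · rw [inter_comm]; exact hdisj _ _ (hθ hlt)
  refine ⟨fun k => r (θ k), fun k => (hr _).1, h0.comp hθ.tendsto_atTop, hchain,
    fun C hC hm => ?_⟩
  refine chainDivides_of_meets h.isOpen (a := a) (fun m => h.isOpen_discCap _ _)
    (fun m => h.isPreconnected_discCap _ _) (fun m => h.discCap_subset _ _) haU ?_ ?_ hC hm
  · intro x hx
    rw [← h.img] at hx
    obtain ⟨w, hw, rfl⟩ := hx
    have hwζ : 0 < dist w ζ := dist_pos.2 (by aesop)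
    refine ⟨φ '' (𝔻 ∩ (closedBall ζ (dist w ζ / 2))ᶜ),
      (h.isOpen_discCap_compl _ _).mem_nhds ⟨w, ⟨hw, ?_⟩, rfl⟩, ?_⟩
    · simp_all
    · filter_upwards [(h0.comp hθ.tendsto_atTop).eventually (gt_mem_nhds (half_pos hwζ))] with k hk
      rw [Set.disjoint_left]
      rintro _ ⟨y, hy, rfl⟩ hy2
      rw [discCap, h.apply_mem_image_iff hy.1] at hy2
      refine hy.2 (mem_closedBall.2 ((mem_ball.1 hy2).le.trans ?_))
      exact hk.le
  · intro V hV
    obtain ⟨ε, hε, hεV⟩ := Metric.mem_nhds_iff.1 hV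
    filter_upwards [hθ.tendsto_atTop.eventually (hdiam (ε/2) (half_pos hε)),
      (tendsto_iff_dist_tendsto_zero.1 hlim).eventually (gt_mem_nhds (half_pos hε))] with k h1 h2 x
        hx
    have h3 := h1 x (h.bdIn_discCap_subset _ _ hx) _ ⟨_, hz _, rfl⟩
    refine hεV (mem_ball.2 ?_)
    calc dist x a ≤ dist x (φ (z (θ k))) + dist (φ (z (θ k))) a := dist_triangle _ _ _
      _ < ε := by grind

/-- A boundary point of the disc fixed by the conjugated map gives a fixed prime end. -/
lemma exists_fixed_primeEnd [CompactSpace S] [LocallyConnectedSpace S] (h : IsDiscModel U φ)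
    {g : S → S} {k : ℂ → ℂ} (hgU : MapsTo g U U) (hk : ContinuousOn k (closedBall 0 1))
    (hkb : MapsTo k 𝔻 𝔻)
    (hkg : ∀ z ∈ 𝔻, φ (k z) = g (φ z)) {ζ : ℂ} (hζ : ‖ζ‖ = 1) (hfix : k ζ = ζ)
    {G : PrimeEndComp U → PrimeEndComp U} (hG : Continuous G)
    (hGg : ∀ x (hx : x ∈ U) (hgx : g x ∈ U), G (pePt U ⟨x, hx⟩) = pePt U ⟨g x, hgx⟩) :
    ∃ p, G (peEnd U p) = peEnd U p := by
  obtain ⟨r, hr, h0, hchain, hkey⟩ := h.exists_primeChain hζ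
  have hprime : IsPrimeChain U (fun k => discCap φ ζ (r k)) := by
    refine ⟨hchain, fun C hC hd => hkey C hC fun m n => ?_⟩
    obtain ⟨m', hm'⟩ := hd m
    obtain ⟨x, hx⟩ := (hC.1 (max m' n)).nonempty
    exact ⟨x, hm' (hC.2.1 _ _ (le_max_left _ _) hx), hC.2.1 _ _ (le_max_right _ _) hx⟩
  let D : PrimeChain U := ⟨_, hprime⟩
  let z : ℕ → ℂ := fun i => ((1 - 1 / ((i:ℝ) + 2) : ℝ) : ℂ) * ζ
  have hz : ∀ i, z i ∈ 𝔻 := by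
    intro i
    have h1 : 0 < 1 / ((i:ℝ) + 2) := by positivity
    have h2 : 1 / ((i:ℝ) + 2) < 1 := by
      rw [div_lt_one (by positivity)]; linarith [(Nat.cast_nonneg i : (0:ℝ) ≤ i)]
    rw [mem_ball_zero_iff, norm_mul, hζ, mul_one, norm_real, Real.norm_of_nonneg] <;>
      linarith
  have hzζ : Tendsto z atTop (𝓝 ζ) := by
    have h1 : Tendsto (fun i : ℕ => 1 / ((i:ℝ) + 2)) atTop (𝓝 0) := by
      have := (tendsto_one_div_add_atTop_nhds_zero_nat (𝕜 := ℝ)).comp (tendsto_add_atTop_nat 1)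
      refine this.congr fun i => ?_
      simp only [comp_apply]; push_cast; ring
    have h2 := ((Complex.continuous_ofReal.tendsto _).comp (h1.const_sub 1)).mul_const ζ
    refine (h2.congr fun i => ?_).trans (by simp)
    simp [z]
  have hkz : Tendsto (fun i => k (z i)) atTop (𝓝 ζ) := by
    have := (hk ζ (by simp [hζ])).tendsto.comp (tendsto_nhdsWithin_iff.2 ⟨hzζ,
      Eventually.of_forall fun i => ball_subset_closedBall (hz i)⟩)
    rwa [hfix] at this
  have hev : ∀ {y : ℕ → ℂ}, (∀ i, y i ∈ 𝔻) → Tendsto y atTop (𝓝 ζ) →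
      ∀ m, ∀ᶠ i in atTop, φ (y i) ∈ D.1 m := by
    intro y hy hyl m
    filter_upwards [hyl.eventually (ball_mem_nhds ζ (hr m))] with i hi
      using ⟨_, ⟨hy i, hi⟩, rfl⟩
  have h1 : Tendsto (fun i => pePt U ⟨φ (z i), h.mem (hz i)⟩) atTop (𝓝 (peEnd U (Quot.mk _ D))) :=
    PrimeEnd.tendsto_peEnd D (hev hz hzζ)
  have h2 := (hG.tendsto _).comp h1
  have hmem : ∀ m, ∀ᶠ i in atTop, g (φ (z i)) ∈ D.1 m := fun m => by
    filter_upwards [hev (fun i => hkb (hz i)) hkz m] with i hi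
    rwa [← hkg _ (hz i)]
  have h3 : Tendsto (fun i => pePt U ⟨g (φ (z i)), hgU (h.mem (hz i))⟩) atTop
      (𝓝 (G (peEnd U (Quot.mk _ D)))) := h2.congr fun i => hGg _ _ _
  refine ⟨Quot.mk _ D, ?_⟩
  generalize G (peEnd U (Quot.mk _ D)) = q at h3
  rw [TopologicalSpace.tendsto_nhds_generateFrom_iff] at h3
  rcases q with ⟨x, hx⟩ | p
  · exfalso
    have hx' := hx
    rw [← h.img] at hx'
    obtain ⟨w, hw, rfl⟩ := hx'
    have hwζ : 0 < dist w ζ := dist_pos.2 (by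
      rintro rfl; simp_all)
    obtain ⟨m, hm⟩ := (h0.eventually (gt_mem_nhds (half_pos hwζ))).exists
    have h4 := h3 (peOpen U (φ '' (𝔻 ∩ (closedBall ζ (dist w ζ / 2))ᶜ)))
      (Or.inl ⟨_, h.isOpen_discCap_compl _ _, by rintro _ ⟨y, hy, rfl⟩; exact h.mem hy.1, rfl⟩)
      ⟨_, rfl, w, ⟨hw, by rw [mem_compl_iff, mem_closedBall]; linarith⟩, rfl⟩
    obtain ⟨i, hi, y, hy1, hy2⟩ := ((hmem m).and h4).exists
    rw [← Sum.inl_injective hy1] at hy2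
    obtain ⟨u, hu, hux⟩ := hi
    simp only [← hux] at hy2
    rw [h.apply_mem_image_iff hu.1] at hy2
    exact hy2 (mem_closedBall.2 ((mem_ball.1 hu.2).le.trans hm.le))
  · obtain ⟨C, rfl⟩ := Quot.exists_rep p
    have hDC : ChainDivides D.1 C.1 := by
      refine hkey C.1 C.2.1 fun m n => ?_
      have h4 := h3 (peSection U (C.1 n)) (Or.inr ⟨_, C.2.1.1 n, rfl⟩)
        (Or.inr ⟨_, rfl, C, rfl, n, fun i hi => C.2.1.2.1 _ _ hi⟩)
      obtain ⟨i, hi, h5⟩ := ((hmem m).and h4).exists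
      rcases h5 with ⟨y, hy1, hy2⟩ | ⟨p, hp, -⟩
      · rw [← Sum.inl_injective hy1] at hy2
        exact ⟨_, hi, hy2⟩
      · exact absurd hp (by simp [peEnd, pePt])
    exact congrArg Sum.inr (Quot.sound ⟨C.2.2 _ hchain hDC, hDC⟩)

/-- If an extension to the prime ends compactification has no periodic prime end, the extension to
the closed disc has no periodic point on the circle. -/
lemma discExt_iterate_ne [CompactSpace S] [LocallyConnectedSpace S] (h : IsDiscModel U φ)
    (f : S ≃ₜ S) (hfU : f '' U = U) (F : PrimeEndComp U ≃ₜ PrimeEndComp U)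
    (hF : IsPEExtension f U F)
    (hper : ∀ (p : PrimeEnd U) (n : ℕ), 1 ≤ n → (⇑F)^[n] (peEnd U p) ≠ peEnd U p) {ζ : ℂ}
    (hζ : ‖ζ‖ = 1) {n : ℕ} (hn : 1 ≤ n) : (discExt φ f)^[n] ζ ≠ ζ := by
  intro hfix
  have hm : MapsTo f U U := fun x hx => hfU ▸ mem_image_of_mem f hx
  have hb : MapsTo (discExt φ f) 𝔻 𝔻 := fun z hz => by
    rw [h.discExt_eq f.continuous hm hz]; exact h.conj_mem hm hz
  have hcm := h.discExt_mapsTo f hfU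
  have hc : ∀ n, ContinuousOn (discExt φ f)^[n] (closedBall 0 1) := by
    intro n
    induction n with
    | zero => exact continuousOn_id
    | succ n ih => exact ih.comp (h.continuousOn_discExt f hfU) hcm
  have hbn := fun n => hb.iterate n
  have hconj : ∀ n, ∀ z ∈ 𝔻, φ ((discExt φ f)^[n] z) = (⇑f)^[n] (φ z) := by
    intro n
    induction n with
    | zero => intro z _; rfl
    | succ n ih =>
      intro z hz
      rw [iterate_succ_apply, ih _ (hb hz), iterate_succ_apply,
        h.discExt_eq f.continuous hm hz, h.apply_inv (hm (h.mem hz))]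
  have hext : ∀ n x (hx : x ∈ U) (hgx : (⇑f)^[n] x ∈ U),
      (⇑F)^[n] (pePt U ⟨x, hx⟩) = pePt U ⟨(⇑f)^[n] x, hgx⟩ := by
    intro n
    induction n with
    | zero => intro x hx _; rfl
    | succ n ih =>
      intro x hx hgx
      rw [iterate_succ_apply, hF x hx (hm hx)]
      exact ih (f x) (hm hx) hgx
  obtain ⟨p, hp⟩ := h.exists_fixed_primeEnd (hm.iterate n) (hc n) (hbn n) (hconj n) hζ hfix
    (F.continuous.iterate n) (hext n)
  exact hper p n hn hp

end IsDiscModel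

/-- Iterates of a nonwandering map are nonwandering. -/
lemma IsNonwanderingMap.iterate {X : Type*} [TopologicalSpace X] {f : X → X} (hf : Continuous f)
    (h : IsNonwanderingMap f) {n : ℕ} (hn : 1 ≤ n) : IsNonwanderingMap f^[n] := by
  intro V hV hVne
  let σ := {W : Set X // IsOpen W ∧ W.Nonempty}
  have step : ∀ W : σ, ∃ (W' : σ) (k : ℕ), 1 ≤ k ∧ W'.1 ⊆ W.1 ∧ MapsTo f^[k] W'.1 W.1 := by
    rintro ⟨W, hW, hWne⟩
    obtain ⟨k, hk, _, ⟨x, hx, rfl⟩, hx'⟩ := h W hW hWne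
    exact ⟨⟨W ∩ f^[k] ⁻¹' W, hW.inter (hW.preimage (hf.iterate k)), x, hx, hx'⟩, k, hk,
      inter_subset_left, fun y hy => hy.2⟩
  choose nx k hk hsub hmap using step
  let W : ℕ → σ := fun i => nx^[i] ⟨V, hV, hVne⟩
  have hW : ∀ i, W (i + 1) = nx (W i) := fun i => iterate_succ_apply' nx i _
  let s : ℕ → ℕ := fun i => ∑ l ∈ Finset.range i, k (W l)
  have hs : StrictMono s := strictMono_nat_of_lt_succ fun i => by
    simp only [s, Finset.sum_range_succ]; have := hk (W i); omega
  have hmaps : ∀ i j, i ≤ j → MapsTo f^[s j - s i] (W j).1 (W i).1 := by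
    intro i j hij
    induction j, hij using Nat.le_induction with
    | base => simp only [Nat.sub_self, Function.iterate_zero]; exact mapsTo_id _
    | succ j hij ih =>
      have h1 : s (j + 1) - s i = (s j - s i) + k (W j) := by
        have := hs.monotone hij
        simp only [s, Finset.sum_range_succ] at *; omega
      rw [h1, Function.iterate_add, hW]
      exact ih.comp (hmap _)
  have hV' : ∀ i, (W i).1 ⊆ V := by
    intro i
    induction i with
    | zero => exact Subset.rfl
    | succ i ih => grind
  obtain ⟨i, -, j, -, hij, hmod⟩ := Set.infinite_univ.exists_lt_map_eq_of_mapsTo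
    (f := fun i => s i % n) (t := Iio n) (fun i _ => Nat.mod_lt _ (by omega)) (finite_Iio n)
  have hlt := hs hij
  obtain ⟨m, hm⟩ := (Nat.modEq_iff_dvd' hlt.le).1 hmod
  obtain ⟨x, hx⟩ := (W j).2.2
  refine ⟨m, Nat.one_le_iff_ne_zero.2 ?_, (f^[n])^[m] x, ⟨x, hV' j hx, rfl⟩, ?_⟩
  · rintro rfl; simp at hm; omega
  · rw [← iterate_mul, ← hm]
    bound

/-- Brouwer's theorem for the disc, in the form of a fixed point in the open disc when there is none
on the circle. -/
lemma exists_fixed_in_ball {F : ℂ → ℂ} (hF : ContinuousOn F (closedBall 0 1))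
    (hm : MapsTo F (closedBall 0 1) (closedBall 0 1))
    (hne : ∀ ζ : ℂ, ‖ζ‖ = 1 → F ζ ≠ ζ) : ∃ z ∈ 𝔻, F z = z := by
  by_contra hcon
  push Not at hcon
  have h0 : ∀ z ∈ closedBall (0:ℂ) 1, z - F z ≠ 0 := by
    intro z hz
    rw [sub_ne_zero]
    rcases eq_or_lt_of_le (mem_closedBall_zero_iff.1 hz) with h | h
    · exact (hne z h).symm
    · exact (hcon z (mem_ball_zero_iff.2 h)).symm
  have hcl : ∀ t ∈ Icc (0:ℝ) 1, ∀ s : ℝ, (t:ℂ) * circ 1 s ∈ closedBall (0:ℂ) 1 := by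
    intro t ht s
    rw [mem_closedBall_zero_iff, norm_mul, norm_circ, norm_real, Real.norm_of_nonneg ht.1]
    simpa using ht.2
  have hmapsc : ∀ p ∈ Icc (0:ℝ) 1 ×ˢ Icc (0:ℝ) 1, ((p.1:ℂ) * circ 1 p.2) ∈
      closedBall (0:ℂ) 1 := fun p hp => hcl p.1 hp.1 p.2
  have hcirc : Continuous (circ 1) := continuous_circ.comp (by fun_prop : Continuous fun t : ℝ =>
      ((1:ℝ), t))
  have e1 := logVar_eq_of_homotopy (H := fun p : ℝ × ℝ => (p.1:ℂ) * circ 1 p.2 - F (p.1 * circ 1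
      p.2))
    (by
      have hc : Continuous fun p : ℝ × ℝ => (p.1:ℂ) * circ 1 p.2 := by fun_prop
      exact hc.continuousOn.sub (hF.comp hc.continuousOn hmapsc))
    (fun p hp => h0 _ (hmapsc p hp)) (fun s _ => by simp only [circ_zero_eq_one])
  have e2 := logVar_eq_of_homotopy (H := fun p : ℝ × ℝ => circ 1 p.2 - p.1 * F (circ 1 p.2))
    (by
      have hc : Continuous fun p : ℝ × ℝ => circ 1 p.2 := by fun_prop
      refine hc.continuousOn.sub (ContinuousOn.mul (by fun_prop) (hF.comp hc.continuousOn ?_))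
      intro p _; rw [mem_closedBall_zero_iff, norm_circ]; simp)
    (fun p hp => by
      have hn : ‖circ 1 p.2‖ = 1 := by rw [norm_circ]; simp
      have hF1 : ‖F (circ 1 p.2)‖ ≤ 1 := mem_closedBall_zero_iff.1 (hm (by simp [hn]))
      rcases eq_or_lt_of_le hp.1.2 with h | h
      · rw [h]; simpa using h0 _ (by simp [hn])
      · intro heq
        have h2 : ‖circ 1 p.2‖ = p.1 * ‖F (circ 1 p.2)‖ := by
          conv_lhs => rw [sub_eq_zero.1 heq, norm_mul, norm_real, Real.norm_of_nonneg hp.1.1]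
        rw [hn] at h2
        nlinarith [hp.1.1, norm_nonneg (F (circ 1 p.2))])
    (fun s _ => by simp only [circ_zero_eq_one])
  simp only [ofReal_zero, zero_mul, sub_zero, Complex.ofReal_one, one_mul, zero_sub] at e1 e2
  rw [logVar_const, ← e2] at e1
  have := logVar_circ (r := 1) one_pos
  rw [← e1] at this
  have hp := two_pi_I_ne_zero
  exact hp this.symm

/-- The variation of the logarithm of `u` along the boundary of the unit square. -/
def edgeVar (u : ℝ × ℝ → ℂ) : ℂ :=
  logVar (fun t => u (t, 0)) + logVar (fun t => u (1, t)) - logVar (fun t => u (t, 1)) -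
    logVar (fun t => u (0, t))

lemma edgeVar_eq_zero {u : ℝ × ℝ → ℂ} (hu : ContinuousOn u (Icc 0 1 ×ˢ Icc 0 1))
    (h0 : ∀ p ∈ Icc (0:ℝ) 1 ×ˢ Icc (0:ℝ) 1, u p ≠ 0) : edgeVar u = 0 := by
  obtain ⟨l, hl, hle⟩ := exists_log_of_convex ((convex_Icc (0:ℝ) 1).prod (convex_Icc (0:ℝ) 1)) hu h0
  have hz : (0:ℝ) ∈ Icc (0:ℝ) 1 := by simp
  have ho : (1:ℝ) ∈ Icc (0:ℝ) 1 := by simp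
  have h1 := fun c hc =>
    IsLogOn.logVar_eq (l := fun t => l (t, c)) ⟨hl.comp (by fun_prop) fun t ht => ⟨ht, hc⟩,
      fun t ht => hle _ ⟨ht, hc⟩⟩
  have h2 := fun c hc =>
    IsLogOn.logVar_eq (l := fun t => l (c, t)) ⟨hl.comp (by fun_prop) fun t ht => ⟨hc, ht⟩,
      fun t ht => hle _ ⟨hc, ht⟩⟩
  rw [edgeVar, h1 0 hz, h1 1 ho, h2 0 hz, h2 1 ho]
  ring

lemma edgeVar_homotopy {H : ℝ → ℝ × ℝ → ℂ}
    (hH : ContinuousOn (fun q : ℝ × ℝ × ℝ => H q.1 q.2) (Icc 0 1 ×ˢ Icc 0 1 ×ˢ Icc 0 1))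
    (h0 : ∀ s ∈ Icc (0:ℝ) 1, ∀ t ∈ Icc (0:ℝ) 1, H s (t, 0) ≠ 0 ∧ H s (1, t) ≠ 0 ∧ H s (t, 1) ≠ 0 ∧
      H s (0, t) ≠ 0) : edgeVar (H 0) = edgeVar (H 1) := by
  have hz : (0:ℝ) ∈ Icc (0:ℝ) 1 := by simp
  have ho : (1:ℝ) ∈ Icc (0:ℝ) 1 := by simp
  have e1 := edgeVar_eq_zero (u := fun p => H p.2 (p.1, 0))
    (hH.comp (f := fun p : ℝ × ℝ => (p.2, p.1, (0:ℝ))) (by fun_prop)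
      fun p hp => ⟨hp.2, hp.1, hz⟩) fun p hp => (h0 _ hp.2 _ hp.1).1
  have e2 := edgeVar_eq_zero (u := fun p => H p.2 (1, p.1))
    (hH.comp (f := fun p : ℝ × ℝ => (p.2, (1:ℝ), p.1)) (by fun_prop)
      fun p hp => ⟨hp.2, ho, hp.1⟩) fun p hp => (h0 _ hp.2 _ hp.1).2.1
  have e3 := edgeVar_eq_zero (u := fun p => H p.2 (p.1, 1))
    (hH.comp (f := fun p : ℝ × ℝ => (p.2, p.1, (1:ℝ))) (by fun_prop)
      fun p hp => ⟨hp.2, hp.1, ho⟩) fun p hp => (h0 _ hp.2 _ hp.1).2.2.1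
  have e4 := edgeVar_eq_zero (u := fun p => H p.2 (0, p.1))
    (hH.comp (f := fun p : ℝ × ℝ => (p.2, (0:ℝ), p.1)) (by fun_prop)
      fun p hp => ⟨hp.2, hz, hp.1⟩) fun p hp => (h0 _ hp.2 _ hp.1).2.2.2
  simp only [edgeVar] at *
  grind

lemma logVar_of_slitPlane {u : ℝ → ℂ} (hu : ContinuousOn u (Icc 0 1))
    (h : ∀ t ∈ Icc (0:ℝ) 1, u t ∈ slitPlane) :
    logVar u = log (u 1) - log (u 0) :=
  IsLogOn.logVar_eq (l := fun t => log (u t))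
    ⟨hu.clog h, fun t ht => exp_log (Complex.slitPlane_ne_zero (h t ht))⟩

lemma logVar_of_neg_slitPlane {u : ℝ → ℂ} (hu : ContinuousOn u (Icc 0 1))
    (h : ∀ t ∈ Icc (0:ℝ) 1, -u t ∈ slitPlane) :
    logVar u = log (-u 1) - log (-u 0) := by
  rw [IsLogOn.logVar_eq (l := fun t => log (-u t) + π * I)
    ⟨(hu.neg.clog h).add continuousOn_const, fun t ht => ?_⟩]
  · ring
  · rw [exp_add, exp_log (Complex.slitPlane_ne_zero (h t ht)), exp_pi_mul_I]
    ring

lemma mem_slitPlane_of_re_nonneg {z : ℂ} (h : 0 ≤ z.re) (h0 : z ≠ 0) : z ∈ slitPlane := by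
  rw [Complex.mem_slitPlane_iff]
  by_contra hcon
  push Not at hcon
  exact h0 (Complex.ext (le_antisymm hcon.1 h) hcon.2)

lemma edgeVar_sub {γ₁ γ₂ : ℝ → ℂ} (h₁ : Continuous γ₁) (h₂ : Continuous γ₂)
    (hr₁ : ∀ t, (γ₂ 0).re ≤ (γ₁ t).re ∧ (γ₁ t).re ≤ (γ₂ 1).re)
    (hr₂ : ∀ t, (γ₁ 0).re ≤ (γ₂ t).re ∧ (γ₂ t).re ≤ (γ₁ 1).re)
    (hn : ∀ t ∈ Icc (0:ℝ) 1, γ₁ t ≠ γ₂ 0 ∧ γ₁ 1 ≠ γ₂ t ∧ γ₁ t ≠ γ₂ 1 ∧ γ₁ 0 ≠ γ₂ t) :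
    edgeVar (fun p => γ₁ p.1 - γ₂ p.2) =
      (log (γ₁ 1 - γ₂ 1) - log (-(γ₁ 1 - γ₂ 1))) -
      (log (γ₁ 0 - γ₂ 0) - log (-(γ₁ 0 - γ₂ 0))) := by
  simp only [edgeVar]
  rw [logVar_of_slitPlane (u := fun t => γ₁ t - γ₂ 0) (by fun_prop) fun t ht =>
      mem_slitPlane_of_re_nonneg (by simpa using (hr₁ t).1) (sub_ne_zero.2 (hn t ht).1),
    logVar_of_slitPlane (u := fun t => γ₁ 1 - γ₂ t) (by fun_prop) fun t ht =>
      mem_slitPlane_of_re_nonneg (by simpa using (hr₂ t).2) (sub_ne_zero.2 (hn t ht).2.1),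
    logVar_of_neg_slitPlane (u := fun t => γ₁ t - γ₂ 1) (by fun_prop) fun t ht =>
      mem_slitPlane_of_re_nonneg (by simpa using (hr₁ t).2)
        (neg_ne_zero.2 (sub_ne_zero.2 (hn t ht).2.2.1)),
    logVar_of_neg_slitPlane (u := fun t => γ₁ 0 - γ₂ t) (by fun_prop) fun t ht =>
      mem_slitPlane_of_re_nonneg (by simpa using (hr₂ t).1)
        (neg_ne_zero.2 (sub_ne_zero.2 (hn t ht).2.2.2))]
  ring

lemma log_sub_log_neg_of_im_pos {z : ℂ} (h : 0 < z.im) :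
    log z - log (-z) = π * I := by
  rw [log, log, norm_neg, Complex.arg_neg_eq_arg_sub_pi_of_im_pos h]
  push_cast; ring

lemma log_sub_log_neg_of_im_neg {z : ℂ} (h : z.im < 0) :
    log z - log (-z) = -(π * I) := by
  rw [log, log, norm_neg, Complex.arg_neg_eq_arg_add_pi_of_im_neg h]
  push_cast; ring

lemma exp_add_two_pi_I (w : ℂ) : exp (w + 2 * π * I) = exp w :=
  exp_periodic w

/-- The lift of an injective map `z ↦ z * exp (κ z)` of the disc to the left half plane. -/
def logLift (κ : ℂ → ℂ) (w : ℂ) : ℂ := w + κ (exp w)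

lemma logLift_add (κ : ℂ → ℂ) (w : ℂ) :
    logLift κ (w + 2 * π * I) = logLift κ w + 2 * π * I := by
  rw [logLift, logLift, exp_add_two_pi_I]; ring

lemma exp_mem_ball {w : ℂ} (h : w.re < 0) : exp w ∈ 𝔻 := by
  rw [mem_ball_zero_iff, norm_exp]
  simpa using h

lemma edgeVar_logLift {κ : ℂ → ℂ} (hκ : ContinuousOn κ 𝔻)
    (hinj : InjOn (logLift κ) {w | w.re < 0}) {a b : ℝ → ℂ} (ha : Continuous a) (hb : Continuous b)
    (har : ∀ t, (a t).re < 0) (hbr : ∀ t, (b t).re < 0)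
    (hn : ∀ t ∈ Icc (0:ℝ) 1, a t ≠ b 0 + 2 * π * I ∧
      a 1 ≠ b t + 2 * π * I ∧ a t ≠ b 1 + 2 * π * I ∧
      a 0 ≠ b t + 2 * π * I) :
    edgeVar (fun p => logLift κ (a p.1) - (logLift κ (b p.2) + 2 * π * I)) =
      edgeVar (fun p => a p.1 - (b p.2 + 2 * π * I)) := by
  let H : ℝ → ℝ × ℝ → ℂ := fun s p => a p.1 - (b p.2 + 2 * π * I) +
    (κ (s * exp (a p.1)) - κ (s * exp (b p.2)))
  have hmem : ∀ s ∈ Icc (0:ℝ) 1, ∀ w : ℂ, w.re < 0 → s * exp w ∈ 𝔻 := by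
    intro s hs w hw
    rw [mem_ball_zero_iff, norm_mul, norm_real, Real.norm_of_nonneg hs.1]
    have := mem_ball_zero_iff.1 (exp_mem_ball hw)
    nlinarith [hs.2, norm_nonneg (exp w)]
  have key : ∀ s ∈ Icc (0:ℝ) 1, ∀ p : ℝ × ℝ, a p.1 ≠ b p.2 + 2 * π * I →
      H s p ≠ 0 := by
    intro s hs p hp hH
    rcases eq_or_lt_of_le hs.1 with h | h
    · rw [← h] at hH
      simp only [H, ofReal_zero, zero_mul, sub_self, add_zero, sub_eq_zero] at hH
      exact hp hH
    · have hls := Real.log_nonpos hs.1 hs.2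
      have he : ∀ w : ℂ, exp (w + Real.log s) = s * exp w := by
        intro w
        rw [exp_add, ← Complex.ofReal_exp, Real.exp_log h, mul_comm]
      have h1 : logLift κ (a p.1 + Real.log s) =
          logLift κ (b p.2 + Real.log s + 2 * π * I) := by
        rw [logLift_add, logLift, logLift, he, he]
        simp only [H] at hH
        linear_combination hH
      have h2 := hinj (show (a p.1 + Real.log s).re < 0 by
        rw [add_re, ofReal_re]; linarith [har p.1])
        (show (b p.2 + Real.log s + 2 * π * I).re < 0 by
          simp; linarith [hbr p.2]) h1
      grind
  have := edgeVar_homotopy (H := H) (by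
    refine ContinuousOn.add (by fun_prop) (ContinuousOn.sub (hκ.comp (by fun_prop) ?_)
      (hκ.comp (by fun_prop) ?_))
    · rintro ⟨s, p⟩ ⟨hs, -⟩; exact hmem s hs _ (har _)
    · rintro ⟨s, p⟩ ⟨hs, -⟩; exact hmem s hs _ (hbr _))
    (fun s hs t ht => ⟨key s hs _ (hn t ht).1, key s hs _ (hn t ht).2.1, key s hs _ (hn t ht).2.2.1,
      key s hs _ (hn t ht).2.2.2⟩)
  have h0 : H 0 = fun p => a p.1 - (b p.2 + 2 * π * I) := by
    funext p; simp [H]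
  have h1 : H 1 = fun p => logLift κ (a p.1) - (logLift κ (b p.2) + 2 * π * I) := by
    funext p; simp only [H, Complex.ofReal_one, one_mul, logLift]; ring
  grind

/-- The curves from `w₀` allowed in `abs_im_sub_le`. -/
def accessSet (κ : ℂ → ℂ) (P : Set ℂ) (w₀ : ℂ) : Set ℂ :=
  {w | w.re < 0 ∧ (w₀.re < w.re ∨ w = w₀) ∧ logLift κ w + 2 * π * I ∉ P ∧
    logLift κ w - 2 * π * I ∉ P}

lemma JoinedIn.exists_continuous {X : Type*} [TopologicalSpace X] {A : Set X} {x y : X}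
    (h : JoinedIn A x y) : ∃ γ : ℝ → X, Continuous γ ∧ γ 0 = x ∧ γ 1 = y ∧ ∀ t, γ t ∈ A :=
  ⟨h.somePath.extend, h.somePath.continuous_extend, by simp, by simp, fun t => by
    simp [Path.extend, Set.IccExtend]⟩

lemma abs_im_sub_le {κ : ℂ → ℂ} (hκ : ContinuousOn κ 𝔻)
    (hinj : InjOn (logLift κ) {w | w.re < 0}) {P : Set ℂ} (hP : ∀ x ∈ P, ∀ y ∈ P, JoinedIn P x y)
    (hPT : ∀ z ∈ P, z + 2 * π * I ∉ P) {w₀ x y : ℂ} {δ : ℝ}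
    (hx : x.re = -δ) (hy : y.re = -δ) (hxP : logLift κ x ∈ P) (hyP : logLift κ y ∈ P)
    (hwx : JoinedIn (accessSet κ P w₀ ∩ {w | w.re ≤ -δ}) w₀ x)
    (hwy : JoinedIn (accessSet κ P w₀ ∩ {w | w.re ≤ -δ}) w₀ y) :
    |x.im - y.im| ≤ 2 * π := by
  suffices H : ∀ {x y : ℂ}, x.re = -δ → y.re = -δ → logLift κ x ∈ P → logLift κ y ∈ P →
      JoinedIn (accessSet κ P w₀ ∩ {w | w.re ≤ -δ}) w₀ x →
      JoinedIn (accessSet κ P w₀ ∩ {w | w.re ≤ -δ}) w₀ y → x.im - y.im ≤ 2 * π by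
    rw [abs_le]
    grind
  clear! x y
  intro x y hx hy hxP hyP hwx hwy
  by_contra hlt
  rw [not_le] at hlt
  obtain ⟨a, hac, ha0, ha1, ha⟩ := hwx.exists_continuous
  obtain ⟨b, hbc, hb0, hb1, hb⟩ := hwy.exists_continuous
  obtain ⟨p, hpc, hp0, hp1, hp⟩ := (hP _ hxP _ hyP).exists_continuous
  have hpi := Real.pi_pos
  have hT0 := two_pi_I_ne_zero
  have hTre : (2 * π * I : ℂ).re = 0 := by simp
  have hTim : (2 * π * I : ℂ).im = 2 * π := by simp
  have hW : ∀ {c d : ℝ → ℂ}, Continuous c → Continuous d → c 0 = w₀ → d 0 = w₀ →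
      (c 1).re = -δ → (d 1).re = -δ → logLift κ (c 1) ∈ P → logLift κ (d 1) ∈ P →
      (∀ t, c t ∈ accessSet κ P w₀ ∩ {w | w.re ≤ -δ}) →
      (∀ t, d t ∈ accessSet κ P w₀ ∩ {w | w.re ≤ -δ}) →
      edgeVar (fun q => logLift κ (c q.1) - (logLift κ (d q.2) + 2 * π * I)) =
      (log (c 1 - (d 1 + 2 * π * I)) -
        log (-(c 1 - (d 1 + 2 * π * I)))) -
      (log (w₀ - (w₀ + 2 * π * I)) -
        log (-(w₀ - (w₀ + 2 * π * I)))) := by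
    intro c d hc hd hc0 hd0 hc1 hd1 hcP hdP hcm hdm
    have hge : ∀ {w}, w ∈ accessSet κ P w₀ ∩ {w | w.re ≤ -δ} → w₀.re ≤ w.re := by
      rintro w ⟨⟨-, h | rfl, -⟩, -⟩
      exacts [h.le, le_rfl]
    have hb0 : ∀ {w}, w ∈ accessSet κ P w₀ ∩ {w | w.re ≤ -δ} →
        w ≠ w₀ + 2 * π * I ∧ w₀ ≠ w + 2 * π * I := by
      rintro w ⟨⟨-, h | rfl, -⟩, -⟩
      · constructor <;> intro he <;> have := congrArg Complex.re he <;> aesop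
      · simp
    have hn : ∀ t ∈ Icc (0:ℝ) 1, c t ≠ d 0 + 2 * π * I ∧
        c 1 ≠ d t + 2 * π * I ∧ c t ≠ d 1 + 2 * π * I ∧
        c 0 ≠ d t + 2 * π * I := by
      intro t _
      refine ⟨hd0 ▸ (hb0 (hcm t)).1, fun he => ?_, fun he => ?_, hc0 ▸ (hb0 (hdm t)).2⟩
      · rw [he, logLift_add] at hcP
        exact (hdm t).1.2.2.1 hcP
      · have := (hcm t).1.2.2.2
        rw [he, logLift_add, add_sub_cancel_right] at this
        exact this hdP
    rw [edgeVar_logLift hκ hinj hc hd (fun t => (hcm t).1.1) (fun t => (hdm t).1.1) hn]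
    have := edgeVar_sub (γ₁ := c) (γ₂ := fun t => d t + 2 * π * I) hc (by fun_prop)
      (fun t => by simp_all)
      (fun t => by simp_all) hn
    rw [this, hc0, hd0]
  have w1 := hW hac hac ha0 ha0 (ha1 ▸ hx) (ha1 ▸ hx) (ha1 ▸ hxP) (ha1 ▸ hxP) ha ha
  have w2 := hW hac hbc ha0 hb0 (ha1 ▸ hx) (hb1 ▸ hy) (ha1 ▸ hxP) (hb1 ▸ hyP) ha hb
  have w3 := hW hbc hac hb0 ha0 (hb1 ▸ hy) (ha1 ▸ hx) (hb1 ▸ hyP) (ha1 ▸ hxP) hb ha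
  have w4 := hW hbc hbc hb0 hb0 (hb1 ▸ hy) (hb1 ▸ hy) (hb1 ▸ hyP) (hb1 ▸ hyP) hb hb
  rw [ha1] at w1 w2 w3
  rw [hb1] at w2 w3 w4
  have hlog : ∀ {z : ℂ}, z.im < 0 → log z - log (-z) = -(π * I) :=
    fun h => log_sub_log_neg_of_im_neg h
  rw [hlog (z := x - (x + 2 * π * I))
    (by rw [sub_im, Complex.add_im, hTim]; linarith)] at w1
  rw [log_sub_log_neg_of_im_pos (z := x - (y + 2 * π * I))
    (by rw [sub_im, Complex.add_im, hTim]; linarith)] at w2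
  rw [hlog (z := y - (x + 2 * π * I))
    (by rw [sub_im, Complex.add_im, hTim]; linarith)] at w3
  rw [hlog (z := y - (y + 2 * π * I))
    (by rw [sub_im, Complex.add_im, hTim]; linarith)] at w4
  have hL : ContinuousOn (logLift κ) {w | w.re < 0} :=
    continuousOn_id.add (hκ.comp (by fun_prop) fun w hw => exp_mem_ball hw)
  have hAc : Continuous fun t => logLift κ (a t) :=
    hL.comp_continuous hac fun t => (ha t).1.1
  have hBc : Continuous fun t => logLift κ (b t) :=
    hL.comp_continuous hbc fun t => (hb t).1.1
  have za := edgeVar_eq_zero (u := fun q => logLift κ (a q.1) - (p q.2 + 2 * π * I))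
    ((hAc.comp continuous_fst).sub ((hpc.comp continuous_snd).add continuous_const)).continuousOn
      fun q _ he => (ha q.1).1.2.2.2 (by grind)
  have zb := edgeVar_eq_zero (u := fun q => logLift κ (b q.1) - (p q.2 + 2 * π * I))
    ((hBc.comp continuous_fst).sub ((hpc.comp continuous_snd).add continuous_const)).continuousOn
      fun q _ he => (hb q.1).1.2.2.2 (by grind)
  have zc := edgeVar_eq_zero (u := fun q => p q.1 - (logLift κ (a q.2) + 2 * π * I))
    ((hpc.comp continuous_fst).sub ((hAc.comp continuous_snd).add continuous_const)).continuousOn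
      fun q _ he => (ha q.2).1.2.2.1 (by grind)
  have zd := edgeVar_eq_zero (u := fun q => p q.1 - (logLift κ (b q.2) + 2 * π * I))
    ((hpc.comp continuous_fst).sub ((hBc.comp continuous_snd).add continuous_const)).continuousOn
      fun q _ he => (hb q.2).1.2.2.1 (by grind)
  have ze := edgeVar_eq_zero (u := fun q => p q.1 - (p q.2 + 2 * π * I))
    (by fun_prop) fun q _ he => hPT _ (hp q.2) (by grind)
  simp only [edgeVar, ha0, hb0, ha1, hb1, hp0, hp1] at w1 w2 w3 w4 za zb zc zd ze
  grind

/-- A conformal parametrization of a plane domain `V` by the unit disc, for which paths landing at a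
point outside `V` lift to landing paths. -/
structure IsPlaneModel (V : Set ℂ) (φ : ℂ → ℂ) : Prop where
  cont : ContinuousOn φ 𝔻
  diff : DifferentiableAt ℂ φ 0
  deriv_ne : deriv φ 0 ≠ 0
  inj : InjOn φ 𝔻
  img : φ '' 𝔻 = V
  open_map : ∀ W : Set ℂ, IsOpen W → W ⊆ 𝔻 → IsOpen (φ '' W)
  zero : φ 0 = 0
  land : ∀ (p : ℝ → ℂ) (b : ℝ) (a : ℂ), a ∉ V →
    (∀ᶠ t in 𝓝[<] b, ContinuousAt p t ∧ p t ∈ 𝔻) →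
    Tendsto (fun t => φ (p t)) (𝓝[<] b) (𝓝 a) → ∃ ξ : ℂ, ‖ξ‖ = 1 ∧ Tendsto p (𝓝[<] b) (𝓝 ξ)

/-- `k` is the extension to the closed disc of the conjugate of `g` by `φ`, with inverse `k'`. -/
structure IsConjPair (φ : ℂ → ℂ) (g : ℂ ≃ₜ ℂ) (k k' : ℂ → ℂ) : Prop where
  cont : ContinuousOn k (closedBall 0 1)
  cont' : ContinuousOn k' (closedBall 0 1)
  maps : MapsTo k (closedBall 0 1) (closedBall 0 1)
  maps' : MapsTo k' (closedBall 0 1) (closedBall 0 1)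
  ball : MapsTo k 𝔻 𝔻
  ball' : MapsTo k' 𝔻 𝔻
  left : ∀ z ∈ closedBall (0:ℂ) 1, k' (k z) = z
  right : ∀ z ∈ closedBall (0:ℂ) 1, k (k' z) = z
  conj : ∀ z ∈ 𝔻, φ (k z) = g (φ z)

lemma joinedIn_of_continuousOn {X : Type*} [TopologicalSpace X] {A : Set X} {a b : ℝ} {γ : ℝ → X}
    (hab : a ≤ b) (hγ : ContinuousOn γ (Icc a b)) (h : ∀ t ∈ Icc a b, γ t ∈ A) :
    JoinedIn A (γ a) (γ b) := by
  have h1 :=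
    ((convex_Icc a b).isPathConnected (nonempty_Icc.2 hab)).image' hγ
  exact (h1.joinedIn _ ⟨a, left_mem_Icc.2 hab, rfl⟩ _ ⟨b, right_mem_Icc.2 hab, rfl⟩).mono
    (image_subset_iff.2 h)

/-- A path reaching a closed set has a first point in it. -/
lemma exists_first_mem {X : Type*} [TopologicalSpace X] {F : Set X} (hF : IsClosed F) {a b : ℝ}
    {γ : ℝ → X} (hab : a ≤ b) (hγ : ContinuousOn γ (Icc a b)) (ha : γ a ∉ F) (hb : γ b ∈ F) :
    ∃ T ∈ Ioc a b, γ T ∈ F ∧ ∀ t ∈ Ico a T, γ t ∉ F := by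
  have hc :=
    isCompact_Icc.of_isClosed_subset (hγ.preimage_isClosed_of_isClosed isClosed_Icc hF)
      inter_subset_left
  obtain ⟨T, ⟨hT, hTF⟩, hmin⟩ := hc.exists_isLeast ⟨b, right_mem_Icc.2 hab, hb⟩
  refine ⟨T, ⟨lt_of_le_of_ne hT.1 ?_, hT.2⟩, hTF, fun t ht htF => ?_⟩
  · rintro rfl; exact ha hTF
  · exact (hmin ⟨⟨ht.1, ht.2.le.trans hT.2⟩, htF⟩).not_gt ht.2

/-- A path leaving a closed set has a last point in it. -/
lemma exists_last_mem {X : Type*} [TopologicalSpace X] {F : Set X} (hF : IsClosed F) {a b : ℝ}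
    {γ : ℝ → X} (hab : a ≤ b) (hγ : ContinuousOn γ (Icc a b)) (ha : γ a ∈ F) (hb : γ b ∉ F) :
    ∃ T ∈ Ico a b, γ T ∈ F ∧ ∀ t ∈ Ioc T b, γ t ∉ F := by
  have hc :=
    isCompact_Icc.of_isClosed_subset (hγ.preimage_isClosed_of_isClosed isClosed_Icc hF)
      inter_subset_left
  obtain ⟨T, ⟨hT, hTF⟩, hmax⟩ := hc.exists_isGreatest ⟨a, left_mem_Icc.2 hab, ha⟩
  refine ⟨T, ⟨hT.1, lt_of_le_of_ne hT.2 ?_⟩, hTF, fun t ht htF => ?_⟩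
  · rintro rfl; exact hb hTF
  · exact (hmax ⟨⟨hT.1.trans ht.1.le, ht.2⟩, htF⟩).not_gt ht.1

lemma JoinedIn.exists_isCompact {X : Type*} [TopologicalSpace X] {A : Set X} {x y : X}
    (h : JoinedIn A x y) : ∃ C ⊆ A, IsCompact C ∧ JoinedIn C x y :=
  ⟨range h.somePath, range_subset_iff.2 h.somePath_mem, isCompact_range h.somePath.continuous,
    h.somePath, fun t => mem_range_self t⟩

lemma abs_sub_le_of_tendsto {κ : ℂ → ℂ} (hκ : ContinuousOn κ 𝔻)
    (hinj : InjOn (logLift κ) {w | w.re < 0}) {P : Set ℂ} (hP : ∀ x ∈ P, ∀ y ∈ P, JoinedIn P x y)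
    (hPT : ∀ z ∈ P, z + 2 * π * I ∉ P) {w₀ : ℂ}
    (hPw : ∀ w : ℂ, w.re < 0 → logLift κ w ∈ P → w₀.re < w.re)
    {e e' : ℝ → ℂ} {θ θ' : ℝ} (he : ContinuousOn e (Ico 0 1)) (he' : ContinuousOn e' (Ico 0 1))
    (heP : ∀ t ∈ Ico (0:ℝ) 1, (e t).re < 0 ∧ logLift κ (e t) ∈ P)
    (heP' : ∀ t ∈ Ico (0:ℝ) 1, (e' t).re < 0 ∧ logLift κ (e' t) ∈ P)
    (hθ : Tendsto e (𝓝[<] 1) (𝓝 (θ * I))) (hθ' : Tendsto e' (𝓝[<] 1) (𝓝 (θ' * I)))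
    (hv : JoinedIn (accessSet κ P w₀) w₀ (e 0)) (hv' : JoinedIn (accessSet κ P w₀) w₀ (e' 0)) :
    |θ - θ'| ≤ 2 * π := by
  refine le_of_forall_pos_le_add fun ε hε => ?_
  -- truncation of one of the two curves
  have key : ∀ {e : ℝ → ℂ} {θ : ℝ}, ContinuousOn e (Ico 0 1) →
      (∀ t ∈ Ico (0:ℝ) 1, (e t).re < 0 ∧ logLift κ (e t) ∈ P) →
      Tendsto e (𝓝[<] 1) (𝓝 (θ * I)) → JoinedIn (accessSet κ P w₀) w₀ (e 0) →
      ∃ δ₀ > 0, ∀ δ > 0, δ < δ₀ → ∃ x : ℂ, x.re = -δ ∧ logLift κ x ∈ P ∧ |x.im - θ| < ε / 2 ∧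
        JoinedIn (accessSet κ P w₀ ∩ {w | w.re ≤ -δ}) w₀ x := by
    clear! e e' θ θ'
    intro e θ he heP hθ hv
    obtain ⟨C, hCA, hC, hCj⟩ := hv.exists_isCompact
    have hev : ∀ᶠ t in 𝓝[<] (1:ℝ), ‖e t - θ * I‖ < ε / 2 := by
      have := hθ.sub_const (θ * I)
      rw [sub_self] at this
      simpa using this.norm.eventually (gt_mem_nhds (by simpa using half_pos hε))
    obtain ⟨b, hb1, hb⟩ := (mem_nhdsLT_iff_exists_Ioo_subset).1 hev
    obtain ⟨η, hη, hη1⟩ : ∃ η ∈ Ico (0:ℝ) 1, ∀ t ∈ Ioo η 1, ‖e t - θ * I‖ < ε / 2 :=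
      ⟨max b 0, ⟨le_max_right _ _, max_lt hb1 one_pos⟩, fun t ht =>
        hb ⟨(le_max_left _ _).trans_lt ht.1, ht.2⟩⟩
    have hK := hC.union (isCompact_Icc.image_of_continuousOn
      (he.mono fun t ht => ⟨ht.1, ht.2.trans_lt hη.2⟩))
    obtain ⟨m, hm, hmax⟩ := hK.exists_isMaxOn ⟨w₀, Or.inl hCj.source_mem⟩
      continuous_re.continuousOn
    have hm0 : m.re < 0 := by
      rcases hm with hm | ⟨t, ht, rfl⟩
      · exact (hCA hm).1
      · grind
    refine ⟨-m.re, by linarith, fun δ hδ hδ₀ => ?_⟩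
    have hlt : ∀ w ∈ C ∪ e '' Icc 0 η, w.re < -δ := fun w hw => by
      have : w.re ≤ m.re := hmax hw
      linarith
    have hre : ∀ᶠ t in 𝓝[<] (1:ℝ), -δ < (e t).re := by
      have := (continuous_re.tendsto _).comp hθ
      simp only [Complex.mul_re, ofReal_re, Complex.I_re, mul_zero, Complex.ofReal_im,
        Complex.I_im, mul_one, sub_self] at this
      exact this.eventually (lt_mem_nhds (by linarith))
    obtain ⟨b, hb1, hb2⟩ := (hre.and (Ioo_mem_nhdsLT (show (0:ℝ) < 1 by simp))).exists
    have hcb : ContinuousOn e (Icc 0 b) := he.mono fun t ht => ⟨ht.1, ht.2.trans_lt hb2.2⟩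
    obtain ⟨T, hT, hTe, hTlt⟩ := exists_first_mem (F := {w : ℂ | -δ ≤ w.re})
      (isClosed_le continuous_const continuous_re) hb2.1.le hcb
      (by simpa using hlt _ (Or.inr ⟨0, ⟨le_rfl, hη.1⟩, rfl⟩)) hb1.le
    have hT1 : T < 1 := hT.2.trans_lt hb2.2
    have hcT : ContinuousOn e (Icc 0 T) := he.mono fun t ht => ⟨ht.1, ht.2.trans_lt hT1⟩
    have hle : ∀ t ∈ Icc 0 T, (e t).re ≤ -δ := by
      have h1 : closure (Ico 0 T) = Icc 0 T := closure_Ico hT.1.ne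
      intro t ht
      rw [← h1] at ht
      refine closure_minimal (s := Ico 0 T) (t := Icc 0 T ∩ {t | (e t).re ≤ -δ})
        (fun t ht => ⟨⟨ht.1, ht.2.le⟩, ?_⟩) ?_ ht |>.2
      · have := hTlt t ht
        simp only [mem_ofPred_eq, not_le] at this
        exact this.le
      · exact (continuous_re.comp_continuousOn hcT).preimage_isClosed_of_isClosed isClosed_Icc
          isClosed_Iic
    have hTη : η < T := by
      by_contra hcon
      have := hlt (e T) (Or.inr (mem_image_of_mem e (show T ∈ Icc 0 η from ⟨hT.1.le, not_lt.1
          hcon⟩)))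
      exact absurd hTe (not_le.2 this)
    refine ⟨e T, le_antisymm (hle T ⟨hT.1.le, le_rfl⟩) hTe, (heP T ⟨hT.1.le, hT1⟩).2, ?_, ?_⟩
    · refine lt_of_le_of_lt ?_ (hη1 T ⟨hTη, hT1⟩)
      have := Complex.abs_im_le_norm (e T - θ * I)
      simpa using this
    · have hCj' : JoinedIn (accessSet κ P w₀ ∩ {w | w.re ≤ -δ}) w₀ (e 0) :=
        hCj.mono fun w hw => ⟨hCA hw, (hlt w (Or.inl hw)).le⟩
      refine hCj'.trans
        (joinedIn_of_continuousOn hT.1.le hcT fun t ht => ⟨?_, hle t ht⟩)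
      obtain ⟨h1, h2⟩ := heP t ⟨ht.1, ht.2.trans_lt hT1⟩
      refine ⟨h1, Or.inl (hPw _ h1 h2), hPT _ h2, fun h3 => hPT _ h3 ?_⟩
      rwa [sub_add_cancel]
  obtain ⟨δ₁, h1, H1⟩ := key he heP hθ hv
  obtain ⟨δ₂, h2, H2⟩ := key he' heP' hθ' hv'
  have hm := lt_min h1 h2
  obtain ⟨x, hx, hxP, hxθ, hxj⟩ := H1 (min δ₁ δ₂ / 2) (by linarith)
    (by linarith [min_le_left δ₁ δ₂])
  obtain ⟨y, hy, hyP, hyθ, hyj⟩ := H2 (min δ₁ δ₂ / 2) (by linarith)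
    (by linarith [min_le_right δ₁ δ₂])
  have := abs_im_sub_le hκ hinj hP hPT hx hy hxP hyP hxj hyj
  rw [abs_lt] at hxθ hyθ
  rw [abs_le] at this ⊢
  constructor <;> linarith

namespace IsPlaneModel

variable {V : Set ℂ} {φ : ℂ → ℂ}

lemma mem (h : IsPlaneModel V φ) {z : ℂ} (hz : z ∈ 𝔻) : φ z ∈ V :=
  h.img ▸ mem_image_of_mem φ hz

lemma isOpen (h : IsPlaneModel V φ) : IsOpen V :=
  h.img ▸ h.open_map _ isOpen_ball subset_rfl

lemma exists_inv (h : IsPlaneModel V φ) : ∃ ψ : ℂ → ℂ, ContinuousOn ψ V ∧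
    (∀ x ∈ V, ψ x ∈ 𝔻 ∧ φ (ψ x) = x) ∧ ∀ z ∈ 𝔻, ψ (φ z) = z := by
  have h1 : ∀ x ∈ V, invFunOn φ 𝔻 x ∈ 𝔻 ∧
      φ (invFunOn φ 𝔻 x) = x := fun x hx =>
    ⟨invFunOn_mem (h.img.symm ▸ hx : x ∈ φ '' 𝔻),
      invFunOn_eq (h.img.symm ▸ hx : x ∈ φ '' 𝔻)⟩
  have h2 := h.inj.leftInvOn_invFunOn
  refine ⟨_, ?_, h1, h2⟩
  rw [continuousOn_open_iff h.isOpen]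
  intro W hW
  convert h.open_map (W ∩ 𝔻) (hW.inter isOpen_ball) inter_subset_right using 1
  ext x
  constructor
  · grind
  · rintro ⟨z, ⟨hzW, hz⟩, rfl⟩
    exact ⟨h.mem hz, by rw [mem_preimage, h2 hz]; exact hzW⟩

lemma apply_ne_zero (h : IsPlaneModel V φ) {z : ℂ} (hz : z ∈ 𝔻) (h0 : z ≠ 0) :
    φ z ≠ 0 := fun hφ => h0 (h.inj hz (mem_ball_self one_pos) (hφ.trans h.zero.symm))

lemma exists_logLift (h : IsPlaneModel V φ) : ∃ κ : ℂ → ℂ, ContinuousOn κ 𝔻 ∧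
    InjOn (logLift κ) {w | w.re < 0} ∧
    ∀ w : ℂ, w.re < 0 → exp (logLift κ w) = φ (exp w) := by
  have h0 : ∀ z ∈ 𝔻, dslope φ 0 z ≠ 0 := by
    intro z hz
    by_cases hz0 : z = 0
    · rw [hz0, dslope_same]; exact h.deriv_ne
    · rw [dslope_of_ne _ hz0, slope_def_field, h.zero, sub_zero]
      exact div_ne_zero (h.apply_ne_zero hz hz0) (by simpa using hz0)
  obtain ⟨κ, hκ, hκe⟩ := exists_log_of_convex (convex_ball (0:ℂ) 1)
    ((continuousOn_dslope (ball_mem_nhds 0 one_pos)).2 ⟨h.cont, h.diff⟩) h0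
  have hexp : ∀ w : ℂ, w.re < 0 → exp (logLift κ w) = φ (exp w) := by
    intro w hw
    rw [logLift, exp_add, hκe _ (exp_mem_ball hw), dslope_of_ne _ (exp_ne_zero w),
      slope_def_field, h.zero, sub_zero, sub_zero, mul_div_cancel₀ _ (exp_ne_zero w)]
  refine ⟨κ, hκ, fun w hw w' hw' he => ?_, hexp⟩
  have h1 := congrArg exp he
  rw [hexp w hw, hexp w' hw'] at h1
  have h2 := h.inj (exp_mem_ball hw) (exp_mem_ball hw') h1
  simpa [logLift, h2] using he

/-- Lifts of landing paths land on the imaginary axis. -/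
lemma exists_lift_landing (h : IsPlaneModel V φ) {a : ℂ} (ha : a ∉ V) {e : ℝ → ℂ}
    (he : ContinuousOn e (Ico 0 1)) (hre : ∀ t ∈ Ico (0:ℝ) 1, (e t).re < 0)
    (hlim : Tendsto (fun t => φ (exp (e t))) (𝓝[<] 1) (𝓝 a)) :
    ∃ θ : ℝ, Tendsto e (𝓝[<] 1) (𝓝 (θ * I)) := by
  have hev : ∀ᶠ t in 𝓝[<] (1:ℝ), t ∈ Ioo (0:ℝ) 1 := Ioo_mem_nhdsLT one_pos
  obtain ⟨ξ, hξ, hlim'⟩ := h.land (fun t => exp (e t)) 1 a ha (by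
    filter_upwards [hev] with t ht
    exact ⟨((he.continuousAt (Ico_mem_nhds ht.1 ht.2))).cexp, exp_mem_ball (hre t ⟨ht.1.le, ht.2⟩)⟩)
    hlim
  have hξ0 : ξ ≠ 0 := by rw [← norm_pos_iff, hξ]; exact one_pos
  have h1 : Tendsto (fun t => exp (e t) / ξ) (𝓝[<] 1) (𝓝 1) := by
    simpa [hξ0] using hlim'.div_const ξ
  have h2 : ∀ᶠ t in 𝓝[<] (1:ℝ), exp (e t) / ξ ∈ slitPlane :=
    h1.eventually (Complex.isOpen_slitPlane.mem_nhds Complex.one_mem_slitPlane)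
  obtain ⟨b, hb1, hb⟩ := mem_nhdsLT_iff_exists_Ioo_subset.1 (hev.and h2)
  obtain ⟨s, hs⟩ := exists_between (show b < 1 from hb1)
  have hconst : ∀ t ∈ Ioo b 1, e t - log (exp (e t) / ξ) =
      e s - log (exp (e s) / ξ) := by
    intro t ht
    have hce : ContinuousOn e (Ioo b 1) := he.mono fun t ht => ⟨(hb ht).1.1.le, ht.2⟩
    have := sub_eq_sub_of_exp_eq (f := e) (g := fun t => log (exp (e t) / ξ) +
      log ξ) isPreconnected_Ioo hce
      (((hce.cexp.div_const ξ).clog fun t ht => (hb ht).2).add continuousOn_const)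
      (fun t ht => by
        rw [exp_add, exp_log (Complex.slitPlane_ne_zero (hb ht).2),
          exp_log hξ0, div_mul_cancel₀ _ hξ0]) ht hs
    linear_combination this
  have h3 : Tendsto e (𝓝[<] 1) (𝓝 (e s - log (exp (e s) / ξ))) := by
    have h4 : Tendsto (fun t => log (exp (e t) / ξ) +
        (e s - log (exp (e s) / ξ))) (𝓝[<] 1)
        (𝓝 (e s - log (exp (e s) / ξ))) := by
      have := (h1.clog Complex.one_mem_slitPlane).add_const
        (e s - log (exp (e s) / ξ))
      simpa using this
    refine h4.congr' ?_
    filter_upwards [Ioo_mem_nhdsLT hb1] with t ht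
    rw [← hconst t ht]; ring
  set L := e s - log (exp (e s) / ξ)
  have h5 := tendsto_nhds_unique ((Complex.continuous_exp.tendsto L).comp h3) hlim'
  have h6 : L.re = 0 := by
    rw [← Real.exp_eq_one_iff, ← norm_exp, h5, hξ]
  refine ⟨L.im, ?_⟩
  convert h3 using 2
  apply Complex.ext <;> simp [h6]

/-- From each point of a disc centred outside `V`, the straight path towards the centre lands. -/
lemma exists_segment_lift (h : IsPlaneModel V φ) {κ : ℂ → ℂ} (hκ : ContinuousOn κ 𝔻)
    (hexp : ∀ w : ℂ, w.re < 0 → exp (logLift κ w) = φ (exp w))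
    {a : ℂ} (ha : a ∉ V) {ρ : ℝ} {l : ℂ → ℂ} (hl : ContinuousOn l (closedBall a ρ))
    (hle : ∀ z ∈ closedBall a ρ, exp (l z) = z) {w : ℂ} (hw : w.re < 0)
    (hwX : logLift κ w ∈ l '' closedBall a ρ) :
    ∃ (e : ℝ → ℂ) (θ : ℝ), ContinuousOn e (Ico 0 1) ∧ e 0 = w ∧
      (∀ t ∈ Ico (0:ℝ) 1, (e t).re < 0 ∧ logLift κ (e t) ∈ l '' closedBall a ρ) ∧
      Tendsto e (𝓝[<] 1) (𝓝 (θ * I)) := by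
  obtain ⟨x, hx, hxl⟩ := hwX
  have hxφ : φ (exp w) = x := by rw [← hexp w hw, ← hxl, hle x hx]
  have hxV := hxφ ▸ h.mem (exp_mem_ball hw)
  obtain ⟨ψ, hψ, hψ1, hψ2⟩ := h.exists_inv
  have h0V := h.zero ▸ h.mem (mem_ball_self one_pos)
  obtain ⟨T, hT, hTV, hTlt⟩ := exists_first_mem (F := Vᶜ) h.isOpen.isClosed_compl zero_le_one
    (γ := fun t : ℝ => x + t * (a - x)) (by fun_prop) (by simpa using hxV) (by simpa using ha)
  let σ : ℝ → ℂ := fun t => x + ((T * t : ℝ) : ℂ) * (a - x)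
  have hσc : Continuous σ := by fun_prop
  have hσV : ∀ t ∈ Ico (0:ℝ) 1, σ t ∈ V := fun t ht => by
    have := hTlt (T * t) ⟨mul_nonneg hT.1.le ht.1, by nlinarith [ht.2, hT.1]⟩
    exact not_not.1 this
  have hσX : ∀ t ∈ Ico (0:ℝ) 1, σ t ∈ closedBall a ρ := fun t ht => by
    refine (convex_closedBall a ρ).add_smul_sub_mem hx (mem_closedBall_self ?_)
      (t := T * t) ⟨mul_nonneg hT.1.le ht.1, mul_le_one₀ hT.2 ht.1 ht.2.le⟩
    exact dist_nonneg.trans hx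
  have hne : ∀ t ∈ Ico (0:ℝ) 1, ψ (σ t) ≠ 0 := fun t ht h0 => by
    have h1 := hle _ (hσX t ht)
    rw [← (hψ1 _ (hσV t ht)).2, h0, h.zero] at h1
    exact exp_ne_zero _ h1
  have hψσ : ContinuousOn (fun t => ψ (σ t)) (Ico 0 1) := hψ.comp hσc.continuousOn hσV
  obtain ⟨e₀, he₀, he₀e⟩ := exists_log_of_convex (convex_Ico (0:ℝ) 1) hψσ hne
  have hz : (0:ℝ) ∈ Ico (0:ℝ) 1 := by simp
  let e : ℝ → ℂ := fun t => e₀ t - e₀ 0 + w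
  have he : ContinuousOn e (Ico 0 1) := (he₀.sub continuousOn_const).add continuousOn_const
  have hσ0 : σ 0 = x := by simp [σ]
  have hee : ∀ t ∈ Ico (0:ℝ) 1, exp (e t) = ψ (σ t) := by
    intro t ht
    rw [exp_add, exp_sub, he₀e t ht, he₀e 0 hz, hσ0, ← hxφ,
      hψ2 _ (exp_mem_ball hw), div_mul_cancel₀ _ (exp_ne_zero _)]
  have hre : ∀ t ∈ Ico (0:ℝ) 1, (e t).re < 0 := by
    intro t ht
    have := mem_ball_zero_iff.1 (hψ1 _ (hσV t ht)).1
    rw [← hee t ht, norm_exp] at this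
    simpa using this
  have hφe : ∀ t ∈ Ico (0:ℝ) 1, φ (exp (e t)) = σ t := fun t ht => by
    rw [hee t ht, (hψ1 _ (hσV t ht)).2]
  obtain ⟨θ, hθ⟩ := h.exists_lift_landing (a := σ 1) (by simpa [σ] using hTV) he hre (by
    refine (hσc.continuousWithinAt.tendsto (x := 1)).congr' ?_
    filter_upwards [Ioo_mem_nhdsLT (one_pos : (0:ℝ) < 1)] with t ht
    grind)
  refine ⟨e, θ, he, by simp [e], fun t ht => ⟨hre t ht, σ t, hσX t ht, ?_⟩, hθ⟩
  have hL : ContinuousOn (logLift κ) {w | w.re < 0} :=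
    continuousOn_id.add (hκ.comp (by fun_prop) fun w hw => exp_mem_ball hw)
  have := sub_eq_sub_of_exp_eq (f := fun t => l (σ t)) (g := fun t => logLift κ (e t))
    isPreconnected_Ico (hl.comp hσc.continuousOn hσX) (hL.comp he hre)
    (fun t ht => by grind) ht hz
  grind

lemma joinedIn_accessSet {κ : ℂ → ℂ}
    (hexp : ∀ w : ℂ, w.re < 0 → exp (logLift κ w) = φ (exp w))
    {P C : Set ℂ} (hC : ∀ z : ℂ, ‖z‖ ≤ 1 / 2 → φ z ∉ C)
    (hPC : ∀ z : ℂ, z ∈ 𝔻 → φ z ∈ exp '' P → φ z ∈ C)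
    (hPT : ∀ z ∈ P, z + 2 * π * I ∉ P) {w : ℂ} (hw : w.re < 0)
    (hwP : logLift κ w ∈ P) {γ : ℝ → ℂ} (hγ : ContinuousOn γ (Icc 0 1))
    (hγb : ∀ t ∈ Icc (0:ℝ) 1, γ t ∈ 𝔻) (h0 : γ 0 = 0) (h1 : γ 1 = exp w)
    (hγC : ∀ t ∈ Ico (0:ℝ) 1, φ (γ t) ∉ C) :
    JoinedIn (accessSet κ P (Real.log (1 / 4) : ℝ)) (Real.log (1 / 4) : ℝ) w := by
  have hlog : Real.log (1 / 4) < Real.log (1 / 2) := Real.log_lt_log (by norm_num) (by norm_num)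
  have hlog2 : Real.log (1 / 2) < 0 := Real.log_neg (by norm_num) (by norm_num)
  -- membership in the set away from `P`
  have hacc : ∀ w : ℂ, w.re < 0 → φ (exp w) ∉ C →
      logLift κ w + 2 * π * I ∉ P ∧ logLift κ w - 2 * π * I ∉ P := by
    intro w hw hwC
    have h2 : exp (logLift κ w - 2 * π * I) = φ (exp w) := by
      rw [← exp_add_two_pi_I, sub_add_cancel, hexp w hw]
    exact ⟨fun hP => hwC (hPC _ (exp_mem_ball hw)
      ⟨_, hP, by rw [exp_add_two_pi_I, hexp w hw]⟩), fun hP => hwC (hPC _ (exp_mem_ball hw)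
      ⟨_, hP, h2⟩)⟩
  have hwC := hPC _ (exp_mem_ball hw) ⟨_, hwP, hexp w hw⟩
  obtain ⟨T, hT, hTF, hTlt⟩ := exists_last_mem (F := closedBall (0:ℂ) (1 / 2))
    isClosed_closedBall zero_le_one hγ (by rw [h0]; simp) (fun hmem => hC _
      (mem_closedBall_zero_iff.1 hmem) (by rw [h1]; exact hwC))
  have hsub : Icc T 1 ⊆ Icc (0:ℝ) 1 := Icc_subset_Icc_left hT.1
  have hge : ∀ t ∈ Icc T 1, 1 / 2 ≤ ‖γ t‖ := by
    have hcl : closure (Ioc T 1) = Icc T 1 := closure_Ioc hT.2.ne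
    intro t ht
    rw [← hcl] at ht
    refine closure_minimal (s := Ioc T 1) (t := Icc T 1 ∩ {t | 1 / 2 ≤ ‖γ t‖})
      (fun t ht => ⟨⟨ht.1.le, ht.2⟩, ?_⟩) ?_ ht |>.2
    · have := hTlt t ht
      rw [mem_closedBall_zero_iff, not_le] at this
      exact this.le
    · exact ((hγ.mono hsub).norm).preimage_isClosed_of_isClosed isClosed_Icc isClosed_Ici
  have hnT : ‖γ T‖ = 1 / 2 := le_antisymm (mem_closedBall_zero_iff.1 hTF)
    (hge T ⟨le_rfl, hT.2.le⟩)
  obtain ⟨l₀, hl₀, hl₀e⟩ := exists_log_of_convex (convex_Icc T 1) (hγ.mono hsub)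
    (fun t ht h => by have := hge t ht; rw [h, norm_zero] at this; norm_num at this)
  have ho : (1:ℝ) ∈ Icc T 1 := ⟨hT.2.le, le_rfl⟩
  let l : ℝ → ℂ := fun t => l₀ t - l₀ 1 + w
  have hl : ContinuousOn l (Icc T 1) := (hl₀.sub continuousOn_const).add continuousOn_const
  have hle : ∀ t ∈ Icc T 1, exp (l t) = γ t := fun t ht => by
    rw [exp_add, exp_sub, hl₀e t ht, hl₀e 1 ho, ← h1, div_mul_cancel₀]
    rw [h1]; exact exp_ne_zero _
  have hl1 : l 1 = w := by simp [l]
  have hlre : ∀ t ∈ Icc T 1, (l t).re = Real.log ‖γ t‖ := fun t ht => by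
    rw [← hle t ht, norm_exp, Real.log_exp]
  have hlneg : ∀ t ∈ Icc T 1, (l t).re < 0 := fun t ht => by
    rw [hlre t ht]
    exact Real.log_neg (by linarith [hge t ht]) (mem_ball_zero_iff.1 (hγb t (hsub ht)))
  have hlT : (l T).re = Real.log (1 / 2) := by rw [hlre T ⟨le_rfl, hT.2.le⟩, hnT]
  refine JoinedIn.trans (y := l T) ?_ ?_
  · refine JoinedIn.of_segment_subset ?_
    rintro x ⟨s, t, hs, ht, hst, rfl⟩
    have hre : (s • ((Real.log (1 / 4) : ℝ) : ℂ) + t • l T).re =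
        s * Real.log (1 / 4) + t * Real.log (1 / 2) := by
      rw [add_re, Complex.real_smul, Complex.real_smul, Complex.re_ofReal_mul,
        Complex.re_ofReal_mul, ofReal_re, hlT]
    have hle2 : s * Real.log (1 / 4) + t * Real.log (1 / 2) ≤ Real.log (1 / 2) := by
      have : s = 1 - t := by linarith
      subst this; nlinarith
    refine ⟨by rw [hre]; linarith, ?_, hacc _ (by rw [hre]; linarith) (hC _ ?_)⟩
    · rcases eq_or_lt_of_le ht with h | h
      · right; subst h
        have : s = 1 := by linarith
        simp [this]
      · left
        rw [hre, ofReal_re]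
        have : s = 1 - t := by linarith
        subst this; nlinarith
    · rw [norm_exp, hre]
      calc _ ≤ Real.exp (Real.log (1 / 2)) := Real.exp_le_exp.2 hle2
        _ = 1 / 2 := Real.exp_log (by norm_num)
  · have := joinedIn_of_continuousOn (A := accessSet κ P (Real.log (1 / 4) : ℝ)) hT.2.le hl
      fun t ht => ⟨hlneg t ht, Or.inl ?_, ?_⟩
    · rwa [hl1] at this
    · rw [hlre t ht, ofReal_re]
      exact hlog.trans_le (Real.log_le_log (by norm_num) (hge t ht))
    · rcases eq_or_lt_of_le ht.2 with h | h
      · grind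
      grind

end IsPlaneModel

namespace IsConjPair

variable {V : Set ℂ} {φ : ℂ → ℂ} {g : ℂ ≃ₜ ℂ} {k k' : ℂ → ℂ}

lemma symm (h : IsConjPair φ g k k') : IsConjPair φ g.symm k' k where
  cont := h.cont'
  cont' := h.cont
  maps := h.maps'
  maps' := h.maps
  ball := h.ball'
  ball' := h.ball
  left := h.right
  right := h.left
  conj z hz := by
    rw [Homeomorph.eq_symm_apply, ← h.conj _ (h.ball' hz), h.right _ (ball_subset_closedBall hz)]

lemma iterate (h : IsConjPair φ g k k') (n : ℕ) :
    ∃ G : ℂ ≃ₜ ℂ, (∀ z, G z = g^[n] z) ∧ IsConjPair φ G k^[n] k'^[n] := by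
  induction n with
  | zero =>
    exact ⟨Homeomorph.refl ℂ, fun z => rfl, continuousOn_id, continuousOn_id, mapsTo_id _,
      mapsTo_id _,
      mapsTo_id _, mapsTo_id _, fun z _ => rfl, fun z _ => rfl, fun z _ => rfl⟩
  | succ n ih =>
    obtain ⟨G, hG, hi⟩ := ih
    refine ⟨G.trans g, fun z => ?_, ?_, ?_, ?_, ?_, ?_, ?_, ?_, ?_, ?_⟩
    · rw [iterate_succ_apply', Homeomorph.trans_apply, hG]
    · rw [iterate_succ']; exact h.cont.comp hi.cont hi.maps
    · rw [iterate_succ]; exact hi.cont'.comp h.cont' h.maps'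
    · rw [iterate_succ']; exact h.maps.comp hi.maps
    · rw [iterate_succ]; exact hi.maps'.comp h.maps'
    · rw [iterate_succ']; exact h.ball.comp hi.ball
    · rw [iterate_succ]; exact hi.ball'.comp h.ball'
    · intro z hz
      rw [iterate_succ_apply, iterate_succ_apply', h.left _ (hi.maps hz), hi.left z hz]
    · intro z hz
      rw [iterate_succ_apply', iterate_succ_apply, hi.right _ (h.maps' hz),
        h.right z hz]
    · intro z hz
      rw [iterate_succ_apply', h.conj _ (hi.ball hz), hi.conj z hz, Homeomorph.trans_apply]

lemma apply_zero (hm : IsPlaneModel V φ) (h : IsConjPair φ g k k') (h0 : g 0 = 0) : k 0 = 0 := by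
  have hb : (0:ℂ) ∈ 𝔻 := mem_ball_self one_pos
  exact hm.inj (h.ball hb) hb (by rw [h.conj 0 hb, hm.zero, h0])

lemma apply_ne_zero (hm : IsPlaneModel V φ) (h : IsConjPair φ g k k') (h0 : g 0 = 0) {z : ℂ}
    (hz : z ∈ closedBall (0:ℂ) 1) (hz0 : z ≠ 0) : k z ≠ 0 := fun hk => by
  have h1 := h.left 0 (mem_closedBall_self zero_le_one)
  rw [h.apply_zero hm h0] at h1
  exact hz0 (by rw [← h.left z hz, hk, h1])

lemma norm_eq_one (h : IsConjPair φ g k k') {z : ℂ} (hz : ‖z‖ = 1) : ‖k z‖ = 1 := by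
  have hz' := mem_closedBall_zero_iff.2 hz.le
  refine le_antisymm (mem_closedBall_zero_iff.1 (h.maps hz')) (not_lt.1 fun hlt => ?_)
  have := h.ball' (mem_ball_zero_iff.2 hlt)
  rw [h.left z hz', mem_ball_zero_iff, hz] at this
  exact lt_irrefl _ this

end IsConjPair

lemma exp_closedBall {w : ℂ} (hw : w.re ≤ 0) : exp w ∈ closedBall (0:ℂ) 1 := by
  rw [mem_closedBall_zero_iff, norm_exp]
  exact Real.exp_le_one_iff.2 hw

/-- A continuous real function avoiding all multiples of `p` oscillates by less than `p`. -/
lemma abs_sub_lt_of_forall_ne {α : ℝ → ℝ} (hα : Continuous α) {p : ℝ} (hp : 0 < p)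
    (hne : ∀ y, ∀ n : ℤ, α y ≠ n * p) (y y' : ℝ) : |α y - α y'| < p := by
  have key : ∀ y y', α y - α y' < p := by
    intro y y'
    by_contra hcon
    have h1 : α y' ≤ ⌈α y' / p⌉ * p := by
      rw [← div_le_iff₀ hp]; exact Int.le_ceil _
    have h2 : ⌈α y' / p⌉ * p ≤ α y := by
      have := (Int.ceil_lt_add_one (α y' / p)).le
      calc ⌈α y' / p⌉ * p ≤ (α y' / p + 1) * p := by gcongr
        _ = α y' + p := by field_simp
        _ ≤ α y := by linarith [not_lt.1 hcon]
    obtain ⟨x, hx⟩ := mem_range_of_exists_le_of_exists_ge hα ⟨y', h1⟩ ⟨y, h2⟩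
    exact hne x _ hx
  exact abs_lt.2 ⟨by linarith [key y' y], key y y'⟩

/-- A lift of a circle homeomorphism without fixed points moves points arbitrarily far under
iteration. -/
lemma exists_iterate_displacement {β : ℝ → ℝ} (hβ : Continuous β) {p : ℝ} (hp : 0 < p)
    (hper : ∀ y, ∃ n : ℤ, β (y + p) = β y + n * p) (hne : ∀ y, ∀ n : ℤ, β y - y ≠ n * p) (R : ℝ) :
    ∃ N : ℕ, ∀ y, R < |β^[N] y - y| := by
  let α : ℝ → ℝ := fun y => β y - y
  have hα : Continuous α := by fun_prop
  have hαp : Function.Periodic α p := by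
    intro y
    obtain ⟨n, hn⟩ := hper y
    have h1 := abs_sub_lt_of_forall_ne hα hp hne (y + p) y
    have h2 : α (y + p) - α y = (n - 1 : ℤ) * p := by
      simp only [α, hn]; push_cast; ring
    rw [h2, abs_mul, abs_of_pos hp] at h1
    have h3 : |((n - 1 : ℤ) : ℝ)| < 1 := by
      by_contra hcon
      nlinarith [not_lt.1 hcon]
    have h4 : n - 1 = 0 := by
      rw [← Int.abs_lt_one_iff]; exact_mod_cast h3
    rw [h4] at h2
    simp only [Int.cast_zero, zero_mul] at h2
    linarith
  obtain ⟨x, -, hx⟩ := (isCompact_Icc (a := (0:ℝ)) (b := p)).exists_isMinOn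
    ⟨0, left_mem_Icc.2 hp.le⟩ hα.abs.continuousOn
  have hc := abs_pos.2 (by simpa using hne x 0)
  have hmin : ∀ y, |α x| ≤ |α y| := fun y => by
    obtain ⟨z, hz, hzy⟩ := hαp.exists_mem_Ico₀ hp y
    rw [hzy]
    exact hx ⟨hz.1, hz.2.le⟩
  obtain ⟨N, hN⟩ := exists_nat_gt (R / |α x|)
  have hN' : R < N * |α x| := by rwa [div_lt_iff₀ hc] at hN
  refine ⟨N, fun y => hN'.trans_le ?_⟩
  have hsign : (∀ y, |α x| ≤ α y) ∨ ∀ y, α y ≤ -|α x| := by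
    by_contra! hcon
    obtain ⟨⟨y, hy⟩, z, hz⟩ := hcon
    have h1 : α y ≤ 0 := by
      rcases le_abs.1 (hmin y) with h | h <;> linarith
    have h2 : 0 ≤ α z := by
      rcases le_abs.1 (hmin z) with h | h <;> linarith
    obtain ⟨w, hw⟩ := mem_range_of_exists_le_of_exists_ge hα ⟨y, h1⟩ ⟨z, h2⟩
    have := hmin w
    rw [hw, abs_zero] at this
    linarith
  rcases hsign with h | h
  · refine le_trans ?_ (le_abs_self _)
    clear hN hN'
    induction N with
    | zero => simp
    | succ n ih =>
      rw [iterate_succ_apply']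
      have := h (β^[n] y)
      grind
  · refine le_trans ?_ (neg_le_abs _)
    clear hN hN'
    induction N with
    | zero => simp
    | succ n ih =>
      rw [iterate_succ_apply']
      have := h (β^[n] y)
      grind

/-- Compatible logarithmic lifts of a plane homeomorphism and of its conjugate on the disc, with
large displacement of an iterate on the boundary. -/
lemma IsConjPair.exists_lifts {V : Set ℂ} {φ : ℂ → ℂ} {g : ℂ ≃ₜ ℂ} {k k' : ℂ → ℂ}
    (h : IsConjPair φ g k k') (hm : IsPlaneModel V φ) (h0 : g 0 = 0)
    (hne : ∀ ζ : ℂ, ‖ζ‖ = 1 → k ζ ≠ ζ) {κ : ℂ → ℂ} (hκ : ContinuousOn κ 𝔻)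
    (hexp : ∀ w : ℂ, w.re < 0 → exp (logLift κ w) = φ (exp w))
    {c : ℂ} (hc : g (exp c) = exp c) (R : ℝ) :
    ∃ G F : ℂ → ℂ, ∃ N : ℕ, Continuous G ∧ (∀ w, exp (G w) = g (exp w)) ∧ G c = c ∧
      ContinuousOn F {w | w.re ≤ 0} ∧ (∀ w : ℂ, w.re < 0 → (F w).re < 0) ∧
      (∀ w : ℂ, w.re < 0 → logLift κ (F w) = G^[N] (logLift κ w)) ∧
      (∀ w : ℂ, w.re < 0 → exp (F w) = k^[N] (exp w)) ∧
      ∀ θ : ℝ, ∃ θ' : ℝ, F (θ * I) = θ' * I ∧ R < |θ' - θ| := by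
  obtain ⟨G₀, hG₀, hG₀e⟩ := exists_log_of_convex (convex_univ (𝕜 := ℝ) (E := ℂ))
    (u := fun w => g (exp w)) (g.continuous.comp Complex.continuous_exp).continuousOn
    (fun w _ hw => exp_ne_zero w (g.injective (hw.trans h0.symm)))
  let G : ℂ → ℂ := fun w => G₀ w - (G₀ c - c)
  have hGe : ∀ w, exp (G w) = g (exp w) := fun w => by
    simp only [G]
    rw [exp_sub, exp_sub, hG₀e w trivial, hG₀e c trivial, hc,
      div_self (exp_ne_zero c), div_one]
  have hG : Continuous G := (continuousOn_univ.1 hG₀).sub continuous_const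
  have hconv := convex_halfSpace_re_le 0
  obtain ⟨F₀, hF₀, hF₀e⟩ := exists_log_of_convex hconv (u := fun w => k (exp w))
    (h.cont.comp Complex.continuous_exp.continuousOn fun w hw => exp_closedBall hw)
    (fun w hw => h.apply_ne_zero hm h0 (exp_closedBall hw) (exp_ne_zero w))
  have hΦ : ContinuousOn (logLift κ) {w | w.re < 0} :=
    continuousOn_id.add (hκ.comp Complex.continuous_exp.continuousOn fun w hw => exp_mem_ball hw)
  have hre₀ : ∀ w : ℂ, w.re < 0 → (F₀ w).re < 0 := fun w hw => by
    have h1 := h.ball (exp_mem_ball hw)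
    rw [← hF₀e w hw.le, mem_ball_zero_iff, norm_exp] at h1
    exact Real.exp_lt_one_iff.1 h1
  have hp : (-1 : ℂ) ∈ {w : ℂ | w.re < 0} := by simp
  have hconj : ∀ w : ℂ, w.re < 0 →
      exp (logLift κ (F₀ w)) = exp (G (logLift κ w)) := fun w hw => by
    rw [hexp _ (hre₀ w hw), hF₀e w hw.le, h.conj _ (exp_mem_ball hw), hGe, hexp w hw]
  set d : ℂ := logLift κ (F₀ (-1)) - G (logLift κ (-1)) with hd
  have hde : exp d = 1 := by
    rw [hd, exp_sub, hconj _ hp, div_self (exp_ne_zero _)]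
  have hdw : ∀ w : ℂ, w.re < 0 → logLift κ (F₀ w) - G (logLift κ w) = d := fun w hw =>
    sub_eq_sub_of_exp_eq (convex_halfSpace_re_lt (0:ℝ)).isPreconnected
      (hΦ.comp (hF₀.mono fun w (hw : w.re < 0) => show w.re ≤ 0 from hw.le) fun w hw => hre₀ w hw)
      (hG.comp_continuousOn hΦ) (fun w hw => hconj w hw) hw hp
  let F : ℂ → ℂ := fun w => F₀ w - d
  have hFe : ∀ w : ℂ, w.re ≤ 0 → exp (F w) = k (exp w) := fun w hw => by
    simp only [F]
    rw [exp_sub, hde, div_one]; exact hF₀e w hw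
  have hF : ContinuousOn F {w | w.re ≤ 0} := hF₀.sub continuousOn_const
  have hFre : ∀ w : ℂ, w.re < 0 → (F w).re < 0 := fun w hw => by
    have h1 := h.ball (exp_mem_ball hw)
    rw [← hFe w hw.le, mem_ball_zero_iff, norm_exp] at h1
    exact Real.exp_lt_one_iff.1 h1
  have hFle : MapsTo F {w | w.re ≤ 0} {w | w.re ≤ 0} := fun w hw => by
    have h1 := h.maps (exp_closedBall hw)
    rw [← hFe w hw, mem_closedBall_zero_iff, norm_exp] at h1
    exact Real.exp_le_one_iff.1 h1
  have hFΦ : ∀ w : ℂ, w.re < 0 → logLift κ (F w) = G (logLift κ w) := fun w hw => by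
    have h1 : logLift κ (F w) = logLift κ (F₀ w) - d := by
      simp only [F, logLift]
      rw [exp_sub, hde, div_one]; ring
    grind
  have hI : ∀ θ : ℝ, F (θ * I) = (F (θ * I)).im * I := fun θ => by
    have h1 : ‖exp (F (θ * I))‖ = 1 := by
      rw [hFe _ (by simp)]
      exact h.norm_eq_one (norm_exp_ofReal_mul_I θ)
    rw [norm_exp, Real.exp_eq_one_iff] at h1
    apply Complex.ext <;> simp [h1]
  let β : ℝ → ℝ := fun θ => (F (θ * I)).im
  have hβ : Continuous β := by
    refine Complex.continuous_im.comp (hF.comp_continuous (by fun_prop) fun θ => ?_)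
    simp
  have hβe : ∀ θ : ℝ, exp (β θ * I) = k (exp (θ * I)) := fun θ => by
    simp only [β]
    rw [← hI, hFe _ (by simp)]
  obtain ⟨N, hN⟩ := exists_iterate_displacement hβ Real.two_pi_pos (fun y => by
    have h1 : exp (β (y + 2 * π) * I) = exp (β y * I) := by
      rw [hβe, hβe]
      congr 1
      push_cast
      rw [add_mul, exp_add_two_pi_I]
    obtain ⟨n, hn⟩ := Complex.exp_eq_exp_iff_exists_int.1 h1
    refine ⟨n, ?_⟩
    have := congrArg Complex.im hn
    simpa using this) (fun y n hn => by
    refine hne (exp (y * I)) (norm_exp_ofReal_mul_I y) ?_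
    rw [← hβe, Complex.exp_eq_exp_iff_exists_int]
    refine ⟨n, ?_⟩
    have : β y = y + n * (2 * π) := by linarith
    rw [this]; push_cast; ring) R
  refine ⟨G, F^[N], N, hG, hGe, by simp [G], ?_, ?_, ?_, ?_, ?_⟩
  · clear hN
    induction N with
    | zero => exact continuousOn_id
    | succ n ih =>
      rw [iterate_succ]
      exact ih.comp hF hFle
  · intro w hw
    exact (show MapsTo F {w | w.re < 0} {w | w.re < 0} from hFre).iterate N hw
  · clear hN
    induction N with
    | zero => intro w _; rfl
    | succ n ih => simp_all
  · clear hN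
    induction N with
    | zero => intro w _; rfl
    | succ n ih =>
      intro w hw
      rw [iterate_succ_apply, iterate_succ_apply, ih _ (hFre w hw), hFe w hw.le]
  · intro θ
    refine ⟨β^[N] θ, ?_, hN θ⟩
    clear hN
    induction N with
    | zero => rfl
    | succ n ih =>
      rw [iterate_succ_apply', iterate_succ_apply', ih, hI]

lemma IsConjPair.apply_mem_iff {V : Set ℂ} {φ : ℂ → ℂ} {h : ℂ ≃ₜ ℂ} {k k' : ℂ → ℂ}
    (hp : IsConjPair φ h k k') (hm : IsPlaneModel V φ) {x : ℂ} : h x ∈ V ↔ x ∈ V := by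
  constructor
  · intro hx
    obtain ⟨z, hz, hzx⟩ : h x ∈ φ '' 𝔻 := by rwa [hm.img]
    have := hp.symm.conj z hz
    rw [hzx, Homeomorph.symm_apply_apply] at this
    rw [← this]
    exact hm.mem (hp.ball' hz)
  · intro hx
    obtain ⟨z, hz, rfl⟩ : x ∈ φ '' 𝔻 := by rwa [hm.img]
    rw [← hp.conj z hz]
    exact hm.mem (hp.ball hz)

lemma exists_logLift_eq {φ : ℂ → ℂ} {κ : ℂ → ℂ}
    (hexp : ∀ w : ℂ, w.re < 0 → exp (logLift κ w) = φ (exp w)) {z p : ℂ}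
    (hz : z ∈ 𝔻) (hz0 : z ≠ 0) (hp : exp p = φ z) :
    ∃ w : ℂ, w.re < 0 ∧ exp w = z ∧ logLift κ w = p := by
  have hre : (log z).re < 0 := by
    rw [Complex.log_re]
    exact Real.log_neg (norm_pos_iff.2 hz0) (mem_ball_zero_iff.1 hz)
  have h1 : exp (p - logLift κ (log z)) = 1 := by
    rw [exp_sub, hp, hexp _ hre, exp_log hz0, div_self]
    rw [← hp]; exact exp_ne_zero p
  set d := p - logLift κ (log z) with hd
  have h2 : exp (log z + d) = z := by
    rw [exp_add, h1, mul_one, exp_log hz0]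
  refine ⟨log z + d, ?_, h2, ?_⟩
  · have : d.re = 0 := by rw [← Real.exp_eq_one_iff, ← norm_exp, h1, norm_one]
    simp_all
  · rw [logLift, h2, hd, logLift, exp_log hz0]; ring

/-- If both a disc `X` centred outside `V` and its image under `h` are accessible from the base
point, then the lift of `h` moves boundary points by at most `4π`. -/
lemma IsConjPair.exists_abs_sub_le {V : Set ℂ} {φ : ℂ → ℂ} {h : ℂ ≃ₜ ℂ} {k k' : ℂ → ℂ}
    (hp : IsConjPair φ h k k') (hm : IsPlaneModel V φ) (h0 : h 0 = 0)
    {κ : ℂ → ℂ} (hκ : ContinuousOn κ 𝔻) (hinj : InjOn (logLift κ) {w | w.re < 0})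
    (hexp : ∀ w : ℂ, w.re < 0 → exp (logLift κ w) = φ (exp w))
    {H F : ℂ → ℂ} (hH : Continuous H) (hHe : ∀ w, exp (H w) = h (exp w))
    (hF : ContinuousOn F {w | w.re ≤ 0}) (hFre : ∀ w : ℂ, w.re < 0 → (F w).re < 0)
    (hFH : ∀ w : ℂ, w.re < 0 → logLift κ (F w) = H (logLift κ w))
    (hFe : ∀ w : ℂ, w.re < 0 → exp (F w) = k (exp w))
    {s : ℝ → ℂ} (hs : ContinuousOn s (Icc 0 1)) (hs0 : H (s 0) = s 0)
    (hsV : ∀ t ∈ Icc (0:ℝ) 1, exp (s t) ∉ V)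
    {ρ : ℝ} (hρ : 0 ≤ ρ) {l : ℂ → ℂ}
    (hl : ContinuousOn l (closedBall (exp (s 1)) ρ))
    (hle : ∀ z ∈ closedBall (exp (s 1)) ρ, exp (l z) = z)
    (hl1 : l (exp (s 1)) = s 1)
    {A : Set ℂ} (hA : A = l '' closedBall (exp (s 1)) ρ ∪ s '' Icc 0 1)
    (hPT : ∀ z ∈ A ∪ H '' A, z + 2 * π * I ∉ A ∪ H '' A)
    {X C : Set ℂ} (hX : X = closedBall (exp (s 1)) ρ) (hCX : C = X ∪ h '' X)
    (hC : ∀ z : ℂ, ‖z‖ ≤ 1 / 2 → φ z ∉ C)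
    {γ₁ γ₂ : ℝ → ℂ} (hγ₁ : ContinuousOn γ₁ (Icc 0 1)) (hγ₂ : ContinuousOn γ₂ (Icc 0 1))
    (hγb₁ : ∀ t ∈ Icc (0:ℝ) 1, γ₁ t ∈ 𝔻)
    (hγb₂ : ∀ t ∈ Icc (0:ℝ) 1, γ₂ t ∈ 𝔻) (hγ0₁ : γ₁ 0 = 0) (hγ0₂ : γ₂ 0 = 0)
    (hγC₁ : ∀ t ∈ Ico (0:ℝ) 1, φ (γ₁ t) ∉ C) (hγC₂ : ∀ t ∈ Ico (0:ℝ) 1, φ (γ₂ t) ∉ C)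
    (hγX₁ : φ (γ₁ 1) ∈ X) (hγX₂ : φ (γ₂ 1) ∈ h '' X) :
    ∃ θ : ℝ, ∀ θ' : ℝ, F (θ * I) = θ' * I → |θ' - θ| ≤ 4 * π := by
  have hmem1 : (1:ℝ) ∈ Icc (0:ℝ) 1 := ⟨zero_le_one, le_rfl⟩
  have ha : exp (s 1) ∉ V := hsV 1 hmem1
  have hXC : X ⊆ C := hCX ▸ subset_union_left
  have hφ0 : φ 0 ∉ C := hC 0 (by simp)
  have hXA : l '' X ⊆ A := by rw [hA, hX]; exact subset_union_left
  have hlXe : ∀ p ∈ l '' X, exp p ∈ X := by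
    rintro _ ⟨x, hx, rfl⟩
    rw [hle x (hX ▸ hx)]; exact hx
  have hlX : IsPathConnected (l '' X) := by
    rw [hX]
    exact ((convex_closedBall _ _).isPathConnected ⟨_, mem_closedBall_self hρ⟩).image' hl
  have hApc : IsPathConnected A := by
    rw [hA, ← hX]
    refine hlX.union (((convex_Icc (0:ℝ) 1).isPathConnected ⟨1, hmem1⟩).image' hs) ⟨s 1, ?_, 1,
      hmem1, rfl⟩
    exact ⟨_, hX ▸ mem_closedBall_self hρ, hl1⟩
  have hPpc : IsPathConnected (A ∪ H '' A) := by
    have : s 0 ∈ A := hA ▸ Or.inr ⟨0, ⟨le_rfl, zero_le_one⟩, rfl⟩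
    exact hApc.union (hApc.image hH) ⟨s 0, this, s 0, this, hs0⟩
  have hPC : ∀ z : ℂ, z ∈ 𝔻 → φ z ∈ exp '' (A ∪ H '' A) → φ z ∈ C := by
    have hAX : ∀ p ∈ A, exp p ∈ V → exp p ∈ X := by
      intro p hpA hpV
      rw [hA, ← hX] at hpA
      rcases hpA with hpA | ⟨t, ht, rfl⟩
      · exact hlXe p hpA
      · exact absurd hpV (hsV t ht)
    rintro z hz ⟨p, hpA | ⟨q, hq, rfl⟩, hpz⟩
    · rw [← hpz]
      exact hXC (hAX p hpA (hpz ▸ hm.mem hz))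
    · have hV : exp q ∈ V := by
        rw [← hp.apply_mem_iff hm, ← hHe, hpz]; exact hm.mem hz
      grind
  have hPC' : ∀ z : ℂ, z ∈ 𝔻 → φ z ∈ exp '' (l '' X) → φ z ∈ X := by
    rintro z hz ⟨p, hpX, hpz⟩
    rw [← hpz]; exact hlXe p hpX
  have hlPT := fun z hz hz' =>
    hPT z (Or.inl (hXA hz)) (Or.inl (hXA hz'))
  have hwlt : ∀ w : ℂ, w.re < 0 → φ (exp w) ∈ C → ((Real.log (1 / 4) : ℝ) : ℂ).re < w.re := by
    intro w hw hwC
    rw [ofReal_re]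
    by_contra hcon
    refine hC _ ?_ hwC
    rw [norm_exp]
    calc Real.exp w.re ≤ Real.exp (Real.log (1 / 4)) := Real.exp_le_exp.2 (not_lt.1 hcon)
      _ = 1 / 4 := Real.exp_log (by norm_num)
      _ ≤ 1 / 2 := by norm_num
  have hPw := fun w hw hwP =>
    hwlt w hw (hPC _ (exp_mem_ball hw) ⟨_, hwP, hexp w hw⟩)
  have hPw' := fun w hw hwP =>
    hPw w hw (Or.inl (hXA hwP))
  -- the point of the disc
  have hb1 := hγb₁ 1 hmem1
  have hb2 := hγb₂ 1 hmem1
  have hkφ : ∀ z ∈ 𝔻, h (φ (k' z)) = φ z := fun z hz => by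
    rw [hp.symm.conj z hz, Homeomorph.apply_symm_apply]
  obtain ⟨v, hv, hve, hvl⟩ := exists_logLift_eq (p := l (φ (γ₁ 1))) hexp hb1
    (fun h => hφ0 (h ▸ hXC hγX₁)) (hle _ (hX ▸ hγX₁))
  have huX : φ (k' (γ₂ 1)) ∈ X := by
    obtain ⟨x, hx, hxe⟩ := hγX₂
    rw [← hkφ _ hb2] at hxe
    rwa [← h.injective hxe]
  obtain ⟨u, hu, hue, hul⟩ := exists_logLift_eq (p := l (φ (k' (γ₂ 1)))) hexp (hp.ball' hb2)
    (fun h => hφ0 (h ▸ hXC huX)) (hle _ (hX ▸ huX))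
  have hvX := hvl ▸ mem_image_of_mem l hγX₁
  have huX' := hul ▸ mem_image_of_mem l huX
  obtain ⟨e, θ, he, he0, heX, hθ⟩ := hm.exists_segment_lift hκ hexp ha hl hle hv (hX ▸ hvX)
  obtain ⟨e', θ', he', he0', heX', hθ'⟩ := hm.exists_segment_lift hκ hexp ha hl hle hu (hX ▸ huX')
  rw [← hX] at heX heX'
  refine ⟨θ', fun θ'' hFθ => ?_⟩
  have i1 : |θ - θ''| ≤ 2 * π := by
    refine abs_sub_le_of_tendsto hκ hinj (fun x hx y hy => hPpc.joinedIn x hx y hy) hPT hPw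
      (e' := fun t => F (e' t)) he (hF.comp he' fun t ht => (heX' t ht).1.le)
      (fun t ht => ⟨(heX t ht).1, Or.inl (hXA (heX t ht).2)⟩)
      (fun t ht => ⟨hFre _ (heX' t ht).1, Or.inr ?_⟩) hθ ?_ ?_ ?_
    · grind
    · rw [← hFθ]
      have h1 : Tendsto F (𝓝[{w | w.re ≤ 0}] (θ' * I)) (𝓝 (F (θ' * I))) :=
        hF _ (by simp)
      refine h1.comp (tendsto_nhdsWithin_iff.2 ⟨hθ', ?_⟩)
      filter_upwards [Ioo_mem_nhdsLT one_pos] with t ht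
      grind
    · rw [he0]
      exact IsPlaneModel.joinedIn_accessSet hexp hC hPC hPT hv (Or.inl (hXA hvX)) hγ₁ hγb₁ hγ0₁
        hve.symm hγC₁
    · simp only [he0']
      refine IsPlaneModel.joinedIn_accessSet hexp hC hPC hPT (hFre u hu) (Or.inr ?_) hγ₂ hγb₂ hγ0₂
        ?_ hγC₂
      · grind
      · rw [hFe _ hu, hue, hp.right _ (ball_subset_closedBall hb2)]
  have i2 : |θ - θ'| ≤ 2 * π := by
    refine abs_sub_le_of_tendsto hκ hinj (fun x hx y hy => hlX.joinedIn x hx y hy) hlPT hPw'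
      he he' heX heX' hθ hθ' ?_ ?_
    · rw [he0]
      exact IsPlaneModel.joinedIn_accessSet hexp (fun z hz hzX => hC z hz (hXC hzX)) hPC' hlPT hv
        hvX hγ₁ hγb₁ hγ0₁
        hve.symm fun t ht hX => hγC₁ t ht (hXC hX)
    · rw [he0']
      refine IsPlaneModel.joinedIn_accessSet hexp (fun z hz hzX => hC z hz (hXC hzX)) hPC' hlPT hu
        huX'
        (γ := fun t => k' (γ₂ t))
        (hp.cont'.comp hγ₂ fun t ht => ball_subset_closedBall (hγb₂ t ht))
        (fun t ht => hp.ball' (hγb₂ t ht)) ?_ hue.symm ?_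
      · simp only [hγ0₂]
        exact hp.symm.apply_zero hm ((Homeomorph.symm_apply_eq h).2 h0.symm)
      · intro t ht htX
        refine hγC₂ t ht ?_
        rw [hCX, ← hkφ _ (hγb₂ t ⟨ht.1, ht.2.le⟩)]
        grind
  rw [abs_le] at i1 i2 ⊢
  constructor <;> linarith

lemma subset_connectedComponentIn_of_inter {X : Type*} [TopologicalSpace X]
    {B A : Set X} {x : X} (hB : IsPreconnected B) (hBA : B ⊆ A)
    (h : (B ∩ connectedComponentIn A x).Nonempty) : B ⊆ connectedComponentIn A x := by
  obtain ⟨y, hyB, hy⟩ := h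
  rw [connectedComponentIn_eq hy]
  exact hB.subset_connectedComponentIn hyB hBA

/-- A nonwandering homeomorphism whose inverse maps a component `O` of an open set into that set
permutes the components of the complement of `closure O`. -/
lemma exists_periodic_component {X : Type*} [TopologicalSpace X] [LocallyConnectedSpace X]
    {D A : Set X} {K K' : X → X} {c z₀ : X}
    (hD : IsOpen D) (hK : ContinuousOn K D) (hK' : ContinuousOn K' D) (hm : MapsTo K D D)
    (hm' : MapsTo K' D D) (hl : ∀ z ∈ D, K' (K z) = z) (hr : ∀ z ∈ D, K (K' z) = z)
    (hnw : ∀ W ⊆ D, IsOpen W → W.Nonempty → ∃ n : ℕ, 1 ≤ n ∧ ∃ w ∈ W, K^[n] w ∈ W)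
    (hA : IsOpen A) (hAD : A ⊆ D) (hc : c ∈ A) (hKc : K c = c)
    (hO : ∀ z ∈ connectedComponentIn A c, K' z ∈ A) (hz₀ : z₀ ∈ D)
    (hz₀O : z₀ ∉ closure (connectedComponentIn A c)) :
    ∃ (E : Set X) (s : ℕ), 1 ≤ s ∧ IsOpen E ∧ IsPreconnected E ∧ E.Nonempty ∧
      E ⊆ D \ closure (connectedComponentIn A c) ∧
      (∀ B, IsPreconnected B → B ⊆ D \ closure (connectedComponentIn A c) → (B ∩ E).Nonempty →
        B ⊆ E) ∧ MapsTo K^[s] ((D ∩ closure E) \ E) ((D ∩ closure E) \ E) := by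
  set O := connectedComponentIn A c with hOdef
  have hOA : O ⊆ A := connectedComponentIn_subset _ _
  have hOD : O ⊆ D := hOA.trans hAD
  have hOo : IsOpen O := hA.connectedComponentIn
  have hcO : c ∈ O := mem_connectedComponentIn hc
  have hK'O : MapsTo K' O O := by
    have h1 : K' c = c := by simpa only [hKc] using hl c (hAD hc)
    have h2 := (isPreconnected_connectedComponentIn.image K' (hK'.mono hOD)
      ).subset_connectedComponentIn ⟨c, hcO, h1⟩ (image_subset_iff.2 hO)
    exact fun z hz => h2 (mem_image_of_mem K' hz)
  have hKO : MapsTo K O (closure O) := by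
    by_contra hcon
    simp only [MapsTo, not_forall] at hcon
    obtain ⟨z, hz, hzK⟩ := hcon
    have hW : IsOpen (O ∩ K ⁻¹' (closure O)ᶜ) :=
      (hK.mono hOD).isOpen_inter_preimage hOo isClosed_closure.isOpen_compl
    obtain ⟨n, hn, w, hw, hnw⟩ := hnw _ (inter_subset_left.trans hOD) hW ⟨z, hz, hzK⟩
    obtain ⟨m, rfl⟩ := Nat.exists_eq_add_of_le' hn
    refine hw.2 (subset_closure ?_)
    have h1 : K'^[m] (K^[m + 1] w) = K w := by
      rw [iterate_succ_apply]
      have h3 : ∀ m, ∀ z ∈ D, K'^[m] (K^[m] z) = z := by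
        intro m
        induction m with
        | zero => intro z _; rfl
        | succ m ih =>
          intro z hz
          rw [iterate_succ_apply, iterate_succ_apply', hl _ (hm.iterate m hz),
            ih z hz]
      exact h3 m _ (hm (hOD hw.1))
    rw [← h1]
    exact hK'O.iterate m hnw.1
  have hcl : ∀ {f : X → X}, ContinuousOn f D → MapsTo f O (closure O) →
      ∀ z ∈ D, z ∈ closure O → f z ∈ closure O := by
    intro f hf hfO z hz hzO
    have h1 : z ∈ closure (D ∩ O) := by rwa [inter_eq_self_of_subset_right hOD]
    have h2 : f z ∈ closure (f '' O) := by
      have := (hf z hz).mono hOD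
      exact this.mem_closure_image hzO
    exact closure_minimal (image_subset_iff.2 hfO) isClosed_closure h2
  set Y₀ := D \ closure O with hY₀
  have hY₀o : IsOpen Y₀ := hD.sdiff isClosed_closure
  have hKY : MapsTo K Y₀ Y₀ := fun z hz => ⟨hm hz.1, fun h => hz.2 (by
    rw [← hl z hz.1]
    exact hcl hK' (hK'O.mono_right subset_closure) _ (hm hz.1) h)⟩
  have hK'Y : MapsTo K' Y₀ Y₀ := fun z hz => ⟨hm' hz.1, fun h => hz.2 (by
    rw [← hr z hz.1]
    exact hcl hK hKO _ (hm' hz.1) h)⟩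
  set E := connectedComponentIn Y₀ z₀ with hE
  have hEo : IsOpen E := hY₀o.connectedComponentIn
  have hEY : E ⊆ Y₀ := connectedComponentIn_subset _ _
  have hED := hEY.trans sdiff_subset
  have hzE : z₀ ∈ E := mem_connectedComponentIn ⟨hz₀, hz₀O⟩
  obtain ⟨s, hs, w, hw, hws⟩ := hnw E hED hEo ⟨z₀, hzE⟩
  have hit : ∀ {f : X → X}, ContinuousOn f D → MapsTo f D D → ContinuousOn f^[s] D := by
    intro f hf hfD
    clear hws hs
    induction s with
    | zero => exact continuousOn_id
    | succ s ih => rw [iterate_succ]; exact ih.comp hf hfD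
  have hls : ∀ z ∈ D, K'^[s] (K^[s] z) = z := by
    clear hws hs hit
    induction s with
    | zero => intro z _; rfl
    | succ m ih =>
      intro z hz
      rw [iterate_succ_apply, iterate_succ_apply', hl _ (hm.iterate m hz), ih z hz]
  have hE' : MapsTo K'^[s] E E := by
    have h2 : K'^[s] '' E ⊆ E :=
      subset_connectedComponentIn_of_inter
        (isPreconnected_connectedComponentIn.image _ ((hit hK' hm').mono hED)) (image_subset_iff.2
          fun z hz => hK'Y.iterate s (hEY hz)) ⟨w, ⟨_, hws, hls w (hED hw)⟩, hw⟩
    exact fun z hz => h2 (mem_image_of_mem _ hz)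
  have hE1 : MapsTo K^[s] E E := by
    have h2 : K^[s] '' E ⊆ E :=
      subset_connectedComponentIn_of_inter
        (isPreconnected_connectedComponentIn.image _ ((hit hK hm).mono hED)) (image_subset_iff.2
          fun z hz => hKY.iterate s (hEY hz)) ⟨_, ⟨w, hw, rfl⟩, hws⟩
    exact fun z hz => h2 (mem_image_of_mem _ hz)
  refine ⟨E, s, hs, hEo, isPreconnected_connectedComponentIn, ⟨z₀, hzE⟩, hEY, fun B hB hBY hBE =>
    subset_connectedComponentIn_of_inter hB hBY hBE, ?_⟩
  rintro z ⟨⟨hzD, hzc⟩, hzE⟩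
  refine ⟨⟨hm.iterate s hzD, ?_⟩, fun h => hzE (by rw [← hls z hzD]; exact hE' h)⟩
  exact closure_mono (image_subset_iff.2 fun x hx => hE1 hx)
    ((((hit hK hm) z hzD).mono hED).mem_closure_image hzc)

namespace IsPlaneModel

variable {V : Set ℂ} {φ : ℂ → ℂ}

/-- A logarithm of `φ - a` is an injective open map. -/
lemma exists_log_sub (h : IsPlaneModel V φ) {a : ℂ} (ha : a ∉ V) : ∃ ψ : ℂ → ℂ,
    ContinuousOn ψ 𝔻 ∧ (∀ z ∈ 𝔻, exp (ψ z) = φ z - a) ∧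
    (∀ z ∈ 𝔻, ∀ z' ∈ 𝔻,
      exp (ψ z) = exp (ψ z') → z = z') ∧
    ∀ W : Set ℂ, IsOpen W → W ⊆ 𝔻 → IsOpen (ψ '' W) := by
  obtain ⟨ψ, hψ, hψe⟩ := exists_log_of_convex (convex_ball (0:ℂ) 1)
    (u := fun z => φ z - a) (h.cont.sub continuousOn_const)
    (fun z hz h0 => ha (sub_eq_zero.1 h0 ▸ h.mem hz))
  have hinj : ∀ z ∈ 𝔻, ∀ z' ∈ 𝔻,
      exp (ψ z) = exp (ψ z') → z = z' := fun z hz z' hz' he => by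
    rw [hψe z hz, hψe z' hz'] at he
    exact h.inj hz hz' (sub_left_inj.1 he)
  refine ⟨ψ, hψ, hψe, hinj, fun W hW hWD => ?_⟩
  rw [isOpen_iff_mem_nhds]
  rintro _ ⟨z, hz, rfl⟩
  have hW' : IsOpen (W ∩ ψ ⁻¹' ball (ψ z) π) :=
    (hψ.mono hWD).isOpen_inter_preimage hW isOpen_ball
  have h1 : IsOpen ((fun y => exp y + a) ⁻¹' (φ '' (W ∩ ψ ⁻¹' ball (ψ z) π))) :=
    (h.open_map _ hW' (inter_subset_left.trans hWD)).preimage (by fun_prop)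
  filter_upwards [h1.mem_nhds ⟨z, ⟨hz, mem_ball_self Real.pi_pos⟩, by
    simp only [hψe z (hWD hz)]; ring⟩, ball_mem_nhds (ψ z) Real.pi_pos] with y ⟨z', hz', he⟩ hy
  refine ⟨z', hz'.1, ?_⟩
  have h2 : exp (ψ z') = exp y := by
    rw [hψe z' (hWD hz'.1), he]; ring
  obtain ⟨n, hn⟩ := Complex.exp_eq_exp_iff_exists_int.1 h2
  have h3 : dist (ψ z') y < 2 * π := by
    have h4 : dist (ψ z') (ψ z) < π := hz'.2
    have h5 : dist y (ψ z) < π := hy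
    calc _ ≤ dist (ψ z') (ψ z) + dist y (ψ z) := dist_triangle_right _ _ _
      _ < _ := by linarith
  rw [hn, dist_eq_norm, add_sub_cancel_left, norm_mul] at h3
  have h6 : ‖(2 * π * I : ℂ)‖ = 2 * π := by
    simp [abs_of_pos Real.pi_pos]
  rw [h6, Complex.norm_intCast] at h3
  have h7 : |(n : ℝ)| < 1 := by
    by_contra hcon
    nlinarith [not_lt.1 hcon, Real.pi_pos]
  have h8 : n = 0 := by
    rw [← Int.abs_lt_one_iff]; exact_mod_cast h7
  rw [hn, h8]; simp

end IsPlaneModel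

lemma closure_connectedComponentIn_inter {X : Type*} [TopologicalSpace X] [LocallyConnectedSpace X]
    {W : Set X} (hW : IsOpen W) (y : X) :
    closure (connectedComponentIn W y) ∩ W ⊆ connectedComponentIn W y := by
  rintro x ⟨hx, hxW⟩
  obtain ⟨z, hz, hzy⟩ := mem_closure_iff.1 hx _ (hW.connectedComponentIn (x := x))
    (mem_connectedComponentIn hxW)
  exact subset_connectedComponentIn_of_inter isPreconnected_connectedComponentIn
    (connectedComponentIn_subset _ _) ⟨z, hz, hzy⟩ (mem_connectedComponentIn hxW)

lemma exists_continuousOn_inv {X Y : Type*} [TopologicalSpace X] [TopologicalSpace Y] {D : Set X}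
    {ψ : X → Y} (hD : IsOpen D) (hinj : InjOn ψ D) (hopen : ∀ W, IsOpen W → W ⊆ D → IsOpen (ψ '' W))
    [Nonempty X] : ∃ χ : Y → X, ContinuousOn χ (ψ '' D) ∧ ∀ z ∈ D, χ (ψ z) = z := by
  have h2 : ∀ z ∈ D, invFunOn ψ D (ψ z) = z := fun z hz => hinj.leftInvOn_invFunOn hz
  refine ⟨invFunOn ψ D, ?_, h2⟩
  rw [continuousOn_open_iff (hopen D hD subset_rfl)]
  intro W hW
  convert hopen (W ∩ D) (hW.inter hD) inter_subset_right using 1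
  grind

lemma isPreconnected_preimage_of_inv {X Y : Type*} [TopologicalSpace X] [TopologicalSpace Y]
    {D : Set X} {ψ : X → Y} {χ : Y → X} (hχ : ContinuousOn χ (ψ '' D)) (hχψ : ∀ z ∈ D, χ (ψ z) = z)
    {T : Set Y} (hT : IsPreconnected T) (hTD : T ⊆ ψ '' D) : IsPreconnected (D ∩ ψ ⁻¹' T) := by
  have : D ∩ ψ ⁻¹' T = χ '' T := by
    ext z
    constructor
    · rintro ⟨hz, hzT⟩
      exact ⟨ψ z, hzT, hχψ z hz⟩
    · rintro ⟨y, hy, rfl⟩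
      obtain ⟨w, hw, rfl⟩ := hTD hy
      rw [hχψ w hw]; exact ⟨hw, hy⟩
  rw [this]
  exact hT.image χ (hχ.mono hTD)

section Frontier

/-- `O` is a component of `{z ∈ D | b < re (ψ z)}` for a chart `ψ : D → ℂ` with inverse `χ`, and `E`
is a maximal connected open subset of `D ∖ closure O`. -/
structure IsFrontierData (D O E : Set ℂ) (ψ χ : ℂ → ℂ) (b : ℝ) (c : ℂ) : Prop where
  hD : IsOpen D
  hψ : ContinuousOn ψ D
  hopen : ∀ W, IsOpen W → W ⊆ D → IsOpen (ψ '' W)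
  hχ : ContinuousOn χ (ψ '' D)
  hχψ : ∀ z ∈ D, χ (ψ z) = z
  hO : O = connectedComponentIn {z ∈ D | b < (ψ z).re} c
  hE : IsOpen E
  hEO : E ⊆ D \ closure O
  hEmax : ∀ B, IsPreconnected B → B ⊆ D \ closure O → (B ∩ E).Nonempty → B ⊆ E

variable {D O E : Set ℂ} {ψ χ : ℂ → ℂ} {b : ℝ} {c : ℂ}

lemma IsFrontierData.local_structure (h : IsFrontierData D O E ψ χ b c) {x : ℂ}
    (hx : x ∈ (D ∩ closure E) \ E) : (ψ x).re = b ∧ ∀ r > 0, ball (ψ x) r ⊆ ψ '' D → ∀ z ∈ D, ψ z ∈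
      ball (ψ x) r →
      (b < (ψ z).re → z ∈ O) ∧ ((ψ z).re < b → z ∈ E) ∧
      ((ψ z).re = b → z ∈ (D ∩ closure E) \ E) := by
  obtain ⟨hD, hψ, hopen, hχ, hχψ, hO, hE, hEO, hEmax⟩ := h
  obtain ⟨⟨hxD, hxE⟩, hxnE⟩ := hx
  have hAo : IsOpen {z ∈ D | b < (ψ z).re} :=
    (continuous_re.comp_continuousOn hψ).isOpen_inter_preimage hD isOpen_Ioi
  have hBo : IsOpen {z ∈ D | (ψ z).re < b} :=
    (continuous_re.comp_continuousOn hψ).isOpen_inter_preimage hD isOpen_Iio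
  have hOA := hO ▸ connectedComponentIn_subset _ _
  have hOo := hO ▸ hAo.connectedComponentIn
  have hltO : ∀ z ∈ D, (ψ z).re < b → z ∉ closure O := fun z hz hzb hzO => by
    obtain ⟨w, hw, hwO⟩ := mem_closure_iff.1 hzO _ hBo ⟨hz, hzb⟩
    grind
  have hxO : x ∈ closure O := by
    by_contra hcon
    have hYo : IsOpen (D \ closure O) := hD.sdiff isClosed_closure
    refine hxnE (hEmax (connectedComponentIn (D \ closure O) x) isPreconnected_connectedComponentIn
      (connectedComponentIn_subset _ _) ?_ (mem_connectedComponentIn ⟨hxD, hcon⟩))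
    exact mem_closure_iff.1 hxE _ hYo.connectedComponentIn (mem_connectedComponentIn ⟨hxD, hcon⟩)
  have hOE : ∀ z ∈ O, z ∉ closure E := fun z hz hzE => by
    obtain ⟨w, hwO, hw⟩ := mem_closure_iff.1 hzE _ hOo hz
    exact (hEO hw).2 (subset_closure hwO)
  have hxb : (ψ x).re = b := by
    refine le_antisymm (not_lt.1 fun hlt => ?_) (not_lt.1 fun hlt => hltO x hxD hlt hxO)
    have : x ∈ O := by
      rw [hO] at hxO ⊢
      exact closure_connectedComponentIn_inter hAo c ⟨hxO, hxD, hlt⟩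
    exact hOE x this hxE
  refine ⟨hxb, fun r hr hrD => ?_⟩
  have hno : IsOpen (D ∩ ψ ⁻¹' ball (ψ x) r) := hψ.isOpen_inter_preimage hD isOpen_ball
  have hxn : x ∈ D ∩ ψ ⁻¹' ball (ψ x) r := ⟨hxD, mem_ball_self hr⟩
  have hright : ∀ z ∈ D, ψ z ∈ ball (ψ x) r → b < (ψ z).re → z ∈ O := by
    intro z hz hzr hzb
    have h1 :=
      isPreconnected_preimage_of_inv hχ hχψ
        ((convex_ball _ _).inter (convex_halfSpace_re_gt b)).isPreconnected
        (inter_subset_left.trans hrD)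
    rw [hO]
    refine subset_connectedComponentIn_of_inter (A := {z ∈ D | b < (ψ z).re}) h1
      (fun w hw => ⟨hw.1, hw.2.2⟩) ?_ (show _ ∧ _ from ⟨hz, hzr, hzb⟩)
    rw [← hO]
    obtain ⟨w, hw, hwO⟩ := mem_closure_iff.1 hxO _ hno hxn
    exact ⟨w, ⟨hw.1, hw.2, (hOA hwO).2⟩, hwO⟩
  have hleft : ∀ z ∈ D, ψ z ∈ ball (ψ x) r → (ψ z).re < b → z ∈ E := by
    intro z hz hzr hzb
    have h1 :=
      isPreconnected_preimage_of_inv hχ hχψ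
        ((convex_ball _ _).inter (convex_halfSpace_re_lt b)).isPreconnected
        (inter_subset_left.trans hrD)
    refine hEmax _ h1 (fun w hw => ⟨hw.1, hltO w hw.1 hw.2.2⟩) ?_ ⟨hz, hzr, hzb⟩
    obtain ⟨w, hw, hwE⟩ := mem_closure_iff.1 hxE _ hno hxn
    -- move a little to the left inside `E`
    have h2 :=
      hopen _ (hE.inter hno) fun y hy => hy.2.1
    obtain ⟨ε, hε, hball⟩ := Metric.isOpen_iff.1 h2 (ψ w) ⟨w, ⟨hwE, hw⟩, rfl⟩
    obtain ⟨y, hy, hyw⟩ := hball (show ψ w - (ε / 2 : ℝ) ∈ ball (ψ w) ε by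
      rw [mem_ball, dist_eq_norm, sub_sub_cancel_left, norm_neg, norm_real,
        Real.norm_of_nonneg (by positivity)]
      linarith)
    refine ⟨y, ⟨hy.2.1, hy.2.2, ?_⟩, hy.1⟩
    have h3 := not_lt.1 fun hlt =>
      (hEO hwE).2 (subset_closure (hright w hw.1 hw.2 hlt))
    show (ψ y).re < b
    rw [hyw, sub_re, ofReal_re]
    linarith
  refine fun z hz hzr => ⟨hright z hz hzr, hleft z hz hzr, fun hzb => ⟨⟨hz, ?_⟩, fun hzE => ?_⟩⟩
  · rw [mem_closure_iff]
    intro W hW hzW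
    have h2 :=
      hopen _ (hW.inter hno) fun y hy => hy.2.1
    obtain ⟨ε, hε, hball⟩ := Metric.isOpen_iff.1 h2 (ψ z) ⟨z, ⟨hzW, hz, hzr⟩, rfl⟩
    obtain ⟨y, hy, hyw⟩ := hball (show ψ z - (ε / 2 : ℝ) ∈ ball (ψ z) ε by
      rw [mem_ball, dist_eq_norm, sub_sub_cancel_left, norm_neg, norm_real,
        Real.norm_of_nonneg (by positivity)]
      linarith)
    refine ⟨y, hy.1, hleft y hy.2.1 hy.2.2 ?_⟩
    simp_all
  · have h2 :=
      hopen _ (hE.inter hno) fun y hy => hy.2.1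
    obtain ⟨ε, hε, hball⟩ := Metric.isOpen_iff.1 h2 (ψ z) ⟨z, ⟨hzE, hz, hzr⟩, rfl⟩
    obtain ⟨y, hy, hyw⟩ := hball (show ψ z + (ε / 2 : ℝ) ∈ ball (ψ z) ε by
      rw [mem_ball, dist_eq_norm, add_sub_cancel_left, norm_real,
        Real.norm_of_nonneg (by positivity)]
      linarith)
    refine (hEO hy.1).2 (subset_closure (hright y hy.2.1 hy.2.2 ?_))
    simp_all

/-- The common frontier of `O` and `E` contains the whole vertical segment through each of its
points. -/
lemma IsFrontierData.segment_subset (h : IsFrontierData D O E ψ χ b c) {x : ℂ}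
    (hx : x ∈ (D ∩ closure E) \ E) {t₁ t₂ : ℝ} (ht : (ψ x).im ∈ Ioo t₁ t₂) (hseg : ∀ t ∈ Ioo t₁ t₂,
      (b + t * I : ℂ) ∈ ψ '' D) :
    ∀ t ∈ Ioo t₁ t₂, χ (b + t * I) ∈ (D ∩ closure E) \ E := by
  have hloc := fun y hy => h.local_structure (x := y) hy
  obtain ⟨hD, hψ, hopen, hχ, hχψ, hO, hE, hEO, hEmax⟩ := h
  have hψχ : ∀ t ∈ Ioo t₁ t₂, χ (b + t * I) ∈ D ∧
      ψ (χ (b + t * I)) = b + t * I := fun t ht => by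
    obtain ⟨z, hz, hzt⟩ := hseg t ht
    grind
  have hc : ContinuousOn (fun t : ℝ => χ (b + t * I)) (Ioo t₁ t₂) :=
    hχ.comp (by fun_prop) hseg
  have hx0 : χ (b + (ψ x).im * I) = x := by
    rw [← (hloc x hx).1, re_add_im, hχψ x hx.1.1]
  have hsub : Ioo t₁ t₂ ⊆ {t | χ (b + t * I) ∈ closure E \ E} := by
    have h1 : IsOpen (Ioo t₁ t₂ ∩ {t | χ (b + t * I) ∈ closure E \ E}) := by
      rw [isOpen_iff_mem_nhds]
      rintro t ⟨ht, htE⟩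
      have h2 := hloc _ (show χ (b + t * I) ∈ (D ∩ closure E) \ E from
        ⟨⟨(hψχ t ht).1, htE.1⟩, htE.2⟩)
      rw [(hψχ t ht).2] at h2
      obtain ⟨r, hr, hrD⟩ := Metric.isOpen_iff.1 (hopen D hD subset_rfl) _ (hseg t ht)
      have h3 : ∀ᶠ s : ℝ in 𝓝 t, (b + s * I : ℂ) ∈ ball (b + t * I : ℂ) r :=
        (show Continuous fun s : ℝ => (b + s * I : ℂ) by fun_prop).continuousAt.eventually
          (ball_mem_nhds _ hr)
      filter_upwards [h3, Ioo_mem_nhds ht.1 ht.2] with s hs hst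
      have h4 := (h2.2 r hr hrD _ (hψχ s hst).1 (by rw [(hψχ s hst).2]; exact hs)).2.2 (by
        rw [(hψχ s hst).2]; simp)
      exact ⟨hst, h4.1.2, h4.2⟩
    have hclosed : IsOpen (Ioo t₁ t₂ ∩ {t | χ (b + t * I) ∉ closure E \ E}) := by
      have h2 := hc.isOpen_inter_preimage isOpen_Ioo (t := (closure E \ E)ᶜ)
        (isClosed_closure.sdiff hE).isOpen_compl
      exact h2
    by_contra hcon
    obtain ⟨s, hs, hsn⟩ := not_subset.1 hcon
    obtain ⟨r, -, hr1, hr2⟩ := (isPreconnected_Ioo (a := t₁) (b := t₂)) _ _ h1 hclosed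
      (fun t ht => by grind)
      ⟨(ψ x).im, ht, ht, by grind⟩ ⟨s, hs, hs, hsn⟩
    exact hr2.2 hr1.2
  grind

lemma div_sub_mem_slitPlane {w k₁ k₂ : ℂ} {b t₁ t₂ : ℝ} (hk₁ : k₁ = b + t₁ * I)
    (hk₂ : k₂ = b + t₂ * I) (h₁ : w ≠ k₁) (h₂ : w ≠ k₂) (ht : t₁ < t₂)
    (hw : ¬(w.re = b ∧ w.im ∈ Ioo t₁ t₂)) : (w - k₁) / (w - k₂) ∈ slitPlane := by
  have h3 : w - k₂ ≠ 0 := sub_ne_zero.2 h₂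
  have h4 : (w - k₁) / (w - k₂) ≠ 0 := div_ne_zero (sub_ne_zero.2 h₁) h3
  rw [Complex.mem_slitPlane_iff_not_le_zero]
  intro hle
  obtain ⟨hre, him⟩ := Complex.le_def.1 hle
  set s := ((w - k₁) / (w - k₂)).re with hs
  have hs0 : s ≤ 0 := by simpa using hre
  have h5 : (w - k₁) / (w - k₂) = (s : ℂ) := Complex.ext (by simp [hs]) (by simpa using him)
  have h6 : w - k₁ = s * (w - k₂) := by rw [← h5, div_mul_cancel₀ _ h3]
  have h7 : s ≠ 0 := fun h => h4 (by rw [h5, h, ofReal_zero])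
  have hsn : s < 0 := lt_of_le_of_ne hs0 h7
  have e1 := congrArg Complex.re h6
  have e2 := congrArg Complex.im h6
  simp [hk₁, hk₂] at e1 e2
  have h8 : w.re = b := by
    have : (w.re - b) * (1 - s) = 0 := by linarith
    rcases mul_eq_zero.1 this with h | h <;> linarith
  refine hw ⟨h8, ?_, ?_⟩
  · by_contra hcon
    nlinarith [mul_nonneg (by linarith : 0 ≤ t₁ - w.im) (by linarith : 0 ≤ 1 - s),
      mul_pos (by linarith : 0 < t₂ - t₁) (by linarith : 0 < -s)]
  · by_contra hcon
    nlinarith [mul_nonneg (by linarith : 0 ≤ w.im - t₂) (by linarith : 0 ≤ 1 - s)]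

/-- The common frontier of `O` and `E` is a single arc. -/
lemma IsFrontierData.subset_segment (h : IsFrontierData D O E ψ χ b c) (hDc : Convex ℝ D)
    (hEc : IsPreconnected E) {t₁ t₂ : ℝ} (ht : t₁ < t₂)
    (hk₁ : (b + t₁ * I : ℂ) ∉ ψ '' D) (hk₂ : (b + t₂ * I : ℂ) ∉ ψ '' D)
    (hseg : ∀ t ∈ Ioo t₁ t₂, (b + t * I : ℂ) ∈ ψ '' D)
    (hY : ∀ t ∈ Ioo t₁ t₂, χ (b + t * I) ∈ (D ∩ closure E) \ E)
    {y : ℂ} (hy : y ∈ (D ∩ closure E) \ E) : (ψ y).im ∈ Ioo t₁ t₂ := by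
  by_contra hcon
  have hloc := fun y hy => h.local_structure (x := y) hy
  obtain ⟨hD, hψ, hopen, hχ, hχψ, hO, hE, hEO, hEmax⟩ := h
  have hψχ : ∀ w ∈ ψ '' D, χ w ∈ D ∧ ψ (χ w) = w := by
    rintro _ ⟨z, hz, rfl⟩
    rw [hχψ z hz]; exact ⟨hz, rfl⟩
  have hOA := hO ▸ connectedComponentIn_subset _ _
  have hOc := hO ▸ isPreconnected_connectedComponentIn
  set k₁ : ℂ := b + t₁ * I with hk₁d
  set k₂ : ℂ := b + t₂ * I with hk₂d
  have hne₁ := fun z hz h => hk₁ ⟨z, hz, h⟩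
  have hne₂ := fun z hz h => hk₂ ⟨z, hz, h⟩
  obtain ⟨l, hl, hle⟩ := exists_log_of_convex hDc (u := fun z => (ψ z - k₁) / (ψ z - k₂))
    ((hψ.sub continuousOn_const).div (hψ.sub continuousOn_const)
      fun z hz => sub_ne_zero.2 (hne₂ z hz))
    (fun z hz => div_ne_zero (sub_ne_zero.2 (hne₁ z hz)) (sub_ne_zero.2 (hne₂ z hz)))
  -- a small neighbourhood of `y`
  obtain ⟨r₀, hr₀, hr₀D⟩ := Metric.isOpen_iff.1 (hopen D hD subset_rfl) (ψ y) ⟨y, hy.1.1, rfl⟩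
  have hyb := (hloc y hy).1
  have hyim : (ψ y).im ∉ Icc t₁ t₂ := by
    intro hmem
    rcases eq_or_lt_of_le hmem.1 with h | h
    · exact hne₁ y hy.1.1 (by rw [hk₁d, h, ← hyb, re_add_im])
    rcases eq_or_lt_of_le hmem.2 with h' | h'
    · exact hne₂ y hy.1.1 (by rw [hk₂d, ← h', ← hyb, re_add_im])
    exact hcon ⟨h, h'⟩
  obtain ⟨r₁, hr₁, hr₁I⟩ := Metric.isOpen_iff.1
    (isClosed_Icc (a := t₁) (b := t₂)).isOpen_compl (ψ y).im hyim
  set r := min r₀ r₁ with hr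
  have hr0 := lt_min hr₀ hr₁
  have hrD : ball (ψ y) r ⊆ ψ '' D :=
    (ball_subset_ball (min_le_left _ _)).trans hr₀D
  set N := D ∩ ψ ⁻¹' ball (ψ y) r with hN
  have hNc :=
    isPreconnected_preimage_of_inv hχ hχψ (convex_ball _ _).isPreconnected hrD
  have hNim : ∀ z ∈ N, (ψ z).im ∉ Icc t₁ t₂ := fun z hz => hr₁I (by
    rw [mem_ball, Real.dist_eq, ← sub_im]
    refine (Complex.abs_im_le_norm _).trans_lt ?_
    have := mem_ball.1 hz.2
    rw [dist_eq_norm] at this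
    exact this.trans_le (min_le_right _ _))
  have hNpt : ∀ δ : ℝ, |δ| < r → χ (ψ y + δ) ∈ D ∧ ψ (χ (ψ y + δ)) ∈ ball (ψ y) r ∧
      (ψ (χ (ψ y + δ))).re = b + δ := fun δ hδ => by
    have h1 : ψ y + δ ∈ ball (ψ y) r := by
      rw [mem_ball, dist_eq_norm, add_sub_cancel_left, norm_real]
      exact hδ
    obtain ⟨h2, h3⟩ := hψχ _ (hrD h1)
    rw [h3]
    bound
  have hNO : (O ∩ N).Nonempty := by
    obtain ⟨h1, h2, h3⟩ := hNpt (r / 2) (by rw [abs_of_pos] <;> linarith)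
    exact ⟨_, ((hloc y hy).2 r hr0 hrD _ h1 h2).1 (by rw [h3]; linarith), h1, h2⟩
  have hNE : (E ∩ N).Nonempty := by
    obtain ⟨h1, h2, h3⟩ := hNpt (-(r / 2)) (by rw [abs_neg, abs_of_pos] <;> linarith)
    exact ⟨_, ((hloc y hy).2 r hr0 hrD _ h1 h2).2.1 (by rw [h3]; linarith), h1, h2⟩
  have hT : IsPreconnected (O ∪ N ∪ E) := by
    refine (hOc.union' hNO hNc).union' ?_ hEc
    obtain ⟨z, hz⟩ := hNE
    exact ⟨z, Or.inr hz.2, hz.1⟩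
  have hTD : O ∪ N ∪ E ⊆ D := union_subset (union_subset (fun z hz => (hOA hz).1)
    inter_subset_left) fun z hz => (hEO hz).1
  have hTseg : ∀ z ∈ O ∪ N ∪ E, ¬((ψ z).re = b ∧ (ψ z).im ∈ Ioo t₁ t₂) := by
    rintro z ((hz | hz) | hz) ⟨h1, h2⟩
    · exact (hOA hz).2.ne' h1
    · exact hNim z hz (Ioo_subset_Icc_self h2)
    · refine (hY _ h2).2 ?_
      rw [← h1, re_add_im, hχψ z (hEO hz).1]
      exact hz
  have hTslit := fun z hz =>
    div_sub_mem_slitPlane hk₁d hk₂d (hne₁ z (hTD hz)) (hne₂ z (hTD hz)) ht (hTseg z hz)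
  have hconst : ∀ x ∈ O ∪ N ∪ E, ∀ z ∈ O ∪ N ∪ E,
      l x - log ((ψ x - k₁) / (ψ x - k₂)) =
        l z - log ((ψ z - k₁) / (ψ z - k₂)) := by
    intro x hx z hz
    have := sub_eq_sub_of_exp_eq hT (hl.mono hTD)
      (g := fun z => log ((ψ z - k₁) / (ψ z - k₂)))
      (ContinuousOn.clog (((hψ.mono hTD).sub continuousOn_const).div
        ((hψ.mono hTD).sub continuousOn_const) fun z hz => sub_ne_zero.2 (hne₂ z (hTD hz))) hTslit)
      (fun z hz => by rw [hle z (hTD hz), exp_log (Complex.slitPlane_ne_zero (hTslit z hz))])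
      hx hz
    exact this
  -- compare the two sides of the midpoint of the segment
  set m := (t₁ + t₂) / 2 with hm
  set q := (t₂ - t₁) / 2 with hq
  have hq0 : 0 < q := by rw [hq]; linarith
  have hmI : m ∈ Ioo t₁ t₂ := ⟨by rw [hm]; linarith, by rw [hm]; linarith⟩
  set w : ℂ := b + m * I with hw
  have hwY := hY m hmI
  obtain ⟨-, hψw⟩ := hψχ w (hseg m hmI)
  have hlocw := (hloc _ hwY).2
  rw [hψw] at hlocw
  obtain ⟨ρ, hρ, hρD⟩ := Metric.isOpen_iff.1 (hopen D hD subset_rfl) w (hseg m hmI)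
  have hside : ∀ δ : ℝ, |δ| < ρ → χ (w + δ) ∈ D ∧ ψ (χ (w + δ)) = w + δ ∧
      (δ ≠ 0 → χ (w + δ) ∈ O ∪ N ∪ E) := fun δ hδ => by
    have h1 : w + δ ∈ ball w ρ := by
      rw [mem_ball, dist_eq_norm, add_sub_cancel_left, norm_real]
      exact hδ
    obtain ⟨h2, h3⟩ := hψχ _ (hρD h1)
    have h4 := hlocw ρ hρ hρD _ h2 (by rw [h3]; exact h1)
    rw [h3] at h4
    have h5 : (w + δ).re = b + δ := by simp [hw]
    rw [h5] at h4
    refine ⟨h2, h3, fun hne => ?_⟩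
    rcases lt_or_gt_of_ne hne with h | h
    · grind
    · exact Or.inl (Or.inl (h4.1 (by linarith)))
  have hM : ∀ δ : ℝ, (w + δ - k₁) / (w + δ - k₂) = (δ + q * I) / (δ - q * I) := by
    intro δ
    have h1 : w + δ - k₁ = δ + q * I := by
      rw [hw, hk₁d, hm, hq]; push_cast; ring
    have h2 : w + δ - k₂ = δ - q * I := by
      rw [hw, hk₂d, hm, hq]; push_cast; ring
    rw [h1, h2]
  set M : ℝ → ℂ := fun δ => (δ + q * I) / (δ - q * I) with hMd
  have hqI : (q : ℂ) * I ≠ 0 := mul_ne_zero (by exact_mod_cast hq0.ne') Complex.I_ne_zero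
  have hMc : ContinuousAt M 0 := by
    refine ContinuousAt.div (by fun_prop) (by fun_prop) ?_
    rw [ofReal_zero, zero_sub]; exact neg_ne_zero.2 hqI
  have hM0 : M 0 = -1 := by
    rw [hMd]; simp only [ofReal_zero, zero_sub, zero_add]
    rw [div_neg, div_self hqI]
  have hMneg : ∀ δ, M (-δ) = (M δ)⁻¹ := fun δ => by
    rw [hMd]; simp only [Complex.ofReal_neg]
    rw [inv_div, ← neg_div_neg_eq]; congr 1 <;> ring
  have hlc : ContinuousAt (fun δ : ℝ => l (χ (w + δ)) - l (χ (w + (-δ : ℝ)))) 0 := by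
    have h1 : ContinuousAt (fun δ : ℝ => l (χ (w + δ))) 0 := by
      have h2 : ContinuousAt χ (w + (0:ℝ)) := by
        rw [ofReal_zero, add_zero]
        exact hχ.continuousAt ((hopen D hD subset_rfl).mem_nhds (hseg m hmI))
      have h3 : ContinuousAt l (χ (w + (0:ℝ))) := by
        rw [ofReal_zero, add_zero]
        exact hl.continuousAt (hD.mem_nhds hwY.1.1)
      exact ContinuousAt.comp (f := fun δ : ℝ => χ (w + δ)) h3
        (ContinuousAt.comp (f := fun δ : ℝ => w + (δ : ℂ)) h2 (by fun_prop))
    refine h1.sub ?_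
    exact ContinuousAt.comp (f := fun δ : ℝ => -δ) (g := fun δ : ℝ => l (χ (w + δ)))
      (by rw [neg_zero]; exact h1) (by fun_prop)
  have hev : ∀ᶠ δ : ℝ in 𝓝[>] 0,
      exp ((l (χ (w + δ)) - l (χ (w + (-δ : ℝ)))) / 2) = M δ := by
    have h1 : ∀ᶠ δ : ℝ in 𝓝[>] 0, δ < ρ := nhdsWithin_le_nhds (gt_mem_nhds hρ)
    filter_upwards [h1, self_mem_nhdsWithin] with δ hδ hδ0
    obtain ⟨h2, h3, h3'⟩ := hside δ (by rw [abs_of_pos hδ0]; exact hδ)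
    obtain ⟨h4, h5, h5'⟩ := hside (-δ) (by rw [abs_neg, abs_of_pos hδ0]; exact hδ)
    have h6 := h3' (ne_of_gt hδ0)
    have h7 := hconst _ h6 _ (h5' (neg_ne_zero.2 (ne_of_gt hδ0)))
    have h8 := hTslit _ h6
    rw [h3, h5, hM, hM] at h7
    rw [h3, hM] at h8
    change l _ - log (M δ) = l _ - log (M (-δ)) at h7
    change M δ ∈ _ at h8
    rw [hMneg, Complex.log_inv _ (Complex.slitPlane_arg_ne_pi h8)] at h7
    rw [show (l (χ (w + δ)) - l (χ (w + (-δ : ℝ)))) / 2 = log (M δ) by linear_combination h7 / 2,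
      exp_log (Complex.slitPlane_ne_zero h8)]
  have hlim : Tendsto (fun δ : ℝ => exp ((l (χ (w + δ)) - l (χ (w + (-δ : ℝ)))) / 2))
      (𝓝[>] 0) (𝓝 1) := by
    have h1 : Tendsto (fun δ : ℝ => exp ((l (χ (w + δ)) - l (χ (w + (-δ : ℝ)))) / 2))
      (𝓝 0) _ := (Complex.continuous_exp.continuousAt.comp (hlc.div_const 2)).tendsto
    convert h1.mono_left nhdsWithin_le_nhds using 2
    simp
  have h9 := tendsto_nhds_unique (hlim.congr' hev) (hMc.tendsto.mono_left nhdsWithin_le_nhds)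
  grind

end Frontier

namespace IsPlaneModel

variable {V : Set ℂ} {φ : ℂ → ℂ}

lemma exists_segment_end (h : IsPlaneModel V φ) {a : ℂ} {ψ χ : ℂ → ℂ}
    (hψ : ContinuousOn ψ 𝔻)
    (hψe : ∀ z ∈ 𝔻, exp (ψ z) = φ z - a)
    (hopen : IsOpen (ψ '' 𝔻)) (hχ : ContinuousOn χ (ψ '' 𝔻))
    (hχψ : ∀ z ∈ 𝔻, χ (ψ z) = z) {p : ℝ → ℂ} {T : ℝ} (hp : Continuous p)
    (hpD : ∀ᶠ t in 𝓝[<] T, p t ∈ ψ '' 𝔻) (hpT : p T ∉ ψ '' 𝔻) :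
    ∃ ξ : ℂ, ‖ξ‖ = 1 ∧ Tendsto (fun t => χ (p t)) (𝓝[<] T) (𝓝 ξ) := by
  have hψχ : ∀ w ∈ ψ '' 𝔻, χ w ∈ 𝔻 ∧ ψ (χ w) = w := by
    rintro _ ⟨z, hz, rfl⟩
    rw [hχψ z hz]; exact ⟨hz, rfl⟩
  have hφχ : ∀ w ∈ ψ '' 𝔻, φ (χ w) = a + exp w := fun w hw => by grind
  have hlim : Tendsto (fun t => φ (χ (p t))) (𝓝[<] T) (𝓝 (a + exp (p T))) := by
    have h1 : Tendsto (fun t => a + exp (p t)) (𝓝[<] T) (𝓝 (a + exp (p T))) :=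
      ((show Continuous fun t => a + exp (p t) by fun_prop).tendsto T).mono_left
        nhdsWithin_le_nhds
    exact h1.congr' (hpD.mono fun t ht => (hφχ _ ht).symm)
  refine h.land (fun t => χ (p t)) T _ (fun hV => hpT ?_) (hpD.mono fun t ht => ⟨?_, (hψχ _ ht).1⟩)
    hlim
  · obtain ⟨ι, hι, hι1, hι2⟩ := h.exists_inv
    have h2 : Tendsto (fun t => ι (φ (χ (p t)))) (𝓝[<] T) (𝓝 (ι (a + exp (p T)))) :=
      (hι.continuousAt (h.isOpen.mem_nhds hV)).tendsto.comp hlim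
    have h3 := (hψ.continuousAt (isOpen_ball.mem_nhds (hι1 _ hV).1)).tendsto.comp h2
    refine ⟨_, (hι1 _ hV).1, tendsto_nhds_unique (h3.congr' ?_)
      ((hp.tendsto T).mono_left nhdsWithin_le_nhds)⟩
    filter_upwards [hpD] with t ht
    grind
  · exact ContinuousAt.comp (f := p) (hχ.continuousAt (hopen.mem_nhds ht)) hp.continuousAt

end IsPlaneModel

/-- A map of the closed disc preserving an open arc in the disc that lands on the circle on both
sides has a periodic point on the circle. -/
lemma exists_periodic_of_arc {k : ℂ → ℂ} (hk : ContinuousOn k (closedBall 0 1))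
    (hk1 : ∀ ζ : ℂ, ‖ζ‖ = 1 → ‖k ζ‖ = 1) {p : ℝ → ℂ} {t₁ t₂ : ℝ} (ht : t₁ < t₂)
    (hp : ContinuousOn p (Ioo t₁ t₂)) (hpD : ∀ t ∈ Ioo t₁ t₂, p t ∈ 𝔻)
    {ξ₁ ξ₂ : ℂ} (h₁ : ‖ξ₁‖ = 1) (h₂ : ‖ξ₂‖ = 1) (hl₁ : Tendsto p (𝓝[>] t₁) (𝓝 ξ₁))
    (hl₂ : Tendsto p (𝓝[<] t₂) (𝓝 ξ₂)) (hmaps : MapsTo k (p '' Ioo t₁ t₂) (p '' Ioo t₁ t₂)) :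
    ∃ ζ : ℂ, ‖ζ‖ = 1 ∧ (k ζ = ζ ∨ k (k ζ) = ζ) := by
  have hcl : closure (p '' Ioo t₁ t₂) ⊆ p '' Ioo t₁ t₂ ∪ {ξ₁, ξ₂} := by
    have hc := continuousOn_Icc_extendFrom_Ioo hp hl₁ hl₂
    have h3 : p '' Ioo t₁ t₂ ⊆ extendFrom (Ioo t₁ t₂) p '' Icc t₁ t₂ := by
      rintro _ ⟨t, ht', rfl⟩
      exact ⟨t, Ioo_subset_Icc_self ht', extendFrom_extends hp t ht'⟩
    refine (closure_minimal h3 (isCompact_Icc.image_of_continuousOn hc).isClosed).trans ?_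
    rintro _ ⟨t, ht', rfl⟩
    rcases eq_or_lt_of_le ht'.1 with h | h
    · subst h
      rw [eq_lim_at_left_extendFrom_Ioo ht hl₁]; simp
    rcases eq_or_lt_of_le ht'.2 with h' | h'
    · subst h'
      rw [eq_lim_at_right_extendFrom_Ioo ht hl₂]; simp
    exact Or.inl ⟨t, ⟨h, h'⟩, (extendFrom_extends hp t ⟨h, h'⟩).symm⟩
  have key : ∀ (ξ : ℂ) (T : ℝ) (l : Filter ℝ), l.NeBot → ‖ξ‖ = 1 → Tendsto p l (𝓝 ξ) →
      (∀ᶠ t in l, t ∈ Ioo t₁ t₂) → k ξ = ξ₁ ∨ k ξ = ξ₂ := by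
    intro ξ T l hl hξ hlim hev
    have h3 : Tendsto (fun t => k (p t)) l (𝓝 (k ξ)) :=
      (hk ξ (mem_closedBall_zero_iff.2 hξ.le)).tendsto.comp
        (tendsto_nhdsWithin_iff.2 ⟨hlim, hev.mono fun t ht =>
          ball_subset_closedBall (hpD t ht)⟩)
    have h4 :=
      mem_closure_of_tendsto h3 (hev.mono fun t ht => hmaps ⟨t, ht, rfl⟩)
    rcases hcl h4 with ⟨t, ht, he⟩ | h5
    · have := hpD t ht
      simp_all
    · exact h5
  have hk₁ := key ξ₁ t₁ _ inferInstance h₁ hl₁ (Ioo_mem_nhdsGT ht)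
  have hk₂ := key ξ₂ t₂ _ inferInstance h₂ hl₂ (Ioo_mem_nhdsLT ht)
  grind

/-- If the disc around a point of the frontier of `V` is not met by the component of its complement
containing the origin after applying the map once, the disc map has a periodic point on the
circle. -/
lemma IsConjPair.exists_apply_mem_closedBall {V : Set ℂ} {φ k k' : ℂ → ℂ} {g : ℂ ≃ₜ ℂ}
    (hm : IsPlaneModel V φ) (hp : IsConjPair φ g k k') (h0 : g 0 = 0)
    (hne : ∀ n : ℕ, 1 ≤ n → ∀ ζ : ℂ, ‖ζ‖ = 1 → k^[n] ζ ≠ ζ)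
    (hnw : ∀ W ⊆ V, IsOpen W → W.Nonempty → ∃ n : ℕ, 1 ≤ n ∧ (g^[n] '' W ∩ W).Nonempty)
    {a : ℂ} (ha : a ∉ V) (hac : a ∈ closure V) {ρ : ℝ} (hρ : 0 < ρ) (hρa : ρ < ‖a‖) :
    ∃ z ∈ connectedComponentIn {z ∈ 𝔻 | φ z ∉ closedBall a ρ} 0,
      φ (k' z) ∈ closedBall a ρ := by
  by_contra! hcon
  obtain ⟨ψ, hψ, hψe, hinj, hopen⟩ := hm.exists_log_sub ha
  set D := 𝔻 with hDd
  have hD : IsOpen D := isOpen_ball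
  have hψinj : InjOn ψ D := fun z hz z' hz' he => hinj z hz z' hz' (by rw [he])
  obtain ⟨χ, hχ, hχψ⟩ := exists_continuousOn_inv hD hψinj hopen
  set b := Real.log ρ with hb
  have hre : ∀ z ∈ D, dist (φ z) a = Real.exp (ψ z).re := fun z hz => by
    rw [dist_eq_norm, ← hψe z hz, norm_exp]
  have hA : {z ∈ D | φ z ∉ closedBall a ρ} = {z ∈ D | b < (ψ z).re} := by
    ext z
    refine and_congr_right fun hz => ?_
    rw [mem_closedBall, not_le, hre z hz, Real.log_lt_iff_lt_exp hρ]
  rw [hA] at hcon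
  have hAo : IsOpen {z ∈ D | b < (ψ z).re} :=
    (continuous_re.comp_continuousOn hψ).isOpen_inter_preimage hD isOpen_Ioi
  have hBo : IsOpen {z ∈ D | (ψ z).re < b} :=
    (continuous_re.comp_continuousOn hψ).isOpen_inter_preimage hD isOpen_Iio
  have hcA : (0:ℂ) ∈ {z ∈ D | b < (ψ z).re} := by
    rw [← hA]
    refine ⟨mem_ball_self one_pos, ?_⟩
    rw [hm.zero, mem_closedBall, dist_eq_norm, zero_sub, norm_neg]
    exact not_le.2 hρa
  set O := connectedComponentIn {z ∈ D | b < (ψ z).re} 0 with hO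
  have hOA : O ⊆ {z ∈ D | b < (ψ z).re} := connectedComponentIn_subset _ _
  obtain ⟨v, hv, hva⟩ := Metric.mem_closure_iff.1 hac ρ hρ
  obtain ⟨z₀, hz₀, rfl⟩ := (hm.img.symm ▸ hv : v ∈ φ '' D)
  have hz₀O : z₀ ∉ closure O := fun hz => by
    obtain ⟨w, hw, hwO⟩ := mem_closure_iff.1 hz _ hBo ⟨hz₀, by
      show (ψ z₀).re < b
      rw [hb, Real.lt_log_iff_exp_lt hρ, ← hre z₀ hz₀, dist_comm]; exact hva⟩
    grind
  obtain ⟨E, s, hs, hE, hEc, hEne, hEO, hEmax, hEs⟩ := exists_periodic_component (D := D)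
    (A := {z ∈ D | b < (ψ z).re}) (K := k) (K' := k') (c := 0) (z₀ := z₀) hD
    (hp.cont.mono ball_subset_closedBall) (hp.cont'.mono ball_subset_closedBall)
    hp.ball hp.ball' (fun z hz => hp.left z (ball_subset_closedBall hz))
    (fun z hz => hp.right z (ball_subset_closedBall hz))
    (by
      intro W hWD hW hWne
      obtain ⟨n, hn, y, ⟨-, ⟨w, hw, rfl⟩, rfl⟩, w', hw', he⟩ := hnw (φ '' W)
        (by rw [← hm.img]; exact image_mono hWD) (hm.open_map W hW hWD) (hWne.image φ)
      refine ⟨n, hn, w, hw, ?_⟩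
      obtain ⟨G, hG, hpn⟩ := hp.iterate n
      rw [← hG, ← hpn.conj w (hWD hw)] at he
      rw [← hm.inj (hWD hw') (hpn.ball (hWD hw)) he]
      exact hw')
    hAo (fun z hz => hz.1) hcA (hp.apply_zero hm h0)
    (fun z hz => by
      rw [← hA]
      exact ⟨hp.ball' (hOA hz).1, not_le.2 (by simpa using hcon z hz)⟩) hz₀ hz₀O
  have h0E := fun h => (hEO h).2 (subset_closure (mem_connectedComponentIn hcA))
  obtain ⟨x, hxD, hxE⟩ := (convex_ball (0:ℂ) 1).isPreconnected.exists_mem_closure_diff hE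
    (by obtain ⟨e, he⟩ := hEne; exact ⟨e, (hEO he).1, he⟩)
    (fun hs => h0E (hs (mem_ball_self one_pos)))
  have hxY : x ∈ (D ∩ closure E) \ E := ⟨⟨hxD, hxE.1⟩, hxE.2⟩
  have hFr : IsFrontierData (𝔻) O E ψ χ b 0 := ⟨hD, hψ, hopen, hχ, hχψ, hO, hE, hEO, hEmax⟩
  have hxb := (hFr.local_structure hxY).1
  have hpc : Continuous fun t : ℝ => (b + t * I : ℂ) := by fun_prop
  have hDo := hopen D hD subset_rfl
  set F : Set ℝ := {t | (b + t * I : ℂ) ∉ ψ '' D} with hF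
  have hFc : IsClosed F := by
    have := (hDo.preimage hpc).isClosed_compl
    exact this
  set t₀ := (ψ x).im with ht₀
  have hxt : (b + t₀ * I : ℂ) = ψ x := by rw [← hxb, re_add_im]
  have ht₀F : t₀ ∉ F := fun h => h (by grind)
  have hper : ∀ t : ℝ, t ≠ t₀ → exp (b + t * I) = exp (b + t₀ * I) →
      t ∈ F := by
    rintro t hne he ⟨z, hz, hzt⟩
    have hzx := hinj z hz x hxD (by rw [hzt, ← hxt]; exact he)
    refine hne ?_
    have := congrArg Complex.im hzt
    rw [hzx] at this
    simpa [ht₀] using this.symm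
  have hpi := Real.two_pi_pos
  have hF₂ : t₀ + 2 * π ∈ F := hper _ (by linarith) (by
    rw [← exp_add_two_pi_I (b + t₀ * I)]; congr 1; push_cast; ring)
  have hF₁ : t₀ - 2 * π ∈ F := hper _ (by linarith) (by
    rw [← exp_add_two_pi_I (b + (t₀ - 2 * π : ℝ) * I)]; congr 1; push_cast; ring)
  obtain ⟨t₂, ht₂, ht₂F, ht₂n⟩ := exists_first_mem hFc (γ := id) (by linarith) continuousOn_id
    ht₀F hF₂
  obtain ⟨t₁, ht₁, ht₁F, ht₁n⟩ := exists_last_mem hFc (γ := id) (by linarith) continuousOn_id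
    hF₁ ht₀F
  have hseg : ∀ t ∈ Ioo t₁ t₂, (b + t * I : ℂ) ∈ ψ '' D := fun t ht => by
    rcases le_total t t₀ with h | h
    · exact not_not.1 (ht₁n t ⟨ht.1, h⟩)
    · exact not_not.1 (ht₂n t ⟨h, ht.2⟩)
  have ht12 := ht₁.2.trans ht₂.1
  have hY := hFr.segment_subset hxY ⟨ht₁.2, ht₂.1⟩ hseg
  have hYs : ∀ y ∈ (D ∩ closure E) \ E,
      y ∈ (fun t : ℝ => χ (b + t * I)) '' Ioo t₁ t₂ := fun y hy => by
    refine ⟨(ψ y).im, hFr.subset_segment (convex_ball _ _) hEc ht12 ht₁F ht₂F hseg hY hy, ?_⟩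
    show χ _ = y
    rw [← (hFr.local_structure hy).1, re_add_im,
      hχψ y hy.1.1]
  obtain ⟨ξ₂, hξ₂, hl₂⟩ := hm.exists_segment_end hψ hψe hDo hχ hχψ hpc
    (mem_of_superset (Ioo_mem_nhdsLT ht12) hseg) ht₂F
  obtain ⟨ξ₁, hξ₁, hl₁⟩ := hm.exists_segment_end hψ hψe hDo hχ hχψ (T := -t₁)
    (hpc.comp continuous_neg) (by
      refine mem_of_superset (Ioo_mem_nhdsLT (neg_lt_neg ht12)) fun t ht => ?_
      grind)
    (by grind)
  have hl₁' : Tendsto (fun t : ℝ => χ (b + t * I)) (𝓝[>] t₁) (𝓝 ξ₁) := by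
    have h1 : Tendsto (fun t : ℝ => -t) (𝓝[>] t₁) (𝓝[<] (-t₁)) := tendsto_neg_nhdsGT
    refine (hl₁.comp h1).congr fun t => ?_
    simp only [Function.comp, neg_neg]
  obtain ⟨G, -, hps⟩ := hp.iterate s
  obtain ⟨ζ, hζ, hζp⟩ := exists_periodic_of_arc hps.cont (fun ζ hζ => hps.norm_eq_one hζ) ht12
    (hχ.comp hpc.continuousOn hseg) (fun t ht => (hY t ht).1.1) hξ₁ hξ₂ hl₁' hl₂ (by
      rintro _ ⟨t, ht, rfl⟩
      exact hYs _ (hEs (hY t ht)))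
  rcases hζp with h | h
  · exact hne s hs ζ hζ h
  · rw [← iterate_add_apply] at h
    grind

/-- Stop a path at its first visit to a closed set. -/
lemma exists_stopped_path {φ : ℂ → ℂ} {D X Y : Set ℂ} (hφ : ContinuousOn φ D) (hX : IsClosed X)
    {p : ℝ → ℂ} (hp : ContinuousOn p (Icc 0 1)) (hpD : ∀ t ∈ Icc (0:ℝ) 1, p t ∈ D)
    (hpY : ∀ t ∈ Icc (0:ℝ) 1, φ (p t) ∉ Y) (h0 : φ (p 0) ∉ X) (h1 : φ (p 1) ∈ X) :
    ∃ γ : ℝ → ℂ, ContinuousOn γ (Icc 0 1) ∧ (∀ t ∈ Icc (0:ℝ) 1, γ t ∈ D) ∧ γ 0 = p 0 ∧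
      (∀ t ∈ Ico (0:ℝ) 1, φ (γ t) ∉ X ∧ φ (γ t) ∉ Y) ∧ φ (γ 1) ∈ X := by
  obtain ⟨T, hT, hTX, hTn⟩ := exists_first_mem hX (γ := fun t => φ (p t)) zero_le_one
    (hφ.comp hp hpD) h0 h1
  have hmap : MapsTo (fun t : ℝ => T * t) (Icc 0 1) (Icc 0 1) := fun t ht =>
    ⟨mul_nonneg hT.1.le ht.1, mul_le_one₀ hT.2 ht.1 ht.2⟩
  refine ⟨fun t => p (T * t), hp.comp (by fun_prop) hmap, fun t ht => hpD _ (hmap ht),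
    congrArg p (mul_zero T), fun t ht => ⟨hTn _ ⟨mul_nonneg hT.1.le ht.1, ?_⟩,
      hpY _ (hmap (Ico_subset_Icc_self ht))⟩, by grind⟩
  simp_all

lemma exists_path_of_mem_connectedComponentIn {A : Set ℂ} (hA : IsOpen A) {x y : ℂ} (hx : x ∈ A)
    (hy : y ∈ connectedComponentIn A x) : ∃ p : ℝ → ℂ, ContinuousOn p (Icc 0 1) ∧
      (∀ t ∈ Icc (0:ℝ) 1, p t ∈ A) ∧ p 0 = x ∧ p 1 = y := by
  have h1 :=
    hA.connectedComponentIn.isConnected_iff_isPathConnected.1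
      (isConnected_connectedComponentIn_iff.2 hx)
  have h2 := (h1.joinedIn x (mem_connectedComponentIn hx) y hy).mono (connectedComponentIn_subset _
      _)
  obtain ⟨p, hp, h3, h4, h5⟩ := h2.exists_continuous
  exact ⟨p, hp.continuousOn, fun t _ => h5 t, h3, h4⟩

/-- Small discs around `a`, their lifts and images keep the separation properties of a compact
set. -/
lemma exists_small_disc {s : ℝ → ℂ} (hs : ContinuousOn s (Icc 0 1)) {H h : ℂ → ℂ}
    (hH : Continuous H) (hh : Continuous h)
    (hQ : ∀ z ∈ s '' Icc 0 1 ∪ H '' (s '' Icc 0 1),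
      z + 2 * π * I ∉ s '' Icc 0 1 ∪ H '' (s '' Icc 0 1))
    {B : Set ℂ} (hB : IsCompact B) (ha : exp (s 1) ∉ B) (hha : h (exp (s 1)) ∉ B) :
    ∃ ρ, 0 < ρ ∧ ρ < ‖exp (s 1)‖ ∧ ∃ l : ℂ → ℂ,
      ContinuousOn l (closedBall (exp (s 1)) ρ) ∧
      (∀ z ∈ closedBall (exp (s 1)) ρ, exp (l z) = z) ∧
      l (exp (s 1)) = s 1 ∧
      (∀ A, A = l '' closedBall (exp (s 1)) ρ ∪ s '' Icc 0 1 →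
        ∀ z ∈ A ∪ H '' A, z + 2 * π * I ∉ A ∪ H '' A) ∧
      ∀ x ∈ closedBall (exp (s 1)) ρ, x ∉ B ∧ h x ∉ B := by
  set a := exp (s 1) with ha_def
  have ha0 : a ≠ 0 := exp_ne_zero _
  set l : ℂ → ℂ := fun z => s 1 + log (z / a) with hl
  have hl1 : l a = s 1 := by simp only [hl]; rw [div_self ha0, Complex.log_one, add_zero]
  have hlc : ∀ z, dist z a < ‖a‖ → ContinuousAt l z := fun z hz => by
    have h1 : z / a ∈ slitPlane := by
      have : z / a = 1 + (z - a) / a := by field_simp; ring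
      rw [this]
      refine Complex.mem_slitPlane_of_norm_lt_one ?_
      rw [norm_div, div_lt_one (norm_pos_iff.2 ha0), ← dist_eq_norm]
      exact hz
    exact continuousAt_const.add ((continuousAt_id.div_const a).clog h1)
  have hla : ContinuousAt l a := hlc a (by rw [dist_self]; exact norm_pos_iff.2 ha0)
  set Q := s '' Icc 0 1 ∪ H '' (s '' Icc 0 1) with hQd
  have hQc : IsCompact Q := by
    have h1 := isCompact_Icc.image_of_continuousOn hs
    exact h1.union (h1.image hH)
  have hQT : IsCompact ((fun z => z + 2 * π * I) '' Q) := hQc.image (by fun_prop)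
  have hdisj : Disjoint Q ((fun z => z + 2 * π * I) '' Q) := by
    rw [Set.disjoint_left]
    rintro _ h1 ⟨z, hz, rfl⟩
    exact hQ z hz h1
  obtain ⟨δ, hδ, hthick⟩ := hdisj.exists_thickenings hQc hQT.isClosed
  have hs1Q : s 1 ∈ Q := Or.inl ⟨1, ⟨zero_le_one, le_rfl⟩, rfl⟩
  have hHs1Q : H (s 1) ∈ Q := Or.inr ⟨_, ⟨1, ⟨zero_le_one, le_rfl⟩, rfl⟩, rfl⟩
  have hBo := hB.isClosed.isOpen_compl
  have hev : ∀ᶠ x in 𝓝 a, l x ∈ ball (s 1) δ ∧ H (l x) ∈ ball (H (s 1)) δ ∧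
      x ∉ B ∧ h x ∉ B := by
    refine (hla.eventually ?_).and (((hH.continuousAt.comp hla).eventually ?_).and
      ((show ∀ᶠ x in 𝓝 a, x ∉ B from hBo.mem_nhds ha).and
        (hh.continuousAt.eventually (hBo.mem_nhds hha))))
    · rw [hl1]; exact ball_mem_nhds _ hδ
    · rw [Function.comp, hl1]; exact ball_mem_nhds _ hδ
  obtain ⟨ε, hε, hev⟩ := Metric.nhds_basis_closedBall.eventually_iff.1 hev
  have hapos := norm_pos_iff.2 ha0
  refine ⟨min ε (‖a‖ / 2), lt_min hε (half_pos hapos),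
    (min_le_right _ _).trans_lt (half_lt_self hapos), l, ?_, ?_, hl1, ?_, ?_⟩
  · intro z hz
    refine (hlc z ?_).continuousWithinAt
    exact (mem_closedBall.1 hz).trans_lt ((min_le_right _ _).trans_lt (half_lt_self hapos))
  · intro z hz
    have hz0 : z ≠ 0 := by
      rintro rfl
      have := (mem_closedBall.1 hz).trans_lt ((min_le_right _ _).trans_lt (half_lt_self hapos))
      rw [dist_eq_norm, zero_sub, norm_neg] at this
      exact lt_irrefl _ this
    simp only [hl]
    rw [exp_add, exp_log (div_ne_zero hz0 ha0), ← ha_def, mul_div_cancel₀ _ ha0]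
  · rintro A rfl
    have hsub : (l '' closedBall a (min ε (‖a‖ / 2)) ∪ s '' Icc 0 1) ∪
        H '' (l '' closedBall a (min ε (‖a‖ / 2)) ∪ s '' Icc 0 1) ⊆ Metric.thickening δ Q := by
      have hmem : ∀ x ∈ closedBall a (min ε (‖a‖ / 2)), _ := fun x hx =>
        hev (Metric.closedBall_subset_closedBall (min_le_left _ _) hx)
      rintro _ ((⟨x, hx, rfl⟩ | hz) | ⟨_, ⟨x, hx, rfl⟩ | hz, rfl⟩)
      · exact Metric.mem_thickening_iff.2 ⟨_, hs1Q, (hmem x hx).1⟩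
      · exact Metric.self_subset_thickening hδ _ (Or.inl hz)
      · exact Metric.mem_thickening_iff.2 ⟨_, hHs1Q, (hmem x hx).2.1⟩
      · exact Metric.self_subset_thickening hδ _ (Or.inr (mem_image_of_mem _ hz))
    intro z hz hz'
    obtain ⟨q, hq, hzq⟩ := Metric.mem_thickening_iff.1 (hsub hz)
    refine Set.disjoint_left.1 hthick (hsub hz') (Metric.mem_thickening_iff.2 ⟨_, ⟨q, hq, rfl⟩, ?_⟩)
    rwa [dist_add_right]
  · intro x hx
    exact (hev (Metric.closedBall_subset_closedBall (min_le_left _ _) hx)).2.2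

/-- The accessible case and the hidden case together: a fixed point `exp (s 0)` off `V` which is
joined to the frontier of `V` by a path `exp ∘ s` off `V`, whose lift stays off the translates of
its images, is incompatible with the absence of periodic points on the circle. -/
theorem IsConjPair.false_of_path {V : Set ℂ} {φ k k' : ℂ → ℂ} {g : ℂ ≃ₜ ℂ}
    (hm : IsPlaneModel V φ) (hp : IsConjPair φ g k k') (h0 : g 0 = 0)
    (hne : ∀ n : ℕ, 1 ≤ n → ∀ ζ : ℂ, ‖ζ‖ = 1 → k^[n] ζ ≠ ζ)
    (hnw : ∀ N : ℕ, 1 ≤ N → ∀ W ⊆ V, IsOpen W → W.Nonempty →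
      ∃ n : ℕ, 1 ≤ n ∧ ((g^[N])^[n] '' W ∩ W).Nonempty)
    {s : ℝ → ℂ} (hs : ContinuousOn s (Icc 0 1)) (hs0 : g (exp (s 0)) = exp (s 0))
    (hsV : ∀ t ∈ Icc (0:ℝ) 1, exp (s t) ∉ V) (hs1 : exp (s 1) ∈ closure V)
    (hQ : ∀ G : ℂ → ℂ, Continuous G → (∀ w, exp (G w) = g (exp w)) →
      G (s 0) = s 0 → ∀ N : ℕ, 1 ≤ N → ∀ z ∈ s '' Icc 0 1 ∪ G^[N] '' (s '' Icc 0 1),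
      z + 2 * π * I ∉ s '' Icc 0 1 ∪ G^[N] '' (s '' Icc 0 1)) : False := by
  obtain ⟨κ, hκ, hinj, hexp⟩ := hm.exists_logLift
  obtain ⟨G, F, N, hG, hGe, hGc, hF, hFre, hFG, hFe, hFθ⟩ := hp.exists_lifts hm h0
    (fun ζ hζ => hne 1 le_rfl ζ hζ) hκ hexp hs0 (4 * π)
  have hN : 1 ≤ N := by
    by_contra hN
    have hN0 : N = 0 := by omega
    subst hN0
    have h1 : EqOn F id {w | w.re < 0} := fun w hw => hinj (hFre w hw) hw (hFG w hw)
    have h2 := h1.of_subset_closure hF continuousOn_id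
      (fun w (hw : w.re < 0) => show w.re ≤ 0 from hw.le) (by simp)
    obtain ⟨θ', h3, h4⟩ := hFθ 0
    rw [h2 (show ((0:ℝ) * I).re ≤ 0 by simp)] at h3
    have h5 := congrArg Complex.im h3
    simp at h5
    rw [← h5] at h4
    simp at h4
    linarith [Real.pi_pos]
  obtain ⟨h, hh, hpN⟩ := hp.iterate N
  have hhN := funext hh
  have hH := hG.iterate N
  have hHe : ∀ w, exp (G^[N] w) = h (exp w) := fun w => by
    rw [hhN]; exact (show Semiconj exp G g from hGe).iterate_right N w
  have hH0 := iterate_fixed hGc N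
  have hh0 : h 0 = 0 := by rw [hhN]; exact iterate_fixed h0 N
  have h1mem : (1:ℝ) ∈ Icc (0:ℝ) 1 := ⟨zero_le_one, le_rfl⟩
  have ha := hsV 1 h1mem
  set B := φ '' closedBall 0 (1 / 2) with hBd
  have hBV : B ⊆ V := by
    rintro _ ⟨z, hz, rfl⟩
    exact hm.mem (closedBall_subset_ball (by norm_num) hz)
  have hB := (isCompact_closedBall (0:ℂ) (1 / 2)).image_of_continuousOn
    (hm.cont.mono (closedBall_subset_ball (by norm_num)))
  obtain ⟨ρ, hρ, hρa, l, hl, hle, hl1, hPT, hXB⟩ := exists_small_disc hs hH h.continuous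
    (hQ G hG hGe hGc N hN) hB (fun hb => ha (hBV hb))
    (fun hb => ha ((hpN.apply_mem_iff hm).1 (hBV hb)))
  set X := closedBall (exp (s 1)) ρ with hX
  have hXc : IsClosed X := isClosed_closedBall
  have hhXc := h.isClosedMap _ hXc
  have h0B : φ 0 ∈ B := mem_image_of_mem _ (mem_closedBall_self (by norm_num))
  have h0X := fun h' => (hXB _ h').1 h0B
  have hBC : ∀ z : ℂ, ‖z‖ ≤ 1 / 2 → φ z ∉ X ∪ h '' X := by
    rintro z hz (h' | ⟨x, hx, he⟩)
    · exact (hXB _ h').1 (mem_image_of_mem _ (mem_closedBall_zero_iff.2 hz))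
    · exact (hXB _ hx).2 (he ▸ mem_image_of_mem _ (mem_closedBall_zero_iff.2 hz))
  have h0hX := fun h' => hBC 0 (by simp) (Or.inr h')
  have hAo : IsOpen {z ∈ 𝔻 | φ z ∉ X} :=
    hm.cont.isOpen_inter_preimage isOpen_ball hXc.isOpen_compl
  have h0A : (0:ℂ) ∈ {z ∈ 𝔻 | φ z ∉ X} := ⟨mem_ball_self one_pos, h0X⟩
  have hneN : ∀ n : ℕ, 1 ≤ n → ∀ ζ : ℂ, ‖ζ‖ = 1 → (k^[N])^[n] ζ ≠ ζ := fun n hn ζ hζ => by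
    rw [← iterate_mul]
    exact hne _ (Nat.mul_pos hN hn) ζ hζ
  have hnwN : ∀ W ⊆ V, IsOpen W → W.Nonempty → ∃ n : ℕ, 1 ≤ n ∧ (h^[n] '' W ∩ W).Nonempty := by
    rw [hhN]; exact hnw N hN
  -- a path to `h '' X`
  obtain ⟨z₂, hz₂, hz₂X⟩ := hpN.exists_apply_mem_closedBall hm hh0 hneN hnwN ha hs1 hρ hρa
  obtain ⟨p₂, hp₂, hp₂A, hp₂0, hp₂1⟩ := exists_path_of_mem_connectedComponentIn hAo h0A hz₂
  have hz₂b := (connectedComponentIn_subset _ _ hz₂).1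
  obtain ⟨γ₂, hγ₂, hγb₂, hγ0₂, hγC₂, hγX₂⟩ := exists_stopped_path hm.cont hhXc hp₂
    (fun t ht => (hp₂A t ht).1) (fun t ht => (hp₂A t ht).2) (by rw [hp₂0]; exact h0hX)
    (by
      rw [hp₂1]
      refine ⟨_, hz₂X, ?_⟩
      rw [← hpN.conj _ (hpN.ball' hz₂b), hpN.right _ (ball_subset_closedBall hz₂b)])
  -- a path to `X`
  obtain ⟨z₁, hz₁, hz₁X⟩ := hpN.symm.exists_apply_mem_closedBall hm
    (by rw [Homeomorph.symm_apply_eq, hh0])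
    (by
      intro n hn ζ hζ he
      obtain ⟨_, -, hpn⟩ := hpN.iterate n
      have h2 := hpn.right ζ (mem_closedBall_zero_iff.2 hζ.le)
      grind)
    (by
      intro W hWV hW hWne
      obtain ⟨n, hn, _, ⟨w, hw, rfl⟩, hw'⟩ := hnwN W hWV hW hWne
      refine ⟨n, hn, w, ⟨_, hw', ?_⟩, hw⟩
      exact (show Function.LeftInverse h.symm h from h.symm_apply_apply).iterate n w)
    ha hs1 hρ hρa
  obtain ⟨p₁, hp₁, hp₁A, hp₁0, hp₁1⟩ := exists_path_of_mem_connectedComponentIn hAo h0A hz₁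
  obtain ⟨γ₁, hγ₁, hγb₁, hγ0₁, hγC₁, hγX₁⟩ := exists_stopped_path (φ := φ) (X := X) (Y := h '' X)
    (p := fun t => k^[N] (p₁ t)) hm.cont hXc
    ((hpN.cont.mono ball_subset_closedBall).comp hp₁ fun t ht => (hp₁A t ht).1)
    (fun t ht => hpN.ball (hp₁A t ht).1)
    (fun t ht => by
      rw [hpN.conj _ (hp₁A t ht).1, h.injective.mem_set_image]
      exact (hp₁A t ht).2)
    (by rw [hp₁0, hpN.apply_zero hm hh0]; exact h0X) (by rw [hp₁1]; exact hz₁X)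
  obtain ⟨θ, hθ⟩ := hpN.exists_abs_sub_le hm hh0 hκ hinj hexp hH hHe hF hFre hFG hFe hs hH0 hsV
    hρ.le hl hle hl1 rfl (hPT _ rfl) hX rfl hBC hγ₁ hγ₂ hγb₁ hγb₂
    (by rw [hγ0₁, hp₁0, hpN.apply_zero hm hh0]) (by rw [hγ0₂, hp₂0])
    (fun t ht => by grind)
    (fun t ht => by grind)
    hγX₁ hγX₂
  obtain ⟨θ', hθ', hlt⟩ := hFθ θ
  grind

section Packaging

variable {S : Type*} [MetricSpace S] [CompactSpace S] {j : ℂ → S} {q : S} {U : Set S}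

/-- Riemann maps onto simply connected domains of the sphere. -/
lemma IsPlaneChart.exists_models (hj : IsPlaneChart j q) (hU : IsOpen U) (hq : q ∉ U) {b : S}
    (hb : b ≠ q) (hbU : b ∉ U) (hsc : SimplyConnectedSpace U) (h0 : j 0 ∈ U) :
    ∃ φ : ℂ → ℂ, IsDiscModel U (j ∘ φ) ∧ IsPlaneModel (j ⁻¹' U) φ := by
  have hV := hU.preimage hj.emb.continuous
  have hUr := image_preimage_eq_of_subset fun x hx =>
    hj.exists_eq fun h => hq (h ▸ hx)
  have hVs : IsSimplyConnected (j ⁻¹' U) := by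
    rw [← hj.emb.isEmbedding.isSimplyConnected_image, hUr]; exact hsc
  obtain ⟨b', rfl⟩ := hj.exists_eq hb
  obtain ⟨φ, hd, hi, himg, hφ0, hφd⟩ := exists_riemann_map hV hVs
    (fun h => hbU (h.ge (mem_univ b'))) h0
  have hm := isDiscModel_comp hj hU hq hb hbU hVs hd hi himg
  refine ⟨φ, hm, hd.continuousOn, hd.differentiableAt (ball_mem_nhds 0 one_pos), hφd, hi,
    himg, fun W hW hWb => ?_, hφ0, fun p b a ha hp hpa => ?_⟩
  · have h1 := (hm.open_map W hW hWb).preimage hj.emb.continuous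
    rwa [image_comp, preimage_image_eq _ hj.emb.injective] at h1
  · exact hm.exists_landing (a := j a) ha hp ((hj.emb.continuous.tendsto a).comp hpa)

/-- The homeomorphism of the plane induced by a homeomorphism fixing the omitted point. -/
def IsPlaneChart.conj (hj : IsPlaneChart j q) (h : S ≃ₜ S) (hq : h q = q) : ℂ ≃ₜ ℂ where
  toFun z := invFun j (h (j z))
  invFun z := invFun j (h.symm (j z))
  left_inv z := by
    beta_reduce
    rw [hj.apply_invFun fun e => hj.apply_ne z (h.injective (e.trans hq.symm)),
      h.symm_apply_apply, hj.invFun_apply]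
  right_inv z := by
    beta_reduce
    rw [hj.apply_invFun fun e => hj.apply_ne z (by rw [← h.apply_symm_apply (j z), e, hq]),
      h.apply_symm_apply, hj.invFun_apply]
  continuous_toFun := hj.continuousOn_invFun.comp_continuous
    (h.continuous.comp hj.emb.continuous) fun z e => hj.apply_ne z (h.injective (Eq.trans e
      hq.symm))
  continuous_invFun := hj.continuousOn_invFun.comp_continuous
    (h.symm.continuous.comp hj.emb.continuous) fun z (e : h.symm (j z) = q) =>
      hj.apply_ne z (by rw [← h.apply_symm_apply (j z), e, hq])

lemma IsPlaneChart.apply_conj (hj : IsPlaneChart j q) (h : S ≃ₜ S) (hq : h q = q) (z : ℂ) :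
    j (hj.conj h hq z) = h (j z) :=
  hj.apply_invFun fun e => hj.apply_ne z (h.injective (e.trans hq.symm))

lemma IsPlaneChart.apply_conj_iterate (hj : IsPlaneChart j q) (h : S ≃ₜ S) (hq : h q = q) (n : ℕ)
    (z : ℂ) : j ((hj.conj h hq)^[n] z) = h^[n] (j z) :=
  (Semiconj.iterate_right (fun z => hj.apply_conj h hq z) n).eq z

/-- The extension of a homeomorphism agreeing with an iterate of `f` on `U` is the corresponding
iterate. -/
lemma IsDiscModel.discExt_eq_iterate {ψ : ℂ → S} (hm : IsDiscModel U ψ) {f h : S ≃ₜ S}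
    (hf : f '' U = U) (hh : h '' U = U) {m : ℕ} (hfh : EqOn h f^[m] U) :
    EqOn (discExt ψ h) (discExt ψ f)^[m] (closedBall 0 1) := by
  have hfm : MapsTo f U U := fun x hx => hf ▸ mem_image_of_mem f hx
  have hhm : MapsTo h U U := fun x hx => hh ▸ mem_image_of_mem h hx
  refine eqOn_closedBall_of_eqOn_ball (hm.continuousOn_discExt h hh)
    ((hm.continuousOn_discExt f hf).iterate (hm.discExt_mapsTo f hf) m) fun z hz => ?_
  rw [hm.discExt_eq h.continuous hhm hz, hfh (hm.mem hz)]
  clear hfh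
  induction m with
  | zero => exact hm.inv_apply hz
  | succ m ih =>
    have h1 := hfm.iterate m (hm.mem hz)
    rw [iterate_succ_apply', iterate_succ_apply', ← ih,
      hm.discExt_eq f.continuous hfm (hm.inv_mem h1), hm.apply_inv h1]

/-- Extensions of conjugates of homeomorphisms preserve the unit circle. -/
lemma IsDiscModel.norm_discExt {ψ : ℂ → S} (hm : IsDiscModel U ψ) {f : S ≃ₜ S} (hf : f '' U = U)
    {ζ : ℂ} (hζ : ‖ζ‖ = 1) : ‖discExt ψ f ζ‖ = 1 := by
  have hf' : f.symm '' U = U := by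
    conv_lhs => rw [← hf, ← image_comp, f.symm_comp_self, image_id]
  have hζ' := mem_closedBall_zero_iff.2 hζ.le
  refine (mem_closedBall_zero_iff.1 (hm.discExt_mapsTo f hf hζ')).lt_or_eq.resolve_left fun h => ?_
  have h1 := hm.discExt_comp f f.symm hf hf' (by rw [f.self_trans_symm]; simp) hζ'
  have hfm' : MapsTo f.symm U U := fun x hx => hf' ▸ mem_image_of_mem f.symm hx
  rw [f.self_trans_symm, hm.discExt_refl hζ', id, comp_apply,
    hm.discExt_eq f.symm.continuous hfm' (mem_ball_zero_iff.2 h)] at h1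
  have h2 := mem_ball_zero_iff.1 (hm.conj_mem hfm' (mem_ball_zero_iff.2 h))
  grind

variable [LocallyConnectedSpace S]

/-- Under an extension without periodic prime ends, there is a fixed point in `U`. -/
lemma IsPlaneChart.exists_fixed (hj : IsPlaneChart j q) (hU : IsOpen U) (hq : q ∉ U) {b : S}
    (hb : b ≠ q) (hbU : b ∉ U) (hsc : SimplyConnectedSpace U) (h0 : j 0 ∈ U) {f : S ≃ₜ S}
    (hf : f '' U = U) {F : PrimeEndComp U ≃ₜ PrimeEndComp U} (hF : IsPEExtension f U F)
    (hper : ∀ (p : PrimeEnd U) (n : ℕ), 1 ≤ n → (⇑F)^[n] (peEnd U p) ≠ peEnd U p) :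
    ∃ x ∈ U, f x = x := by
  obtain ⟨φ, hm, -⟩ := hj.exists_models hU hq hb hbU hsc h0
  obtain ⟨z, hz, hfz⟩ := exists_fixed_in_ball (hm.continuousOn_discExt f hf)
    (hm.discExt_mapsTo f hf) fun ζ hζ => hm.discExt_iterate_ne f hf F hF hper hζ le_rfl
  have hfm : MapsTo f U U := fun x hx => hf ▸ mem_image_of_mem f hx
  rw [hm.discExt_eq f.continuous hfm hz] at hfz
  exact ⟨_, hm.mem hz, by rw [← hm.apply_inv (hfm (hm.mem hz)), hfz]⟩

/-- The obstruction `IsConjPair.false_of_path`, for a homeomorphism of the sphere. -/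
theorem IsPlaneChart.false_of_path (hj : IsPlaneChart j q) (hU : IsOpen U) (hq : q ∉ U)
    (hsc : SimplyConnectedSpace U) (h0 : j 0 ∈ U) {f h : S ≃ₜ S} (hf : f '' U = U)
    (hnw : IsNonwanderingMap f)
    {F : PrimeEndComp U ≃ₜ PrimeEndComp U} (hF : IsPEExtension f U F)
    (hper : ∀ (p : PrimeEnd U) (n : ℕ), 1 ≤ n → (⇑F)^[n] (peEnd U p) ≠ peEnd U p)
    {m : ℕ} (hm : 1 ≤ m) (hfh : EqOn h f^[m] U) (hhq : h q = q) (hh0 : h (j 0) = j 0)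
    {s : ℝ → ℂ} (hs : ContinuousOn s (Icc 0 1))
    (hs0 : h (j (exp (s 0))) = j (exp (s 0)))
    (hsV : ∀ t ∈ Icc (0:ℝ) 1, j (exp (s t)) ∉ U) (hs1 : j (exp (s 1)) ∈ closure U)
    (hQ : ∀ G : ℂ → ℂ, Continuous G → (∀ w, j (exp (G w)) = h (j (exp w))) →
      G (s 0) = s 0 → ∀ N : ℕ, 1 ≤ N → ∀ z ∈ s '' Icc 0 1 ∪ G^[N] '' (s '' Icc 0 1),
      z + 2 * π * I ∉ s '' Icc 0 1 ∪ G^[N] '' (s '' Icc 0 1)) : False := by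
  have hfm : MapsTo f U U := fun x hx => hf ▸ mem_image_of_mem f hx
  have hh : h '' U = U := by
    have h1 : ∀ n : ℕ, f^[n] '' U = U := fun n => by
      induction n with
      | zero => simp
      | succ n ih => rw [iterate_succ', image_comp, ih, hf]
    rw [hfh.image_eq, h1]
  have hhm : MapsTo h U U := fun x hx => hh ▸ mem_image_of_mem h hx
  have hh' : h.symm '' U = U := by
    conv_lhs => rw [← hh, ← image_comp, h.symm_comp_self, image_id]
  have hhm' : MapsTo h.symm U U := fun x hx => hh' ▸ mem_image_of_mem h.symm hx
  obtain ⟨φ, hd, hp⟩ := hj.exists_models hU hq (hj.apply_ne _) (hsV 0 (by simp)) hsc h0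
  have hit := hd.discExt_eq_iterate hf hh hfh
  set g := hj.conj h hhq with hg
  have hgj := hj.apply_conj h hhq
  have hc : ∀ a b : S ≃ₜ S, a '' U = U → b '' U = U → a.trans b = Homeomorph.refl S →
      ∀ z ∈ closedBall (0:ℂ) 1, discExt (j ∘ φ) b (discExt (j ∘ φ) a z) = z := by
    intro a b ha hb hab z hz
    have h1 := hd.discExt_comp a b ha hb (by rw [hab]; simp) hz
    rw [hab, hd.discExt_refl hz] at h1
    exact h1.symm
  have hball : ∀ a : S ≃ₜ S, MapsTo a U U →
      MapsTo (discExt (j ∘ φ) a) 𝔻 𝔻 := fun a ha z hz => by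
    rw [hd.discExt_eq a.continuous ha hz]; exact hd.conj_mem ha hz
  have hpair : IsConjPair φ g (discExt (j ∘ φ) h) (discExt (j ∘ φ) h.symm) :=
    ⟨hd.continuousOn_discExt h hh, hd.continuousOn_discExt _ hh', hd.discExt_mapsTo h hh,
      hd.discExt_mapsTo _ hh', hball h hhm, hball _ hhm', hc h h.symm hh hh' h.self_trans_symm,
      hc h.symm h hh' hh h.symm_trans_self, fun z hz => hj.emb.injective ?_⟩
  swap
  · rw [hgj, hd.discExt_eq h.continuous hhm hz]
    exact hd.apply_inv (hhm (hd.mem hz))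
  refine hpair.false_of_path hp (hj.emb.injective ((hgj 0).trans hh0)) ?_ ?_ hs
    (hj.emb.injective ((hgj _).trans hs0)) hsV ?_ fun G hG hGe => hQ G hG fun w => by
      rw [hGe, hgj]
  · intro n hn ζ hζ hfix
    have hζ' := mem_closedBall_zero_iff.2 hζ.le
    have h1 : ∀ n : ℕ, (discExt (j ∘ φ) h)^[n] ζ = (discExt (j ∘ φ) f)^[m * n] ζ := by
      intro n
      induction n with
      | zero => rfl
      | succ n ih =>
        rw [iterate_succ_apply', ih, mul_add_one, add_comm, iterate_add_apply]
        exact hit ((hd.discExt_mapsTo f hf).iterate _ hζ')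
    rw [h1] at hfix
    exact hd.discExt_iterate_ne f hf F hF hper hζ (Nat.mul_pos hm hn) hfix
  · intro N hN W hWV hW hWne
    obtain ⟨n, hn, _, ⟨_, ⟨w, hw, rfl⟩, rfl⟩, w', hw', he⟩ := (hnw.iterate f.continuous
      (Nat.mul_pos hm hN)) (j '' W) (hj.emb.isOpenMap W hW) (hWne.image j)
    have h1 : ∀ n : ℕ, ∀ x ∈ U, h^[n] x = f^[m * n] x := by
      intro n x hx
      induction n with
      | zero => rfl
      | succ n ih =>
        rw [iterate_succ_apply', ih, mul_add_one, add_comm, iterate_add_apply]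
        exact hfh (hfm.iterate _ hx)
    refine ⟨n, hn, w', ⟨w, hw, hj.emb.injective ?_⟩, hw'⟩
    rw [he, ← iterate_mul, ← iterate_mul, hj.apply_conj_iterate,
      h1 _ _ (hWV hw), mul_assoc]
  · rw [← hj.emb.isOpenMap.preimage_closure_eq_closure_preimage hj.emb.continuous]
    exact hs1

end Packaging

/-- A homeomorphism of the plane moving the origin and supported in a disc. -/
lemma exists_homeomorph_ball {r : ℝ} {v : ℂ} (hv : ‖v‖ < r) :
    ∃ T : ℂ ≃ₜ ℂ, (∀ z, r ≤ ‖z‖ → T z = z) ∧ T 0 = v := by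
  have hr : 0 < r := (norm_nonneg v).trans_lt hv
  set c : NNReal := ⟨‖v‖ / r, by positivity⟩ with hc
  set F : ℂ → ℂ := fun z => z + (max 0 (1 - ‖z‖ / r) : ℝ) • v with hF
  have hA : ApproximatesLinearOn F (ContinuousLinearEquiv.refl ℝ ℂ : ℂ →L[ℝ] ℂ) univ c := by
    intro x _ y _
    have h1 : F x - F y - (ContinuousLinearEquiv.refl ℝ ℂ : ℂ →L[ℝ] ℂ) (x - y) =
        (max 0 (1 - ‖x‖ / r) - max 0 (1 - ‖y‖ / r) : ℝ) • v := by
      simp only [hF, ContinuousLinearEquiv.coe_coe, ContinuousLinearEquiv.refl_apply, sub_smul]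
      ring
    have h2 : |max 0 (1 - ‖x‖ / r) - max 0 (1 - ‖y‖ / r)| ≤ ‖x - y‖ / r := by
      have h3 := abs_max_sub_max_le_abs (1 - ‖x‖ / r) (1 - ‖y‖ / r) 0
      rw [max_comm _ (0:ℝ), max_comm _ (0:ℝ)] at h3
      refine h3.trans ?_
      rw [show 1 - ‖x‖ / r - (1 - ‖y‖ / r) = (‖y‖ - ‖x‖) / r by ring, abs_div, abs_of_pos hr,
        ← norm_neg (x - y), neg_sub]
      gcongr
      exact abs_norm_sub_norm_le y x
    rw [h1, norm_smul, Real.norm_eq_abs]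
    calc _ ≤ ‖x - y‖ / r * ‖v‖ := by gcongr
      _ = ‖v‖ / r * ‖x - y‖ := by ring
  refine ⟨hA.toHomeomorph F (Or.inr ?_), fun z hz => ?_, ?_⟩
  · have h1 : ‖((ContinuousLinearEquiv.refl ℝ ℂ).symm : ℂ →L[ℝ] ℂ)‖₊ = 1 := by
      ext; exact ContinuousLinearMap.norm_id
    rw [h1, inv_one, ← NNReal.coe_lt_coe]
    exact (div_lt_one hr).2 hv
  · show F z = z
    have h1 : 1 - ‖z‖ / r ≤ 0 := by rw [sub_nonpos, one_le_div hr]; exact hz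
    simp [hF, h1]
  · show F 0 = v
    simp [hF]

/-- The map of the sphere induced by a map of the plane. -/
def chartMap {S : Type*} (j : ℂ → S) (q : S) (T : ℂ → ℂ) (x : S) : S :=
  open Classical in if x = q then q else j (T (invFun j x))

namespace IsPlaneChart

variable {S : Type*} [TopologicalSpace S] [T2Space S] {j : ℂ → S} {q : S}

lemma chartMap_apply (hj : IsPlaneChart j q) (T : ℂ → ℂ) (z : ℂ) :
    chartMap j q T (j z) = j (T z) := by
  rw [chartMap, if_neg (hj.apply_ne z), hj.invFun_apply]

lemma chartMap_comp (hj : IsPlaneChart j q) {T T' : ℂ → ℂ} (h : ∀ z, T' (T z) = z) (x : S) :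
    chartMap j q T' (chartMap j q T x) = x := by
  by_cases hx : x = q
  · simp [chartMap, hx]
  · obtain ⟨z, rfl⟩ := hj.exists_eq hx
    rw [hj.chartMap_apply, hj.chartMap_apply, h]

lemma continuous_chartMap (hj : IsPlaneChart j q) {T : ℂ → ℂ} (hT : Continuous T) {r : ℝ}
    (hr : ∀ z, r ≤ ‖z‖ → T z = z) : Continuous (chartMap j q T) := by
  refine continuous_iff_continuousAt.2 fun x => ?_
  by_cases hx : x = q
  · have h1 : (j '' closedBall 0 r)ᶜ ∈ 𝓝 x := by
      refine ((isCompact_closedBall (0:ℂ) r).image hj.emb.continuous).isClosed.isOpen_compl.mem_nhds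
        ?_
      rintro ⟨z, -, rfl⟩
      exact hj.apply_ne z hx
    refine continuousAt_id.congr (mem_of_superset h1 fun y hy => ?_)
    by_cases hyq : y = q
    · simp [chartMap, hyq]
    · obtain ⟨z, rfl⟩ := hj.exists_eq hyq
      show j z = chartMap j q T (j z)
      rw [hj.chartMap_apply, hr z]
      by_contra hz
      exact hy ⟨z, by simpa using (not_le.1 hz).le, rfl⟩
  · have h1 : ContinuousOn (fun y => j (T (invFun j y))) {q}ᶜ :=
      (hj.emb.continuous.comp hT).comp_continuousOn hj.continuousOn_invFun
    refine (h1.congr fun y (hy : y ≠ q) => ?_).continuousAt (isOpen_compl_singleton.mem_nhds hx)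
    rw [chartMap, if_neg hy]

end IsPlaneChart

/-- Points of a connected open set of the sphere can be moved to each other by homeomorphisms
supported in the set. -/
theorem exists_homeomorph_apply_eq {D : Set SphereTwo} (hD : IsOpen D) (hc : IsPreconnected D)
    {x y : SphereTwo} (hx : x ∈ D) (hy : y ∈ D) :
    ∃ κ : SphereTwo ≃ₜ SphereTwo, (∀ z ∉ D, κ z = z) ∧ κ x = y := by
  refine hc.induction₂ (fun x y => ∃ κ : SphereTwo ≃ₜ SphereTwo, (∀ z ∉ D, κ z = z) ∧ κ x = y)
    (fun a ha => ?_) ?_ ?_ hx hy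
  · obtain ⟨q, hq⟩ : ∃ q, a ≠ q := ⟨-a, ne_neg_of_mem_unit_sphere ℝ a⟩
    obtain ⟨j, hj, rfl⟩ := exists_planeChart hq
    obtain ⟨r, hr, hrD⟩ := Metric.isOpen_iff.1 (hD.preimage hj.emb.continuous) 0 ha
    refine mem_nhdsWithin_of_mem_nhds (mem_of_superset
      ((hj.emb.isOpenMap _ isOpen_ball).mem_nhds ⟨0, mem_ball_self hr, rfl⟩) ?_)
    rintro _ ⟨v, hv, rfl⟩
    obtain ⟨T, hT, hT0⟩ := exists_homeomorph_ball (mem_ball_zero_iff.1 hv)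
    have hT' : ∀ z, r ≤ ‖z‖ → T.symm z = z := fun z hz => by
      conv_lhs => rw [← hT z hz, T.symm_apply_apply]
    refine ⟨⟨⟨chartMap j q T, chartMap j q T.symm, hj.chartMap_comp T.symm_apply_apply,
      hj.chartMap_comp T.apply_symm_apply⟩, hj.continuous_chartMap T.continuous hT,
      hj.continuous_chartMap T.symm.continuous hT'⟩, fun z hz => ?_, ?_⟩
    · show chartMap j q T z = z
      by_cases hzq : z = q
      · simp [chartMap, hzq]
      · obtain ⟨w, rfl⟩ := hj.exists_eq hzq
        rw [hj.chartMap_apply, hT]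
        by_contra hw
        exact hz (hrD (mem_ball_zero_iff.2 (not_le.1 hw)))
    · show chartMap j q T (j 0) = j v
      rw [hj.chartMap_apply, hT0]
  · rintro a b c - - - ⟨κ, h1, h2⟩ ⟨κ', h3, h4⟩
    exact ⟨κ.trans κ', fun z hz => by simp [h1 z hz, h3 z hz], by simp [h2, h4]⟩
  · rintro a b - - ⟨κ, h1, h2⟩
    exact ⟨κ.symm, fun z hz => by rw [κ.symm_apply_eq, h1 z hz], by rw [κ.symm_apply_eq, h2]⟩

/-- A nonvanishing function near a point whose logarithm exists on an overlap extends without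
zeros to the complement of the point, and hence has no winding around the point. -/
theorem IsPlaneChart.exists_logVar_eq_zero {j : ℂ → SphereTwo} {q : SphereTwo}
    (hj : IsPlaneChart j q) {O W : Set SphereTwo} (hO : IsOpen O) (hW : IsOpen W)
    (hOW : ∀ x, x ∈ O ∨ x ∈ W) (h0 : j 0 ∉ O) {u L : SphereTwo → ℂ}
    (hu : ContinuousOn u (W \ {j 0})) (hu0 : ∀ x ∈ W, x ≠ j 0 → u x ≠ 0)
    (hL : ContinuousOn L (O ∩ W)) (hLu : ∀ x ∈ O ∩ W, exp (L x) = u x) :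
    ∃ ρ > 0, ∀ r, 0 < r → r < ρ → logVar (fun t => u (j (circ r t))) = 0 := by
  classical
  obtain ⟨χ₀, hχW, hχO, -⟩ := exists_continuous_zero_one_of_isClosed hW.isClosed_compl
    hO.isClosed_compl (disjoint_left.2 fun x h1 h2 => (hOW x).elim h2 h1)
  have hxW : ∀ x, 0 < χ₀ x → x ∈ W := fun x hx => by
    by_contra h
    exact hx.ne' (hχW h)
  have hxO : ∀ x, χ₀ x < 1 → x ∈ O := fun x hx => by
    by_contra h
    exact hx.ne (hχO h)
  set χ : SphereTwo → ℝ := fun x => max 0 (min 1 (3 * χ₀ x - 1)) with hχ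
  have hχc : Continuous χ := by fun_prop
  have hχ0 : ∀ x, χ₀ x < 1 / 3 → χ x = 0 := fun x hx =>
    max_eq_left ((min_le_right _ _).trans (by linarith))
  have hχ1 : ∀ x, 2 / 3 < χ₀ x → χ x = 1 := fun x hx => by
    have h1 : min 1 (3 * χ₀ x - 1) = 1 := min_eq_left (by linarith)
    simp [hχ, h1]
  set v : SphereTwo → ℂ := fun x =>
    if x ∈ O ∩ W then exp (χ x * L x) else if x ∈ O then 1 else u x with hv
  have hv1 : ∀ x, 2 / 3 < χ₀ x → v x = u x := fun x hx => by
    by_cases h : x ∈ O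
    · have h1 : x ∈ O ∩ W := ⟨h, hxW x (by linarith)⟩
      rw [hv]; beta_reduce
      rw [if_pos h1, hχ1 x hx, Complex.ofReal_one, one_mul, hLu x h1]
    · have h1 : x ∉ O ∩ W := fun h1 => h h1.1
      rw [hv]; beta_reduce
      rw [if_neg h1, if_neg h]
  have hv0 : ∀ x, χ₀ x < 1 / 3 → v x = 1 := fun x hx => by
    have h : x ∈ O := hxO x (by linarith)
    rw [hv]; beta_reduce
    rw [if_pos h, hχ0 x hx]
    simp
  have hvc : ContinuousOn v {j 0}ᶜ := by
    intro x hx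
    refine ContinuousAt.continuousWithinAt ?_
    rcases lt_or_ge (χ₀ x) (1 / 3) with h1 | h1
    · refine continuousAt_const.congr (mem_of_superset
        ((isOpen_lt χ₀.continuous continuous_const).mem_nhds h1) fun y hy => (hv0 y hy).symm)
    rcases lt_or_ge (2 / 3) (χ₀ x) with h2 | h2
    · have h3 := hu.continuousAt
        ((hW.sdiff isClosed_singleton).mem_nhds ⟨hxW x (by linarith), hx⟩)
      exact h3.congr (mem_of_superset
        ((isOpen_lt continuous_const χ₀.continuous).mem_nhds h2) fun y hy => (hv1 y hy).symm)
    · have h3 :=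
        (hO.inter hW).mem_nhds ⟨hxO x (by linarith), hxW x (by linarith)⟩
      have h4 : ContinuousAt (fun y => exp (χ y * L y)) x :=
        Complex.continuous_exp.continuousAt.comp
          ((Complex.continuous_ofReal.comp hχc).continuousAt.mul (hL.continuousAt h3))
      exact h4.congr (mem_of_superset h3 fun y hy => (if_pos hy).symm)
  have hvne : ∀ x ≠ j 0, v x ≠ 0 := fun x hx => by
    rw [hv]; beta_reduce
    split_ifs with h1 h2
    · exact exp_ne_zero _
    · exact one_ne_zero
    · exact hu0 x ((hOW x).resolve_left h2) hx
  obtain ⟨j', hj', -⟩ := exists_planeChart (hj.apply_ne 0).symm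
  obtain ⟨l, hl, hle⟩ := hj'.exists_log hvc hvne
  have hχj : χ₀ (j 0) = 1 := hχO h0
  obtain ⟨ρ, hρ, hρb⟩ := Metric.isOpen_iff.1 ((isOpen_lt continuous_const
    (χ₀.continuous.comp hj.emb.continuous) : IsOpen {z : ℂ | 2 / 3 < χ₀ (j z)})) 0
      (show 2 / 3 < χ₀ (j 0) by rw [hχj]; norm_num)
  refine ⟨ρ, hρ, fun r hr hrρ => ?_⟩
  have hne : ∀ t, j (circ r t) ≠ j 0 := fun t h => by
    have h1 := norm_circ r t
    rw [hj.emb.injective h, norm_zero, abs_of_pos hr] at h1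
    exact hr.ne h1
  have hlog : IsLogOn (fun t => l (j (circ r t))) (fun t => u (j (circ r t))) := by
    refine ⟨Continuous.continuousOn (hl.comp_continuous (hj.emb.continuous.comp
      (continuous_circ.comp (by fun_prop : Continuous fun t : ℝ => (r, t)))) hne), fun t _ => ?_⟩
    rw [hle _ (hne t), hv1]
    exact hρb (by rw [mem_ball_zero_iff, norm_circ, abs_of_pos hr]; exact hrρ)
  rw [hlog.logVar_eq, circ_zero_eq_one, sub_self]

/-- The complement of a simply connected open subset of the sphere is connected. -/
theorem isPreconnected_compl_of_simplyConnected {U : Set SphereTwo} (hU : IsOpen U)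
    (hsc : SimplyConnectedSpace U) : IsPreconnected Uᶜ := by
  rw [isPreconnected_iff_subset_of_fully_disjoint_closed hU.isClosed_compl]
  intro A B hA hB hAB hd
  by_contra! hcon
  obtain ⟨b, hbU, hbA⟩ := not_subset.1 hcon.1
  obtain ⟨a, haU, haB⟩ := not_subset.1 hcon.2
  have hab : a ≠ b := by
    rintro rfl
    exact (hAB haU).elim hbA haB
  obtain ⟨j, hj, rfl⟩ := exists_planeChart hab
  have hne : ∀ x : SphereTwo, x ≠ b → x ≠ j 0 → invFun j x ≠ 0 := fun x hx hx0 h => by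
    rw [← hj.apply_invFun hx, h] at hx0; exact hx0 rfl
  have hUb : ∀ x ∈ U, x ≠ b := fun x hx h => hbU (h ▸ hx)
  have : LocallyPathConnectedSpace SphereTwo :=
    ChartedSpace.locallyPathConnectedSpace (EuclideanSpace ℝ (Fin 2)) SphereTwo
  obtain ⟨L, hL, hLe⟩ := Complex.exists_continuousOn_eqOn_exp_comp (U := U) hsc hU
    (g := invFun j) (hj.continuousOn_invFun.mono fun x hx => hUb x hx) (by
      rintro ⟨x, hx, h⟩
      exact hne x (hUb x hx) (fun h => haU (h ▸ hx)) h)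
  have hsub : ∀ x ∈ (A ∩ Uᶜ)ᶜ ∩ (B ∩ Uᶜ)ᶜ, x ∈ U := fun x hx => by
    by_contra h
    exact (hAB h).elim (fun h1 => hx.1 ⟨h1, h⟩) fun h1 => hx.2 ⟨h1, h⟩
  obtain ⟨ρ, hρ, h⟩ := hj.exists_logVar_eq_zero (O := (A ∩ Uᶜ)ᶜ) (W := (B ∩ Uᶜ)ᶜ)
    (hA.inter hU.isClosed_compl).isOpen_compl (hB.inter hU.isClosed_compl).isOpen_compl
    (fun x => or_iff_not_imp_left.2 fun h1 h2 => disjoint_left.1 hd (not_not.1 h1).1 h2.1)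
    (not_not.2 ⟨(hAB haU).resolve_right haB, haU⟩) (u := invFun j) (L := L)
    (hj.continuousOn_invFun.mono fun x hx h =>
      hx.1 (h ▸ ⟨(hAB hbU).resolve_left hbA, hbU⟩))
    (fun x hx h0 => hne x (fun h => hx (h ▸ ⟨(hAB hbU).resolve_left hbA, hbU⟩)) h0)
    (hL.mono hsub) fun x hx => hLe (hsub x hx)
  have h1 := h (ρ / 2) (by positivity) (by linarith)
  simp only [hj.invFun_apply] at h1
  rw [show (fun t => circ (ρ / 2) t) = circ (ρ / 2) from rfl, logVar_circ (by positivity)] at h1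
  exact two_pi_I_ne_zero h1

/-- Unicoherence of the sphere. -/
theorem isPreconnected_inter_of_union_eq_univ {P Q : Set SphereTwo} (hP : IsClosed P)
    (hQ : IsClosed Q) (hPc : IsPreconnected P) (hQc : IsPreconnected Q) (hPQ : P ∪ Q = univ) :
    IsPreconnected (P ∩ Q) := by
  classical
  rw [isPreconnected_iff_subset_of_fully_disjoint_closed (hP.inter hQ)]
  intro A B hA hB hAB hd
  by_contra! hcon
  obtain ⟨b, hb, hbA⟩ := not_subset.1 hcon.1
  obtain ⟨a, ha, haB⟩ := not_subset.1 hcon.2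
  obtain ⟨χ, hχA, hχB, -⟩ := exists_continuous_zero_one_of_isClosed hA hB hd
  have hχa : χ a = 0 := hχA ((hAB ha).resolve_right haB)
  have hχb : χ b = 1 := hχB ((hAB hb).resolve_left hbA)
  set e : SphereTwo → ℂ := fun x => π * χ x * I with he
  have hec : Continuous e := by fun_prop
  set u : SphereTwo → ℂ := fun x => if x ∈ P then exp (e x) else exp (-e x)
  have huP : ∀ x ∈ P, exp (e x) = u x := fun x hx => (if_pos hx).symm
  have huQ : ∀ x ∈ Q, exp (-e x) = u x := fun x hx => by
    by_cases h : x ∈ P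
    · rw [← huP x h, Complex.exp_neg]
      rcases hAB ⟨h, hx⟩ with h1 | h1
      · rw [he]; simp [show χ x = 0 from hχA h1]
      · rw [he]; simp [show χ x = 1 from hχB h1]
    · exact (if_neg h).symm
  have huc : Continuous u := by
    rw [← continuousOn_univ, ← hPQ]
    exact ((Complex.continuous_exp.comp hec).continuousOn.congr fun x hx =>
      (huP x hx).symm).union_of_isClosed
      ((Complex.continuous_exp.comp hec.neg).continuousOn.congr fun x hx => (huQ x hx).symm) hP hQ
  obtain ⟨l, hl, hle⟩ := exists_log_sphere huc fun x => by
    have h1 := hPQ ▸ mem_univ x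
    rcases h1 with h | h
    · rw [← huP x h]; exact exp_ne_zero _
    · rw [← huQ x h]; exact exp_ne_zero _
  have h1 := sub_eq_sub_of_exp_eq hPc hl.continuousOn hec.continuousOn
    (fun x hx => (hle x).trans (huP x hx).symm) ha.1 hb.1
  have h2 := sub_eq_sub_of_exp_eq hQc hl.continuousOn hec.neg.continuousOn
    (fun x hx => (hle x).trans (huQ x hx).symm) ha.2 hb.2
  have ha0 : e a = 0 := by simp [he, hχa]
  have hb1 : e b = π * I := by simp [he, hχb]
  simp only [Pi.neg_apply, ha0, hb1] at h1 h2
  apply two_pi_I_ne_zero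
  linear_combination h1 - h2

/-- A homeomorphism whose action on the prime ends of a simply connected domain has no fixed point
has a fixed point in the complement of the domain. -/
theorem exists_fixed_compl {U : Set SphereTwo} (hU : IsOpen U) (hsc : SimplyConnectedSpace U)
    {q b x₀ : SphereTwo} (hq : q ∉ U) (hb : b ≠ q) (hbU : b ∉ U) (hx₀ : x₀ ∈ U)
    {f : SphereTwo ≃ₜ SphereTwo} (hf : f '' U = U)
    (hne : ∀ φ : ℂ → SphereTwo, IsDiscModel U φ → ∀ ζ : ℂ, ‖ζ‖ = 1 → discExt φ f ζ ≠ ζ) :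
    ∃ y ∉ U, f y = y := by
  classical
  by_contra! hK
  have hfm : MapsTo f U U := fun x hx => hf ▸ mem_image_of_mem f hx
  have hfK : ∀ x ∉ U, f x ∉ U := fun x hx h => by
    obtain ⟨y, hy, hyx⟩ := hf.ge h
    exact hx (f.injective hyx ▸ hy)
  obtain ⟨j', hj', rfl⟩ := exists_planeChart (show x₀ ≠ q from fun h => hq (h ▸ hx₀))
  obtain ⟨j, hj, hj0, hjj⟩ := hj'.exists_inversion
  obtain ⟨φ, hd, hp⟩ := hj'.exists_models hU hq hb hbU hsc hx₀
  set ψ := j' ∘ φ with hψ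
  set k := discExt ψ f with hk
  set d := dslope φ 0 with hdd
  have hkc := hd.continuousOn_discExt f hf
  have hkb : ∀ w ∈ 𝔻, k w ∈ 𝔻 ∧ ψ (k w) = f (ψ w) :=
    fun w hw => by
      rw [hk, hd.discExt_eq f.continuous hfm hw]
      exact ⟨hd.conj_mem hfm hw, hd.apply_inv (hfm (hd.mem hw))⟩
  have hdφ : ∀ w, w * d w = φ w := fun w => by
    have := sub_smul_dslope φ 0 w
    rwa [sub_zero, hp.zero, sub_zero, smul_eq_mul] at this
  have hdc : ContinuousOn d 𝔻 :=
    (continuousOn_dslope (ball_mem_nhds 0 one_pos)).2 ⟨hp.cont, hp.diff⟩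
  have hd0 : ∀ w ∈ 𝔻, d w ≠ 0 := fun w hw => by
    by_cases h : w = 0
    · rw [h, hdd, dslope_same]; exact hp.deriv_ne
    · exact fun h0 => hp.apply_ne_zero hw h (by rw [← hdφ, h0, mul_zero])
  obtain ⟨r₁, ⟨hr0, hr1⟩, hr⟩ : ∃ r ∈ Ioo (0:ℝ) 1, {w ∈ closedBall (0:ℂ) 1 |
      ‖k w‖ ^ 2 ≤ (w * (starRingEnd ℂ) (k w)).re} ⊆ ball 0 r := by
    refine exists_pos_lt_subset_ball one_pos ?_ ?_
    · refine IsClosed.isClosed_le isClosed_closedBall (hkc.norm.pow 2) ?_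
      fun_prop
    · rintro w ⟨hw, hle⟩
      rw [mem_ball_zero_iff]
      refine (mem_closedBall_zero_iff.1 hw).lt_of_ne fun h1 => hne ψ hd w h1 ?_
      have h2 : ‖k w‖ = 1 := hd.norm_discExt hf h1
      have h3 : ‖w - k w‖ ^ 2 ≤ 0 := by
        rw [← normSq_eq_norm_sq, Complex.normSq_sub, normSq_eq_norm_sq,
          normSq_eq_norm_sq, h1, h2]
        rw [h2] at hle
        linarith
      exact (sub_eq_zero.1 (norm_eq_zero.1 (pow_eq_zero_iff two_ne_zero |>.1
        (le_antisymm h3 (by positivity))))).symm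
  have hring : ∀ w ∈ 𝔻, r₁ ≤ ‖w‖ → k w ≠ 0 ∧ (w / k w).re < 1 := by
    intro w hw hrw
    have h1 : (w * (starRingEnd ℂ) (k w)).re < ‖k w‖ ^ 2 := by
      by_contra h
      exact (mem_ball_zero_iff.1 (hr ⟨ball_subset_closedBall hw, not_lt.1 h⟩)).not_ge hrw
    have h2 : k w ≠ 0 := fun h => by simp [h] at h1
    refine ⟨h2, ?_⟩
    have h3 : w / k w = w * (starRingEnd ℂ) (k w) / ((‖k w‖ ^ 2 : ℝ) : ℂ) := by
      rw [Complex.ofReal_pow, ← Complex.mul_conj']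
      field_simp [(map_ne_zero (starRingEnd ℂ)).2 h2]
    rw [h3, Complex.div_ofReal_re, div_lt_one (by positivity)]
    exact h1
  set r₃ := (1 + r₁) / 2 with hr₃
  set r₂ := (r₁ + r₃) / 2 with hr₂
  have h12 : r₁ < r₂ := by simp only [hr₂, hr₃]; linarith
  have h23 : r₂ < r₃ := by simp only [hr₂, hr₃]; linarith
  have h3 : r₃ < 1 := by simp only [hr₃]; linarith
  set c : ℝ → ℝ := fun t => max 0 (min 1 ((t - r₂) / (r₃ - r₂))) with hc
  have hcc : Continuous c := by fun_prop
  have hc0 : ∀ t, t ≤ r₂ → c t = 0 := fun t ht => max_eq_left ((min_le_right _ _).trans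
    (div_nonpos_of_nonpos_of_nonneg (by linarith) (by linarith)))
  have hc1 : ∀ t, r₃ ≤ t → c t = 1 := fun t ht => by
    have : min 1 ((t - r₂) / (r₃ - r₂)) = 1 :=
      min_eq_left ((one_le_div (by linarith)).2 (by linarith))
    grind
  have hcI : ∀ t, 0 ≤ c t ∧ c t ≤ 1 := fun t =>
    ⟨le_max_left _ _, max_le zero_le_one (min_le_left _ _)⟩
  have hsb : ∀ t, ∀ w ∈ 𝔻, (c t : ℂ) * w ∈ 𝔻 :=
    fun t w hw => by
      rw [mem_ball_zero_iff, norm_mul, norm_real, Real.norm_of_nonneg (hcI t).1]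
      exact (mul_le_of_le_one_left (norm_nonneg _) (hcI t).2).trans_lt (mem_ball_zero_iff.1 hw)
  set E : ℂ → ℂ := fun w => w * d (c ‖w‖ * w) / (k w * d (c ‖w‖ * k w)) - 1 with hE
  have hA : ∀ w ∈ {w ∈ 𝔻 | r₁ < ‖w‖}, k w * d (c ‖w‖ * k w) ≠ 0 := fun w hw =>
    mul_ne_zero (hring w hw.1 hw.2.le).1 (hd0 _ (hsb _ _ (hkb w hw.1).1))
  have hEc : ContinuousOn E {w ∈ 𝔻 | r₁ < ‖w‖} := by
    have h1 : ContinuousOn (fun w : ℂ => (c ‖w‖ : ℂ)) {w ∈ 𝔻 | r₁ < ‖w‖} :=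
      Continuous.continuousOn (by fun_prop)
    have h2 : ContinuousOn k {w ∈ 𝔻 | r₁ < ‖w‖} :=
      hkc.mono fun w hw => ball_subset_closedBall hw.1
    exact ((continuousOn_id.mul (hdc.comp (h1.mul continuousOn_id) fun w hw => hsb _ _ hw.1)).div
      (h2.mul (hdc.comp (h1.mul h2) fun w hw => hsb _ _ (hkb w hw.1).1)) hA).sub continuousOn_const
  have hE0 : ∀ w ∈ {w ∈ 𝔻 | r₁ < ‖w‖}, E w ≠ 0 := by
    intro w hw h
    have hkw := hring w hw.1 hw.2.le
    have h1 :=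
      (div_eq_one_iff_eq (hA w hw)).1 (sub_eq_zero.1 h)
    have h2 : w = k w := by
      by_cases hs : (c ‖w‖ : ℂ) = 0
      · grind
      · refine mul_left_cancel₀ hs (hp.inj (hsb _ _ hw.1) (hsb _ _ (hkb w hw.1).1) ?_)
        rw [← hdφ, ← hdφ, mul_assoc, h1, mul_assoc]
    rw [← h2, div_self (h2 ▸ hkw.1)] at hkw
    simp at hkw
  set i := invFun j with hi
  have hiψ : ∀ w ∈ 𝔻, w ≠ 0 → i (ψ w) = (φ w)⁻¹ := fun w hw h0 => by
    have h1 := hjj (φ w)⁻¹ (inv_ne_zero (hp.apply_ne_zero hw h0))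
    rw [inv_inv] at h1
    rw [hψ, comp_apply, ← h1, hi, hj.invFun_apply]
  have hEu : ∀ w ∈ 𝔻, r₃ ≤ ‖w‖ → E w = (i (f (ψ w)) - i (ψ w)) / i (ψ w) := by
    intro w hw hrw
    have h1 := hring w hw (by linarith)
    have hw0 : w ≠ 0 := fun h => by rw [h, norm_zero] at hrw; linarith
    have h2 := hp.apply_ne_zero hw hw0
    have h4 := hp.apply_ne_zero (hkb w hw).1 h1.1
    rw [← (hkb w hw).2, hiψ w hw hw0, hiψ _ (hkb w hw).1 h1.1, hE]
    beta_reduce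
    rw [hc1 _ hrw, Complex.ofReal_one, one_mul, one_mul, hdφ, hdφ]
    field_simp
  set ι := discInv ψ with hι
  set u : SphereTwo → ℂ := fun x => if x ∈ U then E (ι x) else (i (f x) - i x) / i x with hu
  have hclosed := fun r hr' =>
    ((isCompact_closedBall (0:ℂ) r).image_of_continuousOn
      (hd.cont.mono (closedBall_subset_ball hr'))).isClosed
  have hout : ∀ r < 1, ∀ x ∈ U, x ∉ ψ '' closedBall 0 r → r < ‖ι x‖ := fun r _ x hx h => by
    by_contra h1
    exact h ⟨ι x, mem_closedBall_zero_iff.2 (not_lt.1 h1), hd.apply_inv hx⟩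
  have hu3 : ∀ x ∈ (ψ '' closedBall 0 r₃)ᶜ, u x = (i (f x) - i x) / i x := fun x hx => by
    by_cases h : x ∈ U
    · rw [hu]; beta_reduce
      rw [if_pos h, hEu _ (hd.inv_mem h) (hout _ h3 x h hx).le, hd.apply_inv h]
    · exact if_neg h
  have hqj := hj0 ▸ hq
  have hx3 : ∀ x ∈ (ψ '' closedBall 0 r₃)ᶜ, x ≠ j' 0 ∧ f x ≠ j' 0 := by
    intro x hx
    have h0 : ψ 0 = j' 0 := by rw [hψ, comp_apply, hp.zero]
    refine ⟨fun h => hx ⟨0, mem_closedBall_self (by linarith), h0.trans h.symm⟩, fun h => ?_⟩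
    by_cases hxU : x ∈ U
    · have h1 := hkb _ (hd.inv_mem hxU)
      rw [hd.apply_inv hxU, h, ← h0] at h1
      exact (hring _ (hd.inv_mem hxU) (by linarith [hout _ h3 x hxU hx])).1
        (hd.inj h1.1 (mem_ball_self one_pos) h1.2)
    · exact hfK x hxU (h ▸ hx₀)
  have hi0 : ∀ x, x ≠ j' 0 → x ≠ j 0 → i x ≠ 0 := fun x h1 h2 h =>
    h2 (by rw [← hj.apply_invFun h1, ← hi, h])
  have hic := hj.continuousOn_invFun
  have hnum : ContinuousOn (fun x => i (f x) - i x) (ψ '' closedBall 0 r₃)ᶜ :=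
    (hic.comp f.continuous.continuousOn fun x hx => (hx3 x hx).2).sub
      (hic.mono fun x hx => (hx3 x hx).1)
  have hnum0 : ∀ x ∉ U, i (f x) - i x ≠ 0 := fun x hx h => hK x hx (by
    have h1 : ∀ y ∉ U, y ≠ j' 0 := fun y hy h2 => hy (h2 ▸ hx₀)
    rw [← hj.apply_invFun (h1 _ (hfK x hx)), ← hi, sub_eq_zero.1 h, hi, hj.apply_invFun (h1 x hx)])
  have hglue : ∃ ρ > 0, ∀ r, 0 < r → r < ρ → logVar (fun t => u (j (circ r t))) = 0 := by
    refine hj.exists_logVar_eq_zero (O := ψ '' ball 0 r₂)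
      (W := (ψ '' closedBall 0 r₁)ᶜ)
      (hd.open_map _ isOpen_ball (ball_subset_ball (by linarith)))
      (hclosed r₁ hr1).isOpen_compl (fun x => by
        by_cases h : x ∈ ψ '' closedBall 0 r₁
        · exact .inl (image_mono (closedBall_subset_ball h12) h)
        · exact .inr h)
      (fun ⟨w, hw, h⟩ => hqj (h ▸ hd.mem (ball_subset_ball (by linarith) hw)))
      (u := u) (L := fun x => log (1 - ι x / k (ι x)) + π * I) ?_ ?_ ?_ ?_
    · intro x hx
      refine ContinuousAt.continuousWithinAt ?_
      by_cases h : x ∈ (ψ '' closedBall 0 r₃)ᶜ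
      · have h1 : ContinuousAt (fun x => (i (f x) - i x) / i x) x :=
          (hnum.continuousAt ((hclosed r₃ h3).isOpen_compl.mem_nhds h)).div
            (hic.continuousAt (isOpen_compl_singleton.mem_nhds (hx3 x h).1)) (hi0 x (hx3 x h).1
              hx.2)
        exact h1.congr (mem_of_superset ((hclosed r₃ h3).isOpen_compl.mem_nhds h) fun y hy =>
          (hu3 y hy).symm)
      · obtain ⟨w, hw, rfl⟩ := not_not.1 h
        have hwb := closedBall_subset_ball h3 hw
        have hO :=
          hU.inter (hclosed r₁ hr1).isOpen_compl
        have h1 : ContinuousOn (E ∘ ι) (U ∩ (ψ '' closedBall 0 r₁)ᶜ) :=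
          hEc.comp (hd.inv_cont.mono inter_subset_left) fun x hx =>
            ⟨hd.inv_mem hx.1, hout _ hr1 x hx.1 hx.2⟩
        have hmem := hO.mem_nhds ⟨hd.mem hwb, hx.1⟩
        exact (h1.continuousAt hmem).congr (mem_of_superset hmem fun y hy => (if_pos hy.1).symm)
    · intro x hx hxj
      rw [hu]; beta_reduce
      split_ifs with h
      · exact hE0 _ ⟨hd.inv_mem h, hout _ hr1 x h hx⟩
      · exact div_ne_zero (hnum0 x h) (hi0 x (fun h1 => h (h1 ▸ hx₀)) hxj)
    · rintro x ⟨⟨w, hw, rfl⟩, hx⟩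
      have hwb := ball_subset_ball (h23.le.trans h3.le) hw
      have hw1 := hout _ hr1 _ (hd.mem hwb) hx
      rw [hι, hd.inv_apply hwb] at hw1
      have hkw := hring w hwb hw1.le
      refine ContinuousAt.continuousWithinAt (ContinuousAt.add (ContinuousAt.clog ?_ ?_)
        continuousAt_const)
      · have h1 := hd.inv_cont.continuousAt (hU.mem_nhds (hd.mem hwb))
        have h2 : ContinuousAt k (ι (ψ w)) := by
          rw [hι, hd.inv_apply hwb]
          exact hkc.continuousAt (mem_of_superset (isOpen_ball.mem_nhds hwb)
            ball_subset_closedBall)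
        refine continuousAt_const.sub (h1.div (ContinuousAt.comp h2 h1) ?_)
        rw [hι, hd.inv_apply hwb]; exact hkw.1
      · rw [hι, hd.inv_apply hwb]
        exact .inl (by rw [sub_re, Complex.one_re]; linarith [hkw.2])
    · rintro x ⟨⟨w, hw, rfl⟩, hx⟩
      have hwb := ball_subset_ball (h23.le.trans h3.le) hw
      have hw1 := hout _ hr1 _ (hd.mem hwb) hx
      rw [hι, hd.inv_apply hwb] at hw1
      have hkw := hring w hwb hw1.le
      have hne1 : 1 - w / k w ≠ 0 := fun h => by
        have := congrArg Complex.re h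
        rw [sub_re, Complex.one_re, Complex.zero_re] at this
        linarith [hkw.2]
      have h0 := hd0 0 (mem_ball_self one_pos)
      rw [hu]; beta_reduce
      rw [if_pos (hd.mem hwb), hι, hd.inv_apply hwb, exp_add, exp_log hne1,
        exp_pi_mul_I, hE]
      beta_reduce
      rw [hc0 _ (mem_ball_zero_iff.1 hw).le, ofReal_zero, zero_mul, zero_mul,
        mul_div_mul_right _ _ h0]
      ring
  obtain ⟨ρ, hρ, hlog⟩ := hglue
  obtain ⟨ρ', hρ', hb'⟩ := Metric.mem_nhds_iff.1 (((hnum.comp hj.emb.continuous.continuousOn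
    (mapsTo_preimage _ _)).continuousAt (((hclosed r₃ h3).isOpen_compl.preimage
      hj.emb.continuous).mem_nhds (fun ⟨w, hw, h⟩ => hqj (h ▸ hd.mem
        (closedBall_subset_ball h3 hw))))).eventually_ne (hnum0 _ hqj) |>.and
    (((hclosed r₃ h3).isOpen_compl.preimage hj.emb.continuous).mem_nhds (fun ⟨w, hw, h⟩ =>
      hqj (h ▸ hd.mem (closedBall_subset_ball h3 hw)))))
  set r := min ρ ρ' / 2 with hrr
  have hrpos : 0 < r := by positivity
  have hcb : ∀ t, circ r t ∈ ball (0:ℂ) ρ' := fun t => by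
    rw [mem_ball_zero_iff, norm_circ, abs_of_pos hrpos]
    linarith [min_le_right ρ ρ']
  have hcirc : Continuous (circ r) :=
    continuous_circ.comp (by fun_prop : Continuous fun t : ℝ => (r, t))
  have hc0' : ∀ t, circ r t ≠ 0 := fun t h => by
    have h1 := norm_circ r t
    rw [h, norm_zero, abs_of_pos hrpos] at h1
    exact hrpos.ne h1
  have hpc : ContinuousOn (fun z => i (f (j z)) - i (j z)) (ball 0 ρ') :=
    hnum.comp hj.emb.continuous.continuousOn fun z hz => (hb' hz).2
  have h1 := logVar_comp_eq_zero (convex_ball (0:ℂ) ρ') hpc (fun z hz => (hb' hz).1)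
    hcirc.continuousOn (fun t _ => hcb t) (circ_zero_eq_one r)
  have h2 : ∀ t, u (j (circ r t)) = (i (f (j (circ r t))) - i (j (circ r t))) / circ r t :=
    fun t => by
      rw [hu3 _ (hb' (hcb t)).2]
      congr 1
      exact hj.invFun_apply _
  have h4 : ContinuousOn (fun t => (i (f (j (circ r t))) - i (j (circ r t))) / circ r t)
      (Icc 0 1) :=
    (hpc.comp hcirc.continuousOn fun t _ => hcb t).div hcirc.continuousOn fun t _ => hc0' t
  have h5 := logVar_mul h4 (fun t _ => div_ne_zero (hb' (hcb t)).1 (hc0' t)) hcirc.continuousOn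
    (fun t _ => hc0' t)
  have h6 := hlog r hrpos (by linarith [min_le_left ρ ρ', (lt_min hρ hρ' : 0 < min ρ ρ')])
  simp only [h2] at h6
  rw [h6, logVar_circ hrpos, zero_add] at h5
  simp only [div_mul_cancel₀ _ (hc0' _)] at h5
  exact two_pi_I_ne_zero (h5.symm.trans h1)

namespace IsPlaneChart

variable {S : Type*} [TopologicalSpace S] {j : ℂ → S} {q : S}

lemma nonempty_homeomorph_annulus (hj : IsPlaneChart j q) :
    Nonempty (↥({q, j 0}ᶜ : Set S) ≃ₜ AddCircle (1 : ℝ) × ↥(Ioo (0 : ℝ) 1)) := by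
  have h1 : j '' {0}ᶜ = {q, j 0}ᶜ := by
    rw [image_compl_eq_range_sdiff_image hj.emb.injective, image_singleton, hj.range_eq]
    ext x; simp [not_or]
  let e : ℝ ≃o Ioo (0 : ℝ) 1 := StrictMono.orderIsoOfSurjective
    (fun x => ⟨Real.sigmoid x, Real.sigmoid_pos x, Real.sigmoid_lt_one x⟩)
    (fun _ _ h => Real.sigmoid_strictMono h) fun y => by
      obtain ⟨x, hx⟩ := Real.range_sigmoid.ge y.2
      exact ⟨x, Subtype.ext hx⟩
  exact ⟨(Homeomorph.setCongr h1.symm).trans <|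
    (hj.emb.isEmbedding.homeomorphImage {0}ᶜ).symm.trans <|
    (homeomorphUnitSphereProd ℂ).trans <|
    (AddCircle.homeomorphCircle one_ne_zero).symm.prodCongr
      (Real.expOrderIso.symm.trans e).toHomeomorph⟩

lemma nonempty_homeomorph_plane (hj : IsPlaneChart j q) :
    Nonempty (↥({q}ᶜ : Set S) ≃ₜ ℝ × ℝ) :=
  ⟨(Homeomorph.setCongr hj.range_eq.symm).trans <|
    hj.emb.isEmbedding.toHomeomorph.symm.trans Complex.equivRealProdCLM.toHomeomorph⟩

lemma isEssentialLoopIn [T1Space S] (hj : IsPlaneChart j q) {A : Set S} (hA : A ∈ 𝓝 (j 0)) :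
    IsEssentialLoopIn {q, j 0}ᶜ (A \ {j 0}) := by
  obtain ⟨ρ, hρ, hb⟩ := Metric.mem_nhds_iff.1 (hj.emb.continuous.continuousAt.preimage_mem_nhds hA)
  have hr := half_pos hρ
  have hn : ∀ t, ‖circ (ρ / 2) t‖ = ρ / 2 := fun t => by rw [norm_circ, abs_of_pos hr]
  have h0 : ∀ t, j (circ (ρ / 2) t) ≠ j 0 := fun t h => by
    have h1 := hn t
    rw [hj.emb.injective h, norm_zero] at h1
    exact hr.ne h1
  have hV : ∀ t, j (circ (ρ / 2) t) ∈ ({q, j 0}ᶜ : Set S) := fun t h =>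
    h.elim (hj.apply_ne _) (h0 t)
  have hc : Continuous (circ (ρ / 2)) :=
    continuous_circ.comp (by fun_prop : Continuous fun t : ℝ => (ρ / 2, t))
  refine ⟨⟨_, hV 0⟩, ⟨⟨fun t => ⟨_, hV t⟩, ((hj.emb.continuous.comp hc).subtype_mk _).comp
    continuous_subtype_val⟩, by simp, by simp [← circ_zero_eq_one]⟩, fun t =>
    ⟨hb (mem_ball_zero_iff.2 (by rw [hn]; linarith)), h0 t⟩, fun ⟨H⟩ => ?_⟩
  let P : ℝ → unitInterval := projIcc 0 1 zero_le_one
  have h1 := logVar_eq_of_homotopy (H := fun p => invFun j (H (P p.1, P p.2)))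
    (hj.continuousOn_invFun.comp_continuous (by fun_prop) fun p =>
      fun h => (H (P p.1, P p.2)).2 (.inl h)).continuousOn
    (fun p _ h => (H (P p.1, P p.2)).2 (.inr ?_)) (fun s _ => by simp [P])
  · have h2 : ∀ t ∈ Icc (0:ℝ) 1, invFun j (H (P 0, P t)) = circ (ρ / 2) t := fun t ht => by
      simp [P, projIcc_of_mem _ ht, hj.invFun_apply]
    rw [logVar_congr h2, logVar_circ hr] at h1
    simp [P, logVar_const] at h1
  · exact (hj.apply_invFun fun h => (H (P p.1, P p.2)).2 (.inl h)).symm.trans (congrArg j h)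

/-- An open connected subset of a surface stays connected when a point is removed. -/
lemma isPreconnected_diff_singleton [T1Space S] (hj : IsPlaneChart j q) {D : Set S} (hD : IsOpen D)
    (hc : IsPreconnected D) (h0 : j 0 ∈ D) : IsPreconnected (D \ {j 0}) := by
  obtain ⟨ρ, hρ, hb⟩ := Metric.mem_nhds_iff.1
    (hj.emb.continuous.continuousAt.preimage_mem_nhds (hD.mem_nhds h0))
  have hP : IsPreconnected (j '' (ball 0 ρ \ {0})) := by
    have h1 : ball (0:ℂ) ρ \ {0} = (fun p : ℝ × ℝ => circ p.1 p.2) '' Ioo 0 ρ ×ˢ univ := by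
      ext z
      constructor
      · rintro ⟨hz, hz0⟩
        refine ⟨(‖z‖, z.arg / (2 * π)), ⟨⟨norm_pos_iff.2 hz0, mem_ball_zero_iff.1 hz⟩,
          trivial⟩, ?_⟩
        have := norm_mul_exp_arg_mul_I z
        change (‖z‖ : ℂ) * _ = z
        push_cast
        rwa [mul_div_cancel₀ _ (by simp [Real.pi_ne_zero])]
      · rintro ⟨⟨r, t⟩, ⟨hr, -⟩, rfl⟩
        have := norm_circ r t
        rw [abs_of_pos hr.1] at this
        aesop
    rw [h1]
    exact ((isPreconnected_Ioo.prod isPreconnected_univ).image _ continuous_circ.continuousOn).image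
      _ hj.emb.continuous.continuousOn
  have hPD : j '' (ball 0 ρ \ {0}) ⊆ D \ {j 0} := by
    rintro _ ⟨z, hz, rfl⟩
    exact ⟨hb hz.1, fun h => hz.2 (hj.emb.injective h)⟩
  have hB : IsOpen (j '' ball 0 ρ) := hj.emb.isOpenMap _ isOpen_ball
  have key : ∀ u v : Set S, IsOpen u → IsOpen v → D \ {j 0} ⊆ u ∪ v →
      (D \ {j 0}) ∩ (u ∩ v) = ∅ → j '' (ball 0 ρ \ {0}) ⊆ u → D \ {j 0} ⊆ u := by
    intro u v hu hv huv hd hPu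
    have hD0 : IsOpen (D \ {j 0}) := hD.sdiff isClosed_singleton
    refine (isPreconnected_iff_subset_of_disjoint.1 hc (u ∩ (D \ {j 0}) ∪ j '' ball 0 ρ)
      (v ∩ (D \ {j 0})) ((hu.inter hD0).union hB) (hv.inter hD0) (fun x hx => ?_) ?_).elim
      (fun h x hx => ?_) fun h => absurd rfl (h h0).2.2
    · by_cases h : x = j 0
      · aesop
      grind
    · grind
    · grind
  refine isPreconnected_iff_subset_of_disjoint.2 fun u v hu hv huv hd => ?_
  refine (isPreconnected_iff_subset_of_disjoint.1 hP u v hu hv (hPD.trans huv)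
    (subset_empty_iff.1 ((inter_subset_inter_left _ hPD).trans hd.le))).imp
    (key u v hu hv huv hd) (key v u hv hu (by rwa [union_comm]) (by rwa [inter_comm v]))

end IsPlaneChart

/-- A continuum separating the sphere into two connected domains is an annular continuum,
contractible in the sphere. -/
theorem isAnnularContinuum_of_compl_eq {K A B : Set SphereTwo} (hK : IsConnected K)
    (hK' : K.Nontrivial) (hA : IsOpen A) (hB : IsOpen B) (hAc : IsConnected A)
    (hBc : IsConnected B) (hAB : Disjoint A B) (h : Kᶜ = A ∪ B) :
    IsAnnularContinuum K ∧ ContractibleInSurface K := by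
  obtain ⟨a, ha⟩ := hAc.nonempty
  obtain ⟨b, hb⟩ := hBc.nonempty
  have hab := hAB.ne_of_mem ha hb
  obtain ⟨j, hj, rfl⟩ := exists_planeChart hab
  obtain ⟨i, hi, rfl⟩ := exists_planeChart hab.symm
  have hKc : IsClosed K := by rw [← isOpen_compl_iff, h]; exact hA.union hB
  have haK : j 0 ∉ K := h.ge (.inl ha)
  have hbK : i 0 ∉ K := h.ge (.inr hb)
  have hKV : K ⊆ {i 0, j 0}ᶜ := fun x hx hx' => hx'.elim (fun h => hbK (h ▸ hx)) fun h =>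
    haK (h ▸ hx)
  have hVK : ({i 0, j 0}ᶜ : Set SphereTwo) \ K = A \ {j 0} ∪ B \ {i 0} := by
    rw [sdiff_eq, h]
    ext x
    have h1 : x ∈ A → x ≠ i 0 := fun hx e => disjoint_left.1 hAB hx (e ▸ hb)
    have h2 : x ∈ B → x ≠ j 0 := fun hx e => disjoint_left.1 hAB ha (e ▸ hx)
    simp only [mem_inter_iff, mem_compl_iff, mem_insert_iff, mem_singleton_iff, mem_union,
      Set.mem_sdiff]
    tauto
  have hA' := hj.isPreconnected_diff_singleton hA hAc.isPreconnected ha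
  have hB' := hi.isPreconnected_diff_singleton hB hBc.isPreconnected hb
  have hAB' : Disjoint (A \ {j 0}) (B \ {i 0}) := hAB.mono sdiff_subset sdiff_subset
  have hcomp : ∀ P Q : Set SphereTwo, IsOpen P → IsOpen Q → Disjoint P Q → IsPreconnected P →
      ∀ x ∈ P, connectedComponentIn (P ∪ Q) x = P := fun P Q hP hQ hPQ hPc x hx =>
    (isPreconnected_connectedComponentIn.subset_left_of_subset_union hP hQ hPQ
      (connectedComponentIn_subset _ _) ⟨x, mem_connectedComponentIn (.inl hx), hx⟩).antisymm
      (hPc.subset_connectedComponentIn hx subset_union_left)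
  have hAo : IsOpen (A \ {j 0}) := hA.sdiff isClosed_singleton
  have hBo : IsOpen (B \ {i 0}) := hB.sdiff isClosed_singleton
  have hcA := hcomp _ _ hAo hBo hAB' hA'
  have hcB := hcomp _ _ hBo hAo hAB'.symm hB'
  rw [union_comm] at hcB
  have hlA := hj.isEssentialLoopIn (hA.mem_nhds ha)
  have hlB := hi.isEssentialLoopIn (hB.mem_nhds hb)
  rw [pair_comm] at hlB
  obtain ⟨x, hx⟩ : (A \ {j 0}).Nonempty := let ⟨_, δ, hδ, _⟩ := hlA; ⟨_, hδ 0⟩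
  obtain ⟨y, hy⟩ : (B \ {i 0}).Nonempty := let ⟨_, δ, hδ, _⟩ := hlB; ⟨_, hδ 0⟩
  refine ⟨⟨hKc.isCompact, hK, hK', _, (Set.toFinite _).isClosed.isOpen_compl, hKV,
    hj.nonempty_homeomorph_annulus, _, _, ?_, hlA, hlB⟩, {i 0}ᶜ, isOpen_compl_singleton,
    fun x hx h => hbK (h ▸ hx), hj.nonempty_homeomorph_plane⟩
  rw [hVK]
  exact ⟨⟨x, .inl hx, (hcA x hx).symm⟩, ⟨y, .inr hy, (hcB y hy).symm⟩,
    fun e => disjoint_left.1 hAB' hx (e ▸ hx), fun z hz => hz.imp (hcA z) (hcB z)⟩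

lemma ContinuousOn.mul_const_Icc {X : Type*} [TopologicalSpace X] {a : ℝ → X}
    (ha : ContinuousOn a (Icc 0 1)) {c : ℝ} (hc : c ∈ Icc (0:ℝ) 1) :
    ContinuousOn (fun t => a (t * c)) (Icc 0 1) :=
  ha.comp (by fun_prop) fun _ ht => unitInterval.mul_mem ht hc

/-- Two lifts through the exponential of paths avoiding a connected set that contains `0` and `∞`
end at the same point when they start at the same point and their projections have the same
endpoints. -/
lemma IsPlaneChart.eq_of_exp_eq {j : ℂ → SphereTwo} {q : SphereTwo} (hj : IsPlaneChart j q)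
    {C : Set SphereTwo} (hC : IsPreconnected C) (hq : q ∈ C) (h0 : j 0 ∈ C) {a b : ℝ → ℂ}
    (ha : ContinuousOn a (Icc 0 1)) (hb : ContinuousOn b (Icc 0 1))
    (haC : ∀ t ∈ Icc (0:ℝ) 1, j (exp (a t)) ∉ C)
    (hbC : ∀ t ∈ Icc (0:ℝ) 1, j (exp (b t)) ∉ C) (hab : a 0 = b 0)
    (h1 : exp (a 1) = exp (b 1)) : a 1 = b 1 := by
  have : LocallyPathConnectedSpace SphereTwo :=
    ChartedSpace.locallyPathConnectedSpace (EuclideanSpace ℝ (Fin 2)) SphereTwo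
  have hea := Complex.continuous_exp.comp_continuousOn ha
  have heb := Complex.continuous_exp.comp_continuousOn hb
  set P := (exp ∘ a) '' Icc 0 1 ∪ (exp ∘ b) '' Icc 0 1 with hP
  have hPc := (isCompact_Icc.image_of_continuousOn hea).union
    (isCompact_Icc.image_of_continuousOn heb)
  have hO := (hPc.image hj.emb.continuous).isClosed.isOpen_compl
  have hCO : C ⊆ (j '' P)ᶜ := by
    rintro x hx ⟨_, ⟨t, ht, rfl⟩ | ⟨t, ht, rfl⟩, rfl⟩
    exacts [haC t ht hx, hbC t ht hx]
  have hjoin :=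
    ((hO.connectedComponentIn.isConnected_iff_isPathConnected.1
      (isConnected_connectedComponentIn_iff.2 (hCO hq))).joinedIn _
      (hC.subset_connectedComponentIn hq hCO h0) _ (mem_connectedComponentIn (hCO hq))).mono
      (connectedComponentIn_subset _ _)
  obtain ⟨γ, hγ, hγ0, hγ1, hγP⟩ := hjoin.exists_continuous
  obtain ⟨T, hT, hTq, hTn⟩ := exists_first_mem (isClosed_singleton (x := q)) zero_le_one
    hγ.continuousOn (by rw [hγ0]; exact hj.apply_ne 0) hγ1
  obtain ⟨R, hR⟩ := hPc.isBounded.subset_ball 0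
  obtain ⟨σ, hσ, hσR⟩ : ∃ σ ∈ Ico 0 T, γ σ ∉ j '' closedBall 0 R := by
    have h2 : γ ⁻¹' (j '' closedBall 0 R)ᶜ ∈ 𝓝[<] T := nhdsWithin_le_nhds
      ((((isCompact_closedBall _ _).image hj.emb.continuous).isClosed.isOpen_compl.preimage
        hγ).mem_nhds fun ⟨z, _, hz⟩ => hj.apply_ne z (hz.trans hTq))
    obtain ⟨σ, h3, h4⟩ := Filter.nonempty_of_mem (inter_mem h2 (Ico_mem_nhdsLT hT.1))
    exact ⟨σ, h4, h3⟩
  set c : ℝ → ℂ := fun t => invFun j (γ t) with hc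
  have hcj : ∀ t ∈ Icc 0 σ, j (c t) = γ t := fun t ht =>
    hj.apply_invFun (hTn t ⟨ht.1, ht.2.trans_lt hσ.2⟩)
  have hcc : ContinuousOn c (Icc 0 σ) := hj.continuousOn_invFun.comp hγ.continuousOn
    fun t ht => hTn t ⟨ht.1, ht.2.trans_lt hσ.2⟩
  have hcP : ∀ z ∈ P, ∀ t ∈ Icc 0 σ, z - c t ≠ 0 := fun z hz t ht h =>
    hγP t ⟨z, hz, by rw [sub_eq_zero.1 h, hcj t ht]⟩
  have hPa : ∀ t ∈ Icc (0:ℝ) 1, exp (a t) ∈ P := fun t ht => .inl ⟨t, ht, rfl⟩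
  have hPb : ∀ t ∈ Icc (0:ℝ) 1, exp (b t) ∈ P := fun t ht => .inr ⟨t, ht, rfl⟩
  have hm : MapsTo (fun p : ℝ × ℝ => p.1 * σ) (Icc 0 1 ×ˢ Icc 0 1) (Icc 0 σ) := fun p hp =>
    ⟨mul_nonneg hp.1.1 hσ.1, mul_le_of_le_one_left hσ.1 hp.1.2⟩
  have hcm : ContinuousOn (fun p : ℝ × ℝ => c (p.1 * σ)) (Icc 0 1 ×ˢ Icc 0 1) :=
    hcc.comp (by fun_prop) hm
  have key := logVar_eq_of_homotopy
    (H := fun p => (exp (a p.2) - c (p.1 * σ)) / (exp (b p.2) - c (p.1 * σ)))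
    (((hea.comp continuousOn_snd fun p hp => hp.2).sub hcm).div
      ((heb.comp continuousOn_snd fun p hp => hp.2).sub hcm)
      fun p hp => hcP _ (hPb _ hp.2) _ (hm hp))
    (fun p hp => div_ne_zero (hcP _ (hPa _ hp.2) _ (hm hp)) (hcP _ (hPb _ hp.2) _ (hm hp)))
    fun s hs => by
      have h2 := fun t ht =>
        hcP _ (hPb t ht) _ (hm (x := (s, t)) ⟨hs, ht⟩)
      rw [hab, h1, div_self (h2 0 (by simp)), div_self (h2 1 (by simp))]
  have hc0 : c 0 = 0 := by rw [hc]; beta_reduce; rw [hγ0, hj.invFun_apply]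
  obtain ⟨l, hl, hle⟩ := exists_log_of_convex (convex_ball (0:ℂ) R) (u := fun z => z - c σ)
    (by fun_prop) fun z hz h => hσR ⟨z, ball_subset_closedBall hz, by
      rw [sub_eq_zero.1 h, hcj σ ⟨hσ.1, le_rfl⟩]⟩
  simp only [zero_mul, one_mul, hc0, sub_zero] at key
  rw [IsLogOn.logVar_eq (l := fun t => a t - b t) ⟨ha.sub hb, fun t _ => exp_sub _ _⟩,
    IsLogOn.logVar_eq (l := fun t => l (exp (a t)) - l (exp (b t)))
    ⟨(hl.comp hea fun t ht => hR (hPa t ht)).sub (hl.comp heb fun t ht => hR (hPb t ht)),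
      fun t ht => by rw [exp_sub, hle _ (hR (hPa t ht)), hle _ (hR (hPb t ht))]⟩,
    h1, hab] at key
  linear_combination key

instance : LocallyConnectedSpace SphereTwo :=
  ChartedSpace.locallyConnectedSpace (EuclideanSpace ℝ (Fin 2)) SphereTwo

instance : PreconnectedSpace SphereTwo :=
  Subtype.preconnectedSpace (isPreconnected_sphere (by simp [← Module.finrank_eq_rank]) 0 1)

/-- A domain of the sphere without periodic prime ends, with a fixed point. -/
structure IsIrrationalDomain (f : SphereTwo ≃ₜ SphereTwo) (U : Set SphereTwo) (x₀ : SphereTwo) :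
    Prop where
  isOpen : IsOpen U
  simplyConnected : SimplyConnectedSpace U
  image_eq : f '' U = U
  nonwandering : IsNonwanderingMap f
  ext : ∃ F : PrimeEndComp U ≃ₜ PrimeEndComp U, IsPEExtension f U F ∧
    ∀ (p : PrimeEnd U) (n : ℕ), 1 ≤ n → (⇑F)^[n] (peEnd U p) ≠ peEnd U p
  mem : x₀ ∈ U
  fixed : f x₀ = x₀

/-- A periodic gap of `U`: a domain disjoint from `U`, with boundary in that of `U`, which is
invariant under an iterate of `f`. -/
structure IsPeriodicGap (f : SphereTwo ≃ₜ SphereTwo) (U D : Set SphereTwo) : Prop where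
  isOpen : IsOpen D
  isConnected : IsConnected D
  disjoint : Disjoint D U
  closure_diff : closure D \ D ⊆ closure U
  period : ∃ n : ℕ, 1 ≤ n ∧ ∀ z, f^[n] z ∈ D ↔ z ∈ D

lemma iterate_mul_mem_iff {X : Type*} {f : X → X} {D : Set X} {n : ℕ}
    (h : ∀ z, f^[n] z ∈ D ↔ z ∈ D) (k : ℕ) (z : X) : f^[n * k] z ∈ D ↔ z ∈ D := by
  rw [iterate_mul]
  induction k with
  | zero => rfl
  | succ k ih => rw [iterate_succ_apply', h, ih]

lemma exists_homeomorph_iterate {X : Type*} [TopologicalSpace X] (f : X ≃ₜ X) (n : ℕ) :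
    ∃ g : X ≃ₜ X, ⇑g = f^[n] := by
  induction n with
  | zero => exact ⟨.refl X, rfl⟩
  | succ n ih =>
    obtain ⟨g, hg⟩ := ih
    exact ⟨f.trans g, by aesop⟩

/-- An invariant domain of a homeomorphism may be made to have a given fixed point. -/
lemma exists_homeomorph_fixing {g : SphereTwo ≃ₜ SphereTwo} {D : Set SphereTwo} (hD : IsOpen D)
    (hc : IsPreconnected D) (hg : ∀ z, g z ∈ D ↔ z ∈ D) {d : SphereTwo} (hd : d ∈ D) :
    ∃ h : SphereTwo ≃ₜ SphereTwo, (∀ z ∉ D, h z = g z) ∧ h d = d ∧ ∀ z, h z ∈ D ↔ z ∈ D := by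
  obtain ⟨κ, hκ, hκd⟩ := exists_homeomorph_apply_eq hD hc ((hg d).2 hd) hd
  refine ⟨g.trans κ, fun z hz => hκ _ (mt (hg z).1 hz), hκd, fun z => (Iff.trans ?_ (hg z))⟩
  change κ (g z) ∈ D ↔ _
  refine ⟨fun h => by_contra fun h' => h' (hκ _ h' ▸ h), fun h => by_contra fun h' => h' ?_⟩
  rwa [κ.injective (hκ _ h')]

namespace IsIrrationalDomain

variable {f : SphereTwo ≃ₜ SphereTwo} {U D D' : Set SphereTwo} {x₀ p q : SphereTwo}

lemma eq_of_fixed (H : IsIrrationalDomain f U x₀) {h : SphereTwo ≃ₜ SphereTwo} {m : ℕ}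
    (hm : 1 ≤ m) (hfh : EqOn h f^[m] U) (hp : p ∈ closure U) (hpU : p ∉ U) (hhp : h p = p)
    (hq : q ∉ U) (hhq : h q = q) : p = q := by
  by_contra hpq
  obtain ⟨F, hF, hper⟩ := H.ext
  obtain ⟨j, hj, rfl⟩ := exists_planeChart (ne_of_mem_of_not_mem H.mem hq)
  obtain ⟨w, rfl⟩ := hj.exists_eq hpq
  have hw : exp (log w) = w := exp_log fun h => hpU (h ▸ H.mem)
  refine hj.false_of_path (s := fun _ => log w) H.isOpen hq H.simplyConnected H.mem
    H.image_eq H.nonwandering hF hper hm hfh hhq ?_ continuousOn_const (by rwa [hw])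
    (fun _ _ => by rwa [hw]) (by rwa [hw]) fun G _ _ hG N _ z hz hz' => ?_
  · rw [hfh H.mem, iterate_fixed H.fixed]
  · have h1 := iterate_fixed hG N
    simp_all

lemma iterate_ne_of_gap (H : IsIrrationalDomain f U x₀) (hD : IsPeriodicGap f U D)
    (hp : p ∈ closure U) (hpU : p ∉ U) {m : ℕ} (hm : 1 ≤ m) : f^[m] p ≠ p := by
  intro hfp
  obtain ⟨n, hn, hDn⟩ := hD.period
  obtain ⟨d, hd⟩ := hD.isConnected.nonempty
  obtain ⟨g, hg⟩ := exists_homeomorph_iterate f (n * m)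
  obtain ⟨h, h1, h2, -⟩ := exists_homeomorph_fixing hD.isOpen hD.isConnected.isPreconnected
    (g := g) (fun z => by rw [hg, iterate_mul_mem_iff hDn]) hd
  have hpD := fun h => disjoint_left.1 (hD.disjoint.closure_right hD.isOpen) h hp
  refine hpD (H.eq_of_fixed (h := h) (Nat.mul_pos hn hm) (fun x hx => ?_) hp hpU ?_
    (disjoint_left.1 hD.disjoint hd) h2 ▸ hd)
  · rw [h1 x fun h => disjoint_left.1 hD.disjoint h hx, hg]
  · rw [h1 p hpD, hg]
    exact Function.IsPeriodicPt.const_mul hfp n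

lemma not_disjoint_gaps (H : IsIrrationalDomain f U x₀) (hD : IsPeriodicGap f U D)
    (hD' : IsPeriodicGap f U D') : ¬Disjoint D D' := by
  intro hDD
  obtain ⟨F, hF, hper⟩ := H.ext
  obtain ⟨n, hn, hDn⟩ := hD.period
  obtain ⟨n', hn', hDn'⟩ := hD'.period
  obtain ⟨d, hd⟩ := hD.isConnected.nonempty
  obtain ⟨q, hq⟩ := hD'.isConnected.nonempty
  obtain ⟨g, hg⟩ := exists_homeomorph_iterate f (n * n')
  obtain ⟨h', h1, h2, h3⟩ := exists_homeomorph_fixing hD.isOpen hD.isConnected.isPreconnected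
    (g := g) (fun z => by rw [hg, iterate_mul_mem_iff hDn]) hd
  have hgD' : ∀ z, g z ∈ D' ↔ z ∈ D' := fun z => by
    rw [hg, mul_comm, iterate_mul_mem_iff hDn']
  have h3' := fun z => by
    by_cases hz : z ∈ D
    · exact iff_of_false (disjoint_left.1 hDD ((h3 z).2 hz)) (disjoint_left.1 hDD hz)
    · rw [h1 z hz, hgD']
  obtain ⟨h, h4, h5, h6⟩ := exists_homeomorph_fixing hD'.isOpen hD'.isConnected.isPreconnected
    h3' hq
  have h6' := fun z => by
    by_cases hz : z ∈ D'
    · exact iff_of_false (disjoint_right.1 hDD ((h6 z).2 hz)) (disjoint_right.1 hDD hz)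
    · rw [h4 z hz, h3]
  have hhD : ∀ N z, h^[N] z ∈ D ↔ z ∈ D := fun N => by
    simpa using iterate_mul_mem_iff (f := h) (n := 1) h6' N
  have hhg : ∀ N z, z ∉ D → z ∉ D' → h^[N] z = g^[N] z := fun N => by
    induction N with
    | zero => exact fun _ _ _ => rfl
    | succ N ih =>
      intro z hz hz'
      have h7 : h z = g z := by rw [h4 z hz', h1 z hz]
      rw [iterate_succ_apply, iterate_succ_apply, h7,
        ih _ (by rwa [← h7, h6']) (by rwa [hgD'])]
  have hqD := disjoint_right.1 hDD hq
  have hqU := disjoint_left.1 hD'.disjoint hq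
  obtain ⟨j, hj, rfl⟩ := exists_planeChart (ne_of_mem_of_not_mem H.mem hqU)
  obtain ⟨w, rfl⟩ := hj.exists_eq fun h => hqD (h ▸ hd)
  have hUD : ∀ x ∈ U, x ∉ D := fun x hx hx' => disjoint_left.1 hD.disjoint hx' hx
  have hw0 : w ≠ 0 := fun h => hUD _ H.mem (h ▸ hd)
  have hγ : Continuous fun t : ℝ => j (w * (1 - t : ℝ)) :=
    hj.emb.continuous.comp (by fun_prop)
  obtain ⟨T, hT, hTD, hTn⟩ := exists_first_mem hD.isOpen.isClosed_compl zero_le_one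
    hγ.continuousOn (by simpa using hd) (by simpa using hUD _ H.mem)
  have hac := map_mem_closure hγ (s := Ico 0 T)
    (by rw [closure_Ico hT.1.ne]; exact right_mem_Icc.2 hT.1.le) fun t ht => not_not.1 (hTn t ht)
  have haU := fun h =>
    disjoint_left.1 (hD.disjoint.closure_left H.isOpen) hac h
  have hacU := hD.closure_diff ⟨hac, hTD⟩
  have haD' := fun h =>
    disjoint_left.1 (hD'.disjoint.closure_right hD'.isOpen) h hacU
  have hT1 := hT.2.lt_of_ne fun h => haU (by simpa [h] using H.mem)
  have hpos : ∀ t ∈ Icc (0:ℝ) 1, 0 < 1 - t * T := fun t ht => by nlinarith [ht.1, ht.2, hT.1]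
  set s : ℝ → ℂ := fun t => log w + (Real.log (1 - t * T) : ℝ) with hs
  have hsc : ContinuousOn s (Icc 0 1) := continuousOn_const.add
    (Complex.continuous_ofReal.comp_continuousOn
      (ContinuousOn.log (by fun_prop) fun t ht => (hpos t ht).ne'))
  have hes : ∀ t ∈ Icc (0:ℝ) 1, exp (s t) = w * (1 - t * T : ℝ) := fun t ht => by
    rw [hs, exp_add, exp_log hw0, ← Complex.ofReal_exp,
      Real.exp_log (hpos t ht)]
  have hsD : ∀ t ∈ Icc (0:ℝ) 1, t ≠ 1 → j (exp (s t)) ∈ D := fun t ht h => by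
    rw [hes t ht]
    exact not_not.1 (hTn _ ⟨mul_nonneg ht.1 hT.1.le,
      mul_lt_of_lt_one_left hT.1 (ht.2.lt_of_ne h)⟩)
  have hs1 : j (exp (s 1)) = j (w * (1 - T : ℝ)) := by
    rw [hes 1 (by simp), one_mul]
  have hs0 : j (exp (s 0)) = j w := by
    rw [hes 0 (by simp)]; simp
  have hinj : ∀ t ∈ Icc (0:ℝ) 1, ∀ t' ∈ Icc (0:ℝ) 1,
      exp (s t) = exp (s t') → t = t' := fun t ht t' ht' h => by
    rw [hes t ht, hes t' ht'] at h
    have h7 := Complex.ofReal_injective (mul_left_cancel₀ hw0 h)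
    exact mul_right_cancel₀ hT.1.ne' (by linarith)
  refine hj.false_of_path (h := h) (s := s) H.isOpen hqU H.simplyConnected H.mem H.image_eq
    H.nonwandering hF hper (Nat.mul_pos hn hn') (fun x hx => ?_) h5 ?_ hsc ?_ (fun t ht => ?_)
    (hs1 ▸ hacU) fun G hG hGh hG0 N hN => ?_
  · rw [h4 x fun h => disjoint_left.1 hD'.disjoint h hx, h1 x (hUD x hx), hg]
  · rw [h4 _ fun h => disjoint_left.1 hD'.disjoint h H.mem, h1 _ (hUD _ H.mem), hg,
      iterate_fixed H.fixed]
  · rw [hs0, h4 _ (disjoint_left.1 hDD hd), h2]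
  · by_cases h : t = 1
    · rwa [h, hs1]
    · exact disjoint_left.1 hD.disjoint (hsD t ht h)
  have hGN := fun z =>
    (Semiconj.iterate_right (f := fun z => j (exp z)) hGh N).eq z
  have hCc : IsPreconnected (closure U ∪ closure D') := by
    have hUc : IsPreconnected U := isPreconnected_iff_preconnectedSpace.2 <|
      have := H.simplyConnected; inferInstance
    obtain ⟨y, -, hy⟩ := isPreconnected_univ.exists_mem_closure_diff hD'.isOpen ⟨_, trivial, hq⟩
      fun h => disjoint_left.1 hD'.disjoint (h (mem_univ _)) H.mem
    exact hUc.closure.union y (hD'.closure_diff hy) hy.1 hD'.isConnected.isPreconnected.closure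
  have hCD : ∀ x ∈ D, x ∉ closure U ∪ closure D' := fun x hx h => h.elim
    (disjoint_left.1 (hD.disjoint.closure_right hD.isOpen) hx)
    (disjoint_left.1 (hDD.closure_right hD.isOpen) hx)
  have claim : ∀ t ∈ Icc (0:ℝ) 1, ∀ t' ∈ Icc (0:ℝ) 1,
      exp (s t) = exp (G^[N] (s t')) → s t = G^[N] (s t') := by
    intro t ht t' ht' he
    have he' := congrArg j he
    rw [hGN] at he'
    by_cases h7 : t' = 1
    · have h8 : t = 1 := by
        by_contra h8
        have := hsD t ht h8
        rw [he', hhD, h7, hs1] at this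
        exact hTD this
      rw [h7, h8, hs1, hhg N _ hTD haD', hg, ← iterate_mul] at he'
      exact absurd he'.symm (H.iterate_ne_of_gap hD' hacU haU
        (Nat.mul_pos (Nat.mul_pos hn hn') hN))
    · have h8 : t ≠ 1 := by
        rintro rfl
        have := (hhD N _).2 (hsD t' ht' h7)
        rw [← he', hs1] at this
        exact hTD this
      have hlt : ∀ c ∈ Icc (0:ℝ) 1, c ≠ 1 → ∀ τ ∈ Icc (0:ℝ) 1, j (exp (s (τ * c))) ∈ D :=
        fun c hc hc1 τ hτ => hsD _ (unitInterval.mul_mem hτ hc) fun h => by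
          nlinarith [hτ.1, hτ.2, hc.1, hc.2.lt_of_ne hc1]
      have := hj.eq_of_exp_eq hCc (.inr (subset_closure hq)) (.inl (subset_closure H.mem))
        (hsc.mul_const_Icc ht) ((hG.iterate N).comp_continuousOn (hsc.mul_const_Icc ht'))
        (fun τ hτ => hCD _ (hlt t ht h8 τ hτ))
        (fun τ hτ => hCD _ (by
          rw [comp_apply, hGN, hhD]; exact hlt t' ht' h7 τ hτ))
        (by simp only [comp_apply, zero_mul, iterate_fixed hG0])
        (by simpa only [comp_apply, one_mul] using he)
      simpa only [comp_apply, one_mul] using this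
  have hexp : ∀ {z z' : ℂ}, z = z' + 2 * π * I → exp z = exp z' :=
    fun h => by rw [h, exp_periodic]
  have hne : ∀ z : ℂ, z ≠ z + 2 * π * I := fun z h =>
    two_pi_I_ne_zero (left_eq_add.1 h)
  rintro z (⟨t, ht, rfl⟩ | ⟨_, ⟨t, ht, rfl⟩, rfl⟩) (⟨t', ht', h7⟩ | ⟨_, ⟨t', ht', rfl⟩, h7⟩)
  · exact hne (s t) (by rw [← h7, hinj t ht t' ht' (hexp h7).symm])
  · exact hne (s t) (by rw [← h7, ← claim t ht t' ht' (hexp h7).symm])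
  · exact hne (s t') (by rw [claim t' ht' t ht (hexp h7), ← h7, claim t' ht' t ht (hexp h7)])
  · have h8 := congrArg j (hexp h7)
    rw [hGN, hGN] at h8
    have := hinj t' ht' t ht (hj.emb.injective ((h.injective.iterate N) h8))
    exact hne (G^[N] (s t)) (by rw [← h7, this])

end IsIrrationalDomain

namespace IsIrrationalDomain

variable {f : SphereTwo ≃ₜ SphereTwo} {U : Set SphereTwo} {x₀ : SphereTwo}

lemma isConnected (H : IsIrrationalDomain f U x₀) : IsConnected U :=
  ⟨⟨x₀, H.mem⟩, isPreconnected_iff_preconnectedSpace.2 <|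
    have := H.simplyConnected; inferInstance⟩

/-- The components of the exterior of `U` are periodic gaps. -/
lemma isPeriodicGap (H : IsIrrationalDomain f U x₀) {d : SphereTwo} (hd : d ∈ interior Uᶜ) :
    IsPeriodicGap f U (connectedComponentIn (interior Uᶜ) d) := by
  have hW : IsOpen (interior Uᶜ) := isOpen_interior
  have hsub := connectedComponentIn_subset (interior Uᶜ) d
  refine ⟨hW.connectedComponentIn, isConnected_connectedComponentIn_iff.2 hd,
    disjoint_left.2 fun x hx => interior_subset (hsub hx), fun a ha => ?_, ?_⟩
  · by_contra h
    exact ha.2 (closure_connectedComponentIn_inter hW d ⟨ha.1, by rwa [interior_compl]⟩)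
  · obtain ⟨n, hn, _, ⟨x, hx, rfl⟩, hy⟩ := H.nonwandering _ hW.connectedComponentIn
      ⟨d, mem_connectedComponentIn hd⟩
    obtain ⟨g, hg⟩ := exists_homeomorph_iterate f n
    have hgU : g '' U = U := by
      rw [hg, image_iterate_eq]
      exact iterate_fixed H.image_eq n
    have hgD : g '' connectedComponentIn (interior Uᶜ) d = connectedComponentIn (interior Uᶜ) d :=
        by
      rw [connectedComponentIn_eq hx, g.image_connectedComponentIn (hsub hx), g.image_interior,
        image_compl_eq g.bijective, hgU, hg, ← connectedComponentIn_eq hx]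
      exact (connectedComponentIn_eq hy).symm
    refine ⟨n, hn, fun z => ?_⟩
    rw [← hg]
    conv_lhs => rw [← hgD]
    simp

end IsIrrationalDomain

end

/-- Sphere case of the main classification theorem. -/
theorem sphere_classification
    (f : SphereTwo ≃ₜ SphereTwo) (hnw : IsNonwanderingMap ⇑f)
    (hor : IsOrientationPreserving f)
    (U : Set SphereTwo) (hUopen : IsOpen U) (hUinv : ⇑f '' U = U)
    (hUsc : SimplyConnectedSpace ↥U) (hbd : (frontier U).Nontrivial)
    (hirr : ∃ F : PrimeEndComp U ≃ₜ PrimeEndComp U, IsPEExtension f U F ∧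
      ∀ (p : PrimeEnd U) (n : ℕ), 1 ≤ n → (⇑F)^[n] (peEnd U p) ≠ peEnd U p) :
    (IsAnnularContinuum (frontier U) ∧ ContractibleInSurface (frontier U) ∧
        ∀ z ∈ frontier U, ∀ n : ℕ, 1 ≤ n → (⇑f)^[n] z ≠ z) ∨
      (Dense U ∧ IsCompact Uᶜ ∧ IsConnected Uᶜ ∧ Set.Nontrivial Uᶜ ∧ IsConnected U ∧
        ∃ x₀ ∈ Uᶜ, f x₀ = x₀ ∧ ∀ y ∈ Uᶜ, ∀ n : ℕ, 1 ≤ n → (⇑f)^[n] y = y → y = x₀) := by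
  have hfr : frontier U ⊆ Uᶜ := fun x hx h => (hUopen.frontier_eq ▸ hx).2 h
  obtain ⟨q, hq, b, hb, hqb⟩ := hbd
  obtain ⟨F, hF, hper⟩ := hirr
  obtain ⟨x, hx⟩ : U.Nonempty := nonempty_coe_sort.1 inferInstance
  obtain ⟨j, hj, rfl⟩ := exists_planeChart (ne_of_mem_of_not_mem hx (hfr hq))
  obtain ⟨x₀, hx₀, hfx₀⟩ := hj.exists_fixed hUopen (hfr hq) hqb.symm (hfr hb) hUsc hx hUinv hF hper
  have H : IsIrrationalDomain f U x₀ := ⟨hUopen, hUsc, hUinv, hnw, ⟨F, hF, hper⟩, hx₀, hfx₀⟩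
  have hKc := isPreconnected_compl_of_simplyConnected hUopen hUsc
  obtain hW | ⟨d, hd⟩ := (interior Uᶜ).eq_empty_or_nonempty
  · have hdense : Dense U := by
      rwa [interior_eq_empty_iff_dense_compl, compl_compl] at hW
    obtain ⟨y, hyU, hy⟩ := exists_fixed_compl hUopen hUsc (hfr hq) hqb.symm (hfr hb) hx₀ hUinv
      fun φ hφ ζ hζ => hφ.discExt_iterate_ne f hUinv F hF hper hζ le_rfl
    refine .inr ⟨hdense, hUopen.isClosed_compl.isCompact, ⟨⟨q, hfr hq⟩, hKc⟩,
      ⟨q, hfr hq, b, hfr hb, hqb⟩, H.isConnected, y, hyU, hy, fun z hz n hn hfz => ?_⟩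
    obtain ⟨g, hg⟩ := exists_homeomorph_iterate f n
    exact H.eq_of_fixed (h := g) hn (fun x _ => by rw [hg]) (hdense z) hz (by rwa [hg]) hyU
      (by rw [hg, Function.iterate_fixed hy])
  · have hD := H.isPeriodicGap hd
    have hDW : interior Uᶜ ⊆ connectedComponentIn (interior Uᶜ) d := fun z hz => by
      by_contra h
      refine H.not_disjoint_gaps hD (H.isPeriodicGap hz) (disjoint_left.2 fun y hy hy' => h ?_)
      rw [connectedComponentIn_eq hy, ← connectedComponentIn_eq hy']
      exact mem_connectedComponentIn hz
    have hWc : IsConnected (interior Uᶜ) :=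
      hDW.antisymm (connectedComponentIn_subset _ _) ▸ hD.isConnected
    have hfe : frontier U = closure U ∩ Uᶜ := by
      rw [frontier_eq_closure_inter_closure, hUopen.isClosed_compl.closure_eq]
    have hFc := hfe ▸ isPreconnected_inter_of_union_eq_univ
      isClosed_closure hUopen.isClosed_compl H.isConnected.isPreconnected.closure hKc
      (eq_univ_of_forall fun z => (em (z ∈ U)).imp (fun h => subset_closure h) id)
    have hA := isAnnularContinuum_of_compl_eq ⟨⟨q, hq⟩, hFc⟩ ⟨q, hq, b, hb, hqb⟩ hUopen
      isOpen_interior H.isConnected hWc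
      (disjoint_right.2 fun z hz => interior_subset hz) (by
        rw [hfe, compl_inter, compl_compl, union_comm, interior_compl])
    exact .inl ⟨hA.1, hA.2, fun z hz n hn => H.iterate_ne_of_gap hD (hfe ▸ hz).1 (hfr hz) hn⟩

end
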